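/- Let {Γ_n} ⊂ 𝔥 with Γ_n → Γ a Schottky group, and assume Γ is a non-classical Schottky group. Then there exists a quasi-circle η_Γ of Γ such that every relative open neighborhood 𝒪(η_Γ) in Ψ_Γ contains a deformation of η_Γ that is a non-quasi-circle, i.e. a closed curve that either is not a Jordan curve (has a singular point) or is not Γ-invariant. -/

import Mathlib

open Filter Set Topology
open scoped ENNReal NNReal
noncomputable section

abbrev SL2C := Matrix.SpecialLinearGroup (Fin 2) ℂ
noncomputable instance : TopologicalSpace SL2C := instTopologicalSpaceSubtype
abbrev PSL2C := SL2C ⧸ Subgroup.center SL2C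

/-- The Riemann sphere, as a type synonym for the one-point extension of `ℂ`,
equipped with (a bi-Lipschitz copy of) the chordal metric via stereographic embedding. -/
def RSphere : Type := OnePoint ℂ

namespace RSphere

def infty : RSphere := OnePoint.infty
def ofC (z : ℂ) : RSphere := (z : OnePoint ℂ)
instance : Coe ℂ RSphere := ⟨ofC⟩

/-- Stereographic/chordal embedding of the Riemann sphere into `ℂ × ℝ`. -/
def chordalEmbed : RSphere → ℂ × ℝ := fun z =>
  OnePoint.rec ((0 : ℂ), (1 : ℝ))
    (fun w => (2 * w / (1 + ‖w‖ ^ 2), (‖w‖ ^ 2 - 1) / (‖w‖ ^ 2 + 1))) (z : OnePoint ℂ)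

lemma chordalEmbed_injective : Function.Injective chordalEmbed := by
  have key : ∀ z w : ℂ, chordalEmbed (ofC z) = chordalEmbed (ofC w) → z = w := by
    intro z w h
    have hz : (0:ℝ) < 1 + ‖z‖ ^ 2 := by positivity
    have hw : (0:ℝ) < 1 + ‖w‖ ^ 2 := by positivity
    have h1 : 2 * z / (1 + ‖z‖ ^ 2) = 2 * w / (1 + ‖w‖ ^ 2) := congrArg Prod.fst h
    have h2 : (‖z‖ ^ 2 - 1) / (‖z‖ ^ 2 + 1) = (‖w‖ ^ 2 - 1) / (‖w‖ ^ 2 + 1) := congrArg Prod.snd h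
    have hnorm : ‖z‖ ^ 2 = ‖w‖ ^ 2 := by
      rw [div_eq_div_iff (by positivity) (by positivity)] at h2
      nlinarith [h2]
    have hn : ‖z‖ = ‖w‖ := by nlinarith [norm_nonneg z, norm_nonneg w]
    rw [hn] at h1
    have hden : ((1:ℂ) + (‖w‖:ℂ) ^ 2) ≠ 0 := by
      intro hc
      have hre : (1:ℝ) + ‖w‖ ^ 2 = 0 := by exact_mod_cast hc
      nlinarith [norm_nonneg w]
    rw [div_eq_div_iff hden hden] at h1
    have h1' : (2:ℂ) * z = 2 * w := mul_right_cancel₀ hden h1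
    exact mul_left_cancel₀ two_ne_zero h1'
  intro a b h
  induction a using OnePoint.rec with
  | infty =>
    induction b using OnePoint.rec with
    | infty => rfl
    | coe w =>
      exfalso
      have h2 : (1:ℝ) = (‖w‖ ^ 2 - 1) / (‖w‖ ^ 2 + 1) := congrArg Prod.snd h
      have hw : (0:ℝ) < ‖w‖ ^ 2 + 1 := by positivity
      rw [eq_div_iff (ne_of_gt hw)] at h2
      nlinarith
  | coe z =>
    induction b using OnePoint.rec with
    | infty =>
      exfalso
      have h2 : (‖z‖ ^ 2 - 1) / (‖z‖ ^ 2 + 1) = (1:ℝ) := congrArg Prod.snd h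
      have hz : (0:ℝ) < ‖z‖ ^ 2 + 1 := by positivity
      rw [div_eq_iff (ne_of_gt hz)] at h2
      nlinarith
    | coe w => exact congrArg ofC (key z w h)

instance : MetricSpace RSphere := MetricSpace.induced chordalEmbed chordalEmbed_injective inferInstance
instance : MeasurableSpace RSphere := borel RSphere
instance : BorelSpace RSphere := ⟨rfl⟩

end RSphere

open RSphere MeasureTheory

/-- The Möbius transformation of the Riemann sphere associated to a matrix in `SL(2,ℂ)`. -/
def mobius (g : SL2C) : RSphere → RSphere := fun z =>
  OnePoint.rec
    (if g.1 1 0 = 0 then RSphere.infty else RSphere.ofC (g.1 0 0 / g.1 1 0))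
    (fun w => if g.1 1 0 * w + g.1 1 1 = 0 then RSphere.infty
      else RSphere.ofC ((g.1 0 0 * w + g.1 0 1) / (g.1 1 0 * w + g.1 1 1)))
    (z : OnePoint ℂ)

/-- The orbit of a point of the Riemann sphere under a subgroup of `PSL(2,ℂ)`
(described via arbitrary lifts to `SL(2,ℂ)`). -/
def mobiusOrbit (Γ : Subgroup PSL2C) (z : RSphere) : Set RSphere :=
  {w | ∃ g : SL2C, (g : PSL2C) ∈ Γ ∧ mobius g z = w}

/-- The limit set of a subgroup of `PSL(2,ℂ)`: the set of accumulation points of orbits. -/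
def limitSet (Γ : Subgroup PSL2C) : Set RSphere :=
  {w | ∃ z : RSphere, AccPt w (Filter.principal (mobiusOrbit Γ z))}

/-- The Hausdorff dimension of the limit set. -/
noncomputable def limitDim (Γ : Subgroup PSL2C) : ℝ≥0∞ := dimH (limitSet Γ)

/-- A Kleinian group: a finitely generated discrete subgroup of `PSL(2,ℂ)`. -/
def IsKleinian (Γ : Subgroup PSL2C) : Prop :=
  DiscreteTopology Γ ∧ Subgroup.FG Γ

/-- A conical limit point (in the dynamical, Beardon–Maskit/Bowditch sense):
there are group elements `γ n` and distinct points `a ≠ b` with `γ n • x → a` while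
`γ n • y → b` for every `y ≠ x`. -/
def IsConicalLimitPoint (Γ : Subgroup PSL2C) (x : RSphere) : Prop :=
  ∃ (γ : ℕ → SL2C) (a b : RSphere), (∀ n, (γ n : PSL2C) ∈ Γ) ∧ a ≠ b ∧
    Filter.Tendsto (fun n => mobius (γ n) x) Filter.atTop (nhds a) ∧
    ∀ y : RSphere, y ≠ x → Filter.Tendsto (fun n => mobius (γ n) y) Filter.atTop (nhds b)

/-- Convex cocompactness of a Kleinian group, via the Beardon–Maskit/Bowditch
characterization: a Kleinian group is convex cocompact (equivalently, it acts
cocompactly on the convex hull of its limit set in `ℍ³`) iff every limit point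
is a conical limit point. -/
def IsConvexCocompact (Γ : Subgroup PSL2C) : Prop :=
  IsKleinian Γ ∧ ∀ x ∈ limitSet Γ, IsConicalLimitPoint Γ x

/-- The unit circle in `ℂ`. -/
def unitCircle : Set ℂ := Metric.sphere 0 1

/-- A Jordan curve on the Riemann sphere: a homeomorphic image of the unit circle. -/
def IsJordanCurve (C : Set RSphere) : Prop :=
  ∃ f : ℂ → RSphere, ContinuousOn f unitCircle ∧ Set.InjOn f unitCircle ∧ C = f '' unitCircle

/-- A round circle on the Riemann sphere: a Euclidean circle in `ℂ`, or a
Euclidean line together with `∞`. -/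
def IsRoundCircle (C : Set RSphere) : Prop :=
  (∃ (c : ℂ) (r : ℝ), 0 < r ∧ C = RSphere.ofC '' Metric.sphere c r) ∨
  (∃ a v : ℂ, v ≠ 0 ∧ C = insert RSphere.infty (RSphere.ofC '' {z | ∃ t : ℝ, z = a + t • v}))

/-- A loxodromic element of `SL(2,ℂ)`: the trace is not a real number of absolute value `≤ 2`. -/
def IsLoxodromic (g : SL2C) : Prop :=
  ∀ t : ℝ, Matrix.trace (g.1) = (t : ℂ) → 2 < |t|

/-- Schottky data of rank `g`: free generators `gen i` together with `2g` open topological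
disks with disjoint closures and Jordan curve boundaries, such that `gen i` maps the
boundary of the `i`-th disk onto the boundary of the `(i+g)`-th disk and maps the `i`-th
disk off the `(i+g)`-th disk. -/
structure SchottkyData (g : ℕ) where
  gen : Fin g → SL2C
  D : Fin g ⊕ Fin g → Set RSphere
  isOpen : ∀ i, IsOpen (D i)
  nonempty : ∀ i, (D i).Nonempty
  jordan : ∀ i, IsJordanCurve (frontier (D i))
  disjointClosures : ∀ i j, i ≠ j → closure (D i) ∩ closure (D j) = ∅
  lox : ∀ i, IsLoxodromic (gen i)
  maps_boundary : ∀ i : Fin g, mobius (gen i) '' frontier (D (Sum.inl i)) = frontier (D (Sum.inr i))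
  maps_off : ∀ i : Fin g, (mobius (gen i) '' D (Sum.inl i)) ∩ D (Sum.inr i) = ∅

namespace SchottkyData

/-- The subgroup of `PSL(2,ℂ)` generated by the Schottky data. -/
def group {g : ℕ} (S : SchottkyData g) : Subgroup PSL2C :=
  Subgroup.closure (Set.range fun i => ((S.gen i : PSL2C)))

/-- The generators generate freely. -/
def Free {g : ℕ} (S : SchottkyData g) : Prop :=
  Function.Injective ⇑(FreeGroup.lift (fun i : Fin g => ((S.gen i : PSL2C))))

/-- Classical Schottky data: all the boundary curves are round circles. -/
def IsClassical {g : ℕ} (S : SchottkyData g) : Prop :=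
  ∀ i, IsRoundCircle (frontier (S.D i))

/-- The (Schottky) fundamental domain determined by the data: the complement of the
closed disks. -/
def domain {g : ℕ} (S : SchottkyData g) : Set RSphere :=
  (⋃ i, closure (S.D i))ᶜ

/-- The boundary of the orbit of the fundamental domain. -/
def orbitBoundary {g : ℕ} (S : SchottkyData g) : Set RSphere :=
  ⋃ γ : {γ : SL2C // (γ : PSL2C) ∈ S.group}, mobius γ.1 '' (⋃ i, frontier (S.D i))

end SchottkyData

/-- `Γ` is a Schottky group of rank `g`. -/
def IsSchottkyOfRank (Γ : Subgroup PSL2C) (g : ℕ) : Prop :=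
  ∃ S : SchottkyData g, S.group = Γ ∧ S.Free ∧ IsKleinian Γ ∧ IsConvexCocompact Γ

/-- `Γ` is a Schottky group. -/
def IsSchottky (Γ : Subgroup PSL2C) : Prop := ∃ g, IsSchottkyOfRank Γ g

/-- `Γ` is a classical Schottky group of rank `g`: some Schottky data for `Γ` has all its
defining curves round circles. -/
def IsClassicalSchottkyOfRank (Γ : Subgroup PSL2C) (g : ℕ) : Prop :=
  ∃ S : SchottkyData g, S.group = Γ ∧ S.Free ∧ S.IsClassical ∧ IsKleinian Γ ∧ IsConvexCocompact Γ

/-- `Γ` is a classical Schottky group. -/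
def IsClassicalSchottky (Γ : Subgroup PSL2C) : Prop := ∃ g, IsClassicalSchottkyOfRank Γ g

/-- A quasi-circle of `Γ`: a `Γ`-invariant Jordan curve containing the limit set. -/
def IsQuasiCircle (Γ : Subgroup PSL2C) (η : Set RSphere) : Prop :=
  IsJordanCurve η ∧ limitSet Γ ⊆ η ∧
  ∀ g : SL2C, (g : PSL2C) ∈ Γ → mobius g '' η = η

/-- A rectifiable subset of the sphere: finite 1-dimensional Hausdorff measure. -/
def Rectifiable (η : Set RSphere) : Prop := μH[1] η < ⊤

/-! ### The space `ℛ(S¹, W)` of bounded-length closed curves meeting a compact set `W ⊆ ℂ` -/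

/-- The unit circle as a topological space. -/
abbrev S1 := ↥(Metric.sphere (0 : ℂ) 1)

/-- The standard parametrization of the unit circle. -/
noncomputable def circleParam (t : ℝ) : S1 :=
  ⟨circleMap 0 1 t, circleMap_mem_sphere 0 zero_le_one t⟩

/-- The length (total variation) of a closed curve `h : S¹ → ℂ`. -/
noncomputable def curveLength (h : C(S1, ℂ)) : ℝ≥0∞ :=
  eVariationOn (fun t => h (circleParam t)) (Set.Icc 0 (2 * Real.pi))

/-- An element of `ℛ(S¹, W)`: a continuous rectifiable (bounded-length) closed curve
in `ℂ` whose image meets `W`. -/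
structure RCurve (W : Set ℂ) where
  toFun : C(S1, ℂ)
  meets : (Set.range toFun ∩ W).Nonempty
  bddLength : curveLength toFun < ⊤

/-- The Fréchet distance on `ℛ(S¹, W)`:
`d_F(h₁,h₂) = inf {sup |h₁(σ₁ t) - h₂(σ₂ t)| : σ₁, σ₂ ∈ Homeo(S¹)} + |ℓ(h₁) - ℓ(h₂)|`. -/
noncomputable def frechetDist {W : Set ℂ} (h₁ h₂ : RCurve W) : ℝ :=
  (⨅ σ : (S1 ≃ₜ S1) × (S1 ≃ₜ S1), ⨆ t : S1, dist (h₁.toFun (σ.1 t)) (h₂.toFun (σ.2 t))) +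
    |(curveLength h₁.toFun).toReal - (curveLength h₂.toFun).toReal|

/-- The subset of the Riemann sphere traced out by a curve in `ℂ`. -/
def RCurve.carrier {W : Set ℂ} (h : RCurve W) : Set RSphere :=
  RSphere.ofC '' Set.range h.toFun

/-- The collection `E_Γ` of curves in `ℛ(S¹,W)` tracing bounded-length quasi-circles of `Γ`. -/
def ECurves (W : Set ℂ) (Γ : Subgroup PSL2C) : Set (RCurve W) :=
  {h | IsQuasiCircle Γ h.carrier}

/-- Closure of a set of curves with respect to the Fréchet distance. -/
def dClosure {W : Set ℂ} (A : Set (RCurve W)) : Set (RCurve W) :=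
  {h | ∀ ε : ℝ, 0 < ε → ∃ a ∈ A, frechetDist h a < ε}

/-- Boundary (frontier) of a set of curves with respect to the Fréchet distance. -/
def dFrontier {W : Set ℂ} (A : Set (RCurve W)) : Set (RCurve W) :=
  dClosure A ∩ dClosure Aᶜ

/-! ### Generating curves for quasi-circles -/

/-- `A` is a (possibly non-simple) continuous curve from `p` to `q`. -/
def IsCurveFromTo (A : Set RSphere) (p q : RSphere) : Prop :=
  ∃ f : ℝ → RSphere, ContinuousOn f (Set.Icc 0 1) ∧ f 0 = p ∧ f 1 = q ∧
    A = f '' Set.Icc 0 1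

/-- `A` is an arc (a simple continuous curve) from `p` to `q`. -/
def IsArc (A : Set RSphere) (p q : RSphere) : Prop :=
  ∃ f : ℝ → RSphere, ContinuousOn f (Set.Icc 0 1) ∧ Set.InjOn f (Set.Icc 0 1) ∧
    f 0 = p ∧ f 1 = q ∧ A = f '' Set.Icc 0 1

/-- A (possibly singular) generating curve for Schottky data `S`: for each `i` a
curve `conn i` joining a point `p i` of the `i`-th boundary curve to a point `q i` of the
`(i+g)`-th boundary curve, together with a curve `bnd i` on the `(i+g)`-th boundary curve
joining `q i` to the image `gen i ∙ p i`. -/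
structure PreGenCurve {g : ℕ} (S : SchottkyData g) where
  conn : Fin g → Set RSphere
  bnd : Fin g → Set RSphere
  p : Fin g → RSphere
  q : Fin g → RSphere
  p_mem : ∀ i, p i ∈ frontier (S.D (Sum.inl i))
  q_mem : ∀ i, q i ∈ frontier (S.D (Sum.inr i))
  conn_curve : ∀ i, IsCurveFromTo (conn i) (p i) (q i)
  bnd_curve : ∀ i, IsCurveFromTo (bnd i) (q i) (mobius (S.gen i) (p i))
  bnd_sub : ∀ i, bnd i ⊆ frontier (S.D (Sum.inr i))

namespace PreGenCurve

variable {g : ℕ} {S : SchottkyData g}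

/-- The underlying set of a generating curve. -/
def carrier (ζ : PreGenCurve S) : Set RSphere := ⋃ i, (ζ.conn i ∪ ζ.bnd i)

/-- A generating curve is simple if its constituent curves are disjoint arcs (meeting
only at the prescribed endpoints). -/
def IsSimple (ζ : PreGenCurve S) : Prop :=
  (∀ i, IsArc (ζ.conn i) (ζ.p i) (ζ.q i)) ∧
  (∀ i, IsArc (ζ.bnd i) (ζ.q i) (mobius (S.gen i) (ζ.p i))) ∧
  (∀ i, ζ.conn i ∩ ζ.bnd i = {ζ.q i}) ∧
  ∀ i j, i ≠ j → (ζ.conn i ∪ ζ.bnd i) ∩ (ζ.conn j ∪ ζ.bnd j) = ∅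

end PreGenCurve

/-- The `Γ`-invariant closed set generated by a set `ζ`:
`Λ_Γ ∪ ⋃_{γ ∈ Γ} γ(ζ)`. -/
def generatedBy (Γ : Subgroup PSL2C) (ζ : Set RSphere) : Set RSphere :=
  limitSet Γ ∪ ⋃ γ : {γ : SL2C // (γ : PSL2C) ∈ Γ}, mobius γ.1 '' ζ

/-- `η` is generated by a (simple) generating curve of `Γ`. -/
def IsGeneratedByGenCurve (Γ : Subgroup PSL2C) (η : Set RSphere) : Prop :=
  ∃ (g : ℕ) (S : SchottkyData g), S.group = Γ ∧
    ∃ ζ : PreGenCurve S, ζ.IsSimple ∧ generatedBy Γ ζ.carrier = η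

/-- A trivial singular curve: a closed curve generated by some non-simple generating curve. -/
def IsTrivialSingular (Γ : Subgroup PSL2C) (η : Set RSphere) : Prop :=
  ∃ (g : ℕ) (S : SchottkyData g), S.group = Γ ∧
    ∃ ζ : PreGenCurve S, ¬ζ.IsSimple ∧ generatedBy Γ ζ.carrier = η

/-- The set `Ψ_Γ` associated to a sequence `Γ_n → Γ`: the boundary of the closure of
`⋃ n, E_{Γ_n}` in `(ℛ(S¹,W), d_F)`, with the trivial singular curves removed. -/
def PsiSet (W : Set ℂ) (Γseq : ℕ → Subgroup PSL2C) (Γ : Subgroup PSL2C) : Set (RCurve W) :=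
  dFrontier (dClosure (⋃ n, ECurves W (Γseq n))) \ {h | IsTrivialSingular Γ h.carrier}

/-! ### Linear and transverse quasi-circles -/

/-- A linear quasi-circle: off the limit set, the curve consists of points and
circular/linear arcs (each connected component of `η \ Λ_Γ` lies on a round circle). -/
def IsLinearQC (Γ : Subgroup PSL2C) (η : Set RSphere) : Prop :=
  IsQuasiCircle Γ η ∧
  ∀ x ∈ η \ limitSet Γ, ∃ C : Set RSphere, IsRoundCircle C ∧
    connectedComponentIn (η \ limitSet Γ) x ⊆ C

/-- Two subsets of the sphere meet orthogonally at a (finite) point `x`: there are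
differentiable local parametrizations of the two sets through `x` whose (nonzero) tangent
vectors are orthogonal. -/
def MeetsOrthogonallyAt (A B : Set RSphere) (x : RSphere) : Prop :=
  ∃ (z u v : ℂ) (f h : ℝ → ℂ), x = RSphere.ofC z ∧ u ≠ 0 ∧ v ≠ 0 ∧
    HasDerivAt f u 0 ∧ HasDerivAt h v 0 ∧ f 0 = z ∧ h 0 = z ∧
    (∀ᶠ t in nhds (0 : ℝ), RSphere.ofC (f t) ∈ A) ∧
    (∀ᶠ t in nhds (0 : ℝ), RSphere.ofC (h t) ∈ B) ∧
    (u * (starRingEnd ℂ) v).re = 0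

/-- A transverse quasi-circle: it meets the boundary of the orbit of some fundamental
domain orthogonally, and contains no parallel arc (no nondegenerate arc inside that
boundary). -/
def IsTransverseQC (Γ : Subgroup PSL2C) (η : Set RSphere) : Prop :=
  IsQuasiCircle Γ η ∧
  ∃ (g : ℕ) (S : SchottkyData g), S.group = Γ ∧
    (∀ x ∈ η ∩ S.orbitBoundary, MeetsOrthogonallyAt η S.orbitBoundary x) ∧
    ¬∃ (A : Set RSphere) (p q : RSphere), p ≠ q ∧ IsArc A p q ∧ A ⊆ η ∩ S.orbitBoundary

/-! ### Good sequences -/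

/-- A good sequence of quasi-circles for `Γ_n → Γ`: quasi-circles `η_n` of `Γ_n`
converging in the Fréchet metric to a quasi-circle `η_∞` of `Γ`. -/
def IsGoodSequence {W : Set ℂ} (Γseq : ℕ → Subgroup PSL2C) (Γ : Subgroup PSL2C)
    (hn : ℕ → RCurve W) (h : RCurve W) : Prop :=
  (∀ n, IsQuasiCircle (Γseq n) (hn n).carrier) ∧
  Filter.Tendsto (fun n => frechetDist (hn n) h) Filter.atTop (nhds 0) ∧
  IsQuasiCircle Γ h.carrier

/-! ### Quasiconformal maps -/

/-- A quasiconformal homeomorphism of the Riemann sphere (metric definition: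
uniformly bounded circular distortion). -/
def IsQuasiconformal (f : RSphere ≃ₜ RSphere) : Prop :=
  ∃ K : ℝ, ∀ x : RSphere,
    Filter.limsup (fun r : ℝ =>
        (⨆ y ∈ Metric.sphere x r, dist (f x) (f y)) /
          (⨅ y ∈ Metric.sphere x r, dist (f x) (f y)))
      (nhdsWithin 0 (Set.Ioi 0)) ≤ K

/-- `f` conjugates the subgroup `Γ` of `PSL(2,ℂ)` onto the subgroup `Γ'`, i.e.
`Γ' = f Γ f⁻¹` as groups of transformations of the sphere. -/
def ConjugatesBy (f : RSphere ≃ₜ RSphere) (Γ Γ' : Subgroup PSL2C) : Prop :=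
  (∀ g : SL2C, (g : PSL2C) ∈ Γ → ∃ g' : SL2C, (g' : PSL2C) ∈ Γ' ∧
    ∀ z : RSphere, mobius g' (f z) = f (mobius g z)) ∧
  (∀ g' : SL2C, (g' : PSL2C) ∈ Γ' → ∃ g : SL2C, (g : PSL2C) ∈ Γ ∧
    ∀ z : RSphere, mobius g' (f z) = f (mobius g z))

/-! ### Schottky space -/

/-- The subgroup generated by a tuple in `PSL(2,ℂ)`. -/
def tupleGroup {g : ℕ} (γ : Fin g → PSL2C) : Subgroup PSL2C :=
  Subgroup.closure (Set.range γ)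

/-- The subgroup generated by a tuple of matrices in `SL(2,ℂ)`. -/
def groupOfGens {g : ℕ} (γ : Fin g → SL2C) : Subgroup PSL2C :=
  Subgroup.closure (Set.range fun i => ((γ i : PSL2C)))

/-- A marked rank-`g` Schottky group: a tuple of free Schottky generators in `PSL(2,ℂ)`. -/
abbrev MarkedSchottky (g : ℕ) :=
  {γ : Fin g → PSL2C // ∃ S : SchottkyData g, (∀ i, ((S.gen i : PSL2C)) = γ i) ∧
    S.Free ∧ IsKleinian S.group ∧ IsConvexCocompact S.group}

/-- Conjugacy of marked Schottky groups. -/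
def schottkyRel (g : ℕ) : Setoid (MarkedSchottky g) where
  r a b := ∃ h : PSL2C, ∀ i, b.1 i = h * a.1 i * h⁻¹
  iseqv := by
    refine ⟨fun a => ⟨1, fun i => by simp⟩, ?_, ?_⟩
    · rintro a b ⟨h, e⟩
      exact ⟨h⁻¹, fun i => by rw [e i]; group⟩
    · rintro a b c ⟨h, e⟩ ⟨h', e'⟩
      exact ⟨h' * h, fun i => by rw [e' i, e i]; group⟩

/-- The rank-`g` Schottky space `𝔍_g`: marked rank-`g` Schottky groups up to conjugacy in
`PSL(2,ℂ)`, with the quotient topology. -/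
def SchottkySpace (g : ℕ) : Type := Quotient (schottkyRel g)

instance (g : ℕ) : TopologicalSpace (SchottkySpace g) := by
  unfold SchottkySpace; infer_instance

namespace SchottkySpace

/-- The Hausdorff dimension of (the limit set of) a point of Schottky space. -/
noncomputable def dim {g : ℕ} (x : SchottkySpace g) : ℝ≥0∞ :=
  ⨅ γ : {γ : MarkedSchottky g // Quotient.mk (schottkyRel g) γ = x},
    limitDim (tupleGroup γ.1.1)

/-- The open subset `𝔍_g¹` of Schottky space: points of Hausdorff dimension `< 1`. -/
def J1 (g : ℕ) : Set (SchottkySpace g) := {x | dim x < 1}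

/-- The subset `𝔍_{g,o}` of classical Schottky groups in Schottky space. -/
def classicalLocus (g : ℕ) : Set (SchottkySpace g) :=
  {x | ∃ γ : MarkedSchottky g, Quotient.mk (schottkyRel g) γ = x ∧
    IsClassicalSchottky (tupleGroup γ.1)}

end SchottkySpace

/-- An `SL(2,ℂ)`-level tuple of free Schottky generators. -/
def IsSchottkyTuple {g : ℕ} (γ : Fin g → SL2C) : Prop :=
  ∃ S : SchottkyData g, S.gen = γ ∧ S.Free ∧ IsKleinian S.group ∧ IsConvexCocompact S.group



set_option linter.unusedVariables false
set_option linter.unusedSimpArgs false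
set_option linter.deprecated false
/-! ### P0: linear algebra model of the sphere -/

abbrev V2 := ℂ × ℂ
def act (g : SL2C) (u : V2) : V2 :=
  (g.1 0 0 * u.1 + g.1 0 1 * u.2, g.1 1 0 * u.1 + g.1 1 1 * u.2)
def dt (u v : V2) : ℂ := u.1 * v.2 - u.2 * v.1
open Classical in
def pr (u : V2) : RSphere := if u.2 = 0 then RSphere.infty else RSphere.ofC (u.1 / u.2)
open Classical in
def lft (z : RSphere) : V2 :=
  OnePoint.rec ((1 : ℂ), (0 : ℂ)) (fun w => if ‖w‖ ≤ 1 then (w, 1) else (1, w⁻¹)) (z : OnePoint ℂ)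
def sg (z w : RSphere) : ℝ := ‖dt (lft z) (lft w)‖
def Nn (g : SL2C) (z : RSphere) : ℝ := ‖act g (lft z)‖
def mn (g : SL2C) : ℝ := ‖g.1 0 0‖ + ‖g.1 0 1‖ + ‖g.1 1 0‖ + ‖g.1 1 1‖

lemma RSphere.cases' (z : RSphere) : z = RSphere.infty ∨ ∃ w : ℂ, z = RSphere.ofC w := by
  induction z using OnePoint.rec with
  | infty => left; rfl
  | coe w => right; exact ⟨w, rfl⟩

lemma ofC_injective : Function.Injective RSphere.ofC := fun _ _ h => OnePoint.coe_injective h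
lemma ofC_ne_infty (z : ℂ) : RSphere.ofC z ≠ RSphere.infty := OnePoint.coe_ne_infty z

lemma SL2C_det (g : SL2C) : g.1 0 0 * g.1 1 1 - g.1 0 1 * g.1 1 0 = 1 := by
  have := g.2; rwa [Matrix.det_fin_two] at this

lemma lft_infty : lft RSphere.infty = (1, 0) := rfl
open Classical in
lemma lft_ofC (w : ℂ) : lft (RSphere.ofC w) = if ‖w‖ ≤ 1 then (w, 1) else (1, w⁻¹) := rfl

lemma norm_lft (z : RSphere) : ‖lft z‖ = 1 := by
  rcases z.cases' with rfl | ⟨w, rfl⟩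
  · simp [lft_infty]
  · rw [lft_ofC]; split_ifs with h
    · simp [Prod.norm_def, h]
    · push Not at h
      simp only [Prod.norm_def, norm_one, norm_inv]
      exact max_eq_left (inv_le_one_of_one_le₀ h.le)

lemma lft_ne (z : RSphere) : lft z ≠ 0 := by
  intro h; have := norm_lft z; rw [h] at this; simp at this

lemma pr_smul {c : ℂ} (hc : c ≠ 0) (u : V2) : pr (c • u) = pr u := by
  unfold pr
  by_cases h : u.2 = 0
  · simp [h]
  · simp [h, hc]; rw [mul_div_mul_left _ _ hc]

lemma pr_lft (z : RSphere) : pr (lft z) = z := by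
  rcases z.cases' with rfl | ⟨w, rfl⟩
  · simp [lft_infty, pr]
  · rw [lft_ofC]; split_ifs with h
    · simp [pr]
    · push Not at h
      have : w ≠ 0 := by rintro rfl; simp at h; linarith
      simp [pr, this]

lemma ex_smul {u : V2} (hu : u ≠ 0) : ∃ c : ℂ, c ≠ 0 ∧ u = c • lft (pr u) := by
  by_cases h : u.2 = 0
  · have h1 : u.1 ≠ 0 := by
      intro h1; exact hu (Prod.ext h1 h)
    refine ⟨u.1, h1, ?_⟩
    have : pr u = RSphere.infty := by simp [pr, h]
    rw [this, lft_infty]; ext <;> simp [h]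
  · have : pr u = RSphere.ofC (u.1 / u.2) := by simp [pr, h]
    rw [this, lft_ofC]; split_ifs with h2
    · refine ⟨u.2, h, ?_⟩
      ext <;> simp; field_simp
    · have h1 : u.1 ≠ 0 := by
        intro h1; simp [h1] at h2
      refine ⟨u.1, h1, ?_⟩
      ext
      · simp
      · simp; field_simp

lemma ex_smul' {u : V2} (hu : u ≠ 0) : ∃ c : ℂ, ‖c‖ = ‖u‖ ∧ c ≠ 0 ∧ u = c • lft (pr u) := by
  obtain ⟨c, h1, h2⟩ := ex_smul hu
  refine ⟨c, ?_, h1, h2⟩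
  conv_rhs => rw [h2, norm_smul, norm_lft, mul_one]

lemma act_mul (g h : SL2C) (u : V2) : act (g * h) u = act g (act h u) := by
  simp only [act, Matrix.SpecialLinearGroup.coe_mul, Matrix.mul_apply, Fin.sum_univ_two]
  ext <;> simp <;> ring
lemma act_one (u : V2) : act 1 u = u := by simp [act]
lemma act_smul (g : SL2C) (c : ℂ) (u : V2) : act g (c • u) = c • act g u := by
  simp only [act]; ext <;> simp <;> ring
lemma act_add (g : SL2C) (u v : V2) : act g (u + v) = act g u + act g v := by
  simp only [act]; ext <;> simp <;> ring
lemma act_sub (g : SL2C) (u v : V2) : act g (u - v) = act g u - act g v := by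
  simp only [act]; ext <;> simp <;> ring
lemma act_zero (g : SL2C) : act g 0 = 0 := by simp [act]
lemma dt_act (g : SL2C) (u v : V2) : dt (act g u) (act g v) = dt u v := by
  have := SL2C_det g
  simp only [dt, act]
  linear_combination (u.1 * v.2 - u.2 * v.1) * this
lemma act_inv_act (g : SL2C) (u : V2) : act g⁻¹ (act g u) = u := by
  rw [← act_mul]; simp [act_one]
lemma act_act_inv (g : SL2C) (u : V2) : act g (act g⁻¹ u) = u := by
  rw [← act_mul]; simp [act_one]
lemma act_ne {g : SL2C} {u : V2} (hu : u ≠ 0) : act g u ≠ 0 := by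
  intro h; apply hu; rw [← act_inv_act g u, h, act_zero]

lemma mobius_pr (g : SL2C) {u : V2} (hu : u ≠ 0) : mobius g (pr u) = pr (act g u) := by
  have hd := SL2C_det g
  by_cases h : u.2 = 0
  · have h1 : u.1 ≠ 0 := by
      intro h1; exact hu (Prod.ext h1 h)
    have : pr u = RSphere.infty := by simp [pr, h]
    rw [this]
    change (if g.1 1 0 = 0 then RSphere.infty else RSphere.ofC (g.1 0 0 / g.1 1 0)) = _
    simp only [pr, act, h, mul_zero, add_zero, mul_eq_zero, h1, or_false]
    split_ifs with h3
    · rfl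
    · rw [mul_div_mul_right _ _ h1]
  · have : pr u = RSphere.ofC (u.1 / u.2) := by simp [pr, h]
    rw [this]
    change (if g.1 1 0 * (u.1 / u.2) + g.1 1 1 = 0 then RSphere.infty
      else RSphere.ofC ((g.1 0 0 * (u.1 / u.2) + g.1 0 1) / (g.1 1 0 * (u.1 / u.2) + g.1 1 1))) = _
    have e1 : g.1 1 0 * (u.1 / u.2) + g.1 1 1 = (g.1 1 0 * u.1 + g.1 1 1 * u.2) / u.2 := by
      field_simp
    have e2 : g.1 0 0 * (u.1 / u.2) + g.1 0 1 = (g.1 0 0 * u.1 + g.1 0 1 * u.2) / u.2 := by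
      field_simp
    rw [e1, e2]
    by_cases h3 : g.1 1 0 * u.1 + g.1 1 1 * u.2 = 0
    · rw [if_pos (by rw [h3, zero_div]), pr]; exact (if_pos h3).symm
    · rw [if_neg (div_ne_zero h3 h), pr, div_div_div_cancel_right₀ h]; exact (if_neg h3).symm

lemma mobius_eq (g : SL2C) (z : RSphere) : mobius g z = pr (act g (lft z)) := by
  conv_lhs => rw [← pr_lft z]
  exact mobius_pr g (lft_ne z)

lemma mobius_mul (g h : SL2C) (z : RSphere) : mobius (g * h) z = mobius g (mobius h z) := by
  rw [mobius_eq h, mobius_pr g (act_ne (lft_ne z)), mobius_eq, act_mul]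
lemma mobius_one (z : RSphere) : mobius 1 z = z := by rw [mobius_eq, act_one, pr_lft]
lemma mobius_inv_mobius (g : SL2C) (z : RSphere) : mobius g⁻¹ (mobius g z) = z := by
  rw [← mobius_mul]; simp [mobius_one]
lemma mobius_mobius_inv (g : SL2C) (z : RSphere) : mobius g (mobius g⁻¹ z) = z := by
  rw [← mobius_mul]; simp [mobius_one]
lemma mobius_inj (g : SL2C) : Function.Injective (mobius g) :=
  Function.LeftInverse.injective (mobius_inv_mobius g)

lemma act_lft (g : SL2C) (z : RSphere) :
    ∃ c : ℂ, ‖c‖ = Nn g z ∧ c ≠ 0 ∧ act g (lft z) = c • lft (mobius g z) := by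
  rw [mobius_eq]; exact ex_smul' (act_ne (lft_ne z))

lemma Nn_pos (g : SL2C) (z : RSphere) : 0 < Nn g z := norm_pos_iff.2 (act_ne (lft_ne z))

lemma dt_smul (a b : ℂ) (u v : V2) : dt (a • u) (b • v) = a * b * dt u v := by
  simp [dt]; ring

lemma sg_pr {u v : V2} (hu : u ≠ 0) (hv : v ≠ 0) :
    sg (pr u) (pr v) * (‖u‖ * ‖v‖) = ‖dt u v‖ := by
  obtain ⟨c, hc, -, h1⟩ := ex_smul' hu
  obtain ⟨d, hd, -, h2⟩ := ex_smul' hv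
  rw [← hc, ← hd]
  conv_rhs => rw [h1, h2]
  rw [dt_smul, norm_mul, norm_mul, sg]; ring

lemma sg_mobius (g : SL2C) (z w : RSphere) :
    sg (mobius g z) (mobius g w) * (Nn g z * Nn g w) = sg z w := by
  rw [mobius_eq g z, mobius_eq g w, Nn, Nn, sg_pr (act_ne (lft_ne z)) (act_ne (lft_ne w)), dt_act, sg]

lemma Nn_mul (g h : SL2C) (z : RSphere) : Nn (g * h) z = Nn g (mobius h z) * Nn h z := by
  obtain ⟨c, hc, -, h1⟩ := act_lft h z
  change ‖act (g * h) (lft z)‖ = _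
  rw [act_mul, h1, act_smul, norm_smul, hc, mul_comm]; rfl

lemma Nn_one (z : RSphere) : Nn 1 z = 1 := by rw [Nn, act_one, norm_lft]
lemma Nn_inv (g : SL2C) (z : RSphere) : Nn g⁻¹ (mobius g z) * Nn g z = 1 := by
  rw [← Nn_mul]; simp [Nn_one]

lemma Nn_eq (g : SL2C) {u : V2} (hu : u ≠ 0) : Nn g (pr u) * ‖u‖ = ‖act g u‖ := by
  obtain ⟨c, hc, -, h1⟩ := ex_smul' hu
  conv_rhs => rw [h1, act_smul, norm_smul, hc]
  rw [Nn, mul_comm]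


lemma norm_act_le (g : SL2C) (u : V2) : ‖act g u‖ ≤ mn g * ‖u‖ := by
  have a := norm_fst_le u; have b := norm_snd_le u
  have e1 : ‖g.1 0 0 * u.1 + g.1 0 1 * u.2‖ ≤ (‖g.1 0 0‖ + ‖g.1 0 1‖) * ‖u‖ := by
    refine (norm_add_le _ _).trans ?_
    rw [norm_mul, norm_mul, add_mul]; gcongr
  have e2 : ‖g.1 1 0 * u.1 + g.1 1 1 * u.2‖ ≤ (‖g.1 1 0‖ + ‖g.1 1 1‖) * ‖u‖ := by
    refine (norm_add_le _ _).trans ?_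
    rw [norm_mul, norm_mul, add_mul]; gcongr
  have := norm_nonneg u
  refine max_le (e1.trans ?_) (e2.trans ?_) <;>
    exact mul_le_mul_of_nonneg_right (by unfold mn; linarith [norm_nonneg (g.1 0 0), norm_nonneg (g.1 0 1), norm_nonneg (g.1 1 0), norm_nonneg (g.1 1 1)]) this

lemma mn_inv (g : SL2C) : mn g⁻¹ = mn g := by
  simp [mn, Matrix.SpecialLinearGroup.SL2_inv_expl]; ring

lemma Nn_le_mn (g : SL2C) (z : RSphere) : Nn g z ≤ mn g := by
  have := norm_act_le g (lft z); rwa [norm_lft, mul_one] at this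

lemma one_le_mn_mul_Nn (g : SL2C) (z : RSphere) : 1 ≤ mn g * Nn g z := by
  have := norm_act_le g⁻¹ (act g (lft z))
  rwa [act_inv_act, norm_lft, mn_inv] at this

lemma mn_nonneg (g : SL2C) : 0 ≤ mn g := by unfold mn; positivity
lemma one_le_mn (g : SL2C) : 1 ≤ mn g := by
  have h1 := one_le_mn_mul_Nn g RSphere.infty
  have h2 := Nn_le_mn g RSphere.infty
  have h3 := mn_nonneg g
  nlinarith

lemma sg_nonneg (z w : RSphere) : 0 ≤ sg z w := norm_nonneg _
lemma sg_comm (z w : RSphere) : sg z w = sg w z := by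
  unfold sg; rw [← norm_neg]; congr 1; simp [dt]; ring
lemma norm_dt_le (u v : V2) : ‖dt u v‖ ≤ 2 * ‖u‖ * ‖v‖ := by
  have := norm_fst_le u; have := norm_snd_le u; have := norm_fst_le v; have := norm_snd_le v
  refine (norm_sub_le _ _).trans ?_
  rw [norm_mul, norm_mul]
  have h1 : ‖u.1‖ * ‖v.2‖ ≤ ‖u‖ * ‖v‖ := by gcongr
  have h2 : ‖u.2‖ * ‖v.1‖ ≤ ‖u‖ * ‖v‖ := by gcongr
  linarith
lemma sg_le_two (z w : RSphere) : sg z w ≤ 2 := by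
  have := norm_dt_le (lft z) (lft w); rw [norm_lft, norm_lft] at this; unfold sg; linarith
lemma dt_self (u : V2) : dt u u = 0 := by simp [dt]; ring
lemma sg_self (z : RSphere) : sg z z = 0 := by simp [sg, dt_self]

lemma bad {g : SL2C} {z w : RSphere} {t : ℝ} (hz : Nn g z ≤ t) (hw : Nn g w ≤ t) :
    sg z w * mn g ≤ 16 * t := by
  have key : ∀ x : V2, ‖x‖ ≤ 1 → sg z w * ‖act g x‖ ≤ 4 * t := by
    intro x hx
    have e : dt (lft z) (lft w) • x = dt x (lft w) • lft z + dt (lft z) x • lft w := by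
      ext <;> simp [dt] <;> ring
    have e2 := congrArg (fun y => ‖act g y‖) e
    simp only [act_smul, act_add, norm_smul] at e2
    have h1 := norm_dt_le x (lft w)
    have h2 := norm_dt_le (lft z) x
    rw [norm_lft] at h1 h2
    change sg z w * ‖act g x‖ = _ at e2
    rw [e2]
    refine (norm_add_le _ _).trans ?_
    rw [norm_smul, norm_smul]
    change _ * Nn g z + _ * Nn g w ≤ _
    have := (Nn_pos g z).le
    have h3 : ‖dt x (lft w)‖ * Nn g z ≤ 2 * t := by
      apply mul_le_mul (by linarith) hz this (by norm_num)
    have h4 : ‖dt (lft z) x‖ * Nn g w ≤ 2 * t := by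
      apply mul_le_mul (by linarith) hw (Nn_pos g w).le (by norm_num)
    linarith
  have k1 := key (1, 0) (by simp)
  have k2 := key (0, 1) (by simp)
  have a1 := norm_fst_le (act g (1, 0))
  have a2 := norm_snd_le (act g (1, 0))
  have a3 := norm_fst_le (act g (0, 1))
  have a4 := norm_snd_le (act g (0, 1))
  simp only [act, mul_one, mul_zero, add_zero, zero_add] at *
  have := sg_nonneg z w
  unfold mn
  nlinarith

lemma ex_low (g : SL2C) : ∃ b, Nn g b ≤ 2 := by
  by_contra! h
  have h2 : ∀ w, Nn g⁻¹ w < 1 / 2 := by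
    intro w
    have h3 := Nn_inv g (mobius g⁻¹ w)
    rw [mobius_mobius_inv] at h3
    have := h (mobius g⁻¹ w)
    have := Nn_pos g⁻¹ w
    nlinarith
  have a := h2 (pr (1, 0)); have b := h2 (pr (0, 1))
  have a' := Nn_eq g⁻¹ (u := (1, 0)) (by simp)
  have b' := Nn_eq g⁻¹ (u := (0, 1)) (by simp)
  have e := dt_act g⁻¹ (1, 0) (0, 1)
  have e2 := norm_dt_le (act g⁻¹ (1, 0)) (act g⁻¹ (0, 1))
  rw [e] at e2
  simp [dt] at e2
  simp at a' b'
  rw [← a', ← b'] at e2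
  have := Nn_pos g⁻¹ (pr (1, 0)); have := Nn_pos g⁻¹ (pr (0, 1))
  nlinarith

lemma sg_lip_pr {u v : V2} (hu : u ≠ 0) (hv : v ≠ 0) : sg (pr u) (pr v) * ‖u‖ ≤ 2 * ‖u - v‖ := by
  have h := sg_pr hu hv
  have e : dt u v = dt (u - v) v := by simp [dt]; ring
  have h2 := norm_dt_le (u - v) v
  rw [← e, ← h] at h2
  have : 0 < ‖v‖ := norm_pos_iff.2 hv
  nlinarith

private lemma close_aux (u1 u2 v1 v2 : ℂ) (hu1 : ‖u1‖ = 1) (hu2 : ‖u2‖ ≤ 1)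
    (hv1 : ‖v1‖ ≤ 1) (hv2 : ‖v2‖ ≤ 1) (hv : ‖v1‖ = 1 ∨ ‖v2‖ = 1) :
    ∃ c : ℂ, ‖c‖ = 1 ∧ ‖u1 - c * v1‖ ≤ 4 * ‖u1 * v2 - u2 * v1‖ ∧
      ‖u2 - c * v2‖ ≤ 4 * ‖u1 * v2 - u2 * v1‖ := by
  set d := ‖u1 * v2 - u2 * v1‖ with hd
  have hd0 : 0 ≤ d := norm_nonneg _
  by_cases hbig : 1 / 2 ≤ d
  · refine ⟨1, by simp, ?_, ?_⟩
    · refine (norm_sub_le _ _).trans ?_; rw [one_mul]; linarith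
    · refine (norm_sub_le _ _).trans ?_; rw [one_mul]; linarith
  have hv1' : 1 - ‖v1‖ ≤ d := by
    rcases hv with h | h
    · rw [h]; linarith
    · have : ‖u1 * v2‖ - ‖u2 * v1‖ ≤ d := norm_sub_norm_le _ _
      rw [norm_mul, norm_mul, hu1, h] at this
      nlinarith [norm_nonneg v1, norm_nonneg u2]
  have hhalf : 1 / 2 < ‖v1‖ := by linarith
  have hne : v1 ≠ 0 := by rintro rfl; simp at hhalf; linarith
  have hnn : (‖v1‖ : ℂ) ≠ 0 := by simpa using hne
  refine ⟨u1 * ‖v1‖ / v1, by simp [hu1, hne], ?_, ?_⟩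
  · have : u1 - u1 * ‖v1‖ / v1 * v1 = u1 * ((1 - ‖v1‖ : ℝ) : ℂ) := by push_cast; field_simp
    rw [this, norm_mul, hu1, Complex.norm_real, Real.norm_of_nonneg (by linarith)]; linarith
  · have : u2 - u1 * ‖v1‖ / v1 * v2 = -(u1 * v2 - u2 * v1) / v1 + u1 * v2 / v1 * ((1 - ‖v1‖ : ℝ) : ℂ) := by
      push_cast; field_simp; ring
    rw [this]
    refine (norm_add_le _ _).trans ?_
    rw [norm_div, norm_neg, ← hd, norm_mul, norm_div, norm_mul, hu1, Complex.norm_real,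
      Real.norm_of_nonneg (by linarith)]
    have h1 : d / ‖v1‖ ≤ 2 * d := by rw [div_le_iff₀ (by linarith)]; nlinarith
    have h2 : 1 * ‖v2‖ / ‖v1‖ * (1 - ‖v1‖) ≤ 2 * d := by
      have : 1 * ‖v2‖ / ‖v1‖ ≤ 2 := by rw [div_le_iff₀ (by linarith)]; linarith
      calc _ ≤ 2 * (1 - ‖v1‖) := by gcongr
        _ ≤ _ := by linarith
    linarith

lemma close_lift (z w : RSphere) : ∃ c : ℂ, ‖c‖ = 1 ∧ ‖lft z - c • lft w‖ ≤ 4 * sg z w := by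
  have hz := norm_lft z; have hw := norm_lft w
  have a1 := norm_fst_le (lft z); have a2 := norm_snd_le (lft z)
  have b1 := norm_fst_le (lft w); have b2 := norm_snd_le (lft w)
  rw [hz] at a1 a2; rw [hw] at b1 b2
  have hw' : ‖(lft w).1‖ = 1 ∨ ‖(lft w).2‖ = 1 := by
    rw [Prod.norm_def] at hw
    rcases max_choice ‖(lft w).1‖ ‖(lft w).2‖ with h | h
    · left; rw [← h]; exact hw
    · right; rw [← h]; exact hw
  have hz' : ‖(lft z).1‖ = 1 ∨ ‖(lft z).2‖ = 1 := by
    rw [Prod.norm_def] at hz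
    rcases max_choice ‖(lft z).1‖ ‖(lft z).2‖ with h | h
    · left; rw [← h]; exact hz
    · right; rw [← h]; exact hz
  rcases hz' with h | h
  · obtain ⟨c, hc, h1, h2⟩ := close_aux _ _ _ _ h a2 b1 b2 hw'
    exact ⟨c, hc, max_le (by simpa [sg, dt] using h1) (by simpa [sg, dt] using h2)⟩
  · obtain ⟨c, hc, h1, h2⟩ := close_aux _ _ _ _ h a1 b2 b1 hw'.symm
    rw [norm_sub_rev ((lft z).2 * _)] at h1 h2
    exact ⟨c, hc, max_le (by simpa [sg, dt, mul_comm] using h2) (by simpa [sg, dt, mul_comm] using h1)⟩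

lemma Nn_lip (g : SL2C) (z w : RSphere) : |Nn g z - Nn g w| ≤ 4 * mn g * sg z w := by
  obtain ⟨c, hc, h⟩ := close_lift z w
  have : Nn g w = ‖act g (c • lft w)‖ := by rw [act_smul, norm_smul, hc, one_mul, Nn]
  rw [this, Nn]
  refine (abs_norm_sub_norm_le _ _).trans ?_
  rw [← act_sub]
  refine (norm_act_le _ _).trans ?_
  have := mn_nonneg g
  nlinarith

lemma pr_ofC (z : ℂ) : pr (z, 1) = RSphere.ofC z := by simp [pr]
lemma pr_infty : pr (1, 0) = RSphere.infty := by simp [pr]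

lemma sg_ofC (z w : ℂ) : sg (RSphere.ofC z) (RSphere.ofC w) * (max ‖z‖ 1 * max ‖w‖ 1) = ‖z - w‖ := by
  have := sg_pr (u := (z, 1)) (v := (w, 1)) (by simp) (by simp)
  rw [pr_ofC, pr_ofC] at this
  simpa [dt, Prod.norm_def] using this

lemma sg_ofC_infty (z : ℂ) : sg (RSphere.ofC z) RSphere.infty * max ‖z‖ 1 = 1 := by
  have := sg_pr (u := (z, 1)) (v := (1, 0)) (by simp) (by simp)
  rw [pr_ofC, pr_infty] at this
  simpa [dt, Prod.norm_def] using this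

lemma dist_ofC (z w : ℂ) : dist (RSphere.ofC z) (RSphere.ofC w) =
    max ‖2 * z / (1 + ‖z‖ ^ 2) - 2 * w / (1 + ‖w‖ ^ 2)‖
      |(‖z‖ ^ 2 - 1) / (‖z‖ ^ 2 + 1) - (‖w‖ ^ 2 - 1) / (‖w‖ ^ 2 + 1)| := by
  change dist (chordalEmbed (ofC z)) (chordalEmbed (ofC w)) = _
  rw [Prod.dist_eq, dist_eq_norm, Real.dist_eq]; rfl

lemma dist_ofC_infty (z : ℂ) : dist (RSphere.ofC z) RSphere.infty =
    max ‖2 * z / (1 + ‖z‖ ^ 2)‖ |(‖z‖ ^ 2 - 1) / (‖z‖ ^ 2 + 1) - 1| := by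
  change dist (chordalEmbed (ofC z)) (chordalEmbed infty) = _
  rw [Prod.dist_eq, dist_eq_norm, Real.dist_eq]
  change max ‖2 * z / (1 + ‖z‖ ^ 2) - 0‖ |(‖z‖ ^ 2 - 1) / (‖z‖ ^ 2 + 1) - 1| = _
  rw [sub_zero]

private lemma quad_aux {A B S m : ℝ} (hA : 0 ≤ A) (hB : 0 ≤ B) (hS : 0 ≤ S)
    (h1 : A ^ 2 + B ^ 2 ≤ 4 * S ^ 2) (h2 : S ^ 2 ≤ A ^ 2 + B ^ 2) (hm : m = max A B) :
    m ≤ 2 * S ∧ S ≤ 2 * m := by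
  have hmA : A ≤ m := hm ▸ le_max_left _ _
  have hmB : B ≤ m := hm ▸ le_max_right _ _
  constructor
  · rw [hm]; apply max_le <;> apply le_of_sq_le_sq₀ <;> nlinarith
  · apply le_of_sq_le_sq₀ <;> nlinarith
where le_of_sq_le_sq₀ {a b : ℝ} (h : a ^ 2 ≤ b ^ 2) (hb : 0 ≤ b) : a ≤ b := abs_le_of_sq_le_sq' h hb |>.2

lemma dist_sg_aux (z w : RSphere) : dist z w ≤ 2 * sg z w ∧ sg z w ≤ 2 * dist z w := by
  have maxsq : ∀ z : ℂ, max ‖z‖ 1 ^ 2 ≤ 1 + ‖z‖ ^ 2 ∧ 1 + ‖z‖ ^ 2 ≤ 2 * max ‖z‖ 1 ^ 2 := by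
    intro z
    have := norm_nonneg z
    rcases le_total ‖z‖ 1 with h | h
    · rw [max_eq_right h]; constructor <;> nlinarith
    · rw [max_eq_left h]; constructor <;> nlinarith
  have key : ∀ z : ℂ, dist (ofC z) infty ≤ 2 * sg (ofC z) infty ∧ sg (ofC z) infty ≤ 2 * dist (ofC z) infty := by
    intro z
    have h := sg_ofC_infty z
    obtain ⟨m1, m2⟩ := maxsq z
    have hp : 0 < max ‖z‖ 1 := by positivity
    have hS : sg (ofC z) infty ^ 2 * max ‖z‖ 1 ^ 2 = 1 := by rw [← mul_pow, h]; norm_num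
    have hS0 := sq_nonneg (sg (ofC z) infty)
    have e : ‖2 * z / (1 + ‖z‖ ^ 2)‖ ^ 2 + |(‖z‖ ^ 2 - 1) / (‖z‖ ^ 2 + 1) - 1| ^ 2 = 4 / (1 + ‖z‖ ^ 2) := by
      have h1 : ‖(1 + (‖z‖ : ℂ) ^ 2)‖ = 1 + ‖z‖ ^ 2 := by
        rw [← Complex.ofReal_one, ← Complex.ofReal_pow, ← Complex.ofReal_add, Complex.norm_real, Real.norm_of_nonneg (by positivity)]
      rw [norm_div, norm_mul, h1, sq_abs, Complex.norm_two]
      field_simp; ring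
    refine quad_aux (norm_nonneg _) (abs_nonneg _) (sg_nonneg _ _) ?_ ?_ (dist_ofC_infty z)
    · rw [e, div_le_iff₀ (by positivity)]; nlinarith
    · rw [e, le_div_iff₀ (by positivity)]; nlinarith
  rcases z.cases' with rfl | ⟨z, rfl⟩
  · rcases w.cases' with rfl | ⟨w, rfl⟩
    · simp [sg_self]
    · rw [dist_comm, sg_comm]; exact key w
  · rcases w.cases' with rfl | ⟨w, rfl⟩
    · exact key z
    · have h := sg_ofC z w
      obtain ⟨m1, m2⟩ := maxsq z
      obtain ⟨n1, n2⟩ := maxsq w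
      set S := sg (ofC z) (ofC w)
      have hS : S ^ 2 * (max ‖z‖ 1 ^ 2 * max ‖w‖ 1 ^ 2) = ‖z - w‖ ^ 2 := by rw [← mul_pow, ← mul_pow, h]
      have hS0 := sq_nonneg S
      have e : ‖2 * z / (1 + ‖z‖ ^ 2) - 2 * w / (1 + ‖w‖ ^ 2)‖ ^ 2 +
          |(‖z‖ ^ 2 - 1) / (‖z‖ ^ 2 + 1) - (‖w‖ ^ 2 - 1) / (‖w‖ ^ 2 + 1)| ^ 2 =
          4 * ‖z - w‖ ^ 2 / ((1 + ‖z‖ ^ 2) * (1 + ‖w‖ ^ 2)) := by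
        rw [sq_abs]
        have ha : (1 + ‖z‖ ^ 2) ≠ 0 := by positivity
        have hb : (1 + ‖w‖ ^ 2) ≠ 0 := by positivity
        have h1 : 2 * z / (1 + (‖z‖ : ℂ) ^ 2) - 2 * w / (1 + (‖w‖ : ℂ) ^ 2) =
          ((2 / ((1 + ‖z‖ ^ 2) * (1 + ‖w‖ ^ 2)) : ℝ) : ℂ) * (((1 + ‖w‖ ^ 2 : ℝ) : ℂ) * z - ((1 + ‖z‖ ^ 2 : ℝ) : ℂ) * w) := by
          have ha' : (1 + (‖z‖ : ℂ) ^ 2) ≠ 0 := by exact_mod_cast ha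
          have hb' : (1 + (‖w‖ : ℂ) ^ 2) ≠ 0 := by exact_mod_cast hb
          push_cast; field_simp
        rw [h1, norm_mul, mul_pow, Complex.norm_real, Real.norm_eq_abs, sq_abs]
        have h2 : ‖((1 + ‖w‖ ^ 2 : ℝ) : ℂ) * z - ((1 + ‖z‖ ^ 2 : ℝ) : ℂ) * w‖ ^ 2 =
          (1 + ‖w‖ ^ 2) ^ 2 * ‖z‖ ^ 2 + (1 + ‖z‖ ^ 2) ^ 2 * ‖w‖ ^ 2
            + (1 + ‖w‖ ^ 2) * (1 + ‖z‖ ^ 2) * (‖z - w‖ ^ 2 - ‖z‖ ^ 2 - ‖w‖ ^ 2) := by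
          generalize hA : 1 + ‖w‖ ^ 2 = A
          generalize hB : 1 + ‖z‖ ^ 2 = B
          rw [Complex.sq_norm, Complex.sq_norm, Complex.sq_norm, Complex.sq_norm]
          simp only [Complex.normSq_apply, Complex.sub_re, Complex.sub_im, Complex.mul_re, Complex.mul_im, Complex.ofReal_re, Complex.ofReal_im]
          ring
        rw [h2]
        have ha2 : (‖z‖ ^ 2 + 1) ≠ 0 := by positivity
        have hb2 : (‖w‖ ^ 2 + 1) ≠ 0 := by positivity
        field_simp
        ring
      have hp1 : 0 < max ‖z‖ 1 ^ 2 := by positivity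
      have hp2 : 0 < max ‖w‖ 1 ^ 2 := by positivity
      have q1 : max ‖z‖ 1 ^ 2 * max ‖w‖ 1 ^ 2 ≤ (1 + ‖z‖ ^ 2) * (1 + ‖w‖ ^ 2) := by gcongr
      have q2 : (1 + ‖z‖ ^ 2) * (1 + ‖w‖ ^ 2) ≤ (2 * max ‖z‖ 1 ^ 2) * (2 * max ‖w‖ 1 ^ 2) := by gcongr
      refine quad_aux (norm_nonneg _) (abs_nonneg _) (sg_nonneg _ _) ?_ ?_ (dist_ofC z w)
      · rw [e, div_le_iff₀ (by positivity), ← hS]; nlinarith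
      · rw [e, le_div_iff₀ (by positivity), ← hS]; nlinarith

lemma dist_le_sg (z w : RSphere) : dist z w ≤ 2 * sg z w := (dist_sg_aux z w).1
lemma sg_le_dist (z w : RSphere) : sg z w ≤ 2 * dist z w := (dist_sg_aux z w).2
lemma sg_pos {z w : RSphere} (h : z ≠ w) : 0 < sg z w := by
  have := dist_le_sg z w; have := dist_pos.2 h; linarith

lemma Nn_lip_dist (g : SL2C) (z w : RSphere) : |Nn g z - Nn g w| ≤ 8 * mn g * dist z w := by
  have h1 := Nn_lip g z w; have h2 := sg_le_dist z w; have := mn_nonneg g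
  nlinarith

lemma sg_mobius_eq (g : SL2C) (z w : RSphere) :
    sg (mobius g z) (mobius g w) = sg z w / (Nn g z * Nn g w) := by
  rw [eq_div_iff (mul_pos (Nn_pos g z) (Nn_pos g w)).ne', sg_mobius]

lemma sg_mobius_le (g : SL2C) (z w : RSphere) :
    sg (mobius g z) (mobius g w) ≤ mn g ^ 2 * sg z w := by
  have h := sg_mobius g z w
  have h1 := one_le_mn_mul_Nn g z
  have h2 := one_le_mn_mul_Nn g w
  have : 1 ≤ mn g ^ 2 * (Nn g z * Nn g w) := by nlinarith
  have := sg_nonneg (mobius g z) (mobius g w)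
  have := mn_nonneg g
  calc sg (mobius g z) (mobius g w) ≤ sg (mobius g z) (mobius g w) * (mn g ^ 2 * (Nn g z * Nn g w)) := by nlinarith
    _ = mn g ^ 2 * (sg (mobius g z) (mobius g w) * (Nn g z * Nn g w)) := by ring
    _ = _ := by rw [h]

lemma dist_mobius_le (g : SL2C) (z w : RSphere) :
    dist (mobius g z) (mobius g w) ≤ 4 * mn g ^ 2 * dist z w := by
  have h1 := dist_le_sg (mobius g z) (mobius g w)
  have h2 := sg_mobius_le g z w
  have h3 := sg_le_dist z w
  have := sq_nonneg (mn g)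
  nlinarith

lemma lipschitz_mobius (g : SL2C) : LipschitzWith (Real.toNNReal (4 * mn g ^ 2)) (mobius g) :=
  LipschitzWith.of_dist_le' fun z w => dist_mobius_le g z w

lemma continuous_mobius (g : SL2C) : Continuous (mobius g) := (lipschitz_mobius g).continuous

lemma dist_pr_le {u v : V2} (hu : u ≠ 0) (hv : v ≠ 0) : dist (pr u) (pr v) * ‖u‖ ≤ 4 * ‖u - v‖ := by
  have h1 := dist_le_sg (pr u) (pr v)
  have h2 := sg_lip_pr hu hv
  have := norm_nonneg u
  nlinarith

instance : CompactSpace RSphere := by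
  have h : ContinuousOn pr (Metric.sphere (0 : V2) 1) := by
    have : LipschitzOnWith 4 pr (Metric.sphere (0 : V2) 1) := by
      refine LipschitzOnWith.of_dist_le_mul fun u hu v hv => ?_
      rw [mem_sphere_zero_iff_norm] at hu hv
      have := dist_pr_le (u := u) (v := v) (by rintro rfl; simp at hu) (by rintro rfl; simp at hv)
      rw [hu, mul_one] at this
      rw [dist_eq_norm u v]; exact_mod_cast this
    exact this.continuousOn
  have h2 := (isCompact_sphere (0 : V2) 1).image_of_continuousOn h
  refine ⟨?_⟩
  convert h2
  symm
  rw [eq_univ_iff_forall]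
  exact fun z => ⟨lft z, by simp [norm_lft], pr_lft z⟩

/-- `mobius g` as a homeomorphism. -/
def mobHomeo (g : SL2C) : RSphere ≃ₜ RSphere where
  toFun := mobius g
  invFun := mobius g⁻¹
  left_inv := mobius_inv_mobius g
  right_inv := mobius_mobius_inv g
  continuous_toFun := continuous_mobius g
  continuous_invFun := continuous_mobius g⁻¹

/-! ### P1: the conical set of a representation -/

def dm (a b : SL2C) : ℝ :=
  ‖a.1 0 0 - b.1 0 0‖ + ‖a.1 0 1 - b.1 0 1‖ + ‖a.1 1 0 - b.1 1 0‖ + ‖a.1 1 1 - b.1 1 1‖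

lemma dm_nonneg (a b : SL2C) : 0 ≤ dm a b := by unfold dm; positivity
lemma dm_comm (a b : SL2C) : dm a b = dm b a := by
  unfold dm; simp only [norm_sub_rev]
lemma dm_self (a : SL2C) : dm a a = 0 := by simp [dm]

lemma act_diff_le (a b : SL2C) (u : V2) : ‖act a u - act b u‖ ≤ dm a b * ‖u‖ := by
  have h1 := norm_fst_le u; have h2 := norm_snd_le u
  have h0 := norm_nonneg u
  have e1 : ‖(a.1 0 0 - b.1 0 0) * u.1 + (a.1 0 1 - b.1 0 1) * u.2‖ ≤ (‖a.1 0 0 - b.1 0 0‖ + ‖a.1 0 1 - b.1 0 1‖) * ‖u‖ := by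
    refine (norm_add_le _ _).trans ?_
    rw [norm_mul, norm_mul, add_mul]; gcongr
  have e2 : ‖(a.1 1 0 - b.1 1 0) * u.1 + (a.1 1 1 - b.1 1 1) * u.2‖ ≤ (‖a.1 1 0 - b.1 1 0‖ + ‖a.1 1 1 - b.1 1 1‖) * ‖u‖ := by
    refine (norm_add_le _ _).trans ?_
    rw [norm_mul, norm_mul, add_mul]; gcongr
  have k1 : (act a u - act b u).1 = (a.1 0 0 - b.1 0 0) * u.1 + (a.1 0 1 - b.1 0 1) * u.2 := by
    simp [act]; ring
  have k2 : (act a u - act b u).2 = (a.1 1 0 - b.1 1 0) * u.1 + (a.1 1 1 - b.1 1 1) * u.2 := by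
    simp [act]; ring
  rw [Prod.norm_def, k1, k2]
  refine max_le (e1.trans ?_) (e2.trans ?_) <;>
    exact mul_le_mul_of_nonneg_right (by unfold dm; linarith [norm_nonneg (a.1 0 0 - b.1 0 0), norm_nonneg (a.1 0 1 - b.1 0 1), norm_nonneg (a.1 1 0 - b.1 1 0), norm_nonneg (a.1 1 1 - b.1 1 1)]) h0

lemma Nn_diff_le (a b : SL2C) (z : RSphere) : |Nn a z - Nn b z| ≤ dm a b := by
  have := act_diff_le a b (lft z)
  rw [norm_lft, mul_one] at this
  exact (abs_norm_sub_norm_le _ _).trans this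

lemma mn_diff_le (a b : SL2C) : mn a ≤ mn b + dm a b := by
  unfold mn dm
  have := norm_sub_norm_le (a.1 0 0) (b.1 0 0)
  have := norm_sub_norm_le (a.1 0 1) (b.1 0 1)
  have := norm_sub_norm_le (a.1 1 0) (b.1 1 0)
  have := norm_sub_norm_le (a.1 1 1) (b.1 1 1)
  linarith

/-- bound a matrix difference by the action on basis vectors -/
lemma dm_le_of_act {a b : SL2C} {t : ℝ} (h : ∀ u : V2, ‖u‖ ≤ 1 → ‖act a u - act b u‖ ≤ t) : dm a b ≤ 4 * t := by
  have k1 := h (1, 0) (by simp)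
  have k2 := h (0, 1) (by simp)
  have a1 := norm_fst_le (act a (1, 0) - act b (1, 0))
  have a2 := norm_snd_le (act a (1, 0) - act b (1, 0))
  have a3 := norm_fst_le (act a (0, 1) - act b (0, 1))
  have a4 := norm_snd_le (act a (0, 1) - act b (0, 1))
  simp only [act, mul_one, mul_zero, add_zero, zero_add, Prod.fst_sub, Prod.snd_sub] at *
  unfold dm; linarith

lemma dm_mul_le (a b a' b' : SL2C) : dm (a * b) (a' * b') ≤ 4 * (mn a * dm b b' + dm a a' * mn b') := by
  apply dm_le_of_act
  intro u hu
  rw [act_mul, act_mul]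
  have e : act a (act b u) - act a' (act b' u) = act a (act b u - act b' u) + (act a (act b' u) - act a' (act b' u)) := by
    rw [act_sub]; abel
  rw [e]
  refine (norm_add_le _ _).trans (add_le_add ?_ ?_)
  · refine (norm_act_le _ _).trans ?_
    have := act_diff_le b b' u
    have := dm_nonneg b b'
    gcongr
    · exact mn_nonneg a
    · nlinarith
  · refine (act_diff_le _ _ _).trans ?_
    have := norm_act_le b' u
    have := mn_nonneg b'
    gcongr
    · exact dm_nonneg _ _
    · nlinarith

lemma dm_inv (a b : SL2C) : dm a⁻¹ b⁻¹ = dm a b := by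
  have h1 := a.2; have h2 := b.2
  simp only [dm, Matrix.SpecialLinearGroup.SL2_inv_expl]
  simp only [Matrix.of_apply, Matrix.cons_val', Matrix.cons_val_zero, Matrix.cons_val_one, Matrix.cons_val_fin_one]
  rw [← neg_sub', ← neg_sub', norm_neg, norm_neg]; ring

lemma dist_mobius_diff (a b : SL2C) (z : RSphere) :
    dist (mobius a z) (mobius b z) * Nn a z ≤ 4 * dm a b := by
  rw [mobius_eq, mobius_eq]
  have := dist_pr_le (act_ne (g := a) (lft_ne z)) (act_ne (g := b) (lft_ne z))
  have h2 := act_diff_le a b (lft z)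
  rw [norm_lft, mul_one] at h2
  change _ * Nn a z ≤ _ at this
  linarith

lemma dist_mobius_diff' (a b : SL2C) (z : RSphere) :
    dist (mobius a z) (mobius b z) ≤ 4 * mn a * dm a b := by
  have h1 := dist_mobius_diff a b z
  have h2 := one_le_mn_mul_Nn a z
  have h3 := mn_nonneg a
  have h4 : dist (mobius a z) (mobius b z) ≥ 0 := dist_nonneg
  nlinarith

section Rep
variable {G : Type*} [Group G]

def nR (R : G →* SL2C) : Filter (G →* SL2C) := ⨅ γ, comap (fun R1 => dm (R1 γ) (R γ)) (𝓝 0)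

lemma nR_ev (R : G →* SL2C) (γ : G) {ε : ℝ} (hε : 0 < ε) : ∀ᶠ R1 in nR R, dm (R1 γ) (R γ) < ε := by
  have h : Tendsto (fun R1 : G →* SL2C => dm (R1 γ) (R γ)) (nR R) (𝓝 0) :=
    tendsto_comap.mono_left (iInf_le _ γ)
  exact h.eventually (gt_mem_nhds hε)

lemma nR_ev_fin (R : G →* SL2C) {T : Set G} (hT : T.Finite) {ε : ℝ} (hε : 0 < ε) :
    ∀ᶠ R1 in nR R, ∀ γ ∈ T, dm (R1 γ) (R γ) < ε :=
  (eventually_all_finite hT).2 fun γ _ => nR_ev R γ hε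

lemma tendsto_nR {ι : Type*} {l : Filter ι} {R : G →* SL2C} {f : ι → (G →* SL2C)}
    (h : ∀ γ, Tendsto (fun i => dm (f i γ) (R γ)) l (𝓝 0)) : Tendsto f l (nR R) := by
  rw [nR, tendsto_iInf]; intro γ; rw [tendsto_comap_iff]; exact h γ

lemma pure_le_nR (R : G →* SL2C) : pure R ≤ nR R := by
  have : Tendsto (fun _ : Unit => R) ⊤ (nR R) := tendsto_nR fun γ => by simp [dm_self]
  intro s hs
  have := this hs
  simp at this
  exact this

def Lc (R : G →* SL2C) : Set RSphere := {z | ∀ ε > 0, ∃ γ, Nn (R γ) z < ε}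

lemma sg_inv_pt (g : SL2C) (x y : RSphere) : sg x (mobius g⁻¹ y) * Nn g⁻¹ y ≤ 2 * Nn g x := by
  have h := sg_mobius g x (mobius g⁻¹ y)
  rw [mobius_mobius_inv] at h
  have h2 := Nn_inv g⁻¹ y
  rw [inv_inv] at h2
  have h3 := sg_le_two (mobius g x) y
  have := Nn_pos g x
  calc _ = sg (mobius g x) y * Nn g x * (Nn g (mobius g⁻¹ y) * Nn g⁻¹ y) := by rw [← h]; ring
    _ = sg (mobius g x) y * Nn g x := by rw [h2, mul_one]
    _ ≤ _ := by gcongr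

lemma one_big (g : SL2C) {y y' : RSphere} (h : y ≠ y') :
    ∃ z, (z = y ∨ z = y') ∧ sg y y' * mn g ≤ 16 * Nn g z := by
  rcases le_total (Nn g y) (Nn g y') with h1 | h1
  · exact ⟨y', Or.inr rfl, bad h1 le_rfl⟩
  · exact ⟨y, Or.inl rfl, bad le_rfl h1⟩

lemma near_mn (g : SL2C) (x : RSphere) {y y' : RSphere} (h : y ≠ y') :
    ∃ z, (z = y ∨ z = y') ∧ dist x (mobius g⁻¹ z) * (sg y y' * mn g) ≤ 64 * Nn g x := by
  obtain ⟨z, hz, hb⟩ := one_big g⁻¹ h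
  refine ⟨z, hz, ?_⟩
  rw [mn_inv] at hb
  have h1 := sg_inv_pt g x z
  have h2 := dist_le_sg x (mobius g⁻¹ z)
  have h3 := sg_nonneg x (mobius g⁻¹ z)
  have h4 : 0 ≤ sg y y' * mn g := mul_nonneg (sg_nonneg _ _) (mn_nonneg _)
  calc _ ≤ (2 * sg x (mobius g⁻¹ z)) * (16 * Nn g⁻¹ z) := by gcongr
    _ ≤ _ := by linarith

lemma near (g : SL2C) (x : RSphere) {y y' : RSphere} (h : y ≠ y') :
    ∃ z, (z = y ∨ z = y') ∧ dist x (mobius g⁻¹ z) * sg y y' ≤ 64 * Nn g x := by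
  obtain ⟨z, hz, hb⟩ := near_mn g x h
  refine ⟨z, hz, le_trans ?_ hb⟩
  have := one_le_mn g
  have : 0 ≤ dist x (mobius g⁻¹ z) * sg y y' := mul_nonneg dist_nonneg (sg_nonneg _ _)
  nlinarith

lemma claimA2 {R : G →* SL2C} {x : RSphere} (hx : x ∈ Lc R) {y y' : RSphere} (h : y ≠ y') {ε : ℝ} (hε : 0 < ε) :
    ∃ γ, ∃ z, (z = y ∨ z = y') ∧ dist x (mobius (R γ) z) < ε := by
  have hs := sg_pos h
  obtain ⟨γ, hγ⟩ := hx (ε * sg y y' / 64) (by positivity)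
  obtain ⟨z, hz, hb⟩ := near (R γ) x h
  refine ⟨γ⁻¹, z, hz, ?_⟩
  rw [map_inv]
  by_contra! hc
  nlinarith

lemma claimA3 {R : G →* SL2C} {x : RSphere} (hx : x ∈ Lc R) {y1 y2 y3 : RSphere}
    (h12 : y1 ≠ y2) (h13 : y1 ≠ y3) (h23 : y2 ≠ y3) {ε : ℝ} (hε : 0 < ε) :
    ∃ γ, ∃ z, (z = y1 ∨ z = y2 ∨ z = y3) ∧ mobius (R γ) z ≠ x ∧ dist x (mobius (R γ) z) < ε := by
  have hs12 := sg_pos h12; have hs13 := sg_pos h13; have hs23 := sg_pos h23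
  obtain ⟨γ, hγ⟩ := hx (ε * min (sg y1 y2) (min (sg y1 y3) (sg y2 y3)) / 64) (by positivity)
  have m1 := min_le_left (sg y1 y2) (min (sg y1 y3) (sg y2 y3))
  have m2 := (min_le_right (sg y1 y2) (min (sg y1 y3) (sg y2 y3))).trans (min_le_left _ _)
  have m3 := (min_le_right (sg y1 y2) (min (sg y1 y3) (sg y2 y3))).trans (min_le_right _ _)
  have aux : ∀ {y y' : RSphere}, y ≠ y' → min (sg y1 y2) (min (sg y1 y3) (sg y2 y3)) ≤ sg y y' →
      ∃ z, (z = y ∨ z = y') ∧ dist x (mobius (R γ⁻¹) z) < ε := by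
    intro y y' h hm
    obtain ⟨z, hz, hb⟩ := near (R γ) x h
    refine ⟨z, hz, ?_⟩
    rw [map_inv]
    by_contra! hc
    have := sg_pos h
    nlinarith
  obtain ⟨a, ha, da⟩ := aux h12 m1
  by_cases hax : mobius (R γ⁻¹) a = x
  · have hin : ∀ b, b ≠ a → mobius (R γ⁻¹) b ≠ x := fun b hb hc => hb (mobius_inj _ (hc.trans hax.symm))
    rcases ha with rfl | rfl
    · obtain ⟨b, hb, db⟩ := aux h23 m3
      refine ⟨γ⁻¹, b, by tauto, hin b ?_, db⟩
      rcases hb with rfl | rfl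
      · exact h12.symm
      · exact h13.symm
    · obtain ⟨b, hb, db⟩ := aux h13 m2
      refine ⟨γ⁻¹, b, by tauto, hin b ?_, db⟩
      rcases hb with rfl | rfl
      · exact h12
      · exact h23.symm
  · exact ⟨γ⁻¹, a, by tauto, hax, da⟩

def GInv (R : G →* SL2C) (M : Set RSphere) : Prop := ∀ γ, ∀ z ∈ M, mobius (R γ) z ∈ M

lemma GInv.iff {R : G →* SL2C} {M : Set RSphere} (h : GInv R M) (γ : G) (z : RSphere) :
    mobius (R γ) z ∈ M ↔ z ∈ M := by
  refine ⟨fun hz => ?_, h γ z⟩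
  have := h γ⁻¹ _ hz
  rwa [map_inv, mobius_inv_mobius] at this

lemma Lc_inv (R : G →* SL2C) : GInv R (Lc R) := by
  intro δ z hz ε hε
  have hp := Nn_pos (R δ) z
  obtain ⟨γ, hγ⟩ := hz (ε * Nn (R δ) z) (by positivity)
  refine ⟨γ * δ⁻¹, ?_⟩
  have := Nn_mul (R (γ * δ⁻¹)) (R δ) z
  rw [← map_mul, inv_mul_cancel_right] at this
  rw [this] at hγ
  exact lt_of_mul_lt_mul_right hγ hp.le

/-- (a) -/
lemma Lc_subset {R : G →* SL2C} {M : Set RSphere} (hc : IsClosed M) (hi : GInv R M) (h2 : M.Nontrivial) :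
    Lc R ⊆ M := by
  intro x hx
  obtain ⟨y, hy, y', hy', hne⟩ := h2
  rw [← hc.closure_eq, Metric.mem_closure_iff]
  intro ε hε
  obtain ⟨γ, z, hz, hd⟩ := claimA2 hx hne hε
  refine ⟨_, hi γ z ?_, hd⟩
  rcases hz with rfl | rfl <;> assumption

/-- (LB) -/
lemma LB {R : G →* SL2C} {M : Set RSphere} (hi : GInv R M) (h2 : M.Nontrivial) :
    ∃ c > 0, ∀ γ z, c * Metric.infDist z M * mn (R γ) ≤ Nn (R γ) z := by
  obtain ⟨y, hy, y', hy', hne⟩ := h2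
  have := sg_pos hne
  refine ⟨sg y y' / 64, by positivity, fun γ z => ?_⟩
  obtain ⟨w, hw, hb⟩ := near_mn (R γ) z hne
  have : mobius (R γ)⁻¹ w ∈ M := by
    rw [← map_inv]; apply hi; rcases hw with rfl | rfl <;> assumption
  have h3 := Metric.infDist_le_dist_of_mem (x := z) this
  have := mn_nonneg (R γ)
  have : Metric.infDist z M * (sg y y' * mn (R γ)) ≤ dist z (mobius (R γ)⁻¹ w) * (sg y y' * mn (R γ)) := by
    gcongr
  linarith

def DiscG (R : G →* SL2C) : Prop := ∀ M : ℝ, {γ : G | mn (R γ) ≤ M}.Finite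

lemma DiscG_of (R : G →* SL2C) {ε : ℝ} (hε : 0 < ε) (h : ∀ γ, γ ≠ 1 → ε ≤ dm (R γ) 1) : DiscG R := by
  intro M
  by_contra hinf
  have hinf : {γ : G | mn (R γ) ≤ M}.Infinite := hinf
  let f : G → (ℂ × ℂ) × (ℂ × ℂ) := fun γ => (((R γ).1 0 0, (R γ).1 0 1), ((R γ).1 1 0, (R γ).1 1 1))
  have hM : 0 ≤ M := by
    obtain ⟨γ, hγ⟩ := hinf.nonempty
    exact (mn_nonneg _).trans hγ
  have hmaps : MapsTo f {γ : G | mn (R γ) ≤ M} (Metric.closedBall 0 M) := by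
    intro γ hγ
    simp only [mem_setOf_eq, mn] at hγ
    rw [mem_closedBall_zero_iff]
    have := norm_nonneg ((R γ).1 0 0); have := norm_nonneg ((R γ).1 0 1)
    have := norm_nonneg ((R γ).1 1 0); have := norm_nonneg ((R γ).1 1 1)
    refine max_le (max_le ?_ ?_) (max_le ?_ ?_) <;> simp only [f] <;> linarith
  have htb := (isCompact_closedBall (0 : (ℂ × ℂ) × (ℂ × ℂ)) M).totallyBounded
  set δ := ε / (4 * (8 * (M + 1)) + 1) with hδ
  have hδ0 : 0 < δ := by positivity
  obtain ⟨t, ht, hcov⟩ := Metric.totallyBounded_iff.1 htb δ hδ0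
  have : ∀ γ : G, ∃ y, γ ∈ {γ : G | mn (R γ) ≤ M} → y ∈ t ∧ dist (f γ) y < δ := by
    intro γ
    by_cases hγ : γ ∈ {γ : G | mn (R γ) ≤ M}
    · have := hcov (hmaps hγ)
      simp only [mem_iUnion, Metric.mem_ball, exists_prop] at this
      obtain ⟨y, hy, hd⟩ := this
      exact ⟨y, fun _ => ⟨hy, hd⟩⟩
    · exact ⟨0, fun h => absurd h hγ⟩
  choose c hc using this
  obtain ⟨a, ha, b, hb, hab, hcab⟩ := hinf.exists_ne_map_eq_of_mapsTo (f := c) (t := t) (fun γ hγ => (hc γ hγ).1) ht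
  have hd : dist (f a) (f b) < 2 * δ := by
    have h1 := (hc a ha).2; have h2 := (hc b hb).2
    rw [hcab] at h1
    linarith [dist_triangle_right (f a) (f b) (c b)]
  have hdm : dm (R a) (R b) ≤ 8 * δ := by
    rw [dist_eq_norm] at hd
    have a1 := (norm_fst_le (f a - f b)).trans hd.le
    have a2 := (norm_snd_le (f a - f b)).trans hd.le
    have b1 := (norm_fst_le _).trans a1
    have b2 := (norm_snd_le _).trans a1
    have b3 := (norm_fst_le _).trans a2
    have b4 := (norm_snd_le _).trans a2
    simp only [f, Prod.fst_sub, Prod.snd_sub] at b1 b2 b3 b4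
    unfold dm; linarith
  have h1 := h (b⁻¹ * a) (by
    intro hh; exact hab (inv_mul_eq_one.1 hh).symm)
  have h2 := dm_mul_le (R b)⁻¹ (R a) (R b)⁻¹ (R b)
  rw [dm_self, zero_mul, add_zero, inv_mul_cancel, mn_inv, ← map_inv, ← map_mul] at h2
  have hbM : mn (R b) ≤ M := hb
  have h3 : mn (R b) * dm (R a) (R b) ≤ (M + 1) * (8 * δ) := by
    apply mul_le_mul _ hdm (dm_nonneg _ _) (by linarith); linarith
  have h4 : ε ≤ 4 * ((M + 1) * (8 * δ)) := by linarith
  have h5 : δ * (4 * (8 * (M + 1)) + 1) = ε := by rw [hδ]; field_simp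
  nlinarith

structure Good (R : G →* SL2C) : Prop where
  closed : IsClosed (Lc R)
  nt : (Lc R).Nontrivial
  ne : Lc R ≠ univ
  disc : DiscG R

end Rep

/-! ### P2: expansion, paths, tracking, partition of unity -/
section Rep
variable {G : Type*} [Group G]

structure ExpD (R : G →* SL2C) (A : Set G) (r : ℝ) : Prop where
  fin : A.Finite
  pos : 0 < r
  ex : ∀ z, Metric.infDist z (Lc R) < r → ∃ γ ∈ A, ∀ u, dist u (mobius (R γ) z) ≤ r → 20 ≤ Nn (R γ⁻¹) u

lemma ExpD.mono {R : G →* SL2C} {A : Set G} {r r' : ℝ} (h : ExpD R A r) (h0 : 0 < r') (hr : r' ≤ r) : ExpD R A r' :=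
  ⟨h.fin, h0, fun z hz => by
    obtain ⟨γ, h1, h2⟩ := h.ex z (hz.trans_le hr)
    exact ⟨γ, h1, fun u hu => h2 u (hu.trans hr)⟩⟩

lemma exists_exp (R : G →* SL2C) (hc : IsClosed (Lc R)) (hne : (Lc R).Nonempty) : ∃ A r, ExpD R A r := by
  have h1 : ∀ x : RSphere, ∃ γ : G, ∃ ρ > 0, x ∈ Lc R → ∀ z, dist z x < 2 * ρ → ∀ u, dist u (mobius (R γ) z) ≤ ρ → 20 ≤ Nn (R γ⁻¹) u := by
    intro x
    by_cases hx : x ∈ Lc R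
    swap
    · exact ⟨1, 1, one_pos, fun h => absurd h hx⟩
    obtain ⟨γ, hγ⟩ := hx (1 / 40) (by norm_num)
    have h40 : 40 < Nn (R γ⁻¹) (mobius (R γ) x) := by
      have := Nn_inv (R γ) x
      rw [← map_inv] at this
      have hp := Nn_pos (R γ) x
      by_contra! hle
      nlinarith
    have hm := one_le_mn (R γ)
    refine ⟨γ, 20 / (8 * mn (R γ) * (1 + 8 * mn (R γ) ^ 2)), by positivity, fun _ z hz u hu => ?_⟩
    set ρ := 20 / (8 * mn (R γ) * (1 + 8 * mn (R γ) ^ 2)) with hρ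
    have hl := Nn_lip_dist (R γ⁻¹) (mobius (R γ) x) u
    rw [map_inv, mn_inv, ← map_inv] at hl
    have hd := dist_mobius_le (R γ) x z
    rw [dist_comm] at hz
    have h5 : dist (mobius (R γ) x) u ≤ ρ * (1 + 8 * mn (R γ) ^ 2) := by
      have := dist_triangle (mobius (R γ) x) (mobius (R γ) z) u
      rw [dist_comm u] at hu
      have : 4 * mn (R γ) ^ 2 * dist x z ≤ 4 * mn (R γ) ^ 2 * (2 * ρ) := by gcongr
      linarith
    have h6 : 8 * mn (R γ) * dist (mobius (R γ) x) u ≤ 20 := by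
      calc _ ≤ 8 * mn (R γ) * (ρ * (1 + 8 * mn (R γ) ^ 2)) := by gcongr
        _ = 20 := by rw [hρ]; field_simp
    have := abs_le.1 (hl.trans h6)
    linarith
  choose γ ρ hρ h using h1
  obtain ⟨t, ht, hcov⟩ := hc.isCompact.elim_nhds_subcover (fun x => Metric.ball x (ρ x)) (fun x _ => Metric.ball_mem_nhds x (hρ x))
  obtain ⟨r, hr1, hr2⟩ : ∃ r, (∀ x ∈ t, r ≤ ρ x) ∧ (0:ℝ) < r := by
    have e1 : ∀ᶠ r in 𝓝[>] (0:ℝ), ∀ x ∈ t, r ≤ ρ x :=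
      (eventually_all_finset t).2 fun x _ => nhdsWithin_le_nhds (eventually_le_nhds (hρ x))
    exact (e1.and self_mem_nhdsWithin).exists
  refine ⟨γ '' (t : Set RSphere), r, (t.finite_toSet).image γ, hr2, fun z hz => ?_⟩
  obtain ⟨y, hy, hzy⟩ := (Metric.infDist_lt_iff hne).1 hz
  have := hcov hy
  simp only [mem_iUnion, Metric.mem_ball, exists_prop] at this
  obtain ⟨x, hx, hyx⟩ := this
  refine ⟨γ x, mem_image_of_mem _ hx, fun u hu => h x (ht x hx) z ?_ u (hu.trans (hr1 x hx))⟩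
  have := dist_triangle z y x
  have := hr1 x hx
  linarith

lemma contr {g : SL2C} {a b : RSphere} (ha : 10 ≤ Nn g a) (hb : 10 ≤ Nn g b) :
    dist (mobius g a) (mobius g b) ≤ dist a b / 25 := by
  have h1 := dist_le_sg (mobius g a) (mobius g b)
  have h2 := sg_le_dist a b
  have h3 := sg_mobius g a b
  have h4 := sg_nonneg (mobius g a) (mobius g b)
  have h5 : 100 ≤ Nn g a * Nn g b := by nlinarith
  nlinarith

lemma path_ind {R : G →* SL2C} {A : Set G} {r : ℝ} (hE : ExpD R A r) (hc : IsClosed (Lc R)) (hne : (Lc R).Nonempty)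
    {Pr : RSphere → Prop} (h1 : ∀ z, r ≤ Metric.infDist z (Lc R) → Pr z)
    (h2 : ∀ z, ∀ γ ∈ A, z ∉ Lc R → (∀ u, dist u (mobius (R γ) z) ≤ r → 20 ≤ Nn (R γ⁻¹) u) →
      Pr (mobius (R γ) z) → Pr z) : ∀ z, z ∉ Lc R → Pr z := by
  have key : ∀ n : ℕ, ∀ z, z ∉ Lc R → r / 2 ^ n ≤ Metric.infDist z (Lc R) → Pr z := by
    intro n
    induction n with
    | zero => intro z _ h; exact h1 z (by simpa using h)
    | succ n ih =>
      intro z hz hn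
      by_cases hr : r ≤ Metric.infDist z (Lc R)
      · exact h1 z hr
      push Not at hr
      obtain ⟨γ, hγ, hu⟩ := hE.ex z hr
      refine h2 z γ hγ hz hu (ih _ (fun h => hz ((Lc_inv R).iff γ z |>.1 h)) ?_)
      refine (Metric.le_infDist hne).2 fun y hy => ?_
      have hp := hE.pos
      by_cases hd : r ≤ dist (mobius (R γ) z) y
      · refine le_trans ?_ hd
        exact div_le_self hp.le (one_le_pow₀ (by norm_num))
      push Not at hd
      have e1 := hu (mobius (R γ) z) (by simp [hp.le])
      have e2 := hu y (by rw [dist_comm]; exact hd.le)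
      have e3 := contr (g := R γ⁻¹) (by linarith) (by linarith : 10 ≤ Nn (R γ⁻¹) y) (a := mobius (R γ) z)
      rw [map_inv, mobius_inv_mobius] at e3
      have e4 : mobius (R γ)⁻¹ y ∈ Lc R := by rw [← map_inv]; exact Lc_inv R _ _ hy
      have e5 := Metric.infDist_le_dist_of_mem (x := z) e4
      rw [pow_succ] at hn
      have : r / (2 ^ n * 2) = r / 2 ^ n / 2 := by field_simp
      rw [this] at hn
      linarith [show 0 < r / 2 ^ n by positivity]
  intro z hz
  have hpos : 0 < Metric.infDist z (Lc R) := (hc.notMem_iff_infDist_pos hne).1 hz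
  obtain ⟨n, hn⟩ := exists_pow_lt_of_lt_one (div_pos hpos hE.pos) (by norm_num : (1/2:ℝ) < 1)
  refine key n z hz ?_
  have := hE.pos
  rw [lt_div_iff₀ this] at hn
  have e : r / 2 ^ n = (1/2) ^ n * r := by rw [div_pow, one_pow]; ring
  rw [e]; exact hn.le

/-- `R1` is close to `R` relative to `A`. -/
def NrA (R : G →* SL2C) (A : Set G) (δ : ℝ) (R1 : G →* SL2C) : Prop :=
  ∀ γ ∈ A, (∀ u, 20 ≤ Nn (R γ⁻¹) u → 10 ≤ Nn (R1 γ⁻¹) u) ∧ (∀ z, dist (mobius (R1 γ) z) (mobius (R γ) z) ≤ δ) ∧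
    (∀ z, dist (mobius (R1 γ⁻¹) z) (mobius (R γ⁻¹) z) ≤ δ)

lemma nrA_ev (R : G →* SL2C) {A : Set G} (hA : A.Finite) {δ : ℝ} (hδ : 0 < δ) : ∀ᶠ R1 in nR R, NrA R A δ R1 := by
  have h1 : ∀ γ ∈ A, ∀ᶠ R1 in nR R, (∀ u, 20 ≤ Nn (R γ⁻¹) u → 10 ≤ Nn (R1 γ⁻¹) u) ∧ (∀ z, dist (mobius (R1 γ) z) (mobius (R γ) z) ≤ δ) ∧
    (∀ z, dist (mobius (R1 γ⁻¹) z) (mobius (R γ⁻¹) z) ≤ δ) := by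
    intro γ _
    have hm := one_le_mn (R γ)
    filter_upwards [nR_ev R γ (ε := min 10 (δ / (4 * mn (R γ)))) (by positivity)] with R1 h
    have ha := h.trans_le (min_le_left _ _)
    have hb := h.trans_le (min_le_right _ _)
    rw [lt_div_iff₀ (by positivity)] at hb
    refine ⟨fun u hu => ?_, fun z => ?_, fun z => ?_⟩
    · have := Nn_diff_le (R1 γ⁻¹) (R γ⁻¹) u
      rw [map_inv, map_inv, dm_inv, ← map_inv, ← map_inv] at this
      have := abs_le.1 (this.trans ha.le)
      linarith
    · have := dist_mobius_diff' (R γ) (R1 γ) z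
      rw [dist_comm, dm_comm] at this; linarith
    · have := dist_mobius_diff' (R γ⁻¹) (R1 γ⁻¹) z
      rw [map_inv, map_inv, dm_inv, mn_inv, dist_comm, dm_comm, ← map_inv, ← map_inv] at this; linarith
  exact (eventually_all_finite hA).2 h1

lemma track {R R1 : G →* SL2C} {A : Set G} {r δ : ℝ} (hE : ExpD R A r) (hn : NrA R A δ R1) :
    ∀ {z w w'}, z ∈ Lc R → (∀ γ, dist (mobius (R1 γ) w) (mobius (R γ) z) ≤ r) →
    (∀ γ, dist (mobius (R1 γ) w') (mobius (R γ) z) ≤ r) → w = w' := by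
  have key : ∀ n : ℕ, ∀ z w w', z ∈ Lc R → (∀ γ, dist (mobius (R1 γ) w) (mobius (R γ) z) ≤ r) →
    (∀ γ, dist (mobius (R1 γ) w') (mobius (R γ) z) ≤ r) → dist w w' ≤ 2 * r / 25 ^ n := by
    intro n
    induction n with
    | zero =>
      intro z w w' _ h h'
      have a := h 1; have b := h' 1
      simp only [map_one, mobius_one] at a b
      have := dist_triangle_right w w' z
      simp; linarith
    | succ n ih =>
      intro z w w' hz h h'
      obtain ⟨γ, hγ, hu⟩ := hE.ex z (by rw [Metric.infDist_zero_of_mem hz]; exact hE.pos)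
      have i := ih (mobius (R γ) z) (mobius (R1 γ) w) (mobius (R1 γ) w') (Lc_inv R _ _ hz)
        (fun γ' => by simpa [map_mul, mobius_mul] using h (γ' * γ))
        (fun γ' => by simpa [map_mul, mobius_mul] using h' (γ' * γ))
      have e := contr ((hn γ hγ).1 _ (hu _ (h γ))) ((hn γ hγ).1 _ (hu _ (h' γ)))
      rw [map_inv, mobius_inv_mobius, mobius_inv_mobius] at e
      calc dist w w' ≤ _ := e
        _ ≤ (2 * r / 25 ^ n) / 25 := by gcongr
        _ = _ := by rw [pow_succ]; field_simp
  intro z w w' hz h h'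
  have hlim : Tendsto (fun n : ℕ => 2 * r / (25:ℝ) ^ n) atTop (𝓝 0) :=
    tendsto_const_nhds.div_atTop (tendsto_pow_atTop_atTop_of_one_lt (by norm_num))
  have := ge_of_tendsto' hlim fun n => key n z w w' hz h h'
  exact dist_le_zero.1 this

lemma r1path {R R1 : G →* SL2C} {A : Set G} {r δ : ℝ} (hE : ExpD R A r) (hn : NrA R A δ R1) (hδ : δ ≤ r) {w : RSphere}
    (h : ∀ γ, Metric.infDist (mobius (R1 γ) w) (Lc R) < r) : w ∈ Lc R1 := by
  have key : ∀ n : ℕ, ∃ γ, Nn (R1 γ) w ≤ (1 / 10) ^ n := by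
    intro n
    induction n with
    | zero => exact ⟨1, by simp [Nn_one]⟩
    | succ n ih =>
      obtain ⟨γ, hγ⟩ := ih
      obtain ⟨α, hα, hu⟩ := hE.ex _ (h γ)
      refine ⟨α * γ, ?_⟩
      have e := (hn α hα).1 _ (hu _ (((hn α hα).2.1 (mobius (R1 γ) w)).trans hδ))
      have e2 := Nn_inv (R1 α) (mobius (R1 γ) w)
      rw [← map_inv] at e2
      rw [map_mul, Nn_mul, pow_succ]
      have := Nn_pos (R1 α) (mobius (R1 γ) w)
      have := Nn_pos (R1 γ) w
      have h3 : Nn (R1 α) (mobius (R1 γ) w) ≤ 1 / 10 := by nlinarith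
      calc Nn (R1 α) (mobius (R1 γ) w) * Nn (R1 γ) w ≤ 1 / 10 * (1 / 10) ^ n := by gcongr
        _ = (1 / 10) ^ n * (1 / 10) := by ring
  intro ε hε
  obtain ⟨n, hn⟩ := exists_pow_lt_of_lt_one hε (by norm_num : (1 / 10 : ℝ) < 1)
  obtain ⟨γ, hγ⟩ := key n
  exact ⟨γ, hγ.trans_lt hn⟩

lemma fin_T {R : G →* SL2C} (hR : Good R) {ρ₁ ρ₂ : ℝ} (h1 : 0 < ρ₁) (h2 : 0 < ρ₂) :
    {γ : G | ∃ z, ρ₁ ≤ Metric.infDist z (Lc R) ∧ ρ₂ ≤ Metric.infDist (mobius (R γ⁻¹) z) (Lc R)}.Finite := by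
  obtain ⟨c, hc, hLB⟩ := LB (Lc_inv R) hR.nt
  refine (hR.disc (1 / (c * ρ₁ * (c * ρ₂)))).subset ?_
  rintro γ ⟨z, hz1, hz2⟩
  have a := hLB γ⁻¹ z
  have b := hLB γ (mobius (R γ⁻¹) z)
  have e := Nn_inv (R γ⁻¹) z
  rw [← map_inv, inv_inv] at e
  rw [map_inv, mn_inv, ← map_inv] at a
  have hm := one_le_mn (R γ)
  have a' : c * ρ₁ * mn (R γ) ≤ Nn (R γ⁻¹) z := le_trans (by gcongr) a
  have b' : c * ρ₂ * mn (R γ) ≤ Nn (R γ) (mobius (R γ⁻¹) z) := le_trans (by gcongr) b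
  have : (c * ρ₁ * mn (R γ)) * (c * ρ₂ * mn (R γ)) ≤ 1 := by
    rw [← e, mul_comm]; exact mul_le_mul b' a' (by positivity) (Nn_pos _ _).le
  change mn (R γ) ≤ _
  rw [le_div_iff₀ (by positivity)]
  have : mn (R γ) * (c * ρ₁ * (c * ρ₂)) ≤ mn (R γ) * mn (R γ) * (c * ρ₁ * (c * ρ₂)) := by
    gcongr; nlinarith
  linarith

lemma perfect_aux (z : RSphere) : ∃ v : V2, ‖v‖ = 1 ∧ ‖dt (lft z) v‖ = 1 := by
  have h := norm_lft z
  rw [Prod.norm_def] at h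
  rcases max_choice ‖(lft z).1‖ ‖(lft z).2‖ with h1 | h1
  · exact ⟨(0, 1), by simp, by rw [h1] at h; simpa [dt] using h⟩
  · exact ⟨(1, 0), by simp, by rw [h1] at h; simpa [dt] using h⟩

lemma perfect_pt (z : RSphere) {ε : ℝ} (hε : 0 < ε) : ∃ w, w ≠ z ∧ dist z w < ε := by
  obtain ⟨v, hv, hd⟩ := perfect_aux z
  set t : ℝ := min (1 / 2) (ε / 8)
  have ht : 0 < t := by positivity
  have e : dt (lft z) (lft z + (t : ℂ) • v) = t * dt (lft z) v := by
    simp [dt]; ring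
  have hne : lft z + (t : ℂ) • v ≠ 0 := by
    intro h0; rw [h0] at e
    have : ‖(t : ℂ) * dt (lft z) v‖ = 0 := by rw [← e]; simp [dt]
    rw [norm_mul, hd, mul_one, Complex.norm_real, Real.norm_of_nonneg ht.le] at this; exact ht.ne' this
  refine ⟨pr (lft z + (t : ℂ) • v), fun hc => ?_, ?_⟩
  · have h := sg_pr (lft_ne z) hne
    rw [hc, pr_lft, sg_self, zero_mul, e, norm_mul, hd] at h
    rw [mul_one, Complex.norm_real, Real.norm_of_nonneg ht.le] at h; exact ht.ne h
  · have h := dist_pr_le (lft_ne z) hne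
    rw [pr_lft, norm_lft] at h
    rw [sub_add_cancel_left, norm_neg, norm_smul, hv, mul_one, mul_one, Complex.norm_real, Real.norm_of_nonneg ht.le] at h
    have := min_le_right (1 / 2) (ε / 8)
    change t ≤ _ at this
    linarith

lemma Good.dense {R : G →* SL2C} (hR : Good R) : closure (Lc R)ᶜ = univ := by
  have hi : GInv R (closure (Lc R)ᶜ) := by
    intro γ z hz
    refine map_mem_closure (continuous_mobius _) hz fun y hy => ?_
    exact fun h => hy ((Lc_inv R).iff γ y |>.1 h)
  have hnt : (closure (Lc R)ᶜ).Nontrivial := by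
    obtain ⟨z, hz⟩ := (ne_univ_iff_exists_notMem _).1 hR.ne
    obtain ⟨ε, hε, hb⟩ := Metric.isOpen_iff.1 hR.closed.isOpen_compl z hz
    obtain ⟨w, hw, hd⟩ := perfect_pt z hε
    exact ⟨z, subset_closure hz, w, subset_closure (hb (by rwa [Metric.mem_ball, dist_comm])), hw.symm⟩
  have := Lc_subset isClosed_closure hi hnt
  rw [eq_univ_iff_forall]
  intro z
  by_cases hz : z ∈ Lc R
  · exact this hz
  · exact subset_closure hz

end Rep

/-! ### P3: partition of unity -/
section Rep4
variable {G : Type*} [Group G]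

structure PUD (R : G →* SL2C) (r : ℝ) (φ : RSphere → ℝ) (L : ℝ) : Prop where
  nn : ∀ z, 0 ≤ φ z
  le1 : ∀ z, φ z ≤ 1
  L0 : 0 ≤ L
  lip : ∀ z w, |φ z - φ w| ≤ L * dist z w
  van : ∀ z, Metric.infDist z (Lc R) < r / 2 → φ z = 0
  sum : ∀ z, z ∉ Lc R → ∑ᶠ γ, φ (mobius (R γ⁻¹) z) = 1

lemma PU {R : G →* SL2C} (hR : Good R) {r : ℝ} (hr : 0 < r)
    (hcov : ∀ z, z ∉ Lc R → ∃ γ, r ≤ Metric.infDist (mobius (R γ) z) (Lc R)) : ∃ φ L, PUD R r φ L := by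
  set I : RSphere → ℝ := fun z => Metric.infDist z (Lc R) with hI
  have hIl : ∀ z w, |I z - I w| ≤ dist z w := fun z w => by
    have := (Metric.lipschitz_infDist_pt (Lc R)).dist_le_mul z w
    rw [Real.dist_eq] at this; simpa using this
  set ψ : RSphere → ℝ := fun z => max 0 (min 1 (4 / r * I z - 2)) with hψ
  have p0 : ∀ z, 0 ≤ ψ z := fun z => le_max_left _ _
  have p1 : ∀ z, ψ z ≤ 1 := fun z => max_le zero_le_one (min_le_left _ _)
  have pl : ∀ z w, |ψ z - ψ w| ≤ 4 / r * dist z w := fun z w => by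
    have h0 : |ψ z - ψ w| ≤ |min 1 (4 / r * I z - 2) - min 1 (4 / r * I w - 2)| := by
      simp only [hψ, max_comm (0:ℝ)]; exact abs_max_sub_max_le_abs _ _ _
    refine h0.trans ?_
    · simp only [min_comm (1:ℝ)]
      refine (abs_min_sub_min_le_max _ _ _ _).trans ?_
      have : 4 / r * I z - 2 - (4 / r * I w - 2) = 4 / r * (I z - I w) := by ring
      rw [this, sub_self, abs_zero, abs_mul, abs_of_pos (by positivity : 0 < 4 / r)]
      have h4 : (0:ℝ) < 4 / r := by positivity
      exact max_le (mul_le_mul_of_nonneg_left (hIl z w) h4.le) (by positivity)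
  have pv : ∀ z, I z ≤ r / 2 → ψ z = 0 := fun z hz => by
    refine max_eq_left ((min_le_right _ _).trans ?_)
    have : 4 / r * I z ≤ 4 / r * (r / 2) := by gcongr
    have e : 4 / r * (r / 2) = 2 := by field_simp; norm_num
    linarith
  have pone : ∀ z, r ≤ I z → ψ z = 1 := fun z hz => by
    have : 4 / r * r ≤ 4 / r * I z := by gcongr
    have e : 4 / r * r = 4 := by field_simp
    simp only [hψ]
    rw [min_eq_left (by linarith), max_eq_right zero_le_one]
  set s : RSphere → ℝ := fun z => ∑ᶠ γ, ψ (mobius (R γ⁻¹) z) with hs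
  have hT : ∀ ρ > 0, ({γ : G | ∃ z, ρ ≤ I z ∧ r / 2 ≤ I (mobius (R γ⁻¹) z)}).Finite :=
    fun ρ hρ => fin_T hR hρ (by positivity)
  have hsupp : ∀ ρ z, ρ ≤ I z → Function.support (fun γ => ψ (mobius (R γ⁻¹) z)) ⊆
      {γ : G | ∃ z, ρ ≤ I z ∧ r / 2 ≤ I (mobius (R γ⁻¹) z)} := fun ρ z hz γ hγ =>
    ⟨z, hz, by by_contra hlt; exact hγ (pv _ (not_le.1 hlt).le)⟩
  have hpos : ∀ z, z ∉ Lc R → 0 < I z := fun z hz => (hR.closed.notMem_iff_infDist_pos hR.nt.nonempty).1 hz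
  have hfs : ∀ z, z ∉ Lc R → (Function.support (fun γ => ψ (mobius (R γ⁻¹) z))).Finite := fun z hz =>
    (hT _ (hpos z hz)).subset (hsupp _ z le_rfl)
  have sinv : ∀ γ z, s (mobius (R γ) z) = s z := fun γ z => by
    have := finsum_comp_equiv (Equiv.mulLeft γ) (f := fun δ => ψ (mobius (R δ⁻¹) (mobius (R γ) z)))
    simp only [hs]
    rw [← this]
    refine finsum_congr fun δ => ?_
    rw [← mobius_mul, ← map_mul]; simp
  have s1 : ∀ z, z ∉ Lc R → 1 ≤ s z := fun z hz => by
    obtain ⟨γ, hγ⟩ := hcov z hz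
    have h := single_le_finsum γ⁻¹ (hfs z hz) (fun j => p0 _)
    rw [inv_inv, pone _ hγ] at h
    exact h
  have sl : ∃ Ls, 0 ≤ Ls ∧ ∀ z w, r / 4 ≤ I z → r / 4 ≤ I w → |s z - s w| ≤ Ls * dist z w := by
    have hF := hT (r / 4) (by positivity)
    refine ⟨∑ γ ∈ hF.toFinset, 4 / r * (4 * mn (R γ⁻¹) ^ 2), Finset.sum_nonneg fun γ _ => by positivity, fun z w hz hw => ?_⟩
    simp only [hs]
    rw [finsum_eq_sum_of_support_subset_of_finite _ (hsupp _ z hz) hF, finsum_eq_sum_of_support_subset_of_finite _ (hsupp _ w hw) hF,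
      ← Finset.sum_sub_distrib, Finset.sum_mul]
    refine (Finset.abs_sum_le_sum_abs _ _).trans (Finset.sum_le_sum fun γ _ => ?_)
    refine (pl _ _).trans ?_
    have h4 : (0:ℝ) < 4 / r := by positivity
    have := mul_le_mul_of_nonneg_left (dist_mobius_le (R γ⁻¹) z w) h4.le
    linarith
  obtain ⟨Ls, hLs0, hLs⟩ := sl
  have key0 : ∀ z, I z ≤ r / 2 → ψ z / s z = 0 := fun z hz => by rw [pv z hz, zero_div]
  have big : ∀ z, r / 4 ≤ I z → z ∉ Lc R := fun z hz hc => by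
    have : I z = 0 := Metric.infDist_zero_of_mem hc
    linarith
  have q0 : ∀ z, 0 ≤ ψ z / s z := fun z => by
    by_cases h : I z ≤ r / 2
    · rw [key0 z h]
    · have := s1 z (big z (by linarith)); exact div_nonneg (p0 z) (by linarith)
  have q1 : ∀ z, ψ z / s z ≤ 1 := fun z => by
    by_cases h : I z ≤ r / 2
    · rw [key0 z h]; norm_num
    · have := s1 z (big z (by linarith)); rw [div_le_one (by linarith)]; exact (p1 z).trans this
  have hlip0 : ∀ z w, I z < r / 4 → |ψ z / s z - ψ w / s w| ≤ (4 / r + Ls) * dist z w := by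
    intro z w hz
    rw [key0 z (by linarith), zero_sub, abs_neg, abs_of_nonneg (q0 w)]
    by_cases h : I w ≤ r / 2
    · rw [key0 w h]; positivity
    · have h1 := abs_le.1 (hIl z w)
      have h2 : r / 4 ≤ dist z w := by linarith [h1.1]
      refine (q1 w).trans ?_
      have : 4 / r * (r / 4) ≤ 4 / r * dist z w := by gcongr
      have e : 4 / r * (r / 4) = 1 := by field_simp
      have := mul_nonneg hLs0 (dist_nonneg (x := z) (y := w))
      linarith
  refine ⟨fun z => ψ z / s z, 4 / r + Ls, q0, q1, by positivity, fun z w => ?_, fun z hz => key0 z hz.le, fun z hz => ?_⟩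
  · by_cases hz : I z < r / 4
    · exact hlip0 z w hz
    by_cases hw : I w < r / 4
    · have := hlip0 w z hw
      rwa [abs_sub_comm, dist_comm] at this
    push Not at hz hw
    have a := s1 z (big z hz); have b := s1 w (big w hw)
    have e : ψ z / s z - ψ w / s w = (ψ z - ψ w) / s z + ψ w / s w * ((s w - s z) / s z) := by
      field_simp; ring
    have c1 : |(ψ z - ψ w) / s z| ≤ 4 / r * dist z w := by
      rw [abs_div, abs_of_pos (by linarith : 0 < s z)]
      exact (div_le_self (abs_nonneg _) a).trans (pl z w)
    have c2 : |(s w - s z) / s z| ≤ Ls * dist z w := by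
      rw [abs_div, abs_of_pos (by linarith : 0 < s z), abs_sub_comm]
      exact (div_le_self (abs_nonneg _) a).trans (hLs z w hz hw)
    have c3 : |ψ w / s w * ((s w - s z) / s z)| ≤ Ls * dist z w := by
      rw [abs_mul, abs_of_nonneg (q0 w)]
      exact (mul_le_of_le_one_left (abs_nonneg _) (q1 w)).trans c2
    rw [e]
    refine (abs_add_le _ _).trans ?_
    linarith
  · have e : ∀ γ, ψ (mobius (R γ⁻¹) z) / s (mobius (R γ⁻¹) z) = ψ (mobius (R γ⁻¹) z) * (1 / s z) := fun γ => by
      rw [sinv]; ring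
    simp only [e]
    rw [← finsum_mul]
    have := s1 z hz
    change s z * (1 / s z) = 1
    field_simp
end Rep4

/-! ### P4: perturbation lemmas -/
lemma act_finset_sum {ι : Type*} (g : SL2C) (s : Finset ι) (f : ι → V2) : act g (∑ i ∈ s, f i) = ∑ i ∈ s, act g (f i) := by
  classical
  induction s using Finset.induction_on with
  | empty => simp [act_zero]
  | insert a s ha ih => rw [Finset.sum_insert ha, Finset.sum_insert ha, act_add, ih]

lemma act_finsum {ι : Type*} (g : SL2C) {f : ι → V2} (hf : (Function.support f).Finite) : act g (∑ᶠ i, f i) = ∑ᶠ i, act g (f i) := by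
  rw [finsum_eq_sum_of_support_subset_of_finite f subset_rfl hf, act_finset_sum,
    finsum_eq_sum_of_support_subset_of_finite (fun i => act g (f i)) (s := Function.support f) _ hf]
  intro i hi h
  exact hi (by simp only [h, act_zero])

lemma small_ne {P : V2 → V2} {e : ℝ} (he : e < 1) (hP : ∀ u v, ‖P u - P v‖ ≤ e * ‖u - v‖) (h0 : P 0 = 0) {u : V2} (hu : u ≠ 0) :
    u + P u ≠ 0 := by
  intro h
  have h1 := hP u 0
  rw [h0, sub_zero, sub_zero, eq_neg_of_add_eq_zero_right h, norm_neg] at h1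
  have := norm_pos_iff.2 hu
  nlinarith

lemma sg_pert {P : V2 → V2} {e : ℝ} (he0 : 0 ≤ e) (he : e ≤ 1 / 100) (hP : ∀ u v, ‖P u - P v‖ ≤ e * ‖u - v‖)
    (hh : ∀ (c : ℂ) u, P (c • u) = c • P u) (z w : RSphere) :
    |sg (pr (lft z + P (lft z))) (pr (lft w + P (lft w))) - sg z w| ≤ 40 * e * sg z w := by
  have h0 : P 0 = 0 := by have := hh 0 0; simpa using this
  obtain ⟨c, hc, hcl⟩ := close_lift z w
  have hc0 : c ≠ 0 := by intro h; rw [h] at hc; simp at hc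
  set u := lft z with hu
  set v := c • lft w with hv
  have hvn : ‖v‖ = 1 := by rw [hv, norm_smul, hc, norm_lft, one_mul]
  have hun : ‖u‖ = 1 := norm_lft z
  have hu0 : u ≠ 0 := lft_ne z
  have hv0 : v ≠ 0 := by intro h; rw [h] at hvn; simp at hvn
  have e1 : pr (lft w + P (lft w)) = pr (v + P v) := by
    rw [hv, hh, ← smul_add, pr_smul hc0]
  have e2 : sg z w = ‖dt u v‖ := by
    rw [← sg_pr hu0 hv0, hun, hvn, hu, hv, pr_lft, pr_smul hc0, pr_lft]; ring
  rw [e1]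
  have hX := sg_pr (small_ne (by linarith) hP h0 hu0) (small_ne (by linarith) hP h0 hv0)
  have hPu : ‖P u‖ ≤ e := by have := hP u 0; rwa [h0, sub_zero, sub_zero, hun, mul_one] at this
  have hPv : ‖P v‖ ≤ e := by have := hP v 0; rwa [h0, sub_zero, sub_zero, hvn, mul_one] at this
  set s := sg z w with hs
  have hs0 : 0 ≤ s := sg_nonneg z w
  have hd : ‖dt (u + P u) (v + P v) - dt u v‖ ≤ 24 * e * s := by
    have : dt (u + P u) (v + P v) - dt u v = dt u (P v - P u) + dt (P u) (v - u) + dt (P u) (P v - P u) := by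
      simp [dt]; ring
    rw [this]
    have k : ‖v - u‖ ≤ 4 * s := by rw [norm_sub_rev]; exact hcl
    have k2 : ‖P v - P u‖ ≤ e * (4 * s) := (hP v u).trans (by gcongr)
    have a1 := norm_dt_le u (P v - P u)
    have a2 := norm_dt_le (P u) (v - u)
    have a3 := norm_dt_le (P u) (P v - P u)
    have b1 : 2 * ‖u‖ * ‖P v - P u‖ ≤ 2 * 1 * (e * (4 * s)) := by rw [hun]; gcongr
    have b2 : 2 * ‖P u‖ * ‖v - u‖ ≤ 2 * e * (4 * s) := by gcongr
    have b3 : 2 * ‖P u‖ * ‖P v - P u‖ ≤ 2 * 1 * (e * (4 * s)) := by gcongr; linarith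
    have := norm_add₃_le (a := dt u (P v - P u)) (b := dt (P u) (v - u)) (c := dt (P u) (P v - P u))
    linarith
  have n1 : |‖u + P u‖ - 1| ≤ e := by
    rw [← hun]; refine (abs_norm_sub_norm_le _ _).trans ?_; simpa using hPu
  have n2 : |‖v + P v‖ - 1| ≤ e := by
    rw [← hvn]; refine (abs_norm_sub_norm_le _ _).trans ?_; simpa using hPv
  have hd2 : |‖dt (u + P u) (v + P v)‖ - s| ≤ 24 * e * s := by
    rw [e2]; exact (abs_norm_sub_norm_le _ _).trans (by rw [← e2]; exact hd)
  rw [← hX] at hd2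
  set X := sg (pr (u + P u)) (pr (v + P v)) with hXd
  have hX0 : 0 ≤ X := sg_nonneg _ _
  obtain ⟨n1a, n1b⟩ := abs_le.1 n1
  obtain ⟨n2a, n2b⟩ := abs_le.1 n2
  obtain ⟨d1, d2⟩ := abs_le.1 hd2
  set a := ‖u + P u‖
  set b := ‖v + P v‖
  have ab1 : 1 - 2 * e ≤ a * b := by nlinarith
  have ab2 : a * b ≤ 1 + 3 * e := by nlinarith
  have c1 : X * (1 - 2 * e) ≤ (1 + 24 * e) * s := by
    have := mul_le_mul_of_nonneg_left ab1 hX0; linarith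
  have c2 : (1 - 24 * e) * s ≤ X * (1 + 3 * e) := by
    have := mul_le_mul_of_nonneg_left ab2 hX0; linarith
  have hes : 0 ≤ e * s := by positivity
  rw [abs_le]; constructor
  · by_contra! hlt
    have : X * (1 + 3 * e) ≤ (s - 40 * e * s) * (1 + 3 * e) := mul_le_mul_of_nonneg_right (by linarith) (by linarith)
    nlinarith [mul_nonneg hes he0]
  · by_contra! hlt
    have : (s + 40 * e * s) * (1 - 2 * e) < X * (1 - 2 * e) := mul_lt_mul_of_pos_right (by linarith) (by linarith)
    nlinarith [mul_nonneg hes he0, mul_le_mul_of_nonneg_left he hes]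

lemma solve_pert {P : V2 → V2} {e : ℝ} (he : e ≤ 1 / 100) (he0 : 0 ≤ e) (hP : ∀ u v, ‖P u - P v‖ ≤ e * ‖u - v‖) (v : V2) : ∃ u, u + P u = v := by
  have hc : ContractingWith (Real.toNNReal e) (fun u => v - P u) := by
    refine ⟨by rw [← NNReal.coe_lt_coe, Real.coe_toNNReal _ he0, NNReal.coe_one]; linarith, LipschitzWith.of_dist_le' fun a b => ?_⟩
    rw [dist_eq_norm, dist_eq_norm, sub_sub_sub_cancel_left, norm_sub_rev]; exact hP a b
  refine ⟨hc.fixedPoint _, ?_⟩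
  have h := hc.fixedPoint_isFixedPt
  have h' : v - P (hc.fixedPoint _) = hc.fixedPoint _ := h
  exact (eq_add_of_sub_eq h').symm

section Rep5
variable {G : Type*} [Group G]

structure DOK (R : G →* SL2C) (ρ κ : ℝ) (D : V2 → V2) : Prop where
  hom : ∀ (c : ℂ) u, D (c • u) = c • D u
  lip : ∀ u v, ‖D u - D v‖ ≤ κ * ‖u - v‖
  van : ∀ u, u ≠ 0 → Metric.infDist (pr u) (Lc R) < ρ → D u = 0

/-- averaged map -/
def AV (R R1 : G →* SL2C) (Q : V2 → V2) (u : V2) : V2 := ∑ᶠ γ, act (R1 γ) (Q (act (R γ⁻¹) u))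

def Qf (φ : RSphere → ℝ) (u : V2) : V2 := (φ (pr u) : ℂ) • u

lemma Qf_hom (φ : RSphere → ℝ) (c : ℂ) (u : V2) : Qf φ (c • u) = c • Qf φ u := by
  by_cases hc : c = 0
  · simp [Qf, hc]
  · simp only [Qf, pr_smul hc]; rw [smul_comm]

lemma Qf_lip {R : G →* SL2C} {r L : ℝ} {φ : RSphere → ℝ} (h : PUD R r φ L) (u v : V2) : ‖Qf φ u - Qf φ v‖ ≤ (1 + 4 * L) * ‖u - v‖ := by
  have hL := h.L0
  by_cases hu : u = 0
  · simp only [hu, Qf, smul_zero, zero_sub, norm_neg, norm_smul, Complex.norm_real, Real.norm_of_nonneg (h.nn _)]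
    have := h.le1 (pr v); have := norm_nonneg v
    nlinarith [h.nn (pr v), mul_nonneg hL this]
  by_cases hv : v = 0
  · simp only [hv, Qf, smul_zero, sub_zero, norm_smul, Complex.norm_real, Real.norm_of_nonneg (h.nn _)]
    have := h.le1 (pr u); have := norm_nonneg u
    nlinarith [h.nn (pr u), mul_nonneg hL this]
  have e : Qf φ u - Qf φ v = ((φ (pr u) - φ (pr v) : ℝ) : ℂ) • u + (φ (pr v) : ℂ) • (u - v) := by
    simp only [Qf, Complex.ofReal_sub, sub_smul, smul_sub]; abel
  rw [e]
  refine (norm_add_le _ _).trans ?_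
  rw [norm_smul, norm_smul, Complex.norm_real, Complex.norm_real, Real.norm_eq_abs, Real.norm_of_nonneg (h.nn _)]
  have a := mul_le_mul_of_nonneg_right (h.lip (pr u) (pr v)) (norm_nonneg u)
  have b := mul_le_mul_of_nonneg_left (dist_pr_le hu hv) hL
  have c := mul_le_mul_of_nonneg_right (h.le1 (pr v)) (norm_nonneg (u - v))
  linarith

lemma Qf_van {R : G →* SL2C} {r L : ℝ} {φ : RSphere → ℝ} (h : PUD R r φ L) {u : V2} (hu : Metric.infDist (pr u) (Lc R) < r / 2) : Qf φ u = 0 := by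
  rw [Qf, h.van _ hu]; simp

/-- the set of relevant group elements -/
def TT (R : G →* SL2C) (σ r : ℝ) : Set G :=
  {γ : G | ∃ z, σ ≤ Metric.infDist z (Lc R) ∧ r / 2 ≤ Metric.infDist (mobius (R γ⁻¹) z) (Lc R)}

lemma AV_supp {R R1 : G →* SL2C} {r σ : ℝ} {Q : V2 → V2} (hv : ∀ u, u ≠ 0 → Metric.infDist (pr u) (Lc R) < r / 2 → Q u = 0)
    {u : V2} (hu : u ≠ 0) (hσ : σ ≤ Metric.infDist (pr u) (Lc R)) :
    Function.support (fun γ => act (R1 γ) (Q (act (R γ⁻¹) u))) ⊆ TT R σ r := by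
  intro γ hγ
  refine ⟨pr u, hσ, ?_⟩
  by_contra! hlt
  rw [mobius_pr _ hu] at hlt
  exact hγ (by simp only [hv _ (act_ne hu) hlt, act_zero])

lemma AV_fin {R R1 : G →* SL2C} (hR : Good R) {r : ℝ} (hr : 0 < r) {Q : V2 → V2} (hv : ∀ u, u ≠ 0 → Metric.infDist (pr u) (Lc R) < r / 2 → Q u = 0)
    {u : V2} (hu : u ≠ 0) (hz : pr u ∉ Lc R) :
    (Function.support (fun γ => act (R1 γ) (Q (act (R γ⁻¹) u)))).Finite :=
  (fin_T hR ((hR.closed.notMem_iff_infDist_pos hR.nt.nonempty).1 hz) (by positivity : 0 < r / 2)).subset (AV_supp hv hu le_rfl)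

lemma AV_equiv {R R1 : G →* SL2C} (hR : Good R) {r : ℝ} (hr : 0 < r) {Q : V2 → V2} (hv : ∀ u, u ≠ 0 → Metric.infDist (pr u) (Lc R) < r / 2 → Q u = 0)
    {u : V2} (hu : u ≠ 0) (hz : pr u ∉ Lc R) (γ : G) : AV R R1 Q (act (R γ) u) = act (R1 γ) (AV R R1 Q u) := by
  rw [AV, AV, act_finsum _ (AV_fin hR hr hv hu hz), ← finsum_comp_equiv (Equiv.mulLeft γ)]
  refine finsum_congr fun δ => ?_
  simp only [Equiv.coe_mulLeft, map_mul, act_mul, ← act_mul]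
  simp [← map_mul, ← map_inv]

lemma AV_hom {R R1 : G →* SL2C} {Q : V2 → V2} (hh : ∀ (c : ℂ) u, Q (c • u) = c • Q u) {c : ℂ} (hc : c ≠ 0) (u : V2) :
    AV R R1 Q (c • u) = c • AV R R1 Q u := by
  rw [AV, AV, smul_finsum]
  exact finsum_congr fun δ => by rw [act_smul, hh, act_smul]

lemma AV_id {R : G →* SL2C} (hR : Good R) {r L : ℝ} (hr : 0 < r) {φ : RSphere → ℝ} (h : PUD R r φ L) {u : V2} (hu : u ≠ 0) (hz : pr u ∉ Lc R) :
    AV R R (Qf φ) u = u := by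
  have e : ∀ γ, act (R γ) (Qf φ (act (R γ⁻¹) u)) = (φ (mobius (R γ⁻¹) (pr u)) : ℂ) • u := fun γ => by
    rw [Qf, act_smul, ← mobius_pr _ hu, map_inv, act_act_inv]
  have hfin := AV_fin (R1 := R) hR hr (fun u _ h' => Qf_van h h') hu hz
  simp only [AV, e] at hfin ⊢
  have hs := h.sum _ hz
  have hfin2 : (Function.support fun γ => φ (mobius (R γ⁻¹) (pr u))).Finite := by
    refine hfin.subset fun γ hγ h0 => hγ ?_
    simpa [hu] using h0
  rw [finsum_eq_sum_of_support_subset_of_finite _ subset_rfl hfin2] at hs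
  rw [finsum_eq_sum_of_support_subset_of_finite (s := Function.support fun γ => φ (mobius (R γ⁻¹) (pr u))) _ _ hfin2, ← Finset.sum_smul,
    ← Complex.ofReal_sum, hs]
  · simp
  · intro γ hγ h0; exact hγ (by simp only [h0]; simp)

lemma PT_exists {R : G →* SL2C} (hR : Good R) {r L ρ σ e : ℝ} (hr : 0 < r) (hrρ : r ≤ ρ) (hσ : 0 < σ) (he : 0 < e) {φ : RSphere → ℝ} (h : PUD R r φ L) :
    ∃ κ > 0, ∀ᶠ R1 in nR R, ∀ D, DOK R ρ κ D → ∃ P : V2 → V2, (∀ (c : ℂ) u, P (c • u) = c • P u) ∧ (∀ u v, ‖P u - P v‖ ≤ e * ‖u - v‖) ∧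
      ∀ u, u ≠ 0 → σ ≤ Metric.infDist (pr u) (Lc R) → AV R R1 (fun u => Qf φ u + D u) u = u + P u := by
  have hT : (TT R σ r).Finite := fin_T hR hσ (by positivity)
  set T := hT.toFinset with hTd
  set S := ∑ γ ∈ T, (1 + 4 * L) * mn (R γ) with hS
  set S2 := ∑ γ ∈ T, (mn (R γ) + 1) * mn (R γ) with hS2
  have hL := h.L0
  have hS0 : 0 ≤ S := Finset.sum_nonneg fun γ _ => mul_nonneg (by linarith) (mn_nonneg _)
  have hS20 : 0 ≤ S2 := Finset.sum_nonneg fun γ _ => by have := mn_nonneg (R γ); positivity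
  set κ := e / (2 * (1 + S2)) with hκ
  have hκ0 : 0 < κ := by positivity
  refine ⟨κ, hκ0, ?_⟩
  set δ := min 1 (e / (2 * (1 + S))) with hδ
  have hδ0 : 0 < δ := by positivity
  filter_upwards [nR_ev_fin R hT hδ0] with R1 hR1 D hD
  have hR1' : ∀ γ ∈ T, dm (R1 γ) (R γ) ≤ δ := fun γ hγ => (hR1 γ (hT.mem_toFinset.1 hγ)).le
  refine ⟨fun u => ∑ γ ∈ T, (act (R1 γ) (Qf φ (act (R γ⁻¹) u) + D (act (R γ⁻¹) u)) - act (R γ) (Qf φ (act (R γ⁻¹) u))), ?_, ?_, ?_⟩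
  · intro c u
    rw [Finset.smul_sum]
    refine Finset.sum_congr rfl fun γ _ => ?_
    rw [act_smul, Qf_hom, hD.hom, ← smul_add, act_smul, act_smul, smul_sub]
  · intro u v
    rw [← Finset.sum_sub_distrib]
    refine (norm_sum_le _ _).trans ?_
    have hb : ∀ γ ∈ T, ‖(act (R1 γ) (Qf φ (act (R γ⁻¹) u) + D (act (R γ⁻¹) u)) - act (R γ) (Qf φ (act (R γ⁻¹) u))) -
        (act (R1 γ) (Qf φ (act (R γ⁻¹) v) + D (act (R γ⁻¹) v)) - act (R γ) (Qf φ (act (R γ⁻¹) v)))‖ ≤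
        (δ * ((1 + 4 * L) * mn (R γ)) + κ * ((mn (R γ) + 1) * mn (R γ))) * ‖u - v‖ := by
      intro γ hγ
      set a := act (R γ⁻¹) u
      set b := act (R γ⁻¹) v
      have hab : ‖a - b‖ ≤ mn (R γ) * ‖u - v‖ := by
        have := norm_act_le (R γ⁻¹) (u - v)
        rwa [act_sub, map_inv, mn_inv, ← map_inv] at this
      have hm := one_le_mn (R γ)
      have ee : (act (R1 γ) (Qf φ a + D a) - act (R γ) (Qf φ a)) - (act (R1 γ) (Qf φ b + D b) - act (R γ) (Qf φ b))
          = (act (R1 γ) (Qf φ a - Qf φ b) - act (R γ) (Qf φ a - Qf φ b)) + act (R1 γ) (D a - D b) := by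
        simp only [act_add, act_sub]; abel
      rw [ee]
      have h1 := act_diff_le (R1 γ) (R γ) (Qf φ a - Qf φ b)
      have h2 := norm_act_le (R1 γ) (D a - D b)
      have h3 := Qf_lip h a b
      have h4 := hD.lip a b
      have h5 : mn (R1 γ) ≤ mn (R γ) + 1 := (mn_diff_le _ (R γ)).trans (by have := hR1' γ hγ; have := min_le_left 1 (e / (2 * (1 + S))); linarith)
      have h6 : dm (R1 γ) (R γ) * ‖Qf φ a - Qf φ b‖ ≤ δ * ((1 + 4 * L) * (mn (R γ) * ‖u - v‖)) := by
        have h7 : ‖Qf φ a - Qf φ b‖ ≤ (1 + 4 * L) * (mn (R γ) * ‖u - v‖) := h3.trans (by gcongr)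
        exact mul_le_mul (hR1' γ hγ) h7 (norm_nonneg _) hδ0.le
      have h7 : mn (R1 γ) * ‖D a - D b‖ ≤ (mn (R γ) + 1) * (κ * (mn (R γ) * ‖u - v‖)) := by
        have h8 : ‖D a - D b‖ ≤ κ * (mn (R γ) * ‖u - v‖) := h4.trans (by gcongr)
        exact mul_le_mul h5 h8 (norm_nonneg _) (by linarith)
      refine (norm_add_le _ _).trans ?_
      linarith
    refine (Finset.sum_le_sum hb).trans ?_
    rw [← Finset.sum_mul, Finset.sum_add_distrib]
    have s1 : ∑ γ ∈ T, δ * ((1 + 4 * L) * mn (R γ)) = δ * S := by rw [hS, Finset.mul_sum]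
    have s2 : ∑ γ ∈ T, κ * ((mn (R γ) + 1) * mn (R γ)) = κ * S2 := by rw [hS2, Finset.mul_sum]
    rw [s1, s2]
    refine mul_le_mul_of_nonneg_right ?_ (norm_nonneg _)
    have k1 : δ * S ≤ e / 2 := by
      have : δ * S ≤ e / (2 * (1 + S)) * S := mul_le_mul_of_nonneg_right (min_le_right _ _) hS0
      refine this.trans ?_
      rw [div_mul_eq_mul_div, div_le_div_iff₀ (by positivity) (by norm_num)]; nlinarith
    have k2 : κ * S2 ≤ e / 2 := by
      rw [hκ, div_mul_eq_mul_div, div_le_div_iff₀ (by positivity) (by norm_num)]; nlinarith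
    linarith
  · intro u hu hσu
    have hz : pr u ∉ Lc R := fun hc => by rw [Metric.infDist_zero_of_mem hc] at hσu; linarith
    have hv : ∀ u, u ≠ 0 → Metric.infDist (pr u) (Lc R) < r / 2 → Qf φ u + D u = 0 := fun u hu' h' => by
      rw [Qf_van h h', hD.van u hu' (by linarith), add_zero]
    have i := AV_id hR hr h hu hz
    rw [AV, finsum_eq_sum_of_support_subset_of_finite _ (AV_supp (fun u _ h' => Qf_van h h') hu hσu) hT] at i
    rw [AV, finsum_eq_sum_of_support_subset_of_finite _ (AV_supp hv hu hσu) hT]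
    dsimp only
    rw [Finset.sum_sub_distrib, i]
    abel
end Rep5

/-! ### P5: structural stability -/
section Rep6
variable {G : Type*} [Group G]

structure STC (R R1 : G →* SL2C) (ρ ε : ℝ) (F0 D : V2 → V2) (Ψ : RSphere ≃ₜ RSphere) : Prop where
  eqv : ∀ γ z, Ψ (mobius (R γ) z) = mobius (R1 γ) (Ψ z)
  close : ∀ z, dist (Ψ z) z ≤ ε
  sgc : ∀ z w, ρ ≤ Metric.infDist z (Lc R) → ρ ≤ Metric.infDist w (Lc R) → |sg (Ψ z) (Ψ w) - sg z w| ≤ ε * sg z w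
  img : Ψ '' Lc R = Lc R1
  form : ∀ z, z ∉ Lc R → Ψ z = pr (F0 (lft z) + AV R R1 D (lft z))

lemma DOK_zero (R : G →* SL2C) (ρ : ℝ) {κ : ℝ} (hκ : 0 ≤ κ) : DOK R ρ κ (fun _ => 0) :=
  ⟨fun _ _ => by simp, fun u v => by simp only [sub_self, norm_zero]; positivity, fun _ _ _ => rfl⟩

lemma NrA_self (R : G →* SL2C) (A : Set G) {δ : ℝ} (hδ : 0 ≤ δ) : NrA R A δ R :=
  fun γ _ => ⟨fun u h => by linarith, fun z => by simpa using hδ, fun z => by simpa using hδ⟩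

lemma cover_of_exp {R : G →* SL2C} {A : Set G} {r : ℝ} (hE : ExpD R A r) (hc : IsClosed (Lc R)) (hne : (Lc R).Nonempty) :
    ∀ z, z ∉ Lc R → ∃ γ, r ≤ Metric.infDist (mobius (R γ) z) (Lc R) := by
  refine path_ind hE hc hne (fun z hz => ⟨1, by simpa [mobius_one] using hz⟩) ?_
  rintro z γ _ _ _ ⟨δ, hδ⟩
  exact ⟨δ * γ, by rwa [map_mul, mobius_mul]⟩

lemma exists_tr {R R1 : G →* SL2C} {l : Filter RSphere} {f : RSphere → RSphere} {z : RSphere} {ε : ℝ} (U : Ultrafilter RSphere) (hU : ↑U ≤ 𝓝 z)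
    (h : ∀ᶠ y in (U : Filter RSphere), ∀ γ, dist (mobius (R1 γ) (f y)) (mobius (R γ) y) ≤ ε) :
    ∃ w, Tendsto f U (𝓝 w) ∧ ∀ γ, dist (mobius (R1 γ) w) (mobius (R γ) z) ≤ ε := by
  obtain ⟨w, -, hw⟩ := isCompact_univ.ultrafilter_le_nhds (U.map f) (by simp)
  have hw' : Tendsto f U (𝓝 w) := hw
  refine ⟨w, hw', fun γ => ?_⟩
  have t1 : Tendsto (fun y => mobius (R1 γ) (f y)) U (𝓝 (mobius (R1 γ) w)) := ((continuous_mobius (R1 γ)).tendsto w).comp hw'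
  have t2 : Tendsto (fun y => mobius (R γ) y) U (𝓝 (mobius (R γ) z)) := ((continuous_mobius (R γ)).tendsto z).mono_left hU
  exact le_of_tendsto (t1.dist t2) (h.mono fun y hy => hy γ)

theorem STab {R : G →* SL2C} (hR : Good R) {ρ ε : ℝ} (hρ : 0 < ρ) (hε : 0 < ε) :
    ∃ κ > 0, ∀ᶠ R1 in nR R, ∃ F0 : V2 → V2, (∀ z, ρ ≤ Metric.infDist z (Lc R) → ‖F0 (lft z) - lft z‖ ≤ ε) ∧
      ∀ D, DOK R ρ κ D → ∃ Ψ : RSphere ≃ₜ RSphere, STC R R1 ρ ε F0 D Ψ := by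
  have hne := hR.nt.nonempty
  obtain ⟨A, r0, hE0⟩ := exists_exp R hR.closed hne
  set r := min r0 ρ with hrd
  have hr : 0 < r := lt_min hE0.pos hρ
  have hrρ : r ≤ ρ := min_le_right _ _
  have hE : ExpD R A r := hE0.mono hr (min_le_left _ _)
  obtain ⟨φ, L, hφ⟩ := PU hR hr (cover_of_exp hE hR.closed hne)
  set ε' := min ε (r / 8) with hε'
  have hε'0 : 0 < ε' := by positivity
  have hε'1 : ε' ≤ ε := min_le_left _ _
  have hε'2 : ε' ≤ r / 8 := min_le_right _ _
  set e := min (1 / 100) (ε' / 40) with hed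
  have he0 : 0 < e := by positivity
  have he1 : e ≤ 1 / 100 := min_le_left _ _
  have he2 : e ≤ ε' / 40 := min_le_right _ _
  obtain ⟨κ, hκ, hPT⟩ := PT_exists hR hr hrρ (by positivity : 0 < r / 2) he0 hφ
  refine ⟨κ, hκ, ?_⟩
  filter_upwards [hPT, nrA_ev R hE.fin (by positivity : 0 < ε' / 2)] with R1 hP hN
  refine ⟨AV R R1 (Qf φ), ?_, ?_⟩
  · intro z hz
    obtain ⟨P, hP1, hP2, hP3⟩ := hP _ (DOK_zero R ρ hκ.le)
    have h3 := hP3 (lft z) (lft_ne z) (by rw [pr_lft]; linarith)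
    simp only [add_zero] at h3
    have e0 : AV R R1 (fun u => Qf φ u) = AV R R1 (Qf φ) := rfl
    rw [e0] at h3
    rw [h3, add_sub_cancel_left]
    have h0 : P 0 = 0 := by have := hP1 0 0; simpa using this
    have := hP2 (lft z) 0
    rw [h0, sub_zero, sub_zero, norm_lft, mul_one] at this
    linarith
  intro D hD
  obtain ⟨P, hP1, hP2, hP3⟩ := hP D hD
  have hP0 : P 0 = 0 := by have := hP1 0 0; simpa using this
  set Q : V2 → V2 := fun u => Qf φ u + D u with hQ
  have hQv : ∀ u, u ≠ 0 → Metric.infDist (pr u) (Lc R) < r / 2 → Q u = 0 := fun u hu' h' => by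
    simp only [hQ]; rw [Qf_van hφ h', hD.van u hu' (by linarith), add_zero]
  have hQh : ∀ (c : ℂ) u, Q (c • u) = c • Q u := fun c u => by
    simp only [hQ]; rw [Qf_hom, hD.hom, smul_add]
  set F := AV R R1 Q with hF
  have Finv : ∀ γ z, (mobius (R γ) z ∈ Lc R ↔ z ∈ Lc R) := fun γ z => (Lc_inv R).iff γ z
  have hcov := cover_of_exp hE hR.closed hne
  -- nonvanishing
  have Fne : ∀ z, z ∉ Lc R → F (lft z) ≠ 0 := by
    intro z hz h0
    obtain ⟨γ, hγ⟩ := hcov z hz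
    have h1 := AV_equiv (R1 := R1) hR hr hQv (lft_ne z) (by rwa [pr_lft]) γ
    have h1' : F (act (R γ) (lft z)) = act (R1 γ) (F (lft z)) := h1
    rw [h0, act_zero] at h1'
    have h2 := hP3 (act (R γ) (lft z)) (act_ne (lft_ne z)) (by rw [← mobius_eq]; linarith)
    exact small_ne (by linarith) hP2 hP0 (act_ne (lft_ne z)) (h2.symm.trans h1')
  set Ψo : RSphere → RSphere := fun z => pr (F (lft z)) with hΨo
  have ΨoK : ∀ z, r / 2 ≤ Metric.infDist z (Lc R) → Ψo z = pr (lft z + P (lft z)) := fun z hz => by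
    simp only [hΨo]; rw [hP3 _ (lft_ne z) (by rwa [pr_lft])]
  have Ψoeq : ∀ γ z, z ∉ Lc R → Ψo (mobius (R γ) z) = mobius (R1 γ) (Ψo z) := by
    intro γ z hz
    obtain ⟨c, -, hc, h2⟩ := act_lft (R γ) z
    have h1 := AV_equiv (R1 := R1) hR hr hQv (lft_ne z) (by rwa [pr_lft]) γ
    rw [h2, AV_hom hQh hc] at h1
    simp only [hΨo]
    rw [mobius_pr _ (Fne z hz), ← pr_smul hc]
    exact congrArg pr h1
  have Ψocl : ∀ z, z ∉ Lc R → dist (Ψo z) z ≤ ε' := by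
    refine path_ind hE hR.closed hne (fun z hz => ?_) ?_
    · rw [ΨoK z (by linarith), dist_comm]
      have h1 := dist_pr_le (lft_ne z) (small_ne (by linarith) hP2 hP0 (lft_ne z))
      rw [pr_lft, norm_lft, mul_one, sub_add_cancel_left, norm_neg] at h1
      have := hP2 (lft z) 0
      rw [hP0, sub_zero, sub_zero, norm_lft, mul_one] at this
      linarith
    · intro z γ hγ hz hu ih
      have h1 := Ψoeq γ z hz
      have h2 : Ψo z = mobius (R1 γ⁻¹) (Ψo (mobius (R γ) z)) := by rw [h1, map_inv, mobius_inv_mobius]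
      have h3 := (hN γ hγ).2.2 (Ψo (mobius (R γ) z))
      have h4 := contr (g := R γ⁻¹) (a := Ψo (mobius (R γ) z)) (b := mobius (R γ) z) (by have := hu _ (ih.trans (by linarith)); linarith)
        (by have := hu (mobius (R γ) z) (by simpa using hr.le); linarith)
      rw [← h2] at h3
      have h5 := dist_triangle (Ψo z) (mobius (R γ⁻¹) (Ψo (mobius (R γ) z))) (mobius (R γ⁻¹) (mobius (R γ) z))
      have h6 : mobius (R γ⁻¹) (mobius (R γ) z) = z := by rw [map_inv, mobius_inv_mobius]
      rw [h6] at h5 h4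
      linarith
  have Ψotr : ∀ z, z ∉ Lc R → ∀ γ, dist (mobius (R1 γ) (Ψo z)) (mobius (R γ) z) ≤ ε' := fun z hz γ => by
    rw [← Ψoeq γ z hz]; exact Ψocl _ (fun h => hz ((Finv γ z).1 h))
  have exΛ : ∀ z, ∃ w, ∀ γ, dist (mobius (R1 γ) w) (mobius (R γ) z) ≤ ε' := by
    intro z
    have hn : (𝓝[(Lc R)ᶜ] z).NeBot := mem_closure_iff_nhdsWithin_neBot.1 (by rw [hR.dense]; trivial)
    have hU := Ultrafilter.of_le (𝓝[(Lc R)ᶜ] z)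
    obtain ⟨w, -, hw⟩ := exists_tr (l := ⊥) (f := Ψo) (R := R) (R1 := R1) (ε := ε') (z := z) (Ultrafilter.of (𝓝[(Lc R)ᶜ] z)) (hU.trans nhdsWithin_le_nhds)
      (by
        have : ∀ᶠ y in 𝓝[(Lc R)ᶜ] z, ∀ γ, dist (mobius (R1 γ) (Ψo y)) (mobius (R γ) y) ≤ ε' := by
          filter_upwards [self_mem_nhdsWithin] with y hy using Ψotr y hy
        exact hU this)
    exact ⟨w, hw⟩
  choose W hW using exΛ
  classical
  set Ψ : RSphere → RSphere := fun z => if z ∈ Lc R then W z else Ψo z with hΨ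
  have ΨΛ : ∀ z ∈ Lc R, Ψ z = W z := fun z hz => if_pos hz
  have ΨΩ : ∀ z, z ∉ Lc R → Ψ z = Ψo z := fun z hz => if_neg hz
  have Ψtr : ∀ z γ, dist (mobius (R1 γ) (Ψ z)) (mobius (R γ) z) ≤ ε' := fun z γ => by
    by_cases hz : z ∈ Lc R
    · rw [ΨΛ z hz]; exact hW z γ
    · rw [ΨΩ z hz]; exact Ψotr z hz γ
  have uniq : ∀ z w, z ∈ Lc R → (∀ γ, dist (mobius (R1 γ) w) (mobius (R γ) z) ≤ ε') → w = Ψ z := fun z w hz h =>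
    track hE hN hz (fun γ => (h γ).trans (by linarith)) (fun γ => (Ψtr z γ).trans (by linarith))
  have Ψeq : ∀ γ z, Ψ (mobius (R γ) z) = mobius (R1 γ) (Ψ z) := by
    intro γ z
    by_cases hz : z ∈ Lc R
    · refine (uniq _ _ ((Finv γ z).2 hz) fun δ => ?_).symm
      rw [← mobius_mul, ← mobius_mul, ← map_mul, ← map_mul]; exact Ψtr z _
    · rw [ΨΩ z hz, ΨΩ _ (fun h => hz ((Finv γ z).1 h)), Ψoeq γ z hz]
  have Ψcl : ∀ z, dist (Ψ z) z ≤ ε' := fun z => by have := Ψtr z 1; simpa [mobius_one] using this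
  have bigΩ : ∀ z, r / 2 ≤ Metric.infDist z (Lc R) → z ∉ Lc R := fun z hz hc => by
    rw [Metric.infDist_zero_of_mem hc] at hz; linarith
  have Ψsg : ∀ z w, r / 2 ≤ Metric.infDist z (Lc R) → r / 2 ≤ Metric.infDist w (Lc R) → |sg (Ψ z) (Ψ w) - sg z w| ≤ 40 * e * sg z w := by
    intro z w hz hw
    rw [ΨΩ z (bigΩ z hz), ΨΩ w (bigΩ w hw), ΨoK z hz, ΨoK w hw]
    exact sg_pert he0.le he1 hP2 hP1 z w
  have shrink : ∀ z w, r ≤ Metric.infDist z (Lc R) → dist z w < r / 2 → r / 2 ≤ Metric.infDist w (Lc R) := fun z w hz hw => by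
    have := Metric.infDist_le_infDist_add_dist (s := Lc R) (x := z) (y := w); linarith
  have contΩ : ∀ z, z ∉ Lc R → ContinuousAt Ψ z := by
    refine path_ind hE hR.closed hne (fun z hz => ?_) ?_
    · rw [Metric.continuousAt_iff]
      intro η hη
      refine ⟨min (r / 2) (η / 8), by positivity, fun w hw => ?_⟩
      have hw1 := hw.trans_le (min_le_left _ _)
      have hw2 := hw.trans_le (min_le_right _ _)
      rw [dist_comm] at hw1
      have h1 := (abs_le.1 (Ψsg w z (shrink z w hz hw1) (by linarith))).2
      have h2 := dist_le_sg (Ψ w) (Ψ z)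
      have h3 := sg_le_dist w z
      have h4 := sg_nonneg w z
      have h5 : 40 * e * sg w z ≤ 40 * (1 / 100) * sg w z := by gcongr
      linarith
    · intro z γ hγ hz hu ih
      have : Ψ = fun y => mobius (R1 γ⁻¹) (Ψ (mobius (R γ) y)) := by
        funext y; rw [Ψeq, map_inv, mobius_inv_mobius]
      rw [this]
      exact (continuous_mobius _).continuousAt.comp (ih.comp (continuous_mobius _).continuousAt)
  have cont : Continuous Ψ := by
    rw [continuous_iff_continuousAt]
    intro z
    by_cases hz : z ∈ Lc R
    swap
    · exact contΩ z hz
    rw [ContinuousAt, tendsto_iff_ultrafilter]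
    intro U hU
    obtain ⟨w, hw1, hw2⟩ := exists_tr (l := ⊥) (f := Ψ) (R := R) (R1 := R1) (ε := ε') (z := z) U hU (Eventually.of_forall fun y γ => Ψtr y γ)
    rwa [uniq z w hz hw2] at hw1
  have injΛ : ∀ z w, z ∈ Lc R → Ψ z = Ψ w → z = w := by
    intro z w hz h
    refine track (R1 := R) hE (NrA_self R A hε'0.le) hz (fun γ => by simpa using hr.le) (fun γ => ?_)
    have h1 := Ψtr z γ
    have h2 := Ψtr w γ
    rw [← h, dist_comm] at h2
    have := dist_triangle (mobius (R γ) w) (mobius (R1 γ) (Ψ z)) (mobius (R γ) z)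
    linarith
  have inj : Function.Injective Ψ := by
    intro z w h
    by_cases hz : z ∈ Lc R
    · exact injΛ z w hz h
    by_cases hw : w ∈ Lc R
    · exact (injΛ w z hw h.symm).symm
    obtain ⟨γ, hγ⟩ := hcov z hz
    apply mobius_inj (R γ)
    have h1 : Ψ (mobius (R γ) z) = Ψ (mobius (R γ) w) := by rw [Ψeq, Ψeq, h]
    have h2 := Ψcl (mobius (R γ) z)
    have h3 := Ψcl (mobius (R γ) w)
    rw [← h1] at h3
    have h4 := dist_triangle_left (mobius (R γ) z) (mobius (R γ) w) (Ψ (mobius (R γ) z))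
    have h5 := Ψsg _ _ (by linarith : r / 2 ≤ Metric.infDist (mobius (R γ) z) (Lc R)) (shrink _ (mobius (R γ) w) hγ (by linarith))
    rw [h1, sg_self] at h5
    by_contra hne'
    have h6 := sg_pos hne'
    rw [zero_sub, abs_neg, abs_of_pos h6] at h5
    nlinarith
  have hΛ1 : Ψ '' Lc R ⊆ Lc R1 := by
    rintro _ ⟨z, hz, rfl⟩
    refine r1path hE hN (by linarith) fun γ => ?_
    rw [← Ψeq]
    refine (Metric.infDist_le_dist_of_mem ((Finv γ z).2 hz)).trans_lt ?_
    have := Ψcl (mobius (R γ) z)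
    linarith
  have hΛ2 : Lc R1 ⊆ Ψ '' Lc R := by
    refine Lc_subset ((hR.closed.isCompact.image cont).isClosed) ?_ (hR.nt.image inj)
    rintro γ _ ⟨z, hz, rfl⟩
    exact ⟨_, (Finv γ z).2 hz, Ψeq γ z⟩
  have surj : Function.Surjective Ψ := by
    intro w
    by_cases hw : ∀ γ, Metric.infDist (mobius (R1 γ) w) (Lc R) < r
    · obtain ⟨z, -, hz⟩ := hΛ2 (r1path hE hN (by linarith) hw)
      exact ⟨z, hz⟩
    push Not at hw
    obtain ⟨γ, hγ⟩ := hw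
    set v := mobius (R1 γ) w with hv
    obtain ⟨u, hu⟩ := solve_pert he1 he0.le hP2 (lft v)
    have hu0 : u ≠ 0 := by
      rintro rfl; rw [hP0, add_zero] at hu; exact lft_ne v hu.symm
    have h1 := dist_pr_le (lft_ne v) hu0
    have h2 : ‖lft v - u‖ ≤ e * ‖u‖ := by
      rw [← hu, add_sub_cancel_left]; have := hP2 u 0; rwa [hP0, sub_zero, sub_zero] at this
    have h3 : ‖u‖ ≤ 2 := by
      have := norm_sub_norm_le u (lft v); rw [norm_lft, norm_sub_rev] at this
      nlinarith [norm_nonneg u]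
    rw [pr_lft, norm_lft, mul_one] at h1
    have h4 : dist v (pr u) < r / 2 := by nlinarith
    have h5 := shrink _ _ hγ h4
    refine ⟨mobius (R γ⁻¹) (pr u), ?_⟩
    rw [Ψeq, ΨΩ _ (bigΩ _ h5)]
    obtain ⟨c, hc, h6⟩ := ex_smul hu0
    have h7 := hP3 u hu0 h5
    have h8 : pr (F (lft (pr u))) = v := by
      have h9 := AV_hom (R := R) (R1 := R1) hQh hc (lft (pr u))
      rw [← h6] at h9
      rw [← pr_smul hc]
      have : c • F (lft (pr u)) = lft v := by rw [← hu, ← h7]; exact h9.symm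
      rw [this, pr_lft]
    simp only [hΨo]
    rw [h8, hv, map_inv, mobius_inv_mobius]
  let Eq := Equiv.ofBijective Ψ ⟨inj, surj⟩
  have cE : Continuous Eq := cont
  refine ⟨cE.homeoOfEquivCompactToT2, ⟨Ψeq, fun z => (Ψcl z).trans hε'1, fun z w hz hw => ?_, hΛ1.antisymm hΛ2, fun z hz => ?_⟩⟩
  · refine (Ψsg z w (by linarith) (by linarith)).trans ?_
    have := sg_nonneg z w
    gcongr; linarith
  · change Ψ z = _
    rw [ΨΩ z hz]
    have hz' : pr (lft z) ∉ Lc R := by rwa [pr_lft]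
    have : F (lft z) = AV R R1 (Qf φ) (lft z) + AV R R1 D (lft z) := by
      rw [hF, AV, AV, AV, ← finsum_add_distrib (AV_fin hR hr (fun u _ h' => Qf_van hφ h') (lft_ne z) hz')
        (AV_fin hR hr (fun u hu h' => hD.van u hu (by linarith)) (lft_ne z) hz')]
      exact finsum_congr fun γ => by rw [← act_add]
    simp only [hΨo]; rw [this]
end Rep6

/-! ### P6: comparison of norms and openness of Good -/
section Rep7
variable {G : Type*} [Group G]

lemma pow_cmp {θ a b e : ℝ} (hθ : 0 < θ) (he : e ≤ 10 * (1 - (10 : ℝ) ^ (-θ))) (ha : 10 ≤ a) (h : |a - b| ≤ e) : a ^ (1 - θ) ≤ b := by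
  have ha0 : 0 < a := by linarith
  have h1 : a ^ (1 - θ) = a * a ^ (-θ) := by
    rw [sub_eq_add_neg, Real.rpow_add ha0, Real.rpow_one]
  have h2 : a ^ (-θ) ≤ (10 : ℝ) ^ (-θ) := Real.rpow_le_rpow_of_nonpos (by norm_num) ha (by linarith)
  have h3 := (abs_le.1 h).2
  have h4 : (10 : ℝ) ^ (-θ) ≤ 1 - e / 10 := by linarith
  have h5 : 0 ≤ e := (abs_nonneg _).trans h
  rw [h1]
  nlinarith

lemma fin_mn_bound (R : G →* SL2C) {T : Set G} (hT : T.Finite) : ∃ M ≥ 1, ∀ γ ∈ T, mn (R γ) ≤ M := by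
  obtain ⟨M, hM⟩ := (hT.image (fun γ => mn (R γ))).bddAbove
  exact ⟨max M 1, le_max_right _ _, fun γ h => (hM ⟨γ, h, rfl⟩).trans (le_max_left _ _)⟩

theorem Compare {R : G →* SL2C} (hR : Good R) {θ : ℝ} (hθ : 0 < θ) (hθ1 : θ < 1) :
    ∃ c > 0, ∀ᶠ R1 in nR R, (∀ γ, c * mn (R γ) ^ (1 - θ) ≤ mn (R1 γ)) ∧ (∃ c1 > 0, ∀ γ, c1 * mn (R1 γ) ^ (1 - θ) ≤ mn (R γ)) ∧ Good R1 := by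
  have hne := hR.nt.nonempty
  obtain ⟨A, r, hE⟩ := exists_exp R hR.closed hne
  have hr := hE.pos
  obtain ⟨p, hp⟩ := (ne_univ_iff_exists_notMem _).1 hR.ne
  have hd : 0 < Metric.infDist p (Lc R) := (hR.closed.notMem_iff_infDist_pos hne).1 hp
  set d := Metric.infDist p (Lc R) with hdd
  set T : Set G := {τ | r ≤ Metric.infDist (mobius (R τ) p) (Lc R)} with hT
  have hTf : T.Finite := by
    refine ((fin_T hR hd hr).image (fun γ => γ⁻¹)).subset fun τ hτ => ⟨τ⁻¹, ⟨p, le_refl d, ?_⟩, inv_inv τ⟩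
    rw [inv_inv]; exact hτ
  obtain ⟨MA, hMA1, hMA⟩ := fin_mn_bound R hE.fin
  obtain ⟨MT, hMT1, hMT⟩ := fin_mn_bound R hTf
  have h10 : (10 : ℝ) ^ (-θ) < 1 := Real.rpow_lt_one_of_one_lt_of_neg (by norm_num) (by linarith)
  set e := min 1 (10 * (1 - (10 : ℝ) ^ (-θ))) with hed
  have he0 : 0 < e := lt_min one_pos (by linarith)
  have he1 : e ≤ 1 := min_le_left _ _
  have he2 : e ≤ 10 * (1 - (10 : ℝ) ^ (-θ)) := min_le_right _ _
  obtain ⟨κ, hκ, hST⟩ := STab hR (ρ := r) (ε := e / (16 * MA)) hr (by positivity)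
  obtain ⟨c0, hc0, hLB⟩ := LB (Lc_inv R) hR.nt
  refine ⟨(c0 * d / (MT + 1)) ^ (1 - θ) / (MT + 1), by positivity, ?_⟩
  filter_upwards [hST, nR_ev_fin R hE.fin (by positivity : 0 < e / 2), nR_ev_fin R hTf one_pos] with R1 hST1 hA1 hT1
  obtain ⟨F0, -, hF⟩ := hST1
  obtain ⟨Ψ, hΨ⟩ := hF _ (DOK_zero R r hκ.le)
  have key : ∀ z, z ∉ Lc R → ∃ δ, r ≤ Metric.infDist (mobius (R δ) z) (Lc R) ∧ 1 ≤ Nn (R δ⁻¹) (mobius (R δ) z) ∧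
      1 ≤ Nn (R1 δ⁻¹) (Ψ (mobius (R δ) z)) ∧ Nn (R δ⁻¹) (mobius (R δ) z) ^ (1 - θ) ≤ Nn (R1 δ⁻¹) (Ψ (mobius (R δ) z)) ∧
      Nn (R1 δ⁻¹) (Ψ (mobius (R δ) z)) ^ (1 - θ) ≤ Nn (R δ⁻¹) (mobius (R δ) z) := by
    refine path_ind hE hR.closed hne (fun z hz => ⟨1, ?_⟩) ?_
    · simp [mobius_one, Nn_one, hz]
    · rintro z γ hγ hz hu ⟨δ, h1, h2, h3, h4, h5⟩
      refine ⟨δ * γ, ?_⟩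
      have q1 : mobius (R (δ * γ)) z = mobius (R δ) (mobius (R γ) z) := by rw [map_mul, mobius_mul]
      have q2 : ∀ w, Nn (R (δ * γ)⁻¹) w = Nn (R γ⁻¹) (mobius (R δ⁻¹) w) * Nn (R δ⁻¹) w := fun w => by
        rw [mul_inv_rev, map_mul, Nn_mul]
      have q3 : ∀ w, Nn (R1 (δ * γ)⁻¹) w = Nn (R1 γ⁻¹) (mobius (R1 δ⁻¹) w) * Nn (R1 δ⁻¹) w := fun w => by
        rw [mul_inv_rev, map_mul, Nn_mul]
      set x := mobius (R γ) z with hx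
      rw [q1, q2, q3]
      have q4 : mobius (R δ⁻¹) (mobius (R δ) x) = x := by rw [map_inv, mobius_inv_mobius]
      have q5 : mobius (R1 δ⁻¹) (Ψ (mobius (R δ) x)) = Ψ x := by rw [← hΨ.eqv, q4]
      rw [q4, q5]
      have g1 := hu x (by simpa using hr.le)
      have g2 : |Nn (R γ⁻¹) x - Nn (R1 γ⁻¹) (Ψ x)| ≤ e := by
        have a1 := Nn_lip_dist (R γ⁻¹) x (Ψ x)
        have a2 := hΨ.close x
        have a3 := Nn_diff_le (R γ⁻¹) (R1 γ⁻¹) (Ψ x)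
        have a4 := hA1 γ hγ
        have a5 := hMA γ hγ
        rw [map_inv, map_inv, dm_inv, dm_comm] at a3
        rw [map_inv, mn_inv, dist_comm] at a1
        have a6 : 8 * mn (R γ) * dist (Ψ x) x ≤ 8 * MA * (e / (16 * MA)) := by
          gcongr
        have a7 : 8 * MA * (e / (16 * MA)) = e / 2 := by field_simp; norm_num
        rw [map_inv, map_inv]
        calc _ ≤ _ := abs_sub_le _ (Nn (R γ)⁻¹ (Ψ x)) _
          _ ≤ e := by linarith
      have g3 := abs_le.1 g2
      have g4 : 10 ≤ Nn (R1 γ⁻¹) (Ψ x) := by linarith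
      have g5 := pow_cmp hθ he2 (by linarith : 10 ≤ Nn (R γ⁻¹) x) g2
      have g6 := pow_cmp hθ he2 g4 (by rwa [abs_sub_comm])
      refine ⟨h1, by nlinarith, by nlinarith, ?_, ?_⟩
      · rw [Real.mul_rpow (by linarith) (by linarith)]; gcongr
      · rw [Real.mul_rpow (by linarith) (by linarith)]; gcongr
  have key2 : ∀ γ, ∃ a b : ℝ, 1 ≤ a ∧ 1 ≤ b ∧ a ^ (1 - θ) ≤ b ∧ b ^ (1 - θ) ≤ a ∧ a ≤ Nn (R γ) p * (MT + 1) ∧ Nn (R γ) p ≤ a * (MT + 1) ∧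
      b ≤ Nn (R1 γ) (Ψ p) * (MT + 1) ∧ Nn (R1 γ) (Ψ p) ≤ b * (MT + 1) := by
    intro γ
    obtain ⟨δ, h1, h2, h3, h4, h5⟩ := key (mobius (R γ) p) (fun h => hp (((Lc_inv R).iff γ p).1 h))
    have hτ : δ * γ ∈ T := by rw [hT, mem_setOf_eq, map_mul, mobius_mul]; exact h1
    set τ := δ * γ with hτd
    have q0 : mobius (R δ) (mobius (R γ) p) = mobius (R τ) p := by rw [hτd, map_mul, mobius_mul]
    have q1 : δ⁻¹ = γ * τ⁻¹ := by rw [hτd]; group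
    rw [q0, q1] at h2 h3 h4 h5
    have q2 : Nn (R (γ * τ⁻¹)) (mobius (R τ) p) = Nn (R γ) p * Nn (R τ)⁻¹ (mobius (R τ) p) := by
      rw [map_mul, Nn_mul, map_inv, mobius_inv_mobius]
    have q3 : Nn (R1 (γ * τ⁻¹)) (Ψ (mobius (R τ) p)) = Nn (R1 γ) (Ψ p) * Nn (R1 τ)⁻¹ (mobius (R1 τ) (Ψ p)) := by
      rw [hΨ.eqv, map_mul, Nn_mul, map_inv, mobius_inv_mobius]
    have m1 : mn (R τ) ≤ MT + 1 := by linarith [hMT τ hτ]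
    have m2 : mn (R1 τ) ≤ MT + 1 := by linarith [hMT τ hτ, hT1 τ hτ, mn_diff_le (R1 τ) (R τ)]
    have b1 := Nn_le_mn (R τ)⁻¹ (mobius (R τ) p)
    have b3 := Nn_le_mn (R1 τ)⁻¹ (mobius (R1 τ) (Ψ p))
    have b4 := one_le_mn_mul_Nn (R1 τ)⁻¹ (mobius (R1 τ) (Ψ p))
    rw [mn_inv] at b1 b3 b4
    have p1 := Nn_pos (R γ) p
    have p2 := Nn_pos (R1 γ) (Ψ p)
    refine ⟨_, _, h2, h3, h4, h5, ?_, ?_, ?_, ?_⟩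
    · rw [q2]; gcongr; linarith
    · rw [q2, mul_assoc]
      have p3 := Nn_pos (R τ)⁻¹ (mobius (R τ) p)
      have b2 := one_le_mn_mul_Nn (R τ)⁻¹ (mobius (R τ) p)
      rw [mn_inv] at b2
      have : 1 ≤ Nn (R τ)⁻¹ (mobius (R τ) p) * (MT + 1) := by nlinarith
      nlinarith
    · rw [q3]; gcongr; linarith
    · rw [q3, mul_assoc]
      have p3 := Nn_pos (R1 τ)⁻¹ (mobius (R1 τ) (Ψ p))
      have : 1 ≤ Nn (R1 τ)⁻¹ (mobius (R1 τ) (Ψ p)) * (MT + 1) := by nlinarith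
      nlinarith
  have hup : ∀ γ, (c0 * d / (MT + 1)) ^ (1 - θ) / (MT + 1) * mn (R γ) ^ (1 - θ) ≤ mn (R1 γ) := by
    intro γ
    obtain ⟨a, b, h1, h2, h3, h4, h5, h6, h7, h8⟩ := key2 γ
    have g1 := hLB γ p
    have g2 := Nn_le_mn (R1 γ) (Ψ p)
    have g3 : c0 * d / (MT + 1) * mn (R γ) ≤ a := by
      rw [div_mul_eq_mul_div, div_le_iff₀ (by linarith)]
      exact g1.trans h6
    have g4 : (c0 * d / (MT + 1) * mn (R γ)) ^ (1 - θ) ≤ a ^ (1 - θ) :=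
      Real.rpow_le_rpow (by have := mn_nonneg (R γ); positivity) g3 (by linarith)
    rw [Real.mul_rpow (by positivity) (mn_nonneg _)] at g4
    rw [div_mul_eq_mul_div, div_le_iff₀ (by linarith)]
    nlinarith
  have hcl : IsClosed (Lc R1) := by rw [← hΨ.img]; exact Ψ.isClosedMap _ hR.closed
  have hnt : (Lc R1).Nontrivial := by rw [← hΨ.img]; exact hR.nt.image Ψ.injective
  have hpm : Ψ p ∉ Lc R1 := by
    rw [← hΨ.img]; rintro ⟨q, hq, h⟩; exact hp (Ψ.injective h ▸ hq)
  refine ⟨hup, ?_, hcl, hnt, fun h => hpm (h ▸ mem_univ _), fun M => ?_⟩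
  · obtain ⟨c1, hc1, hLB1⟩ := LB (Lc_inv R1) hnt
    have hd1 : 0 < Metric.infDist (Ψ p) (Lc R1) := (hcl.notMem_iff_infDist_pos hnt.nonempty).1 hpm
    set d1 := Metric.infDist (Ψ p) (Lc R1)
    refine ⟨(c1 * d1 / (MT + 1)) ^ (1 - θ) / (MT + 1), by positivity, fun γ => ?_⟩
    obtain ⟨a, b, h1, h2, h3, h4, h5, h6, h7, h8⟩ := key2 γ
    have g1 := hLB1 γ (Ψ p)
    have g2 := Nn_le_mn (R γ) p
    have g3 : c1 * d1 / (MT + 1) * mn (R1 γ) ≤ b := by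
      rw [div_mul_eq_mul_div, div_le_iff₀ (by linarith)]
      exact g1.trans h8
    have g4 : (c1 * d1 / (MT + 1) * mn (R1 γ)) ^ (1 - θ) ≤ b ^ (1 - θ) :=
      Real.rpow_le_rpow (by have := mn_nonneg (R1 γ); positivity) g3 (by linarith)
    rw [Real.mul_rpow (by positivity) (mn_nonneg _)] at g4
    rw [div_mul_eq_mul_div, div_le_iff₀ (by linarith)]
    nlinarith
  · set c := (c0 * d / (MT + 1)) ^ (1 - θ) / (MT + 1) with hc
    have hcp : 0 < c := by positivity
    refine (hR.disc ((M / c) ^ (1 - θ)⁻¹)).subset fun γ hγ => ?_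
    have h1 := (hup γ).trans hγ
    have h2 : mn (R γ) ^ (1 - θ) ≤ M / c := by rw [le_div_iff₀ hcp, mul_comm]; exact h1
    have h3 := Real.rpow_le_rpow (Real.rpow_nonneg (mn_nonneg (R γ)) _) h2 (by rw [inv_nonneg]; linarith : 0 ≤ (1 - θ)⁻¹)
    rwa [Real.rpow_rpow_inv (mn_nonneg _) (by linarith)] at h3
end Rep7

/-! ### P7: Poincare series -/
lemma cover_lem {X : Type*} [MetricSpace X] [MeasurableSpace X] [BorelSpace X] {K : Set X} (hK : IsCompact K) (hKn : K.Nonempty) {s : ℝ} (hs : 0 < s)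
    (h0 : μH[s] K = 0) {ε : ℝ} (hε : 0 < ε) : ∃ (I : Finset ℕ) (x : ℕ → X) (ρ : ℕ → ℝ), (∀ n, 0 < ρ n) ∧ (∀ i, x i ∈ K) ∧
      K ⊆ (⋃ i ∈ I, Metric.ball (x i) (ρ i)) ∧ ∑ i ∈ I, ρ i ^ s ≤ ε := by
  set e := ε / (2 ^ s * 2) with he
  have he0 : 0 < e := by positivity
  rw [Measure.hausdorffMeasure_apply] at h0
  have h1 : (⨅ (t : ℕ → Set X) (_ : K ⊆ ⋃ n, t n) (_ : ∀ n, Metric.ediam (t n) ≤ 1), ∑' n, ⨆ _ : (t n).Nonempty, Metric.ediam (t n) ^ s) < ENNReal.ofReal e := by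
    refine lt_of_le_of_lt ?_ (ENNReal.ofReal_pos.2 he0)
    rw [← h0]
    exact le_iSup₂_of_le (1 : ℝ≥0∞) one_pos le_rfl
  simp only [iInf_lt_iff] at h1
  obtain ⟨t, ht1, ht2, ht3⟩ := h1
  have hfin : ∀ n, Metric.ediam (t n) ≠ ⊤ := fun n => ((ht2 n).trans_lt ENNReal.one_lt_top).ne
  set dd : ℕ → ℝ := fun n => (Metric.ediam (t n)).toReal with hdd
  have hsum : ∀ I : Finset ℕ, ∑ i ∈ I, dd i ^ s ≤ e := by
    intro I
    have h2 : ∀ i, ENNReal.ofReal (dd i ^ s) ≤ ⨆ _ : (t i).Nonempty, Metric.ediam (t i) ^ s := by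
      intro i
      rcases (t i).eq_empty_or_nonempty with h | h
      · simp [hdd, h, Real.zero_rpow hs.ne']
      · rw [iSup_pos h, ← ENNReal.ofReal_rpow_of_nonneg ENNReal.toReal_nonneg hs.le, ENNReal.ofReal_toReal (hfin i)]
    have h3 : ENNReal.ofReal (∑ i ∈ I, dd i ^ s) ≤ ENNReal.ofReal e := by
      rw [ENNReal.ofReal_sum_of_nonneg (fun i _ => by positivity)]
      exact ((Finset.sum_le_sum fun i _ => h2 i).trans (ENNReal.sum_le_tsum I)).trans ht3.le
    exact (ENNReal.ofReal_le_ofReal_iff he0.le).1 h3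
  set τ : ℕ → ℝ := fun n => (e * (1 / 2) ^ (n + 1)) ^ s⁻¹ with hτ
  have hτ0 : ∀ n, 0 < τ n := fun n => by positivity
  have hτs : ∀ n, τ n ^ s = e * (1 / 2) ^ (n + 1) := fun n => Real.rpow_inv_rpow (by positivity) hs.ne'
  obtain ⟨x0, hx0⟩ := hKn
  classical
  have hx : ∀ n, ∃ x ∈ K, ∀ y ∈ t n ∩ K, dist y x ≤ dd n := by
    intro n
    by_cases h : (t n ∩ K).Nonempty
    · obtain ⟨x, hx1, hx2⟩ := h
      refine ⟨x, hx2, fun y hy => ?_⟩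
      rw [dist_edist]
      exact ENNReal.toReal_mono (hfin n) (Metric.edist_le_ediam_of_mem hy.1 hx1)
    · exact ⟨x0, hx0, fun y hy => (h ⟨y, hy⟩).elim⟩
  choose x hxK hxd using hx
  set ρ : ℕ → ℝ := fun n => 2 * max (dd n) (τ n) with hρ
  have hρ0 : ∀ n, 0 < ρ n := fun n => by have := hτ0 n; positivity
  have hcov : K ⊆ ⋃ n, Metric.ball (x n) (ρ n) := by
    intro y hy
    obtain ⟨n, hn⟩ := mem_iUnion.1 (ht1 hy)
    refine mem_iUnion.2 ⟨n, ?_⟩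
    have h5 := hxd n y ⟨hn, hy⟩
    have h6 := le_max_left (dd n) (τ n)
    have h7 := le_max_right (dd n) (τ n)
    have := hτ0 n
    rw [Metric.mem_ball]; simp only [hρ]; linarith
  obtain ⟨I, hI⟩ := hK.elim_finite_subcover _ (fun n => Metric.isOpen_ball) hcov
  refine ⟨I, x, ρ, hρ0, hxK, hI, ?_⟩
  have h8 : ∀ i, ρ i ^ s ≤ 2 ^ s * (dd i ^ s + e * (1 / 2) ^ (i + 1)) := by
    intro i
    have hd0 : 0 ≤ dd i := ENNReal.toReal_nonneg
    simp only [hρ]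
    rw [Real.mul_rpow (by norm_num) (by positivity), ← hτs]
    gcongr
    rcases max_choice (dd i) (τ i) with h | h <;> rw [h]
    · have := hτ0 i; have : 0 ≤ τ i ^ s := by positivity
      linarith
    · have : 0 ≤ dd i ^ s := by positivity
      linarith
  have h9 : ∑ i ∈ I, (1 / 2 : ℝ) ^ (i + 1) ≤ 1 := by
    have hs2 : Summable (fun i : ℕ => (1 / 2 : ℝ) ^ (i + 1)) := by
      simp_rw [pow_succ]; exact (summable_geometric_two).mul_right _
    refine (hs2.sum_le_tsum I fun i _ => by positivity).trans ?_
    simp_rw [pow_succ]; rw [tsum_mul_right, tsum_geometric_two]; norm_num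
  calc _ ≤ ∑ i ∈ I, 2 ^ s * (dd i ^ s + e * (1 / 2) ^ (i + 1)) := Finset.sum_le_sum fun i _ => h8 i
    _ = 2 ^ s * (∑ i ∈ I, dd i ^ s + e * ∑ i ∈ I, (1 / 2 : ℝ) ^ (i + 1)) := by
        rw [← Finset.mul_sum, Finset.sum_add_distrib, Finset.mul_sum]
    _ ≤ 2 ^ s * (e + e * 1) := by gcongr; exact hsum I
    _ = ε := by rw [he]; field_simp; norm_num

section Rep8
variable {G : Type*} [Group G]

lemma path_lem {R : G →* SL2C} {A : Set G} {r : ℝ} (hE : ExpD R A r) :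
    ∃ C ≥ 1, ∀ x ∈ Lc R, ∀ t, 0 < t → t ≤ 1 → ∃ γ, Nn (R γ) x ≤ t ∧ t ≤ C * Nn (R γ) x ∧ mn (R γ) * Nn (R γ) x ≤ C := by
  have hr := hE.pos
  obtain ⟨MA, hMA1, hMA⟩ := fin_mn_bound R hE.fin
  refine ⟨max MA (max (32 / r) (mn (1 : SL2C))), hMA1.le.trans (le_max_left _ _), ?_⟩
  set C := max MA (max (32 / r) (mn (1 : SL2C))) with hC
  have c1 : MA ≤ C := le_max_left _ _
  have c2 : 32 / r ≤ C := (le_max_left _ _).trans (le_max_right _ _)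
  have c3 : mn (1 : SL2C) ≤ C := (le_max_right _ _).trans (le_max_right _ _)
  intro x hx t ht0 ht1
  have key : ∀ n : ℕ, (∃ γ, (γ = 1 ∨ ∀ u, dist u (mobius (R γ) x) ≤ r → 20 ≤ Nn (R γ⁻¹) u) ∧ t < Nn (R γ) x ∧ Nn (R γ) x ≤ (1 / 20) ^ n) ∨
      (∃ γ, (γ = 1 ∨ ∀ u, dist u (mobius (R γ) x) ≤ r → 20 ≤ Nn (R γ⁻¹) u) ∧ Nn (R γ) x ≤ t ∧ t ≤ C * Nn (R γ) x) := by
    intro n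
    induction n with
    | zero =>
      by_cases h : t < 1
      · left; exact ⟨1, Or.inl rfl, by simpa [Nn_one] using h, by simp [Nn_one]⟩
      · right; exact ⟨1, Or.inl rfl, by simp [Nn_one]; linarith, by simp [Nn_one]; linarith⟩
    | succ n ih =>
      rcases ih with ⟨γ, h1, h2, h3⟩ | h
      swap
      · exact Or.inr h
      have hy : mobius (R γ) x ∈ Lc R := Lc_inv R γ x hx
      obtain ⟨δ, hδ, h4⟩ := hE.ex _ (by rw [Metric.infDist_zero_of_mem hy]; exact hr)
      set y := mobius (R γ) x with hyd
      have e1 : mobius (R (δ * γ)) x = mobius (R δ) y := by rw [map_mul, mobius_mul]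
      have hQ : ∀ u, dist u (mobius (R (δ * γ)) x) ≤ r → 20 ≤ Nn (R (δ * γ)⁻¹) u := by
        intro u hu
        rw [e1] at hu
        have h5 := h4 u hu
        rw [mul_inv_rev, map_mul, Nn_mul]
        have h6 : 1 ≤ Nn (R γ⁻¹) (mobius (R δ⁻¹) u) := by
          rcases h1 with rfl | h1
          · simp [Nn_one]
          · have h7 := contr (g := R δ⁻¹) (a := u) (b := mobius (R δ) y) (by linarith) (by have := h4 (mobius (R δ) y) (by simpa using hr.le); linarith)
            have h8 : mobius (R δ⁻¹) (mobius (R δ) y) = y := by rw [map_inv, mobius_inv_mobius]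
            rw [h8] at h7
            have := h1 (mobius (R δ⁻¹) u) (by linarith)
            linarith
        nlinarith
      have e2 : Nn (R (δ * γ)) x = Nn (R δ) y * Nn (R γ) x := by rw [map_mul, Nn_mul]
      have e3 := Nn_inv (R δ) y
      have e4 := h4 (mobius (R δ) y) (by simpa using hr.le)
      rw [map_inv] at e4
      have e5 := Nn_pos (R δ) y
      have e6 : Nn (R δ) y ≤ 1 / 20 := by rw [le_div_iff₀ (by norm_num)]; nlinarith
      have e7 := one_le_mn_mul_Nn (R δ) y
      have e8 := hMA δ hδ
      have e9 := Nn_pos (R γ) x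
      by_cases hlt : t < Nn (R (δ * γ)) x
      · left
        refine ⟨δ * γ, Or.inr hQ, hlt, ?_⟩
        rw [e2, pow_succ, mul_comm]
        gcongr
      · right
        refine ⟨δ * γ, Or.inr hQ, by linarith, ?_⟩
        rw [e2]
        have : 1 ≤ C * Nn (R δ) y := by nlinarith
        nlinarith
  obtain ⟨n, hn⟩ := exists_pow_lt_of_lt_one ht0 (by norm_num : (1 / 20 : ℝ) < 1)
  rcases key n with ⟨γ, h1, h2, h3⟩ | ⟨γ, h1, h2, h3⟩
  · linarith
  refine ⟨γ, h2, h3, ?_⟩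
  rcases h1 with rfl | h1
  · simpa [Nn_one] using c3
  obtain ⟨b, hb⟩ := ex_low (R γ⁻¹)
  have h4 : r < dist b (mobius (R γ) x) := by
    by_contra h; push Not at h; have := h1 b h; linarith
  have h5 := h1 (mobius (R γ) x) (by simpa using hr.le)
  have h6 := bad (g := R γ⁻¹) (z := b) (w := mobius (R γ) x) (t := Nn (R γ⁻¹) (mobius (R γ) x)) (by linarith) le_rfl
  have h7 := dist_le_sg b (mobius (R γ) x)
  rw [map_inv] at h6 h5
  rw [mn_inv] at h6
  have h8 := Nn_inv (R γ) x
  have h9 := Nn_pos (R γ) x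
  refine le_trans ?_ c2
  rw [le_div_iff₀ hr]
  have h10 := mn_nonneg (R γ)
  have h11 : r / 2 * mn (R γ) ≤ 16 * Nn (R γ)⁻¹ (mobius (R γ) x) := by nlinarith
  nlinarith

theorem Poinc {R : G →* SL2C} (hR : Good R) {s : ℝ} (hs : 0 < s) (h0 : μH[s] (Lc R) = 0) : Summable (fun γ => mn (R γ) ^ (-(2 * s))) := by
  classical
  have hne := hR.nt.nonempty
  obtain ⟨A, r, hE⟩ := exists_exp R hR.closed hne
  obtain ⟨C, hC1, hpath⟩ := path_lem hE
  obtain ⟨p, hp⟩ := (ne_univ_iff_exists_notMem _).1 hR.ne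
  have hd : 0 < Metric.infDist p (Lc R) := (hR.closed.notMem_iff_infDist_pos hne).1 hp
  set d := Metric.infDist p (Lc R) with hdd
  obtain ⟨c0, hc0, hLB⟩ := LB (Lc_inv R) hR.nt
  set f : G → ℝ := fun γ => Nn (R γ) p with hf
  have f0 : ∀ γ, 0 < f γ := fun γ => Nn_pos _ _
  have hFin : ∀ M, {γ | f γ ≤ M}.Finite := fun M => by
    refine (hR.disc (M / (c0 * d))).subset fun γ hγ => ?_
    rw [mem_setOf_eq, le_div_iff₀ (by positivity)]
    have := hLB γ p
    have h2 : f γ ≤ M := hγ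
    simp only [hf] at h2
    linarith
  set C2 := 1 + 8 * C ^ 2 with hC2
  have hC20 : 1 ≤ C2 := by nlinarith
  set ε := min ((C2 ^ (2 * s))⁻¹ / 2) ((C2 ^ 2)⁻¹ ^ s) with hε
  have hε0 : 0 < ε := by positivity
  obtain ⟨I, x, ρ, hρ0, hxK, hcov, hsum⟩ := cover_lem hR.closed.isCompact hne hs h0 hε0
  have hρI : ∀ i ∈ I, ρ i ≤ (C2 ^ 2)⁻¹ := fun i hi => by
    have h1 : ρ i ^ s ≤ (C2 ^ 2)⁻¹ ^ s := (Finset.single_le_sum (f := fun i => ρ i ^ s) (fun j _ => by have := hρ0 j; positivity) hi).trans (hsum.trans (min_le_right _ _))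
    exact (Real.rpow_le_rpow_iff (hρ0 i).le (by positivity) hs).1 h1
  have hρ1 : ∀ i ∈ I, ρ i ≤ 1 := fun i hi => (hρI i hi).trans (inv_le_one_of_one_le₀ (by nlinarith))
  have hg : ∀ i, ∃ g : G, i ∈ I → ∀ y ∈ Metric.ball (x i) (ρ i), Nn (R g) y ≤ C2 * √(ρ i) := by
    intro i
    by_cases hi : i ∈ I
    swap
    · exact ⟨1, fun h => (hi h).elim⟩
    obtain ⟨g, h1, h2, h3⟩ := hpath (x i) (hxK i) (√(ρ i)) (Real.sqrt_pos.2 (hρ0 i)) (Real.sqrt_le_one.2 (hρ1 i hi))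
    refine ⟨g, fun _ y hy => ?_⟩
    have h4 := (abs_le.1 (Nn_lip_dist (R g) y (x i))).2
    have h5 : dist y (x i) ≤ ρ i := (Metric.mem_ball.1 hy).le
    have h6 := Real.mul_self_sqrt (hρ0 i).le
    have h7 := Real.sqrt_pos.2 (hρ0 i)
    have h8 := Nn_pos (R g) (x i)
    have h9 : mn (R g) * √(ρ i) ≤ C ^ 2 := by
      have : mn (R g) * √(ρ i) ≤ mn (R g) * (C * Nn (R g) (x i)) := mul_le_mul_of_nonneg_left h2 (mn_nonneg _)
      nlinarith
    have h10 : 8 * mn (R g) * dist y (x i) ≤ 8 * (C ^ 2 * √(ρ i)) := by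
      have a1 : 8 * mn (R g) * dist y (x i) ≤ 8 * mn (R g) * ρ i := by have := mn_nonneg (R g); gcongr
      have a2 : mn (R g) * ρ i = mn (R g) * √(ρ i) * √(ρ i) := by rw [mul_assoc, h6]
      have a3 : mn (R g) * √(ρ i) * √(ρ i) ≤ C ^ 2 * √(ρ i) := by gcongr
      linarith
    rw [hC2]; linarith
  choose g hg using hg
  have hB0 : {γ | mobius (R γ) p ∉ ⋃ i ∈ I, Metric.ball (x i) (ρ i)}.Finite := by
    set U := ⋃ i ∈ I, Metric.ball (x i) (ρ i) with hU
    have hUo : IsOpen U := isOpen_biUnion fun i _ => Metric.isOpen_ball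
    obtain ⟨δ, hδ, hδU⟩ := hR.closed.isCompact.exists_thickening_subset_open hUo hcov
    refine ((fin_T hR hd hδ).image (fun γ => γ⁻¹)).subset fun τ hτ => ⟨τ⁻¹, ⟨p, le_refl d, ?_⟩, inv_inv τ⟩
    rw [inv_inv]
    by_contra h
    push Not at h
    exact hτ (hδU (by rw [Metric.mem_thickening_iff]; exact (Metric.infDist_lt_iff hne).1 h))
  set C0 := ∑ γ ∈ hB0.toFinset, f γ ^ (-(2 * s)) with hC0
  have fp : ∀ γ, 0 < f γ ^ (-(2 * s)) := fun γ => Real.rpow_pos_of_pos (f0 γ) _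
  have hstep : ∀ i ∈ I, ∀ γ, mobius (R γ) p ∈ Metric.ball (x i) (ρ i) → f (g i * γ) ≤ f γ ∧ f γ ^ (-(2 * s)) ≤ C2 ^ (2 * s) * ρ i ^ s * f (g i * γ) ^ (-(2 * s)) := by
    intro i hi γ hγ
    have h1 := hg i hi _ hγ
    have e1 : f (g i * γ) = Nn (R (g i)) (mobius (R γ) p) * f γ := by simp only [hf]; rw [map_mul, Nn_mul]
    have h2 : f (g i * γ) ≤ C2 * √(ρ i) * f γ := by rw [e1]; have := f0 γ; gcongr
    have hq : 0 < √(ρ i) := Real.sqrt_pos.2 (hρ0 i)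
    constructor
    · have h3 : √(ρ i) ≤ C2⁻¹ := by
        rw [← Real.sqrt_sq (by positivity : 0 ≤ C2⁻¹), inv_pow]; exact Real.sqrt_le_sqrt (hρI i hi)
      have h4 : C2 * √(ρ i) ≤ 1 := by
        calc _ ≤ C2 * C2⁻¹ := by gcongr
          _ = 1 := mul_inv_cancel₀ (by positivity)
      have := f0 γ
      nlinarith
    · have h3 : (C2 * √(ρ i) * f γ) ^ (-(2 * s)) ≤ f (g i * γ) ^ (-(2 * s)) :=
        Real.rpow_le_rpow_of_nonpos (f0 _) h2 (by linarith)
      rw [Real.mul_rpow (by positivity) (f0 _).le, Real.mul_rpow (by positivity) hq.le] at h3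
      have h4 : √(ρ i) ^ (-(2 * s)) = (ρ i ^ s)⁻¹ := by
        rw [Real.sqrt_eq_rpow, ← Real.rpow_mul (hρ0 i).le, ← Real.rpow_neg (hρ0 i).le]; congr 1; ring
      rw [h4, Real.rpow_neg (by positivity : 0 ≤ C2)] at h3
      have h5 : 0 < ρ i ^ s := Real.rpow_pos_of_pos (hρ0 i) _
      have h6 : 0 < C2 ^ (2 * s) := by positivity
      calc f γ ^ (-(2 * s)) = C2 ^ (2 * s) * ρ i ^ s * ((C2 ^ (2 * s))⁻¹ * (ρ i ^ s)⁻¹ * f γ ^ (-(2 * s))) := by field_simp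
        _ ≤ _ := by gcongr
  have main : ∀ M, ∑ γ ∈ (hFin M).toFinset, f γ ^ (-(2 * s)) ≤ 2 * C0 := by
    intro M
    set F := (hFin M).toFinset with hF
    have hmem : ∀ γ, γ ∈ F ↔ f γ ≤ M := fun γ => by rw [hF, Set.Finite.mem_toFinset]; rfl
    have h1 : ∀ γ ∈ F, f γ ^ (-(2 * s)) ≤ (if γ ∈ hB0.toFinset then f γ ^ (-(2 * s)) else 0) +
        ∑ i ∈ I, C2 ^ (2 * s) * ρ i ^ s * (if g i * γ ∈ F then f (g i * γ) ^ (-(2 * s)) else 0) := by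
      intro γ hγ
      have hnn : ∀ i ∈ I, 0 ≤ C2 ^ (2 * s) * ρ i ^ s * (if g i * γ ∈ F then f (g i * γ) ^ (-(2 * s)) else 0) := fun i _ => by
        have := hρ0 i; have := (fp (g i * γ)).le
        split_ifs <;> positivity
      by_cases hb : γ ∈ hB0.toFinset
      · rw [if_pos hb]; linarith [Finset.sum_nonneg hnn]
      · rw [if_neg hb, zero_add]
        rw [Set.Finite.mem_toFinset, mem_setOf_eq, not_not] at hb
        simp only [mem_iUnion] at hb
        obtain ⟨i, hi, hb⟩ := hb
        obtain ⟨h2, h3⟩ := hstep i hi γ hb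
        refine le_trans ?_ (Finset.single_le_sum hnn hi)
        rw [if_pos ((hmem _).2 (h2.trans ((hmem _).1 hγ)))]
        exact h3
    set S := ∑ γ ∈ F, f γ ^ (-(2 * s)) with hS
    have h2 : ∀ i, ∑ γ ∈ F, (if g i * γ ∈ F then f (g i * γ) ^ (-(2 * s)) else 0) ≤ S := by
      intro i
      rw [← Finset.sum_filter]
      rw [← Finset.sum_image (s := F.filter fun γ => g i * γ ∈ F) (g := fun γ => g i * γ) (f := fun γ => f γ ^ (-(2 * s))) (fun a _ b _ h => mul_left_cancel h)]
      refine Finset.sum_le_sum_of_subset_of_nonneg ?_ fun γ _ _ => (fp γ).le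
      intro γ hγ
      obtain ⟨δ, h3, rfl⟩ := Finset.mem_image.1 hγ
      exact (Finset.mem_filter.1 h3).2
    have h3 : ∑ γ ∈ F, (if γ ∈ hB0.toFinset then f γ ^ (-(2 * s)) else 0) ≤ C0 := by
      rw [← Finset.sum_filter]
      exact Finset.sum_le_sum_of_subset_of_nonneg (fun γ h => (Finset.mem_filter.1 h).2) fun γ _ _ => (fp γ).le
    have h4 := Finset.sum_le_sum h1
    rw [Finset.sum_add_distrib, Finset.sum_comm] at h4
    simp_rw [← Finset.mul_sum] at h4
    have h5 : ∑ i ∈ I, C2 ^ (2 * s) * ρ i ^ s * ∑ γ ∈ F, (if g i * γ ∈ F then f (g i * γ) ^ (-(2 * s)) else 0) ≤ ∑ i ∈ I, C2 ^ (2 * s) * ρ i ^ s * S :=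
      Finset.sum_le_sum fun i _ => mul_le_mul_of_nonneg_left (h2 i) (by have := hρ0 i; positivity)
    have hS0 : 0 ≤ S := Finset.sum_nonneg fun γ _ => (fp γ).le
    have h6 : ∑ i ∈ I, C2 ^ (2 * s) * ρ i ^ s * S ≤ S / 2 := by
      rw [← Finset.sum_mul, ← Finset.mul_sum]
      have h7 : C2 ^ (2 * s) * ∑ i ∈ I, ρ i ^ s ≤ 1 / 2 := by
        calc _ ≤ C2 ^ (2 * s) * ((C2 ^ (2 * s))⁻¹ / 2) := by gcongr; exact hsum.trans (min_le_left _ _)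
          _ = 1 / 2 := by have : C2 ^ (2 * s) ≠ 0 := by positivity
                          field_simp
      nlinarith
    linarith
  have hsumf : Summable (fun γ => f γ ^ (-(2 * s))) := by
    refine summable_of_sum_le (c := 2 * C0) (fun γ => (fp γ).le) fun u => ?_
    obtain ⟨M, hM⟩ := (u.finite_toSet.image f).bddAbove
    refine le_trans (Finset.sum_le_sum_of_subset_of_nonneg (fun γ hγ => ?_) fun γ _ _ => (fp γ).le) (main M)
    rw [Set.Finite.mem_toFinset]
    exact hM ⟨γ, hγ, rfl⟩
  refine Summable.of_nonneg_of_le (fun γ => Real.rpow_nonneg (mn_nonneg _) _) (fun γ => ?_) hsumf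
  exact Real.rpow_le_rpow_of_nonpos (f0 γ) (Nn_le_mn _ _) (by linarith)
end Rep8

/-! ### invariant Jordan curves transport along the stability homeomorphism -/
section Rep9
variable {G : Type*} [Group G]

def LocF (η : Set RSphere) (z : RSphere) : Prop := ∃ U ∈ 𝓝 z, μH[1] (η ∩ U) < ⊤

structure QC (R : G →* SL2C) (η : Set RSphere) : Prop where
  jor : IsJordanCurve η
  inv : ∀ γ, mobius (R γ) '' η = η
  sub : Lc R ⊆ η
  loc : ∀ z, z ∉ Lc R → LocF η z

def LL (Φ : RSphere → RSphere) (z : RSphere) : Prop := ∃ V ∈ 𝓝 z, ∃ K : ℝ≥0, LipschitzOnWith K Φ V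

lemma LocF_transport (Φ : RSphere ≃ₜ RSphere) {η : Set RSphere} {z : RSphere} (hL : LL Φ z) (h : LocF η z) :
    LocF (Φ '' η) (Φ z) := by
  obtain ⟨V, hV, K, hK⟩ := hL
  obtain ⟨U, hU, hη⟩ := h
  refine ⟨Φ '' (U ∩ V), Φ.isOpenMap.image_mem_nhds (inter_mem hU hV), ?_⟩
  rw [← image_inter Φ.injective]
  have h1 := (hK.mono (s := η ∩ (U ∩ V)) (fun x hx => hx.2.2)).hausdorffMeasure_image_le (d := 1) zero_le_one
  refine h1.trans_lt (ENNReal.mul_lt_top (by simp) ((measure_mono ?_).trans_lt hη))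
  exact inter_subset_inter_right _ inter_subset_left

lemma LL_mobius (g : SL2C) (z : RSphere) : LL (mobius g) z :=
  ⟨univ, univ_mem, _, (lipschitz_mobius g).lipschitzOnWith⟩

lemma LL_comp {Φ Φ' : RSphere → RSphere} {z : RSphere} (hc : ContinuousAt Φ z) (h : LL Φ z) (h' : LL Φ' (Φ z)) : LL (Φ' ∘ Φ) z := by
  obtain ⟨V, hV, K, hK⟩ := h
  obtain ⟨V', hV', K', hK'⟩ := h'
  refine ⟨V ∩ Φ ⁻¹' V', inter_mem hV (hc hV'), K' * K, ?_⟩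
  exact hK'.comp (hK.mono inter_subset_left) (fun x hx => hx.2)

lemma IsJordanCurve.image {η : Set RSphere} (h : IsJordanCurve η) (Φ : RSphere ≃ₜ RSphere) : IsJordanCurve (Φ '' η) := by
  obtain ⟨f, hf, hi, rfl⟩ := h
  exact ⟨Φ ∘ f, Φ.continuous.comp_continuousOn hf, fun x hx y hy e => hi hx hy (Φ.injective e), by rw [image_comp]⟩

lemma STC.LL0 {R R1 : G →* SL2C} {ρ ε : ℝ} {F0 D : V2 → V2} {Ψ : RSphere ≃ₜ RSphere} (h : STC R R1 ρ ε F0 D Ψ) (hε : ε ≤ 1/2)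
    {z : RSphere} (hz : ρ < Metric.infDist z (Lc R)) : LL Ψ z ∧ LL Ψ.symm (Ψ z) := by
  have ho : IsOpen {w | ρ < Metric.infDist w (Lc R)} := isOpen_lt continuous_const (Metric.continuous_infDist_pt _)
  have hV := ho.mem_nhds (show z ∈ {w | ρ < Metric.infDist w (Lc R)} from hz)
  have key : ∀ a ∈ {w | ρ < Metric.infDist w (Lc R)}, ∀ b ∈ {w | ρ < Metric.infDist w (Lc R)},
      dist (Ψ a) (Ψ b) ≤ 6 * dist a b ∧ dist a b ≤ 8 * dist (Ψ a) (Ψ b) := by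
    intro a ha b hb
    have := abs_le.1 (h.sgc a b (le_of_lt ha) (le_of_lt hb))
    have h0 := sg_nonneg a b
    have h1 := dist_le_sg a b
    have h2 := sg_le_dist a b
    have h3 := dist_le_sg (Ψ a) (Ψ b)
    have h4 := sg_le_dist (Ψ a) (Ψ b)
    constructor <;> nlinarith
  refine ⟨⟨_, hV, 6, LipschitzOnWith.of_dist_le_mul fun a ha b hb => (key a ha b hb).1⟩, ?_⟩
  refine ⟨_, Ψ.isOpenMap.image_mem_nhds hV, 8, LipschitzOnWith.of_dist_le_mul ?_⟩
  rintro _ ⟨a, ha, rfl⟩ _ ⟨b, hb, rfl⟩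
  simpa using (key a ha b hb).2

lemma STC.LL {R R1 : G →* SL2C} {ρ ε : ℝ} {F0 D : V2 → V2} {Ψ : RSphere ≃ₜ RSphere} (h : STC R R1 ρ ε F0 D Ψ) (hε : ε ≤ 1/2)
    (hcov : ∀ z, z ∉ Lc R → ∃ γ, ρ < Metric.infDist (mobius (R γ) z) (Lc R)) {z : RSphere} (hz : z ∉ Lc R) :
    LL Ψ z ∧ LL Ψ.symm (Ψ z) := by
  obtain ⟨γ, hγ⟩ := hcov z hz
  obtain ⟨h1, h2⟩ := h.LL0 hε hγ
  constructor
  · have e : (Ψ : RSphere → RSphere) = mobius (R1 γ⁻¹) ∘ (Ψ ∘ mobius (R γ)) := by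
      funext w; simp [h.eqv, map_inv, mobius_inv_mobius]
    rw [e]
    exact LL_comp (Ψ.continuous.comp (continuous_mobius _)).continuousAt
      (LL_comp (continuous_mobius _).continuousAt (LL_mobius _ _) h1) (LL_mobius _ _)
  · have e : (Ψ.symm : RSphere → RSphere) = mobius (R γ⁻¹) ∘ (Ψ.symm ∘ mobius (R1 γ)) := by
      funext w
      obtain ⟨w, rfl⟩ := Ψ.surjective w
      simp [← h.eqv, map_inv, mobius_inv_mobius]
    rw [e]
    refine LL_comp (Ψ.symm.continuous.comp (continuous_mobius _)).continuousAt
      (LL_comp (continuous_mobius _).continuousAt (LL_mobius _ _) ?_) (LL_mobius _ _)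
    rwa [← h.eqv]

lemma STC.QC_fwd {R R1 : G →* SL2C} {ρ ε : ℝ} {F0 D : V2 → V2} {Ψ : RSphere ≃ₜ RSphere} (h : STC R R1 ρ ε F0 D Ψ) (hε : ε ≤ 1/2)
    (hcov : ∀ z, z ∉ Lc R → ∃ γ, ρ < Metric.infDist (mobius (R γ) z) (Lc R)) {η : Set RSphere} (hη : QC R η) :
    QC R1 (Ψ '' η) := by
  refine ⟨hη.jor.image Ψ, fun γ => ?_, ?_, fun z hz => ?_⟩
  · conv_rhs => rw [← hη.inv γ]
    simp only [image_image, h.eqv]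
  · rw [← h.img]; exact image_mono hη.sub
  · obtain ⟨z, rfl⟩ := Ψ.surjective z
    have hz' : z ∉ Lc R := fun h' => hz (h.img ▸ mem_image_of_mem _ h')
    exact LocF_transport Ψ (h.LL hε hcov hz').1 (hη.loc z hz')

lemma STC.QC_bwd {R R1 : G →* SL2C} {ρ ε : ℝ} {F0 D : V2 → V2} {Ψ : RSphere ≃ₜ RSphere} (h : STC R R1 ρ ε F0 D Ψ) (hε : ε ≤ 1/2)
    (hcov : ∀ z, z ∉ Lc R → ∃ γ, ρ < Metric.infDist (mobius (R γ) z) (Lc R)) {η : Set RSphere} (hη : QC R1 η) :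
    QC R (Ψ.symm '' η) := by
  refine ⟨hη.jor.image Ψ.symm, fun γ => ?_, ?_, fun z hz => ?_⟩
  · conv_rhs => rw [← hη.inv γ]
    simp only [image_image]
    refine image_congr fun w _ => ?_
    obtain ⟨w, rfl⟩ := Ψ.surjective w
    rw [← h.eqv]; simp
  · intro z hz
    refine ⟨Ψ z, hη.sub ?_, by simp⟩
    rw [← h.img]; exact mem_image_of_mem _ hz
  · have hz' : Ψ z ∉ Lc R1 := by
      rw [← h.img]; rintro ⟨w, hw, e⟩; exact hz (Ψ.injective e ▸ hw)
    have := LocF_transport Ψ.symm (h.LL hε hcov hz).2 (hη.loc _ hz')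
    simpa using this

lemma Good.cov {R : G →* SL2C} (hR : Good R) : ∃ r > 0, ∀ z, z ∉ Lc R → ∃ γ, r < Metric.infDist (mobius (R γ) z) (Lc R) := by
  obtain ⟨A, r, hE⟩ := exists_exp R hR.closed hR.nt.nonempty
  have hr := hE.pos
  refine ⟨r/2, by linarith, fun z hz => ?_⟩
  obtain ⟨γ, h⟩ := cover_of_exp hE hR.closed hR.nt.nonempty z hz
  exact ⟨γ, by linarith⟩

def PP (R : G →* SL2C) : Prop := ∃ η, QC R η

lemma PP_loc {R : G →* SL2C} (hR : Good R) : ∀ᶠ R1 in nR R, (PP R1 ↔ PP R) := by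
  obtain ⟨r, hr, hcov⟩ := hR.cov
  obtain ⟨κ, hκ, h⟩ := STab hR hr (ε := 1/2) (by norm_num)
  filter_upwards [h] with R1 ⟨F0, _, h⟩
  obtain ⟨Ψ, hΨ⟩ := h _ (DOK_zero R r hκ.le)
  exact ⟨fun ⟨η, hη⟩ => ⟨_, hΨ.QC_bwd le_rfl hcov hη⟩, fun ⟨η, hη⟩ => ⟨_, hΨ.QC_fwd le_rfl hcov hη⟩⟩

lemma PP_path {f : ℝ → (G →* SL2C)} (hg : ∀ t ∈ Icc (0:ℝ) 1, Good (f t))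
    (hc : ∀ t ∈ Icc (0:ℝ) 1, Tendsto f (𝓝[Icc 0 1] t) (nR (f t))) : PP (f 0) ↔ PP (f 1) := by
  refine isPreconnected_Icc.induction₂ (s := Icc (0:ℝ) 1) (fun x y => PP (f x) ↔ PP (f y)) (fun t ht => ?_)
    (fun a b c _ _ _ h1 h2 => h1.trans h2) (fun a b _ _ h => h.symm) (by simp) (by simp)
  filter_upwards [(hc t ht).eventually (PP_loc (hg t ht))] with y hy
  exact hy.symm
end Rep9

/-! ### ping-pong data give good representations -/
section Rep10
variable {k : ℕ}

def bar (s : Fin k × Bool) : Fin k × Bool := (s.1, !s.2)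
lemma bar_bar (s : Fin k × Bool) : bar (bar s) = s := by simp [bar]
lemma bar_ne (s : Fin k × Bool) : bar s ≠ s := by
  intro h; have := congrArg Prod.snd h; simp [bar] at this

def vl (R : FreeGroup (Fin k) →* SL2C) (s : Fin k × Bool) : SL2C := R (FreeGroup.mk [s])

lemma vl_bar (R : FreeGroup (Fin k) →* SL2C) (s : Fin k × Bool) : vl R (bar s) = (vl R s)⁻¹ := by
  unfold vl bar; rw [← map_inv, FreeGroup.inv_mk]; simp [FreeGroup.invRev]

lemma vl_cons (R : FreeGroup (Fin k) →* SL2C) (s : Fin k × Bool) (L : List (Fin k × Bool)) :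
    R (FreeGroup.mk (s :: L)) = vl R s * R (FreeGroup.mk L) := by
  unfold vl; rw [← map_mul, FreeGroup.mul_mk]; rfl

structure Sch (R : FreeGroup (Fin k) →* SL2C) (O : Fin k × Bool → Set RSphere) : Prop where
  op : ∀ s, IsOpen (O s)
  dj : ∀ s t, s ≠ t → Disjoint (O s) (O t)
  mp : ∀ s z, z ∉ O (bar s) → mobius (vl R s) z ∈ O s
  ex : ∃ p, p ∉ closure (⋃ s, O s)

lemma Sch.of_half {R : FreeGroup (Fin k) →* SL2C} {O : Fin k × Bool → Set RSphere} (op : ∀ s, IsOpen (O s))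
    (dj : ∀ s t, s ≠ t → Disjoint (O s) (O t)) (mp : ∀ i z, z ∉ O (i, false) → mobius (R (FreeGroup.of i)) z ∈ O (i, true))
    (ex : ∃ p, p ∉ closure (⋃ s, O s)) : Sch R O := by
  have h1 : ∀ i, vl R (i, true) = R (FreeGroup.of i) := fun i => rfl
  refine ⟨op, dj, ?_, ex⟩
  rintro ⟨i, b⟩ z hz
  cases b
  · have h2 : vl R (i, false) = (vl R (i, true))⁻¹ := vl_bar R (i, true)
    by_contra hc
    have := mp i _ hc
    rw [h2, h1, mobius_mobius_inv] at this
    exact hz this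
  · exact mp i z hz

def DD (R : FreeGroup (Fin k) →* SL2C) (O : Fin k × Bool → Set RSphere) (s : Fin k × Bool) : Set RSphere := mobius (vl R s) '' (O (bar s))ᶜ

variable {R : FreeGroup (Fin k) →* SL2C} {O : Fin k × Bool → Set RSphere}

lemma Sch.DD_closed (h : Sch R O) (s) : IsClosed (DD R O s) :=
  (mobHomeo (vl R s)).isClosedMap _ (h.op _).isClosed_compl

lemma Sch.DD_sub (h : Sch R O) (s) : DD R O s ⊆ O s := by
  rintro _ ⟨z, hz, rfl⟩; exact h.mp s z hz

lemma Sch.DD_back (h : Sch R O) {s z} (hz : z ∈ DD R O s) : mobius (vl R (bar s)) z ∉ O (bar s) := by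
  obtain ⟨w, hw, rfl⟩ := hz
  rw [vl_bar, mobius_inv_mobius]; exact hw

lemma Sch.word (h : Sch R O) {p : RSphere} (hp : ∀ s, p ∉ O s) : ∀ (L : List (Fin k × Bool)), FreeGroup.IsReduced L → ∀ t ∈ L.head?,
    mobius (R (FreeGroup.mk L)) p ∈ DD R O t := by
  intro L
  induction L with
  | nil => simp
  | cons s L ih =>
    intro hL t ht
    obtain rfl : s = t := by simpa using ht
    rw [vl_cons, mobius_mul]
    refine mem_image_of_mem _ ?_
    cases L with
    | nil => simpa [← FreeGroup.one_eq_mk, mobius_one] using hp _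
    | cons u L =>
      have hu := h.DD_sub _ (ih (FreeGroup.isReduced_cons_cons.1 hL).2 u (by simp))
      have h1 : u ≠ bar s := by
        rintro rfl
        have := (FreeGroup.isReduced_cons_cons.1 hL).1 rfl
        simp [bar] at this
      intro hc
      exact Set.disjoint_left.1 (h.dj _ _ h1) hu hc

lemma Sch.word1 (h : Sch R O) {p : RSphere} (hp : ∀ s, p ∉ O s) {γ : FreeGroup (Fin k)} (hγ : γ ≠ 1) :
    mobius (R γ) p ∈ ⋃ s, DD R O s := by
  have h1 := h.word hp γ.toWord FreeGroup.isReduced_toWord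
  rw [FreeGroup.mk_toWord] at h1
  have h2 : γ.toWord ≠ [] := by simpa using hγ
  obtain ⟨t, L, e⟩ := List.exists_cons_of_ne_nil h2
  exact mem_iUnion.2 ⟨t, h1 t (by simp [e])⟩

lemma Sch.disc (h : Sch R O) : DiscG R := by
  obtain ⟨p, hp⟩ := h.ex
  have hp' : ∀ s, p ∉ O s := fun s hs => hp (subset_closure (mem_iUnion.2 ⟨s, hs⟩))
  obtain ⟨δ, hδ, hb⟩ := Metric.isOpen_iff.1 isClosed_closure.isOpen_compl p hp
  have hm := one_le_mn (1 : SL2C)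
  refine DiscG_of R (ε := δ / (4 * mn 1)) (by positivity) fun γ hγ => ?_
  have h1 := h.word1 hp' hγ
  have h2 : δ ≤ dist (mobius (R γ) p) p := by
    by_contra hc
    refine hb (not_le.1 hc) (subset_closure ?_)
    obtain ⟨s, hs⟩ := mem_iUnion.1 h1
    exact mem_iUnion.2 ⟨s, h.DD_sub s hs⟩
  have h3 := dist_mobius_diff' 1 (R γ) p
  rw [mobius_one, dist_comm, dm_comm] at h3
  rw [div_le_iff₀ (by positivity)]
  linarith

def LamP (R : FreeGroup (Fin k) →* SL2C) (O : Fin k × Bool → Set RSphere) : Set RSphere := {z | ∀ γ, mobius (R γ) z ∈ ⋃ s, DD R O s}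

lemma Sch.LamP_closed (h : Sch R O) : IsClosed (LamP R O) := by
  have : LamP R O = ⋂ γ, mobius (R γ) ⁻¹' (⋃ s, DD R O s) := by ext; simp [LamP]
  rw [this]
  exact isClosed_iInter fun γ => (isClosed_iUnion_of_finite fun s => h.DD_closed s).preimage (continuous_mobius _)

lemma Sch.LamP_inv (h : Sch R O) : GInv R (LamP R O) := by
  intro γ z hz δ
  rw [← mobius_mul, ← map_mul]; exact hz _

lemma Sch.LamP_meet (h : Sch R O) (s : Fin k × Bool) : (LamP R O ∩ DD R O s).Nonempty := by
  by_contra hne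
  rw [Set.not_nonempty_iff_eq_empty] at hne
  obtain ⟨p, hp⟩ := h.ex
  have hp' : ∀ s, p ∉ O s := fun s hs => hp (subset_closure (mem_iUnion.2 ⟨s, hs⟩))
  have hcl : IsClosed (⋃ s, DD R O s) := isClosed_iUnion_of_finite fun s => h.DD_closed s
  obtain ⟨T, hT⟩ := (h.DD_closed s).isCompact.elim_finite_subcover (fun γ => mobius (R γ) ⁻¹' (⋃ s, DD R O s)ᶜ)
    (fun γ => hcl.isOpen_compl.preimage (continuous_mobius _)) (by
      intro z hz
      by_contra hc
      have : z ∈ LamP R O ∩ DD R O s := ⟨fun γ => by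
        by_contra h'; exact hc (mem_iUnion.2 ⟨γ, h'⟩), hz⟩
      rw [hne] at this; exact this)
  set a : FreeGroup (Fin k) := FreeGroup.mk [s] with ha
  have hw : ∀ n : ℕ, mobius (R (a ^ (n+1))) p ∈ DD R O s := by
    intro n
    induction n with
    | zero => 
      rw [zero_add, pow_one]
      exact mem_image_of_mem _ (hp' _)
    | succ n ih =>
      rw [pow_succ', map_mul, mobius_mul]
      refine mem_image_of_mem _ fun hc => ?_
      exact Set.disjoint_left.1 (h.dj _ _ (bar_ne s)) hc (h.DD_sub _ ih)
  have hin : ∀ n : ℕ, (a ^ (n+1))⁻¹ ∈ T := by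
    intro n
    obtain ⟨γ, hγ, h1⟩ := mem_iUnion₂.1 (hT (hw n))
    by_contra hc
    refine h1 ?_
    rw [← mobius_mul, ← map_mul]
    refine h.word1 hp' fun e => hc ?_
    rw [← eq_inv_of_mul_eq_one_left e]; exact hγ
  have ha1 : a ≠ 1 := by
    rw [ha, FreeGroup.one_eq_mk]
    intro e
    have := congrArg FreeGroup.toWord e
    simp [FreeGroup.toWord_mk] at this
  have hinj : Function.Injective (fun n : ℕ => (a ^ (n+1))⁻¹) := by
    intro n m e
    have e1 : a ^ (n+1) = a ^ (m+1) := inv_injective e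
    have := injective_pow_iff_not_isOfFinOrder.2 (not_isOfFinOrder_of_isMulTorsionFree ha1) e1
    omega
  exact Set.infinite_of_injective_forall_mem hinj hin (Finset.finite_toSet T)

lemma Sch.LamP_sub (h : Sch R O) : LamP R O ⊆ Lc R := by
  obtain ⟨p, hp⟩ := h.ex
  obtain ⟨δ, hδ, hb⟩ := Metric.isOpen_iff.1 isClosed_closure.isOpen_compl p hp
  have hout : ∀ q, dist q p < δ → ∀ s, q ∉ O s := fun q hq s hs => hb hq (subset_closure (mem_iUnion.2 ⟨s, hs⟩))
  obtain ⟨q, hqp, hq⟩ := perfect_pt p hδ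
  have hp' := hout p (by simpa using hδ)
  have hq' := hout q (by rwa [dist_comm])
  -- gap
  have hgap : ∃ c > 0, ∀ s, ∀ a ∈ DD R O s, ∀ b ∉ O s, c ≤ sg a b := by
    have : ∀ s, ∃ c > 0, ∀ a ∈ DD R O s, ∀ b ∉ O s, c ≤ sg a b := by
      intro s
      obtain ⟨c, hc, h1⟩ := (h.DD_closed s).isCompact.exists_cthickening_subset_open (h.op s) (h.DD_sub s)
      refine ⟨c/2, by linarith, fun a ha b hb => ?_⟩
      by_contra hlt
      refine hb (h1 (Metric.mem_cthickening_of_dist_le b a c _ ha ?_))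
      have := dist_le_sg a b
      rw [dist_comm]; linarith
    choose c hc h1 using this
    by_cases hk : Nonempty (Fin k × Bool)
    · obtain ⟨i, hi⟩ := Finite.exists_min c
      exact ⟨c i, hc i, fun s a ha b hb => (hi s).trans (h1 s a ha b hb)⟩
    · exact ⟨1, one_pos, fun s => (hk ⟨s⟩).elim⟩
  obtain ⟨c, hc, hgap⟩ := hgap
  intro z hz
  have hpath : ∀ n : ℕ, ∃ L : List (Fin k × Bool), L.length = n + 1 ∧ FreeGroup.IsReduced L ∧ ∀ t ∈ L.head?, mobius (R (FreeGroup.mk L)) z ∉ O t := by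
    intro n
    induction n with
    | zero =>
      obtain ⟨s, hs⟩ := mem_iUnion.1 (hz 1)
      rw [map_one, mobius_one] at hs
      refine ⟨[bar s], rfl, FreeGroup.IsReduced.singleton, fun t ht => ?_⟩
      obtain rfl : bar s = t := by simpa using ht
      exact h.DD_back hs
    | succ n ih =>
      obtain ⟨L, hl, hr, ht⟩ := ih
      obtain ⟨u, L, rfl⟩ := List.exists_cons_of_ne_nil (l := L) (by rintro rfl; simp at hl)
      obtain ⟨s, hs⟩ := mem_iUnion.1 (hz (FreeGroup.mk (u :: L)))
      have hu := ht u (by simp)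
      have hsu : s ≠ u := by rintro rfl; exact hu (h.DD_sub _ hs)
      refine ⟨bar s :: u :: L, by simpa using hl, FreeGroup.isReduced_cons_cons.2 ⟨?_, hr⟩, fun t ht => ?_⟩
      · intro e
        by_contra hne
        apply hsu
        ext
        · exact congrArg _ e
        · clear * - hne; revert hne; obtain ⟨_, a⟩ := s; obtain ⟨_, b⟩ := u; cases a <;> cases b <;> simp [bar]
      · obtain rfl : bar s = t := by simpa using ht
        rw [vl_cons, mobius_mul]
        exact h.DD_back hs
  intro ε hε
  have hsg := sg_pos hqp
  set M := 32 / (c * sg q p * ε) + 1 with hM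
  have hfin := h.disc M
  obtain ⟨γ, L, hL, hr, ht, rfl, hγ⟩ : ∃ γ, ∃ L : List (Fin k × Bool), L ≠ [] ∧ FreeGroup.IsReduced L ∧ (∀ t ∈ L.head?, mobius (R (FreeGroup.mk L)) z ∉ O t) ∧ γ = FreeGroup.mk L ∧ M < mn (R γ) := by
    choose L hl hr ht using hpath
    by_contra hc
    push Not at hc
    have hinj : Function.Injective (fun n => FreeGroup.mk (L n)) := by
      intro n m e
      have := congrArg FreeGroup.toWord e
      simp only [FreeGroup.toWord_mk, (hr _).reduce_eq] at this
      have := congrArg List.length this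
      rw [hl, hl] at this; omega
    exact Set.infinite_of_injective_forall_mem hinj (fun n => hc _ (L n) (by intro e; have := hl n; simp [e] at this) (hr n) (ht n) rfl) hfin
  obtain ⟨t, L, rfl⟩ := List.exists_cons_of_ne_nil hL
  set γ := FreeGroup.mk (t :: L) with hγd
  refine ⟨γ, ?_⟩
  have hx := ht t (by simp)
  obtain ⟨y, hy, hbig⟩ := one_big (R γ) hqp
  have hyO : ∀ s, y ∉ O s := by rcases hy with rfl | rfl <;> assumption
  have hyD := h.word hyO _ hr t (by simp)
  have h1 := hgap t _ hyD _ hx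
  have h2 := sg_mobius_eq (R γ) y z
  have hNy := Nn_pos (R γ) y
  have hNz := Nn_pos (R γ) z
  have h3 : c * (Nn (R γ) y * Nn (R γ) z) ≤ 2 := by
    have := sg_le_two y z
    rw [← hγd, h2, le_div_iff₀ (by positivity)] at h1
    linarith
  by_contra hge
  push Not at hge
  have h4 : sg q p * M ≤ 16 * Nn (R γ) y := le_trans (by gcongr) hbig
  have h5 : c * (sg q p * M) * ε ≤ 32 := by
    calc c * (sg q p * M) * ε ≤ c * (16 * Nn (R γ) y) * Nn (R γ) z := by gcongr
      _ ≤ 32 := by nlinarith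
  have h6 : c * (sg q p * M) * ε = 32 + c * sg q p * ε := by rw [hM]; field_simp
  have : 0 < c * sg q p * ε := by positivity
  linarith

theorem Sch.good (h : Sch R O) (hk : 0 < k) : Good R := by
  have hnt : (LamP R O).Nontrivial := by
    set s : Fin k × Bool := (⟨0, hk⟩, true)
    obtain ⟨a, ha, ha'⟩ := h.LamP_meet s
    obtain ⟨b, hb, hb'⟩ := h.LamP_meet (bar s)
    refine ⟨a, ha, b, hb, ?_⟩
    rintro rfl
    exact Set.disjoint_left.1 (h.dj _ _ (bar_ne s)) (h.DD_sub _ hb') (h.DD_sub _ ha')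
  have e : Lc R = LamP R O := subset_antisymm (Lc_subset h.LamP_closed h.LamP_inv hnt) h.LamP_sub
  refine ⟨e ▸ h.LamP_closed, e ▸ hnt, ?_, h.disc⟩
  rw [e]
  obtain ⟨p, hp⟩ := h.ex
  intro hu
  have : p ∈ LamP R O := hu ▸ mem_univ p
  have := this 1
  rw [map_one, mobius_one] at this
  obtain ⟨s, hs⟩ := mem_iUnion.1 this
  exact hp (subset_closure (mem_iUnion.2 ⟨s, h.DD_sub s hs⟩))

end Rep10

/-! ### explicit paths of representations, and the Fuchsian end point -/
section Rep11
variable {k : ℕ}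

def Mx (A P θ : ℂ) : SL2C := ⟨!![Complex.exp (-θ) * A, -Complex.exp θ - Complex.exp (-θ) * A * P; Complex.exp (-θ), -(Complex.exp (-θ) * P)], by
  rw [Matrix.det_fin_two_of, Complex.exp_neg]
  have := Complex.exp_ne_zero θ
  field_simp; ring⟩

lemma Mx_infty (A P θ : ℂ) : mobius (Mx A P θ) RSphere.infty = RSphere.ofC A := by
  have h : mobius (Mx A P θ) RSphere.infty = if Complex.exp (-θ) = 0 then RSphere.infty else RSphere.ofC (Complex.exp (-θ) * A / Complex.exp (-θ)) := rfl
  have h0 := Complex.exp_ne_zero (-θ)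
  rw [h, if_neg h0, mul_div_cancel_left₀ _ h0]

lemma Mx_ofC (A P θ w : ℂ) (hw : w ≠ P) : mobius (Mx A P θ) (RSphere.ofC w) = RSphere.ofC (A - Complex.exp θ ^ 2 / (w - P)) := by
  have h : mobius (Mx A P θ) (RSphere.ofC w) = if Complex.exp (-θ) * w + -(Complex.exp (-θ) * P) = 0 then RSphere.infty else
    RSphere.ofC ((Complex.exp (-θ) * A * w + (-Complex.exp θ - Complex.exp (-θ) * A * P)) / (Complex.exp (-θ) * w + -(Complex.exp (-θ) * P))) := rfl
  have h0 := Complex.exp_ne_zero θ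
  have h1 : w - P ≠ 0 := sub_ne_zero.2 hw
  have h2 : Complex.exp (-θ) * w + -(Complex.exp (-θ) * P) = Complex.exp (-θ) * (w - P) := by ring
  rw [h, h2, if_neg (mul_ne_zero (Complex.exp_ne_zero _) h1)]
  congr 1
  rw [Complex.exp_neg]
  field_simp; ring

lemma Mx_P (A P θ : ℂ) : mobius (Mx A P θ) (RSphere.ofC P) = RSphere.infty := by
  have h : mobius (Mx A P θ) (RSphere.ofC P) = if Complex.exp (-θ) * P + -(Complex.exp (-θ) * P) = 0 then RSphere.infty else
    RSphere.ofC ((Complex.exp (-θ) * A * P + (-Complex.exp θ - Complex.exp (-θ) * A * P)) / (Complex.exp (-θ) * P + -(Complex.exp (-θ) * P))) := rfl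
  rw [h, if_pos (by ring)]

lemma Mx_inv (A P θ : ℂ) : (Mx A P θ)⁻¹ = Mx P A (θ + Real.pi * Complex.I) := by
  have h0 := Complex.exp_ne_zero θ
  rw [Matrix.SpecialLinearGroup.SL2_inv_expl]
  ext i j
  fin_cases i <;> fin_cases j <;> simp [Mx, Complex.exp_add, Complex.exp_neg] <;> field_simp <;> ring

lemma exists_Mx (g : SL2C) (h : g.1 1 0 ≠ 0) : ∃ A P θ, g = Mx A P θ := by
  refine ⟨g.1 0 0 / g.1 1 0, - g.1 1 1 / g.1 1 0, - Complex.log (g.1 1 0), ?_⟩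
  have hd := SL2C_det g
  ext i j
  fin_cases i <;> fin_cases j <;> simp [Mx, Complex.exp_neg, Complex.exp_log h] <;> field_simp
  linear_combination -hd

lemma tendsto_free {ι : Type*} {l : Filter ι} {R : FreeGroup (Fin k) →* SL2C} {f : ι → (FreeGroup (Fin k) →* SL2C)}
    (h : ∀ i, Tendsto (fun j => dm (f j (FreeGroup.of i)) (R (FreeGroup.of i))) l (𝓝 0)) : Tendsto f l (nR R) := by
  refine tendsto_nR fun γ => ?_
  induction γ using FreeGroup.induction_on with
  | C1 => simpa [dm_self] using tendsto_const_nhds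
  | of i => exact h i
  | inv_of i h => simpa [dm_inv] using h
  | mul x y hx hy =>
    have hb : Tendsto (fun j => 4 * (mn (R x) * dm (f j y) (R y) + dm (f j x) (R x) * (mn (R y) + dm (f j y) (R y)))) l (𝓝 (4 * (mn (R x) * 0 + 0 * (mn (R y) + 0)))) :=
      ((hy.const_mul _).add (hx.mul (hy.const_add _))).const_mul _
    simp only [mul_zero, zero_mul, add_zero] at hb
    refine squeeze_zero (fun _ => dm_nonneg _ _) (fun j => ?_) hb
    rw [map_mul, map_mul, dm_comm]
    refine (dm_mul_le _ _ _ _).trans ?_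
    rw [dm_comm (R y), dm_comm (R x)]
    have := mn_diff_le (f j y) (R y)
    have := dm_nonneg (f j x) (R x)
    gcongr

lemma Mx_cont {ι : Type*} [TopologicalSpace ι] {A P θ : ι → ℂ} (hA : Continuous A) (hP : Continuous P) (hθ : Continuous θ) (x : ι) :
    Tendsto (fun y => dm (Mx (A y) (P y) (θ y)) (Mx (A x) (P x) (θ x))) (𝓝 x) (𝓝 0) := by
  have : Continuous (fun y => dm (Mx (A y) (P y) (θ y)) (Mx (A x) (P x) (θ x))) := by
    simp only [dm, Mx, Matrix.of_apply, Matrix.cons_val', Matrix.cons_val_zero, Matrix.cons_val_one]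
    fun_prop
  have h := this.tendsto x
  rwa [dm_self] at h

def Rp (A P θ : Fin k → ℂ) : FreeGroup (Fin k) →* SL2C := FreeGroup.lift fun i => Mx (A i) (P i) (θ i)

lemma Rp_of (A P θ : Fin k → ℂ) (i) : Rp A P θ (FreeGroup.of i) = Mx (A i) (P i) (θ i) := by simp [Rp]

lemma Rp_path (hk : 0 < k) {A P θ : ℝ → Fin k → ℂ} (hA : Continuous A) (hP : Continuous P) (hθ : Continuous θ)
    (h : ∀ t ∈ Icc (0:ℝ) 1, ∃ O, Sch (Rp (A t) (P t) (θ t)) O) : PP (Rp (A 0) (P 0) (θ 0)) ↔ PP (Rp (A 1) (P 1) (θ 1)) := by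
  refine PP_path (f := fun t => Rp (A t) (P t) (θ t)) (fun t ht => ?_) (fun t ht => ?_)
  · obtain ⟨O, hO⟩ := h t ht
    exact hO.good hk
  · refine tendsto_free fun i => ?_
    simp only [Rp_of]
    exact (Mx_cont (A := fun t => A t i) (P := fun t => P t i) (θ := fun t => θ t i) (by fun_prop) (by fun_prop) (by fun_prop) t).mono_left nhdsWithin_le_nhds

lemma continuous_ofC : Continuous RSphere.ofC := by
  refine Metric.continuous_iff.2 fun z ε hε => ⟨ε/2, by linarith, fun w hw => ?_⟩
  have h1 := dist_le_sg (ofC w) (ofC z)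
  have h2 := sg_ofC w z
  have h3 := sg_nonneg (ofC w) (ofC z)
  have h4 : 1 ≤ max ‖w‖ 1 * max ‖z‖ 1 := one_le_mul_of_one_le_of_one_le (le_max_right _ _) (le_max_right _ _)
  rw [dist_eq_norm] at hw
  nlinarith

lemma dist_ofC_le (w z : ℂ) : dist (ofC w) (ofC z) ≤ 2 * dist w z := by
  have h1 := dist_le_sg (ofC w) (ofC z)
  have h2 := sg_ofC w z
  have h3 := sg_nonneg (ofC w) (ofC z)
  have h4 : 1 ≤ max ‖w‖ 1 * max ‖z‖ 1 := one_le_mul_of_one_le_of_one_le (le_max_right _ _) (le_max_right _ _)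
  rw [dist_eq_norm]
  nlinarith

lemma lipschitz_ofC : LipschitzWith 2 RSphere.ofC := LipschitzWith.of_dist_le_mul fun w z => by simpa using dist_ofC_le w z

lemma isOpen_ofC {U : Set ℂ} (hU : IsOpen U) : IsOpen (RSphere.ofC '' U) := by
  rw [Metric.isOpen_iff]
  rintro _ ⟨z, hz, rfl⟩
  obtain ⟨δ, hδ, hb⟩ := Metric.isOpen_iff.1 hU z hz
  set m := max ‖z‖ 1 with hm
  have hm1 : 1 ≤ m := le_max_right _ _
  -- if dist(ofC w)(ofC z) < ε then w near z
  refine ⟨min (1 / (4 * m ^ 2)) (δ / (8 * m ^ 2)), by positivity, fun x hx => ?_⟩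
  rw [Metric.mem_ball] at hx
  have hx1 := hx.trans_le (min_le_left _ _)
  have hx2 := hx.trans_le (min_le_right _ _)
  have hs := sg_le_dist x (ofC z)
  rcases RSphere.cases' x with rfl | ⟨w, rfl⟩
  · exfalso
    have h1 := sg_ofC_infty z
    rw [sg_comm] at h1
    rw [← hm] at h1
    have : sg infty (ofC z) * m ≤ 2 * (1 / (4 * m^2)) * m := by gcongr; linarith
    have h2 : 2 * (1 / (4 * m^2)) * m = 1 / (2 * m) := by field_simp; ring
    have h3 : 1 / (2 * m) ≤ 1 / 2 := by
      rw [div_le_div_iff₀ (by positivity) (by norm_num)]; linarith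
    linarith
  · refine mem_image_of_mem _ (hb ?_)
    rw [Metric.mem_ball, dist_eq_norm]
    have h2 := sg_ofC w z
    rw [← hm] at h2
    have hw : max ‖w‖ 1 ≤ m + ‖w - z‖ := by
      refine max_le ?_ (by linarith [norm_nonneg (w - z)])
      have : ‖w‖ ≤ ‖w - z‖ + ‖z‖ := by simpa using norm_add_le (w - z) z
      have := le_max_left ‖z‖ 1
      linarith
    set d := ‖w - z‖
    set σ := sg (ofC w) (ofC z)
    have hσ1 : σ * (2 * m ^ 2) ≤ 1 := by
      have : σ ≤ 2 * (1 / (4 * m^2)) := by linarith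
      calc σ * (2 * m ^ 2) ≤ 2 * (1 / (4 * m^2)) * (2 * m ^ 2) := by gcongr
        _ = 1 := by field_simp; ring
    have hσ2 : σ * (4 * m ^ 2) < δ := by
      have : σ < 2 * (δ / (8 * m^2)) := by linarith
      calc σ * (4 * m ^ 2) < 2 * (δ / (8 * m^2)) * (4 * m ^ 2) := by gcongr
        _ = δ := by field_simp; ring
    have hσ := sg_nonneg (ofC w) (ofC z)
    have h3 : d ≤ σ * ((m + d) * m) := h2.symm.le.trans (by gcongr)
    have hd : 0 ≤ d := norm_nonneg _
    have h4 : σ * m * d ≤ d / 2 := by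
      have : σ * m ≤ 1/2 := by
        have : σ * m ≤ σ * m ^ 2 := by gcongr; nlinarith
        linarith
      nlinarith
    nlinarith

lemma closed_ofC_of_bdd {K : Set ℂ} (hK : IsCompact K) : IsClosed (RSphere.ofC '' K) := (hK.image continuous_ofC).isClosed

lemma Sch_balls {R : FreeGroup (Fin k) →* SL2C} {c : Fin k × Bool → ℂ} {r : Fin k × Bool → ℝ}
    (hd : ∀ s t, s ≠ t → Disjoint (Metric.ball (c s) (r s)) (Metric.ball (c t) (r t)))
    (hi : ∀ i, mobius (R (FreeGroup.of i)) RSphere.infty ∈ ofC '' Metric.ball (c (i, true)) (r (i, true)))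
    (hm : ∀ i w, w ∉ Metric.ball (c (i, false)) (r (i, false)) → mobius (R (FreeGroup.of i)) (ofC w) ∈ ofC '' Metric.ball (c (i, true)) (r (i, true))) :
    Sch R (fun s => ofC '' Metric.ball (c s) (r s)) := by
  refine Sch.of_half (fun s => isOpen_ofC Metric.isOpen_ball) (fun s t h => ?_) (fun i z hz => ?_) ⟨infty, fun h => ?_⟩
  · exact (disjoint_image_iff ofC_injective).2 (hd s t h)
  · rcases RSphere.cases' z with rfl | ⟨w, rfl⟩
    · exact hi i
    · exact hm i w fun h => hz (mem_image_of_mem _ h)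
  · have h1 : IsCompact (⋃ s, Metric.closedBall (c s) (r s)) := isCompact_iUnion fun s => isCompact_closedBall _ _
    have h2 : closure (⋃ s, ofC '' Metric.ball (c s) (r s)) ⊆ ofC '' (⋃ s, Metric.closedBall (c s) (r s)) := by
      refine closure_minimal ?_ (closed_ofC_of_bdd h1)
      rw [image_iUnion]
      exact iUnion_mono fun s => image_mono Metric.ball_subset_closedBall
    obtain ⟨w, _, e⟩ := h2 h
    exact ofC_ne_infty w e

end Rep11

section Rep12
variable {k : ℕ}

def Ee (c : ℂ) : Set RSphere := {z | z = RSphere.infty ∨ ∃ w : ℂ, (c * w).im = 0 ∧ z = ofC w}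

lemma Ee_eq {c : ℂ} (hc : c ≠ 0) : ∃ h : SL2C, Ee c = mobius h '' (ofC '' Metric.sphere 0 1) := by
  obtain ⟨s, hs⟩ := IsAlgClosed.exists_pow_nat_eq (2 * Complex.I / c) (n := 2) (by norm_num)
  have hs0 : s ≠ 0 := by
    rintro rfl
    have : 2 * Complex.I / c ≠ 0 := by simp [hc]
    exact this (by rw [← hs]; simp)
  have hI := Complex.I_ne_zero
  refine ⟨⟨!![s⁻¹ * (Complex.I / c), s⁻¹ * (Complex.I / c); -s⁻¹, s⁻¹], ?_⟩, ?_⟩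
  · rw [Matrix.det_fin_two_of]
    have : s⁻¹ * (Complex.I / c) * s⁻¹ - s⁻¹ * (Complex.I / c) * -s⁻¹ = (2 * Complex.I / c) / s ^ 2 := by field_simp; ring
    rw [this, hs]
    field_simp
  · set h : SL2C := ⟨!![s⁻¹ * (Complex.I / c), s⁻¹ * (Complex.I / c); -s⁻¹, s⁻¹], _⟩ with hh
    have e1 : mobius h (ofC 1) = infty := by
      have : mobius h (ofC 1) = if -s⁻¹ * 1 + s⁻¹ = 0 then infty else ofC ((s⁻¹ * (Complex.I / c) * 1 + s⁻¹ * (Complex.I / c)) / (-s⁻¹ * 1 + s⁻¹)) := rfl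
      rw [this, if_pos (by ring)]
    have e2 : ∀ w, w ≠ 1 → mobius h (ofC w) = ofC (Complex.I / c * ((1 + w) / (1 - w))) := by
      intro w hw
      have : mobius h (ofC w) = if -s⁻¹ * w + s⁻¹ = 0 then infty else ofC ((s⁻¹ * (Complex.I / c) * w + s⁻¹ * (Complex.I / c)) / (-s⁻¹ * w + s⁻¹)) := rfl
      have h1 : 1 - w ≠ 0 := sub_ne_zero.2 hw.symm
      have h2 : -s⁻¹ * w + s⁻¹ = s⁻¹ * (1 - w) := by ring
      rw [this, h2, if_neg (mul_ne_zero (inv_ne_zero hs0) h1)]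
      congr 1
      field_simp; ring
    ext z
    constructor
    · rintro (rfl | ⟨v, hv, rfl⟩)
      · exact ⟨_, ⟨1, by simp, rfl⟩, e1⟩
      · obtain ⟨x, hx⟩ : ∃ x : ℝ, c * v = x := ⟨(c * v).re, by apply Complex.ext <;> simp [hv]⟩
        have hx1 : (x : ℂ) + Complex.I ≠ 0 := by
          intro e; have := congrArg Complex.im e; simp at this
        have hw : (x - Complex.I) / (x + Complex.I) ≠ 1 := by
          rw [Ne, div_eq_one_iff_eq hx1]
          intro e; have := congrArg Complex.im e; norm_num at this
        refine ⟨_, ⟨(x - Complex.I) / (x + Complex.I), ?_, rfl⟩, ?_⟩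
        · rw [mem_sphere_zero_iff_norm, norm_div]
          have : ‖(x:ℂ) - Complex.I‖ = ‖(x:ℂ) + Complex.I‖ := by
            rw [← Complex.norm_conj]; simp [sub_neg_eq_add]
          rw [this, div_self]
          simpa using hx1
        · rw [e2 _ hw]
          congr 1
          have hv' : v = x / c := by rw [← hx]; field_simp
          have h3 : 1 - ((x:ℂ) - Complex.I) / (x + Complex.I) = 2 * Complex.I / (x + Complex.I) := by field_simp; ring
          rw [h3, hv']
          field_simp
          ring
    · rintro ⟨_, ⟨w, hw, rfl⟩, rfl⟩
      by_cases h1 : w = 1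
      · subst h1; left; exact e1
      · right
        refine ⟨_, ?_, e2 w h1⟩
        have : c * (Complex.I / c * ((1 + w) / (1 - w))) = Complex.I * ((1 + w) / (1 - w)) := by field_simp
        rw [this]
        have hn : w.re ^ 2 + w.im ^ 2 = 1 := by
          rw [mem_sphere_zero_iff_norm] at hw
          have := Complex.sq_norm w
          rw [hw, Complex.normSq_apply] at this
          nlinarith
        simp only [Complex.mul_im, Complex.I_re, Complex.I_im, zero_mul, one_mul, zero_add, Complex.div_re, Complex.add_re, Complex.sub_re, Complex.add_im, Complex.sub_im, Complex.one_re, Complex.one_im]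
        have : (1 + w.re) * (1 - w.re) + w.im * (0 - w.im) = 0 := by nlinarith
        rw [← add_div, this, zero_div]

lemma jordan_circle : IsJordanCurve (ofC '' Metric.sphere 0 1) :=
  ⟨ofC, continuous_ofC.continuousOn, ofC_injective.injOn, rfl⟩

lemma sphere_hm (c : ℂ) (r : ℝ) : μH[1] (Metric.sphere c r) < ⊤ := by
  rcases lt_or_ge r 0 with h | h
  · rw [Metric.sphere_eq_empty_of_neg h]; simp
  have e : Metric.sphere c r = circleMap c r '' Icc 0 (2 * Real.pi) := by
    rw [← abs_of_nonneg h, ← image_circleMap_Ioc, abs_of_nonneg h]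
    refine subset_antisymm (image_mono Ioc_subset_Icc_self) ?_
    rintro _ ⟨t, ht, rfl⟩
    rw [image_circleMap_Ioc, abs_of_nonneg h]
    exact circleMap_mem_sphere _ h _
  rw [e]
  refine ((lipschitzWith_circleMap c r).lipschitzOnWith.hausdorffMeasure_image_le (d := 1) zero_le_one).trans_lt (ENNReal.mul_lt_top (by simp) ?_)
  rw [hausdorffMeasure_real]
  exact measure_Icc_lt_top

lemma Ee_QC {c : ℂ} (hc : c ≠ 0) {A P θ : Fin k → ℂ} (hA : ∀ i, (c * A i).im = 0) (hP : ∀ i, (c * P i).im = 0) (hθ : ∀ i, (c * Complex.exp (θ i)).im = 0) :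
    QC (Rp A P θ) (Ee c) := by
  obtain ⟨h, hh⟩ := Ee_eq hc
  have hJ : IsJordanCurve (Ee c) := by rw [hh]; exact jordan_circle.image (mobHomeo h)
  have step : ∀ A P θ : ℂ, (c * A).im = 0 → (c * P).im = 0 → (c * Complex.exp θ).im = 0 → ∀ z ∈ Ee c, mobius (Mx A P θ) z ∈ Ee c := by
    intro A P θ hA hP hθ z hz
    rcases hz with rfl | ⟨w, hw, rfl⟩
    · rw [Mx_infty]; exact Or.inr ⟨A, hA, rfl⟩
    · by_cases hwP : w = P
      · subst hwP; rw [Mx_P]; exact Or.inl rfl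
      · rw [Mx_ofC _ _ _ _ hwP]
        refine Or.inr ⟨_, ?_, rfl⟩
        have re : ∀ x : ℂ, x.im = 0 → ∃ y : ℝ, x = y := fun x hx => ⟨x.re, by apply Complex.ext <;> simp [hx]⟩
        obtain ⟨a, ha⟩ := re _ hA
        obtain ⟨p, hp⟩ := re _ hP
        obtain ⟨b, hb⟩ := re _ hθ
        obtain ⟨v, hv⟩ := re _ hw
        have h1 : w - P ≠ 0 := sub_ne_zero.2 hwP
        have : c * (A - Complex.exp θ ^ 2 / (w - P)) = ((a - b ^ 2 / (v - p) : ℝ) : ℂ) := by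
          push_cast
          rw [← ha, ← hb, ← hv, ← hp, ← mul_sub]
          field_simp
        rw [this, Complex.ofReal_im]
  have hof : ∀ i, mobius (Mx (A i) (P i) (θ i)) '' Ee c = Ee c := by
    intro i
    refine subset_antisymm ?_ fun z hz => ?_
    · rintro _ ⟨z, hz, rfl⟩
      exact step _ _ _ (hA i) (hP i) (hθ i) z hz
    · refine ⟨mobius (Mx (A i) (P i) (θ i))⁻¹ z, ?_, mobius_mobius_inv _ _⟩
      rw [Mx_inv]
      refine step _ _ _ (hP i) (hA i) ?_ z hz
      rw [Complex.exp_add, Complex.exp_pi_mul_I]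
      have := hθ i
      simp only [mul_neg, mul_one, Complex.neg_im, this, neg_zero]
  have hinv : ∀ γ, mobius (Rp A P θ γ) '' Ee c = Ee c := by
    intro γ
    induction γ using FreeGroup.induction_on with
    | C1 => simp [mobius_one]
    | of i => rw [Rp_of]; exact hof i
    | inv_of i h =>
      conv_lhs => rw [← h]
      rw [map_inv, image_image]
      simp [mobius_inv_mobius]
    | mul x y hx hy =>
      have : mobius (Rp A P θ (x * y)) = mobius (Rp A P θ x) ∘ mobius (Rp A P θ y) := by
        funext z; rw [map_mul, mobius_mul]; rfl
      rw [this, image_comp, hy, hx]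
  refine ⟨hJ, hinv, ?_, fun z _ => ⟨univ, univ_mem, ?_⟩⟩
  · refine Lc_subset ?_ (fun γ z hz => ?_) ?_
    · rw [hh]
      exact (((isCompact_sphere (0:ℂ) 1).image continuous_ofC).image (continuous_mobius h)).isClosed
    · exact (hinv γ) ▸ mem_image_of_mem _ hz
    · exact ⟨infty, Or.inl rfl, ofC 0, Or.inr ⟨0, by simp, rfl⟩, (ofC_ne_infty 0).symm⟩
  · rw [inter_univ, hh]
    refine ((lipschitz_mobius h).lipschitzOnWith.hausdorffMeasure_image_le (d := 1) zero_le_one).trans_lt (ENNReal.mul_lt_top (by simp) ?_)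
    exact (lipschitz_ofC.lipschitzOnWith.hausdorffMeasure_image_le (d := 1) zero_le_one).trans_lt (ENNReal.mul_lt_top (by simp) (sphere_hm 0 1))

lemma ex_pos_fin {ι : Type*} [Finite ι] (f : ι → ℝ) (h : ∀ i, 0 < f i) : ∃ ε > 0, ∀ i, ε ≤ f i := by
  cases isEmpty_or_nonempty ι
  · exact ⟨1, one_pos, fun i => isEmptyElim i⟩
  · obtain ⟨i, hi⟩ := Finite.exists_min f
    exact ⟨f i, h i, hi⟩

theorem PP_of_discs (hk : 0 < k) {A P θ : Fin k → ℂ} {c : Fin k × Bool → ℂ} {r : Fin k × Bool → ℝ} (hr : ∀ s, 0 < r s)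
    (hd : ∀ s t, s ≠ t → r s + r t < dist (c s) (c t))
    (hA : ∀ i, ‖A i - c (i, true)‖ ≤ r (i, true)) (hP : ∀ i, ‖P i - c (i, false)‖ < r (i, false))
    (hm : ∀ i w, r (i, false) ≤ ‖w - c (i, false)‖ → ‖A i - Complex.exp (θ i) ^ 2 / (w - P i) - c (i, true)‖ ≤ r (i, true)) :
    PP (Rp A P θ) := by
  set a : Fin k × Bool → ℂ := fun s => if s.2 then A s.1 else P s.1 with ha
  have hac : ∀ s, ‖a s - c s‖ ≤ r s := by
    rintro ⟨i, b⟩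
    cases b
    · exact (hP i).le
    · exact hA i
  have hane : ∀ s t, s ≠ t → a s - a t ≠ 0 := by
    intro s t h e
    have h1 := hd s t h
    have h2 := hac s
    have h3 := hac t
    rw [sub_eq_zero] at e
    rw [e, ← dist_eq_norm] at h2
    rw [← dist_eq_norm] at h3
    have := dist_triangle_left (c s) (c t) (a t)
    linarith
  -- enlarged balls
  obtain ⟨ε, hε, hε'⟩ := ex_pos_fin (fun p : {p : (Fin k × Bool) × (Fin k × Bool) // p.1 ≠ p.2} => dist (c p.1.1) (c p.1.2) - (r p.1.1 + r p.1.2))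
    (fun p => by have := hd _ _ p.2; linarith)
  -- generic slope
  obtain ⟨σ, hσ⟩ : ∃ σ : ℝ, ∀ s t, s ≠ t → (((1:ℂ) + σ * Complex.I) * (a s - a t)).re ≠ 0 := by
    obtain ⟨σ, hσ⟩ := Infinite.exists_notMem_finset (Finset.univ.image fun p : (Fin k × Bool) × (Fin k × Bool) => (a p.1 - a p.2).re / (a p.1 - a p.2).im)
    refine ⟨σ, fun s t h e => ?_⟩
    have e' : (a s - a t).re = σ * (a s - a t).im := by
      simp [Complex.mul_re, Complex.sub_re, Complex.sub_im] at e ⊢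
      linarith
    by_cases h0 : (a s - a t).im = 0
    · rw [h0, mul_zero] at e'
      exact hane s t h (Complex.ext e' h0)
    · refine hσ (Finset.mem_image.2 ⟨(s, t), Finset.mem_univ _, ?_⟩)
      rw [div_eq_iff h0]; exact e'
  set c0 : ℂ := 1 + σ * Complex.I with hc0
  have hc0n : c0 ≠ 0 := by
    intro e; have := congrArg Complex.re e; simp [hc0] at this
  obtain ⟨δ, hδ, hδ'⟩ := ex_pos_fin (fun p : {p : (Fin k × Bool) × (Fin k × Bool) // p.1 ≠ p.2} => |(c0 * (a p.1.1 - a p.1.2)).re|)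
    (fun p => abs_pos.2 (hσ _ _ p.2))
  have hc0p : 0 < ‖c0‖ := norm_pos_iff.2 hc0n
  set ρ := δ / (2 * ‖c0‖) with hρd
  have hρ : 0 < ρ := by positivity
  obtain ⟨T, hT0, hT⟩ : ∃ T : ℝ, 0 ≤ T ∧ ∀ i, Real.exp ((θ i).re - T) < ρ := by
    have : ∀ i : Fin k, ∀ᶠ T : ℝ in atTop, Real.exp ((θ i).re - T) < ρ := by
      intro i
      have h1 : Tendsto (fun T : ℝ => Real.exp ((θ i).re - T)) atTop (𝓝 0) :=
        Real.tendsto_exp_atBot.comp (tendsto_atBot_add_const_left _ _ tendsto_neg_atTop_atBot)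
      exact h1.eventually (gt_mem_nhds hρ)
    obtain ⟨T, h1, h2⟩ := ((eventually_all.2 this).and (eventually_ge_atTop 0)).exists
    exact ⟨T, h2, h1⟩
  have hTn : ∀ i, ‖Complex.exp (θ i - T)‖ < ρ := fun i => by
    rw [Complex.norm_exp]; simpa using hT i
  -- stage 1
  have st1 := Rp_path hk (A := fun _ => A) (P := fun _ => P) (θ := fun t i => θ i - t * T) (by fun_prop) (by fun_prop) (by fun_prop) (by
    intro t ht
    refine ⟨_, Sch_balls (c := c) (r := fun s => r s + ε / 2) (fun s t h => ?_) (fun i => ?_) (fun i w hw => ?_)⟩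
    · refine Metric.ball_disjoint_ball ?_
      have := hε' ⟨(s, t), h⟩
      simp only at this
      linarith
    · rw [Rp_of, Mx_infty]
      refine mem_image_of_mem _ ?_
      rw [Metric.mem_ball, dist_eq_norm]
      have := hA i; linarith
    · rw [Metric.mem_ball, dist_eq_norm, not_lt] at hw
      have hwP : w ≠ P i := by
        rintro rfl; have := hP i; linarith
      rw [Rp_of, Mx_ofC _ _ _ _ hwP]
      refine mem_image_of_mem _ ?_
      rw [Metric.mem_ball, dist_eq_norm]
      have h1 := hm i w (by linarith)
      have h2 := hA i
      set q : ℝ := Real.exp (-(t * T)) ^ 2 with hq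
      have hq1 : q ≤ 1 := by
        have : Real.exp (-(t * T)) ≤ 1 := Real.exp_le_one_iff.2 (by have := mul_nonneg ht.1 hT0; linarith)
        exact pow_le_one₀ (Real.exp_pos _).le this
      have hq0 : 0 ≤ q := by positivity
      have e : A i - Complex.exp (θ i - t * T) ^ 2 / (w - P i) - c (i, true) =
          ((1 - q : ℝ) : ℂ) * (A i - c (i, true)) + (q : ℂ) * (A i - Complex.exp (θ i) ^ 2 / (w - P i) - c (i, true)) := by
        rw [sub_eq_add_neg (θ i), Complex.exp_add]
        have : Complex.exp (-(t * T : ℂ)) ^ 2 = (q : ℂ) := by rw [hq]; push_cast; rfl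
        rw [mul_pow, this]
        push_cast; ring
      rw [e]
      refine (norm_add_le _ _).trans_lt ?_
      rw [norm_mul, norm_mul, Complex.norm_real, Complex.norm_real, Real.norm_of_nonneg (by linarith), Real.norm_of_nonneg hq0]
      have : (1 - q) * ‖A i - c (i, true)‖ ≤ (1 - q) * r (i, true) := by gcongr
      have : q * ‖A i - Complex.exp (θ i) ^ 2 / (w - P i) - c (i, true)‖ ≤ q * r (i, true) := by gcongr
      nlinarith)
  -- stage 2
  set mv : ℝ → ℂ → ℂ := fun t z => z - t * (Complex.I * (c0 * z).im / c0) with hmv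
  have hmvc : ∀ t z, c0 * mv t z = (c0 * z).re + (1 - t) * (c0 * z).im * Complex.I := by
    intro t z
    simp only [hmv]
    have := Complex.re_add_im (c0 * z)
    rw [mul_sub, ← this]
    simp only [Complex.add_im, Complex.ofReal_im, Complex.mul_im, Complex.ofReal_re, Complex.I_re, Complex.I_im]
    field_simp
    simp
    ring
  have st2 := Rp_path hk (A := fun t i => mv t (A i)) (P := fun t i => mv t (P i)) (θ := fun t i => θ i - T - t * (Complex.I * (Complex.log c0 + θ i).im))
    (by simp only [hmv]; fun_prop) (by simp only [hmv]; fun_prop) (by fun_prop) (by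
    intro t ht
    have hnorm : ∀ i, ‖Complex.exp (θ i - T - t * (Complex.I * (Complex.log c0 + θ i).im))‖ < ρ := by
      intro i
      have := hTn i
      rw [Complex.norm_exp] at this ⊢
      simpa using this
    refine ⟨_, Sch_balls (c := fun s => mv t (a s)) (r := fun _ => ρ) (fun s u h => ?_) (fun i => ?_) (fun i w hw => ?_)⟩
    · refine Metric.ball_disjoint_ball ?_
      have h1 := hδ' ⟨(s, u), h⟩
      simp only at h1
      have h2 : (c0 * (mv t (a s) - mv t (a u))).re = (c0 * (a s - a u)).re := by
        rw [mul_sub, hmvc, hmvc, mul_sub]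
        simp
      have h3 := Complex.abs_re_le_norm (c0 * (mv t (a s) - mv t (a u)))
      rw [h2, norm_mul] at h3
      rw [dist_eq_norm, hρd]
      have h4 : δ ≤ ‖c0‖ * ‖mv t (a s) - mv t (a u)‖ := h1.trans h3
      calc δ / (2 * ‖c0‖) + δ / (2 * ‖c0‖) = δ / ‖c0‖ := by field_simp; norm_num
        _ ≤ _ := by rw [div_le_iff₀ hc0p]; linarith
    · rw [Rp_of, Mx_infty]
      refine mem_image_of_mem _ ?_
      simpa [ha] using hρ
    · rw [Metric.mem_ball, dist_eq_norm, not_lt] at hw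
      have hw' : ρ ≤ ‖w - mv t (P i)‖ := by simpa [ha] using hw
      have hwP : w ≠ mv t (P i) := by
        intro e; rw [e, sub_self, norm_zero] at hw'; linarith
      rw [Rp_of, Mx_ofC _ _ _ _ hwP]
      refine mem_image_of_mem _ ?_
      rw [Metric.mem_ball, dist_eq_norm]
      have e : ∀ x : ℂ, mv t (A i) - x - mv t (a (i, true)) = -x := fun x => by simp [ha]
      rw [e, norm_neg, norm_div, norm_pow, div_lt_iff₀ (by linarith)]
      have := hnorm i
      have h0 := norm_nonneg (Complex.exp (θ i - T - t * (Complex.I * (Complex.log c0 + θ i).im)))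
      nlinarith)
  have hend : PP (Rp (fun i => mv 1 (A i)) (fun i => mv 1 (P i)) (fun i => θ i - T - (1:ℝ) * (Complex.I * (Complex.log c0 + θ i).im))) := by
    refine ⟨_, Ee_QC hc0n (fun i => ?_) (fun i => ?_) (fun i => ?_)⟩
    · rw [hmvc]; simp
    · rw [hmvc]; simp
    · rw [← Complex.exp_log hc0n, ← Complex.exp_add, Complex.exp_log hc0n, Complex.exp_im]
      simp
  simp only [Complex.ofReal_zero, Complex.ofReal_one, zero_mul, sub_zero, one_mul] at st1 st2 hend
  have hm0 : ∀ z, mv 0 z = z := fun z => by simp [hmv]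
  simp only [hm0] at st2
  exact st1.2 (st2.2 hend)

end Rep12

/-! ### classical Schottky data carry invariant curves -/
section Rep13

lemma QC_conj {G : Type*} [Group G] {R R' : G →* SL2C} (h : SL2C) (e : ∀ γ, R' γ = h * R γ * h⁻¹) {η : Set RSphere} (hη : QC R η) :
    QC R' (mobius h '' η) := by
  have key : ∀ (R R' : G →* SL2C) (h : SL2C), (∀ γ, R' γ = h * R γ * h⁻¹) → ∀ z ∈ Lc R, mobius h z ∈ Lc R' := by
    intro R R' h e z hz ε hε
    have hm := one_le_mn h
    obtain ⟨γ, hγ⟩ := hz (ε / (mn h ^ 2)) (by positivity)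
    refine ⟨γ, ?_⟩
    rw [e, Nn_mul, mobius_inv_mobius, Nn_mul]
    rw [lt_div_iff₀ (by positivity)] at hγ
    refine lt_of_le_of_lt ?_ hγ
    have h1 := Nn_le_mn h (mobius (R γ) z)
    have h2 := Nn_le_mn h⁻¹ (mobius h z)
    rw [mn_inv] at h2
    have h3 := (Nn_pos (R γ) z).le
    have h4 := (Nn_pos h⁻¹ (mobius h z)).le
    calc _ ≤ mn h * Nn (R γ) z * mn h := by gcongr
      _ = _ := by ring
  have hL : Lc R' = mobius h '' Lc R := by
    refine subset_antisymm (fun z hz => ⟨mobius h⁻¹ z, key R' R h⁻¹ (fun γ => ?_) z hz, mobius_mobius_inv _ _⟩) ?_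
    · rintro _ ⟨z, hz, rfl⟩; exact key R R' h e z hz
    · rw [e]; group
  refine ⟨hη.jor.image (mobHomeo h), fun γ => ?_, ?_, fun z hz => ?_⟩
  · conv_rhs => rw [← hη.inv γ]
    simp only [image_image, e, mobius_mul, mobius_inv_mobius]
  · rw [hL]; exact image_mono hη.sub
  · obtain ⟨z, rfl⟩ := (mobHomeo h).surjective z
    refine LocF_transport (mobHomeo h) (LL_mobius h z) (hη.loc z fun h' => hz ?_)
    rw [hL]; exact mem_image_of_mem _ h'

lemma conn_ofC {s : Set ℂ} (h : Convex ℝ s) : IsPreconnected (ofC '' s) :=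
  h.isPreconnected.image _ continuous_ofC.continuousOn

instance : PreconnectedSpace RSphere := by
  refine ⟨(conn_ofC convex_univ).subset_closure (subset_univ _) fun z _ => ?_⟩
  rcases RSphere.cases' z with rfl | ⟨w, rfl⟩
  · refine Metric.mem_closure_iff.2 fun ε hε => ?_
    obtain ⟨w, hw, hd⟩ := perfect_pt infty hε
    rcases RSphere.cases' w with rfl | ⟨w, rfl⟩
    · exact (hw rfl).elim
    · exact ⟨_, ⟨w, mem_univ _, rfl⟩, hd⟩
  · exact subset_closure ⟨w, mem_univ _, rfl⟩

lemma circ_alg {N d : ℝ} {e : ℂ} (hN : N ≠ 0) (hd : 0 < ‖e‖ ^ 2 - N * d) :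
    ∃ (c : ℂ) (r : ℝ), 0 < r ∧ ∀ w : ℂ, w ∈ Metric.sphere c r ↔ N * ‖w‖ ^ 2 - 2 * (e * w).re + d = 0 := by
  refine ⟨(starRingEnd ℂ) e / N, Real.sqrt (‖e‖ ^ 2 - N * d) / |N|, by positivity, fun w => ?_⟩
  rw [mem_sphere_iff_norm, ← sq_eq_sq₀ (norm_nonneg _) (by positivity), div_pow, Real.sq_sqrt hd.le, sq_abs]
  have h1 : ‖w - (starRingEnd ℂ) e / N‖ ^ 2 = ‖w‖ ^ 2 - 2 * (e * w).re / N + ‖e‖ ^ 2 / N ^ 2 := by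
    have : ((N:ℝ):ℂ) = (N : ℂ) := rfl
    have h2 : (starRingEnd ℂ) e / N = ((e.re / N : ℝ) : ℂ) - ((e.im / N : ℝ) : ℂ) * Complex.I := by
      apply Complex.ext <;> simp [neg_div]
    rw [h2]
    simp only [Complex.sq_norm, Complex.normSq_apply, Complex.sub_re, Complex.sub_im, Complex.mul_re, Complex.mul_im, Complex.ofReal_re, Complex.ofReal_im, Complex.I_re, Complex.I_im]
    field_simp
    ring
  rw [h1]
  have hN2 : N ^ 2 ≠ 0 := pow_ne_zero _ hN
  constructor
  · intro h
    field_simp at h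
    have h3 : N * (N * ‖w‖ ^ 2 - 2 * (e * w).re + d) = 0 := by nlinarith
    exact (mul_eq_zero.1 h3).resolve_left hN
  · intro h
    field_simp
    linear_combination N * h

lemma round_image {C : Set RSphere} (hC : IsRoundCircle C) {q : ℂ} (hq : ofC q ∉ C) :
    ∃ (c : ℂ) (r : ℝ), 0 < r ∧ mobius (Mx 0 q 0) '' C = ofC '' Metric.sphere c r := by
  set h := Mx 0 q 0 with hh
  have h0 : mobius h⁻¹ infty = ofC q := by rw [hh, Mx_inv, Mx_infty]
  have h1 : mobius h⁻¹ (ofC 0) = infty := by rw [hh, Mx_inv, Mx_P]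
  have h2 : ∀ w, w ≠ 0 → mobius h⁻¹ (ofC w) = ofC (q - 1 / w) := by
    intro w hw
    rw [hh, Mx_inv, Mx_ofC _ _ _ _ hw, zero_add, Complex.exp_pi_mul_I]; simp
  suffices hs : ∃ (c : ℂ) (r : ℝ), 0 < r ∧ ∀ w, (w ∈ Metric.sphere c r ↔ mobius h⁻¹ (ofC w) ∈ C) by
    obtain ⟨c, r, hr, hw⟩ := hs
    refine ⟨c, r, hr, ?_⟩
    ext y
    have : y ∈ mobius h '' C ↔ mobius h⁻¹ y ∈ C :=
      ⟨by rintro ⟨z, hz, rfl⟩; rwa [mobius_inv_mobius], fun hy => ⟨_, hy, mobius_mobius_inv _ _⟩⟩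
    rw [this]
    rcases RSphere.cases' y with rfl | ⟨w, rfl⟩
    · rw [h0]
      exact ⟨fun h' => (hq h').elim, by rintro ⟨w, _, e⟩; exact (ofC_ne_infty w e).elim⟩
    · rw [← hw, ofC_injective.mem_set_image]
  rcases hC with ⟨c, r, hr, rfl⟩ | ⟨a, v, hv, rfl⟩
  · rw [ofC_injective.mem_set_image, mem_sphere_iff_norm] at hq
    set e := q - c
    have hN : ‖e‖ ^ 2 - r ^ 2 ≠ 0 := by
      intro h'
      exact hq ((sq_eq_sq₀ (norm_nonneg _) hr.le).1 (by linarith))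
    obtain ⟨c', r', hr', h3⟩ := circ_alg (N := ‖e‖ ^ 2 - r ^ 2) (d := 1) (e := e) hN (by nlinarith)
    refine ⟨c', r', hr', fun w => ?_⟩
    rw [h3]
    by_cases hw : w = 0
    · subst hw
      rw [h1]
      simp only [norm_zero, mul_zero, Complex.zero_re]
      exact ⟨fun h' => by norm_num at h', by rintro ⟨w, _, e⟩; exact (ofC_ne_infty w e).elim⟩
    · rw [h2 w hw, ofC_injective.mem_set_image, mem_sphere_iff_norm]
      have e1 : q - 1 / w - c = (e * w - 1) / w := by field_simp; simp only [e]; ring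
      have hwp : 0 < ‖w‖ := norm_pos_iff.2 hw
      rw [e1, norm_div, div_eq_iff hwp.ne', ← sq_eq_sq₀ (norm_nonneg _) (by positivity)]
      have e2 : ‖e * w - 1‖ ^ 2 = ‖e‖ ^ 2 * ‖w‖ ^ 2 - 2 * (e * w).re + 1 := by
        simp only [Complex.sq_norm, Complex.normSq_apply, Complex.sub_re, Complex.sub_im, Complex.mul_re, Complex.mul_im, Complex.one_re, Complex.one_im]
        ring
      rw [e2]
      constructor <;> intro h' <;> nlinarith
  · have hline : ∀ z, ofC z ∈ insert infty (ofC '' {z | ∃ t : ℝ, z = a + t • v}) ↔ ((starRingEnd ℂ) v * (z - a)).im = 0 := by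
      intro z
      rw [mem_insert_iff, ofC_injective.mem_set_image]
      simp only [ofC_ne_infty, false_or, mem_setOf_eq]
      constructor
      · rintro ⟨t, rfl⟩
        simp; ring
      · intro h'
        have hvn : v.re ^ 2 + v.im ^ 2 ≠ 0 := by
          intro h0
          apply hv
          apply Complex.ext <;> simp <;> nlinarith [sq_nonneg v.re, sq_nonneg v.im]
        refine ⟨((starRingEnd ℂ) v * (z - a)).re / (v.re ^ 2 + v.im ^ 2), ?_⟩
        simp at h'
        apply Complex.ext
        · rw [Complex.add_re, Complex.smul_re]
          simp
          field_simp
          linear_combination (-v.im) * h'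
        · rw [Complex.add_im, Complex.smul_im]
          simp
          field_simp
          linear_combination v.re * h'
    set κ := ((starRingEnd ℂ) v * (q - a)).im with hκ
    have hκ0 : κ ≠ 0 := fun h' => hq ((hline q).2 h')
    have hvp : 0 < ‖v‖ := norm_pos_iff.2 hv
    obtain ⟨c', r', hr', h3⟩ := circ_alg (N := κ) (d := 0) (e := Complex.I * v / 2) hκ0 (by simp; positivity)
    refine ⟨c', r', hr', fun w => ?_⟩
    rw [h3]
    by_cases hw : w = 0
    · subst hw
      rw [h1]; simp
    · rw [h2 w hw, hline]
      have hwp : 0 < ‖w‖ := norm_pos_iff.2 hw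
      have e1 : (starRingEnd ℂ) v * (q - 1 / w - a) = (starRingEnd ℂ) v * (q - a) - (starRingEnd ℂ) v / w := by ring
      have e2 : ((starRingEnd ℂ) v / w).im = - (v * w).im / ‖w‖ ^ 2 := by
        rw [Complex.div_im, Complex.sq_norm]
        simp
        ring
      have e3 : (Complex.I * v / 2 * w).re = - (v * w).im / 2 := by
        have : Complex.I * v / 2 * w = (Complex.I * (v * w)) / 2 := by ring
        rw [this]; simp
      rw [e1, Complex.sub_im, ← hκ, e2, e3]
      constructor
      · intro h'; field_simp; linarith
      · intro h'; field_simp at h'; linarith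

lemma ext_disc {c : ℂ} {r : ℝ} (hr : 0 < r) : (ofC '' Metric.closedBall c r)ᶜ = mobius (Mx c 0 0) '' (ofC '' Metric.ball 0 (1 / r)) := by
  ext y
  constructor
  · intro hy
    rcases RSphere.cases' y with rfl | ⟨w, rfl⟩
    · exact ⟨_, ⟨0, by simpa using hr, rfl⟩, Mx_P _ _ _⟩
    · rw [mem_compl_iff, ofC_injective.mem_set_image, mem_closedBall_iff_norm, not_le] at hy
      have h0 : c - w ≠ 0 := by rw [← norm_pos_iff, norm_sub_rev]; linarith
      refine ⟨_, ⟨1 / (c - w), ?_, rfl⟩, ?_⟩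
      · rw [mem_ball_zero_iff, norm_div, norm_one, norm_sub_rev]
        exact one_div_lt_one_div_of_lt hr hy
      · rw [Mx_ofC _ _ _ _ (one_div_ne_zero h0)]; simp
  · rintro ⟨_, ⟨w, hw, rfl⟩, rfl⟩
    by_cases h0 : w = 0
    · subst h0; rw [Mx_P]; rintro ⟨w, _, e⟩; exact ofC_ne_infty w e
    · rw [Mx_ofC _ _ _ _ h0, mem_compl_iff, ofC_injective.mem_set_image, mem_closedBall_iff_norm, not_le]
      rw [mem_ball_zero_iff] at hw
      have : ‖c - Complex.exp 0 ^ 2 / (w - 0) - c‖ = 1 / ‖w‖ := by simp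
      rw [this]
      have hwp : 0 < ‖w‖ := norm_pos_iff.2 h0
      rw [lt_div_iff₀ hr] at hw
      rw [lt_div_iff₀ hwp]; linarith

lemma ext_conn {c : ℂ} {r : ℝ} (hr : 0 < r) : IsPreconnected (ofC '' Metric.closedBall c r)ᶜ := by
  rw [ext_disc hr]
  exact (conn_ofC (convex_ball _ _)).image _ (continuous_mobius _).continuousOn

lemma subset_or_disj {U T : Set RSphere} (hT : IsPreconnected T) (h : Disjoint T (frontier U)) : T ⊆ U ∨ Disjoint T U := by
  have hcov : T ⊆ interior U ∪ (closure U)ᶜ := by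
    intro x hx
    by_cases h1 : x ∈ interior U
    · exact Or.inl h1
    · exact Or.inr fun h2 => Set.disjoint_left.1 h hx ⟨h2, h1⟩
  have hd : Disjoint (interior U) (closure U)ᶜ :=
    Set.disjoint_left.2 fun x hx hx' => hx' (subset_closure (interior_subset hx))
  rcases hT.subset_or_subset isOpen_interior isClosed_closure.isOpen_compl hd hcov with h1 | h1
  · exact Or.inl (h1.trans interior_subset)
  · exact Or.inr (Set.disjoint_left.2 fun x hx hx' => h1 hx (subset_closure hx'))

lemma sphere_split (c : ℂ) {r : ℝ} (z : RSphere) : z ∈ ofC '' Metric.ball c r ∨ z ∈ ofC '' Metric.sphere c r ∨ z ∈ (ofC '' Metric.closedBall c r)ᶜ := by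
  by_cases h : z ∈ ofC '' Metric.closedBall c r
  · obtain ⟨w, hw, rfl⟩ := h
    rw [← Metric.ball_union_sphere] at hw
    rcases hw with hw | hw
    · exact Or.inl ⟨w, hw, rfl⟩
    · exact Or.inr (Or.inl ⟨w, hw, rfl⟩)
  · exact Or.inr (Or.inr h)

lemma open_disc_cases {U : Set RSphere} (hU : IsOpen U) (hne : U.Nonempty) {c : ℂ} {r : ℝ} (hr : 0 < r) (hf : frontier U = ofC '' Metric.sphere c r) :
    (infty ∉ U → U = ofC '' Metric.ball c r) ∧ (Disjoint (ofC '' Metric.ball c r) U → U = (ofC '' Metric.closedBall c r)ᶜ) := by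
  have d0 : Disjoint U (frontier U) := by
    rw [disjoint_comm, hU.frontier_eq]; exact disjoint_sdiff_left
  have d1 : Disjoint (ofC '' Metric.ball c r) (frontier U) := by
    rw [hf, disjoint_image_iff ofC_injective]; exact Metric.sphere_disjoint_ball.symm
  have d2 : Disjoint (ofC '' Metric.closedBall c r)ᶜ (frontier U) := by
    rw [hf, Set.disjoint_compl_left_iff_subset]; exact image_mono Metric.sphere_subset_closedBall
  have h1 := subset_or_disj (conn_ofC (convex_ball c r)) d1
  have h2 := subset_or_disj (ext_conn hr) d2
  have hsp : ∀ z ∈ U, z ∉ ofC '' Metric.sphere c r := fun z hz h' => Set.disjoint_left.1 d0 hz (hf ▸ h')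
  constructor
  · intro hi
    have h3 : Disjoint (ofC '' Metric.closedBall c r)ᶜ U := by
      refine h2.resolve_left fun h' => hi (h' ?_)
      rintro ⟨w, _, e⟩; exact ofC_ne_infty w e
    have h4 : U ⊆ ofC '' Metric.ball c r := fun z hz =>
      (sphere_split c z).resolve_right fun h' => h'.elim (hsp z hz) fun h'' => Set.disjoint_left.1 h3 h'' hz
    refine subset_antisymm h4 (h1.resolve_right fun h5 => ?_)
    obtain ⟨z, hz⟩ := hne
    exact Set.disjoint_left.1 h5 (h4 hz) hz
  · intro h3
    have h4 : U ⊆ (ofC '' Metric.closedBall c r)ᶜ := fun z hz => by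
      rcases sphere_split c z with h' | h' | h'
      · exact (Set.disjoint_left.1 h3 h' hz).elim
      · exact (hsp z hz h').elim
      · exact h'
    refine subset_antisymm h4 (h2.resolve_right fun h5 => ?_)
    obtain ⟨z, hz⟩ := hne
    exact Set.disjoint_left.1 h5 (h4 hz) hz

end Rep13

section Rep14

lemma ofC_of_mobius_infty {g : SL2C} {w : ℂ} (h : mobius g infty = ofC w) : g.1 1 0 ≠ 0 := by
  intro h0
  have h1 : mobius g infty = if g.1 1 0 = 0 then RSphere.infty else RSphere.ofC (g.1 0 0 / g.1 1 0) := rfl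
  rw [h1, if_pos h0] at h
  exact ofC_ne_infty _ h.symm

lemma classical_point {k : ℕ} (hk : 0 < k) (S : SchottkyData k) : ∃ q : ℂ, ∀ s, ofC q ∉ closure (S.D s) := by
  have hcl : IsClosed (⋃ s, closure (S.D s)) := isClosed_iUnion_of_finite fun s => isClosed_closure
  have hne : (⋃ s, closure (S.D s)) ≠ univ := by
    intro h
    set s0 : Fin k ⊕ Fin k := Sum.inl ⟨0, hk⟩
    set s1 : Fin k ⊕ Fin k := Sum.inr ⟨0, hk⟩
    have h01 : s0 ≠ s1 := by simp [s0, s1]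
    have hc : IsClopen (closure (S.D s0)) := by
      refine ⟨isClosed_closure, ?_⟩
      have : closure (S.D s0) = (⋃ s : {s // s ≠ s0}, closure (S.D s))ᶜ := by
        ext z
        rw [mem_compl_iff, mem_iUnion]
        constructor
        · rintro hz ⟨⟨s, hs⟩, hz'⟩
          have := S.disjointClosures s s0 hs
          exact (this ▸ (⟨hz', hz⟩ : z ∈ closure (S.D s) ∩ closure (S.D s0)) : z ∈ (∅ : Set RSphere))
        · intro hz
          have : z ∈ ⋃ s, closure (S.D s) := h ▸ mem_univ z
          obtain ⟨s, hs⟩ := mem_iUnion.1 this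
          by_cases e : s = s0
          · exact e ▸ hs
          · exact (hz ⟨⟨s, e⟩, hs⟩).elim
      rw [this]
      exact (isClosed_iUnion_of_finite fun s => isClosed_closure).isOpen_compl
    rcases isClopen_iff.1 hc with h2 | h2
    · obtain ⟨z, hz⟩ := S.nonempty s0
      exact (h2 ▸ subset_closure hz : z ∈ (∅ : Set RSphere))
    · obtain ⟨z, hz⟩ := S.nonempty s1
      have := S.disjointClosures s0 s1 h01
      rw [h2, univ_inter] at this
      exact (this ▸ subset_closure hz : z ∈ (∅ : Set RSphere))
  obtain ⟨z, hz⟩ := (ne_univ_iff_exists_notMem _).1 hne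
  have key : ∃ q : ℂ, ofC q ∉ ⋃ s, closure (S.D s) := by
    rcases RSphere.cases' z with rfl | ⟨w, rfl⟩
    · obtain ⟨ε, hε, hb⟩ := Metric.isOpen_iff.1 hcl.isOpen_compl infty hz
      obtain ⟨w, hw, hd⟩ := perfect_pt infty hε
      rcases RSphere.cases' w with rfl | ⟨w, rfl⟩
      · exact (hw rfl).elim
      · exact ⟨w, hb (by rw [Metric.mem_ball, dist_comm]; exact hd)⟩
    · exact ⟨w, hz⟩
  obtain ⟨q, hq⟩ := key
  exact ⟨q, fun s hs => hq (mem_iUnion.2 ⟨s, hs⟩)⟩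

theorem PP_classical {k : ℕ} (hk : 0 < k) (S : SchottkyData k) (hS : S.IsClassical) : PP (FreeGroup.lift S.gen) := by
  have hinj : ∀ g, Function.Injective (mobius g) := fun g => (mobHomeo g).injective
  obtain ⟨q, hq⟩ := classical_point hk S
  set h := Mx 0 q 0 with hh
  have hq' : ∀ s, ofC q ∉ frontier (S.D s) := fun s h' => hq s (frontier_subset_closure h')
  choose c r hr hfr using fun s => round_image (hS s) (hq' s)
  rw [← hh] at hfr
  have hi : mobius h (ofC q) = infty := Mx_P _ _ _
  have hfr' : ∀ s, frontier (mobius h '' S.D s) = ofC '' Metric.sphere (c s) (r s) := fun s => by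
    rw [← hfr]; exact ((mobHomeo h).image_frontier _).symm
  have hop : ∀ s, IsOpen (mobius h '' S.D s) := fun s => (mobHomeo h).isOpenMap _ (S.isOpen s)
  have hball : ∀ s, mobius h '' S.D s = ofC '' Metric.ball (c s) (r s) := fun s => by
    refine (open_disc_cases (hop s) ((S.nonempty s).image _) (hr s) (hfr' s)).1 ?_
    rintro ⟨z, hz, e⟩
    rw [← hi] at e
    exact hq s (subset_closure (mobius_inj h e ▸ hz))
  have hcb : ∀ s, mobius h '' closure (S.D s) = ofC '' Metric.closedBall (c s) (r s) := fun s => by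
    rw [closure_eq_self_union_frontier, image_union, hball, hfr, ← image_union, Metric.ball_union_sphere]
  have hdis : ∀ s t, s ≠ t → r s + r t < dist (c s) (c t) := fun s t hst => by
    rw [← disjoint_closedBall_closedBall_iff (hr s).le (hr t).le, ← disjoint_image_iff ofC_injective, ← hcb, ← hcb,
      disjoint_image_iff (hinj h), Set.disjoint_iff_inter_eq_empty]
    exact S.disjointClosures s t hst
  have hg : ∀ i, mobius (h * S.gen i * h⁻¹) '' (ofC '' Metric.ball (c (Sum.inl i)) (r (Sum.inl i))) =
      (ofC '' Metric.closedBall (c (Sum.inr i)) (r (Sum.inr i)))ᶜ := fun i => by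
    have e : mobius (h * S.gen i * h⁻¹) '' (ofC '' Metric.ball (c (Sum.inl i)) (r (Sum.inl i))) =
        mobius h '' (mobius (S.gen i) '' S.D (Sum.inl i)) := by
      rw [← hball]; simp only [image_image, mobius_mul, mobius_inv_mobius]
    rw [e]
    refine (open_disc_cases ?_ (((S.nonempty _).image _).image _) (hr _) ?_).2 ?_
    · exact (mobHomeo h).isOpenMap _ ((mobHomeo (S.gen i)).isOpenMap _ (S.isOpen _))
    · have h1 : frontier (mobius h '' (mobius (S.gen i) '' S.D (Sum.inl i))) = mobius h '' (mobius (S.gen i) '' frontier (S.D (Sum.inl i))) :=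
        ((mobHomeo h).image_frontier _).symm.trans (congrArg _ ((mobHomeo (S.gen i)).image_frontier _).symm)
      rw [h1, S.maps_boundary, hfr]
    · rw [← hball, disjoint_image_iff (hinj h), disjoint_comm, Set.disjoint_iff_inter_eq_empty]
      exact S.maps_off i
  have hg' : ∀ i z, z ∉ ofC '' Metric.ball (c (Sum.inl i)) (r (Sum.inl i)) →
      mobius (h * S.gen i * h⁻¹) z ∈ ofC '' Metric.closedBall (c (Sum.inr i)) (r (Sum.inr i)) := fun i z hz => by
    by_contra hc
    rw [← mem_compl_iff, ← hg, (hinj (h * S.gen i * h⁻¹)).mem_set_image] at hc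
    exact hz hc
  have hinf : ∀ i, infty ∉ ofC '' Metric.ball (c (Sum.inl i)) (r (Sum.inl i)) := by
    rintro i ⟨w, _, e⟩; exact ofC_ne_infty _ e
  have hM : ∀ i, ∃ A P θ, h * S.gen i * h⁻¹ = Mx A P θ := fun i => by
    obtain ⟨w, _, e⟩ := hg' i infty (hinf i)
    exact exists_Mx _ (ofC_of_mobius_infty e.symm)
  choose A P θ hM using hM
  have hPb : ∀ i, P i ∈ Metric.ball (c (Sum.inl i)) (r (Sum.inl i)) := fun i => by
    by_contra hc
    obtain ⟨w, _, e⟩ := hg' i (ofC (P i)) (by rwa [ofC_injective.mem_set_image])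
    rw [hM, Mx_P] at e
    exact ofC_ne_infty _ e
  let τ : Fin k × Bool → Fin k ⊕ Fin k := fun s => if s.2 then Sum.inr s.1 else Sum.inl s.1
  have hτ : Function.Injective τ := by
    rintro ⟨i, b⟩ ⟨j, b'⟩ e
    cases b <;> cases b' <;> simp_all [τ]
  have hP : PP (Rp A P θ) := by
    refine PP_of_discs hk (c := fun s => c (τ s)) (r := fun s => r (τ s)) (fun s => hr _) (fun s t hst => hdis _ _ (hτ.ne hst)) ?_ ?_ ?_
    · intro i
      have := hg' i infty (hinf i)
      rw [hM, Mx_infty, ofC_injective.mem_set_image, mem_closedBall_iff_norm] at this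
      exact this
    · intro i
      exact mem_ball_iff_norm.1 (hPb i)
    · intro i w hw
      have hw' : w ∉ Metric.ball (c (Sum.inl i)) (r (Sum.inl i)) := fun h' => absurd (mem_ball_iff_norm.1 h') (not_lt.2 hw)
      have := hg' i (ofC w) (by rwa [ofC_injective.mem_set_image])
      rw [hM, Mx_ofC _ _ _ _ (fun e : w = P i => hw' (by rw [e]; exact hPb i)), ofC_injective.mem_set_image, mem_closedBall_iff_norm] at this
      exact this
  obtain ⟨η, hη⟩ := hP
  refine ⟨_, QC_conj (R' := FreeGroup.lift S.gen) h⁻¹ (fun γ => ?_) hη⟩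
  have : (FreeGroup.lift S.gen) = (MulAut.conj h⁻¹).toMonoidHom.comp (Rp A P θ) := by
    ext1 i
    simp only [FreeGroup.lift_apply_of, MonoidHom.comp_apply, Rp_of, MulEquiv.coe_toMonoidHom, MulAut.conj_apply, ← hM]
    group
  rw [this]; simp

end Rep14

section Rep15

lemma act_neg (g : SL2C) (u : V2) : act (-g) u = -act g u := by
  ext <;> simp [act] <;> ring

lemma act_ext {g h : SL2C} (e : ∀ u, act g u = act h u) : g = h := by
  have h1 := e (1, 0)
  have h2 := e (0, 1)
  simp only [act, Prod.mk.injEq, mul_one, mul_zero, add_zero, zero_add] at h1 h2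
  ext i j
  fin_cases i <;> fin_cases j
  · exact h1.1
  · exact h2.1
  · exact h1.2
  · exact h2.2

lemma pr_neg (u : V2) : pr (-u) = pr u := by
  have := pr_smul (c := -1) (by norm_num) u
  simpa using this

lemma mobius_neg (g : SL2C) : mobius (-g) = mobius g := by
  funext z; rw [mobius_eq, act_neg, pr_neg, ← mobius_eq]

lemma Nn_neg (g : SL2C) (z : RSphere) : Nn (-g) z = Nn g z := by
  unfold Nn; rw [act_neg, norm_neg]

lemma psl_eq {a b : SL2C} (h : (a : PSL2C) = (b : PSL2C)) : a = b ∨ a = -b := by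
  rw [QuotientGroup.eq, Matrix.SpecialLinearGroup.mem_center_iff] at h
  obtain ⟨r, hr, he⟩ := h
  have hr2 : r = 1 ∨ r = -1 := by
    rw [Fintype.card_fin] at hr
    exact sq_eq_one_iff.1 hr
  have hb : ∀ u, act b u = r • act a u := by
    intro u
    have e : b = a * (a⁻¹ * b) := by group
    rw [e, act_mul]
    have : act (a⁻¹ * b) u = r • u := by
      unfold act
      rw [← he]
      ext <;> simp
    rw [this, act_smul]
  rcases hr2 with rfl | rfl
  · left; exact act_ext fun u => by rw [hb, one_smul]
  · right; exact act_ext fun u => by rw [act_neg, hb]; simp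

lemma psl_neg (a : SL2C) : ((-a : SL2C) : PSL2C) = (a : PSL2C) := by
  rw [QuotientGroup.eq, Matrix.SpecialLinearGroup.mem_center_iff]
  refine ⟨-1, by simp, ?_⟩
  have : (-a)⁻¹ * a = -1 := by
    rw [inv_mul_eq_iff_eq_mul]; simp
  rw [this]
  ext i j
  fin_cases i <;> fin_cases j <;> simp

lemma psl_mobius {a b : SL2C} (h : (a : PSL2C) = (b : PSL2C)) : mobius a = mobius b := by
  rcases psl_eq h with rfl | rfl
  · rfl
  · exact mobius_neg _

lemma psl_Nn {a b : SL2C} (h : (a : PSL2C) = (b : PSL2C)) (z : RSphere) : Nn a z = Nn b z := by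
  rcases psl_eq h with rfl | rfl
  · rfl
  · exact Nn_neg _ _

variable {G : Type*} [Group G] {G' : Type*} [Group G']

def Img (R : G →* SL2C) (Γ : Subgroup PSL2C) : Prop := ∀ a : SL2C, (a : PSL2C) ∈ Γ ↔ ∃ γ, (a : PSL2C) = ((R γ : SL2C) : PSL2C)

lemma Img_lift {k : ℕ} (f : Fin k → SL2C) : Img (FreeGroup.lift f) (groupOfGens f) := by
  intro a
  have h1 : groupOfGens f = ((QuotientGroup.mk' (Subgroup.center SL2C)).comp (FreeGroup.lift f)).range := by
    have : (QuotientGroup.mk' (Subgroup.center SL2C)).comp (FreeGroup.lift f) = FreeGroup.lift (fun i => ((f i : SL2C) : PSL2C)) := by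
      ext i; simp
    rw [this, FreeGroup.range_lift_eq_closure]; rfl
  rw [h1]
  constructor
  · rintro ⟨γ, h⟩; exact ⟨γ, h.symm⟩
  · rintro ⟨γ, h⟩; exact ⟨γ, h.symm⟩

lemma Img.Lc_le {R : G →* SL2C} {R' : G' →* SL2C} {Γ : Subgroup PSL2C} (h : Img R Γ) (h' : Img R' Γ) : Lc R ⊆ Lc R' := by
  intro z hz ε hε
  obtain ⟨γ, hγ⟩ := hz ε hε
  obtain ⟨γ', e⟩ := (h' (R γ)).1 ((h _).2 ⟨γ, rfl⟩)
  exact ⟨γ', by rwa [← psl_Nn e]⟩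

lemma Img.Lc_eq {R : G →* SL2C} {R' : G' →* SL2C} {Γ : Subgroup PSL2C} (h : Img R Γ) (h' : Img R' Γ) : Lc R = Lc R' :=
  subset_antisymm (h.Lc_le h') (h'.Lc_le h)

lemma Img.QC {R : G →* SL2C} {R' : G' →* SL2C} {Γ : Subgroup PSL2C} (h : Img R Γ) (h' : Img R' Γ) {η : Set RSphere} (hη : QC R η) : QC R' η := by
  refine ⟨hη.jor, fun γ => ?_, ?_, fun z hz => ?_⟩
  · obtain ⟨γ', e⟩ := (h (R' γ)).1 ((h' _).2 ⟨γ, rfl⟩)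
    rw [psl_mobius e]; exact hη.inv _
  · rw [← h.Lc_eq h']; exact hη.sub
  · exact hη.loc z (by rwa [h.Lc_eq h'])

lemma Img.orbit {R : G →* SL2C} {Γ : Subgroup PSL2C} (h : Img R Γ) (z : RSphere) (γ : G) : mobius (R γ) z ∈ mobiusOrbit Γ z :=
  ⟨R γ, (h _).2 ⟨γ, rfl⟩, rfl⟩

lemma accpt_of {s : Set RSphere} {x : RSphere} (h : ∀ ε > 0, ∃ y ∈ s, y ≠ x ∧ dist x y < ε) : AccPt x (𝓟 s) := by
  rw [accPt_iff_nhds]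
  intro U hU
  obtain ⟨ε, hε, hb⟩ := Metric.mem_nhds_iff.1 hU
  obtain ⟨y, hy, hyx, hd⟩ := h ε hε
  exact ⟨y, ⟨hb (by rw [Metric.mem_ball, dist_comm]; exact hd), hy⟩, hyx⟩

lemma three_pts : ∃ y1 y2 y3 : RSphere, y1 ≠ y2 ∧ y1 ≠ y3 ∧ y2 ≠ y3 :=
  ⟨ofC 0, ofC 1, infty, fun h => by simpa using ofC_injective h, ofC_ne_infty _, ofC_ne_infty _⟩

/-- three-point pigeonhole for accumulation -/
lemma acc3 {O : RSphere → Set RSphere} {x y1 y2 y3 : RSphere}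
    (h : ∀ ε > 0, ∃ z, (z = y1 ∨ z = y2 ∨ z = y3) ∧ ∃ w ∈ O z, w ≠ x ∧ dist x w < ε) : ∃ z, AccPt x (𝓟 (O z)) := by
  by_contra hc
  push Not at hc
  have h1 : ∀ z, ∃ ε > 0, ∀ w ∈ O z, w ≠ x → ε ≤ dist x w := by
    intro z
    by_contra h'
    push Not at h'
    exact hc z (accpt_of fun ε hε => by
      obtain ⟨w, h1, h2, h3⟩ := h' ε hε; exact ⟨w, h1, h2, h3⟩)
  choose e he hw using h1
  obtain ⟨z, hz, w, hwz, hwx, hd⟩ := h (min (e y1) (min (e y2) (e y3))) (lt_min (he _) (lt_min (he _) (he _)))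
  have := hw z w hwz hwx
  rcases hz with rfl | rfl | rfl
  · exact absurd (hd.trans_le (min_le_left _ _)) (not_lt.2 this)
  · exact absurd (hd.trans_le ((min_le_right _ _).trans (min_le_left _ _))) (not_lt.2 this)
  · exact absurd (hd.trans_le ((min_le_right _ _).trans (min_le_right _ _))) (not_lt.2 this)

lemma Lc_sub_limitSet {R : G →* SL2C} {Γ : Subgroup PSL2C} (h : ∀ γ, ((R γ : SL2C) : PSL2C) ∈ Γ) : Lc R ⊆ limitSet Γ := by
  intro x hx
  obtain ⟨y1, y2, y3, h12, h13, h23⟩ := three_pts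
  refine acc3 (O := mobiusOrbit Γ) (y1 := y1) (y2 := y2) (y3 := y3) fun ε hε => ?_
  obtain ⟨γ, z, hz, h1, h2⟩ := claimA3 hx h12 h13 h23 hε
  exact ⟨z, hz, _, ⟨R γ, h γ, rfl⟩, h1, h2⟩

lemma conical_Lc {R : G →* SL2C} {Γ : Subgroup PSL2C} (h : Img R Γ) {x : RSphere} (hx : IsConicalLimitPoint Γ x) : x ∈ Lc R := by
  obtain ⟨γ, a, b, hγ, hab, hxa, hyb⟩ := hx
  obtain ⟨y, y', hy, hy', hyy⟩ : ∃ y y' : RSphere, y ≠ x ∧ y' ≠ x ∧ y ≠ y' := by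
    obtain ⟨y1, y2, y3, h12, h13, h23⟩ := three_pts
    by_cases e1 : y1 = x
    · exact ⟨y2, y3, e1 ▸ h12.symm, e1 ▸ h13.symm, h23⟩
    · by_cases e2 : y2 = x
      · exact ⟨y1, y3, e1, e2 ▸ h23.symm, h13⟩
      · exact ⟨y1, y2, e1, e2, h12⟩
  intro ε hε
  have hsab := sg_pos hab
  have hd0 : 0 < dist a b := dist_pos.2 hab
  have hsyy := sg_pos hyy
  set δ := dist a b
  -- eventually
  have ht : ∀ t > 0, ∀ᶠ n in atTop, dist (mobius (γ n) x) a < t ∧ dist (mobius (γ n) y) b < t ∧ dist (mobius (γ n) y') b < t := by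
    intro t ht
    filter_upwards [Metric.tendsto_nhds.1 hxa t ht, Metric.tendsto_nhds.1 (hyb y hy) t ht, Metric.tendsto_nhds.1 (hyb y' hy') t ht] with n h1 h2 h3
    exact ⟨h1, h2, h3⟩
  set T := min (δ / 4) (sg y y' * (δ / 4 * ε) ^ 2 / 16) with hT
  have hTp : 0 < T := by positivity
  obtain ⟨n, h1, h2, h3⟩ := (ht (T / 2) (by positivity)).exists
  have hT1 : T ≤ δ / 4 := min_le_left _ _
  have hT2 : T ≤ sg y y' * (δ / 4 * ε) ^ 2 / 16 := min_le_right _ _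
  set N := Nn (γ n)
  have p0 := Nn_pos (γ n) x
  have p1 := Nn_pos (γ n) y
  have p2 := Nn_pos (γ n) y'
  have e1 := sg_mobius (γ n) x y
  have e2 := sg_mobius (γ n) x y'
  have e3 := sg_mobius (γ n) y y'
  have b1 : δ / 4 ≤ sg (mobius (γ n) x) (mobius (γ n) y) := by
    have := dist_le_sg (mobius (γ n) x) (mobius (γ n) y)
    have t1 : δ ≤ dist (mobius (γ n) x) a + dist (mobius (γ n) x) (mobius (γ n) y) + dist (mobius (γ n) y) b := by
      have u1 := dist_triangle a (mobius (γ n) x) b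
      have u2 := dist_triangle (mobius (γ n) x) (mobius (γ n) y) b
      rw [dist_comm a (mobius (γ n) x)] at u1; linarith
    linarith
  have b2 : δ / 4 ≤ sg (mobius (γ n) x) (mobius (γ n) y') := by
    have := dist_le_sg (mobius (γ n) x) (mobius (γ n) y')
    have t1 : δ ≤ dist (mobius (γ n) x) a + dist (mobius (γ n) x) (mobius (γ n) y') + dist (mobius (γ n) y') b := by
      have u1 := dist_triangle a (mobius (γ n) x) b
      have u2 := dist_triangle (mobius (γ n) x) (mobius (γ n) y') b
      rw [dist_comm a (mobius (γ n) x)] at u1; linarith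
    linarith
  have b3 : sg (mobius (γ n) y) (mobius (γ n) y') ≤ 2 * T := by
    have := sg_le_dist (mobius (γ n) y) (mobius (γ n) y')
    have u1 := dist_triangle_right (mobius (γ n) y) (mobius (γ n) y') b
    linarith
  have c1 : δ / 4 * (N x * N y) ≤ 2 := by
    have := sg_le_two x y
    have : δ / 4 * (N x * N y) ≤ sg (mobius (γ n) x) (mobius (γ n) y) * (N x * N y) := by gcongr
    linarith
  have c2 : δ / 4 * (N x * N y') ≤ 2 := by
    have := sg_le_two x y'
    have : δ / 4 * (N x * N y') ≤ sg (mobius (γ n) x) (mobius (γ n) y') * (N x * N y') := by gcongr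
    linarith
  have c3 : sg y y' ≤ 2 * T * (N y * N y') := by
    rw [← e3]; gcongr
  have c4 : (δ / 4) ^ 2 * N x ^ 2 * sg y y' ≤ 8 * T := by
    have m1 : (δ / 4 * (N x * N y)) * (δ / 4 * (N x * N y')) ≤ 2 * 2 := by gcongr
    calc (δ / 4) ^ 2 * N x ^ 2 * sg y y' ≤ (δ / 4) ^ 2 * N x ^ 2 * (2 * T * (N y * N y')) := by gcongr
      _ = 2 * T * ((δ / 4 * (N x * N y)) * (δ / 4 * (N x * N y'))) := by ring
      _ ≤ 2 * T * (2 * 2) := by gcongr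
      _ = 8 * T := by ring
  have c5 : N x ^ 2 < ε ^ 2 := by
    have : (δ / 4) ^ 2 * N x ^ 2 * sg y y' ≤ (δ / 4) ^ 2 * sg y y' * (ε ^ 2 / 2) := by
      calc _ ≤ 8 * T := c4
        _ ≤ 8 * (sg y y' * (δ / 4 * ε) ^ 2 / 16) := by gcongr
        _ = _ := by ring
    have h9 : N x ^ 2 ≤ ε ^ 2 / 2 := by
      by_contra hcon
      push Not at hcon
      have : (δ / 4) ^ 2 * sg y y' * (ε ^ 2 / 2) < (δ / 4) ^ 2 * sg y y' * N x ^ 2 := by gcongr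
      linarith
    have : 0 < ε ^ 2 := by positivity
    linarith
  obtain ⟨γ', e⟩ := (h (γ n)).1 (hγ n)
  refine ⟨γ', ?_⟩
  rw [← psl_Nn e]
  exact lt_of_pow_lt_pow_left₀ 2 hε.le c5

lemma limitSet_eq {R : G →* SL2C} {Γ : Subgroup PSL2C} (h : Img R Γ) (hc : ∀ x ∈ limitSet Γ, IsConicalLimitPoint Γ x) : limitSet Γ = Lc R :=
  subset_antisymm (fun x hx => conical_Lc h (hc x hx)) (Lc_sub_limitSet fun γ => (h _).2 ⟨γ, rfl⟩)

lemma Lc_closed {R : G →* SL2C} {Γ : Subgroup PSL2C} (h : Img R Γ) (hc : ∀ x ∈ limitSet Γ, IsConicalLimitPoint Γ x) : IsClosed (Lc R) := by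
  refine isClosed_of_closure_subset fun x hx => ?_
  by_contra hxn
  apply hxn
  rw [← limitSet_eq h hc]
  obtain ⟨y1, y2, y3, h12, h13, h23⟩ := three_pts
  refine acc3 (O := mobiusOrbit Γ) (y1 := y1) (y2 := y2) (y3 := y3) fun ε hε => ?_
  obtain ⟨x', hx', hd⟩ := Metric.mem_closure_iff.1 hx (ε / 2) (by positivity)
  have hne : x ≠ x' := fun e => hxn (e ▸ hx')
  have hp := dist_pos.2 hne
  obtain ⟨γ, z, hz, h1, h2⟩ := claimA3 hx' h12 h13 h23 (lt_min (half_pos hε) hp)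
  refine ⟨z, hz, _, h.orbit z γ, ?_, ?_⟩
  · intro e
    have := h2.trans_le (min_le_right _ _)
    rw [e, dist_comm] at this
    exact lt_irrefl _ this
  · have := h2.trans_le (min_le_left _ _)
    have := dist_triangle x x' (mobius (R γ) z)
    linarith

lemma dm_continuous : Continuous fun a : SL2C => dm a 1 := by
  unfold dm
  have h : ∀ i j, Continuous fun a : SL2C => a.1 i j := fun i j => (continuous_apply_apply i j).comp continuous_subtype_val
  have := h 0 0; have := h 0 1; have := h 1 0; have := h 1 1
  fun_prop

lemma dm_tendsto {ι : Type*} {l : Filter ι} {f : ι → SL2C} {a : SL2C} (h : Tendsto f l (𝓝 a)) : Tendsto (fun n => dm (f n) a) l (𝓝 0) := by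
  have hc : Continuous fun b : SL2C => dm b a := by
    unfold dm
    have h : ∀ i j, Continuous fun a : SL2C => a.1 i j := fun i j => (continuous_apply_apply i j).comp continuous_subtype_val
    have := h 0 0; have := h 0 1; have := h 1 0; have := h 1 1
    fun_prop
  have := (hc.tendsto a).comp h
  rwa [dm_self] at this

lemma disc_sl {Γ : Subgroup PSL2C} (h : DiscreteTopology Γ) : ∃ ε > 0, ∀ a : SL2C, (a : PSL2C) ∈ Γ → dm a 1 < ε → (a : PSL2C) = 1 := by
  have h1 : IsOpen ({1} : Set Γ) := isOpen_discrete _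
  obtain ⟨U, hU, hU1⟩ := isOpen_induced_iff.1 h1
  have h2 : IsOpen ((fun a : SL2C => (a : PSL2C)) ⁻¹' U) := hU.preimage continuous_quotient_mk'
  have h3 : (1 : SL2C) ∈ ((fun a : SL2C => (a : PSL2C)) ⁻¹' U) := by
    have : (1 : Γ) ∈ ((↑) : Γ → PSL2C) ⁻¹' U := by rw [hU1]; rfl
    exact this
  obtain ⟨V, hV, hVe⟩ := isOpen_induced_iff.1 h2
  have h4 : (1 : SL2C).1 ∈ V := by
    exact (Set.ext_iff.1 hVe (1 : SL2C)).2 h3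
  have h5 : V ∈ 𝓝 (1 : SL2C).1 := hV.mem_nhds h4
  have h6 : ∃ ε > 0, ∀ m : Matrix (Fin 2) (Fin 2) ℂ, (∀ i j, dist (m i j) ((1 : SL2C).1 i j) < ε) → m ∈ V := by
    letI : PseudoMetricSpace (Matrix (Fin 2) (Fin 2) ℂ) := inferInstanceAs (PseudoMetricSpace (Fin 2 → Fin 2 → ℂ))
    obtain ⟨ε, hε, hb⟩ := Metric.mem_nhds_iff.1 h5
    refine ⟨ε, hε, fun m hm => hb ?_⟩
    rw [Metric.mem_ball]
    exact (dist_pi_lt_iff hε).2 fun i => (dist_pi_lt_iff hε).2 fun j => hm i j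
  obtain ⟨ε, hε, hm⟩ := h6
  refine ⟨ε, hε, fun a ha hd => ?_⟩
  have h7 : a ∈ (fun a : SL2C => (a : PSL2C)) ⁻¹' U := by
    refine (Set.ext_iff.1 hVe a).1 (hm a.1 fun i j => ?_)
    rw [dist_eq_norm]
    unfold dm at hd
    have p1 := norm_nonneg (a.1 0 0 - (1 : SL2C).1 0 0)
    have p2 := norm_nonneg (a.1 0 1 - (1 : SL2C).1 0 1)
    have p3 := norm_nonneg (a.1 1 0 - (1 : SL2C).1 1 0)
    have p4 := norm_nonneg (a.1 1 1 - (1 : SL2C).1 1 1)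
    fin_cases i <;> fin_cases j <;> simp only [Fin.mk_zero, Fin.mk_one, Fin.zero_eta, Fin.isValue] <;> linarith
  have h8 : (⟨(a : PSL2C), ha⟩ : Γ) ∈ ((↑) : Γ → PSL2C) ⁻¹' U := h7
  rw [hU1] at h8
  exact congrArg Subtype.val h8

lemma free_inj {k : ℕ} {f : Fin k → SL2C} (h : Function.Injective ⇑(FreeGroup.lift (fun i => ((f i : SL2C) : PSL2C)))) {γ : FreeGroup (Fin k)}
    (hγ : ((FreeGroup.lift f γ : SL2C) : PSL2C) = 1) : γ = 1 := by
  have e : (QuotientGroup.mk' (Subgroup.center SL2C)).comp (FreeGroup.lift f) = FreeGroup.lift (fun i => ((f i : SL2C) : PSL2C)) := by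
    ext i; simp
  apply h
  rw [map_one, ← e]; exact hγ

lemma disc_R {k : ℕ} {f : Fin k → SL2C} (h : Function.Injective ⇑(FreeGroup.lift (fun i => ((f i : SL2C) : PSL2C))))
    (hd : DiscreteTopology (groupOfGens f)) : DiscG (FreeGroup.lift f) := by
  obtain ⟨ε, hε, h1⟩ := disc_sl hd
  refine DiscG_of _ hε fun γ hγ => ?_
  by_contra hc
  push Not at hc
  exact hγ (free_inj h (h1 _ ((Img_lift f _).2 ⟨γ, rfl⟩) hc))

end Rep15

open scoped commutatorElement
section Rep16

lemma dt_zero_par {u v : V2} (hu : u ≠ 0) (h : dt u v = 0) : ∃ c : ℂ, v = c • u := by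
  unfold dt at h
  by_cases h1 : u.1 = 0
  · have h2 : u.2 ≠ 0 := fun h2 => hu (Prod.ext h1 h2)
    refine ⟨v.2 / u.2, Prod.ext ?_ ?_⟩
    · simp only [Prod.smul_fst, smul_eq_mul, h1, mul_zero]
      rw [h1, zero_mul, zero_sub, neg_eq_zero] at h
      exact (mul_eq_zero.1 h).resolve_left h2
    · simp only [Prod.smul_snd, smul_eq_mul]; field_simp
  · refine ⟨v.1 / u.1, Prod.ext ?_ ?_⟩
    · simp only [Prod.smul_fst, smul_eq_mul]; field_simp
    · simp only [Prod.smul_snd, smul_eq_mul]; field_simp; linear_combination h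

lemma dt_smul_right (c : ℂ) (u v : V2) : dt u (c • v) = c * dt u v := by
  have := dt_smul 1 c u v; simpa using this

lemma V2_basis {u v : V2} (h : dt u v ≠ 0) (w : V2) : w = (dt w v / dt u v) • u + (dt u w / dt u v) • v := by
  unfold dt at *
  ext
  · simp only [Prod.fst_add, Prod.smul_fst, smul_eq_mul]
    rw [div_mul_eq_mul_div, div_mul_eq_mul_div, ← add_div, eq_div_iff h]; ring
  · simp only [Prod.snd_add, Prod.smul_snd, smul_eq_mul]
    rw [div_mul_eq_mul_div, div_mul_eq_mul_div, ← add_div, eq_div_iff h]; ring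

lemma eig_vec (g : SL2C) {l : ℂ} (h : l ^ 2 - (g.1 0 0 + g.1 1 1) * l + 1 = 0) : ∃ v : V2, v ≠ 0 ∧ act g v = l • v := by
  have hd := SL2C_det g
  by_cases h1 : g.1 0 1 = 0 ∧ l = g.1 0 0
  · obtain ⟨hb, hl⟩ := h1
    by_cases h2 : g.1 1 0 = 0 ∧ l = g.1 1 1
    · refine ⟨(1, 0), by simp, ?_⟩
      simp only [act, h2.1, hl]; simp
    · refine ⟨(l - g.1 1 1, g.1 1 0), fun h' => h2 ?_, ?_⟩
      · rw [Prod.mk_eq_zero] at h'; exact ⟨h'.2, sub_eq_zero.1 h'.1⟩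
      · ext
        · simp only [act, Prod.smul_fst, smul_eq_mul, hb, hl]; ring
        · simp only [act, Prod.smul_snd, smul_eq_mul]; ring
  · refine ⟨(g.1 0 1, l - g.1 0 0), fun h' => h1 ?_, ?_⟩
    · rw [Prod.mk_eq_zero] at h'; exact ⟨h'.1, sub_eq_zero.1 h'.2⟩
    · ext
      · simp only [act, Prod.smul_fst, smul_eq_mul]; ring
      · simp only [act, Prod.smul_snd, smul_eq_mul]; linear_combination (-1) * h - hd

lemma roots_ex (t : ℂ) : ∃ l m : ℂ, l + m = t ∧ l * m = 1 := by
  obtain ⟨s, hs⟩ := IsAlgClosed.exists_pow_nat_eq (t ^ 2 - 4) (n := 2) (by norm_num)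
  exact ⟨(t + s) / 2, (t - s) / 2, by ring, by linear_combination (-1/4) * hs⟩

lemma eig_ex (g : SL2C) : ∃ (v : V2) (l : ℂ), v ≠ 0 ∧ act g v = l • v := by
  obtain ⟨l, m, h1, h2⟩ := roots_ex (g.1 0 0 + g.1 1 1)
  obtain ⟨v, h3, h4⟩ := eig_vec g (l := l) (by rw [← h1]; linear_combination (-1) * h2)
  exact ⟨v, l, h3, h4⟩

lemma eig_ne {g : SL2C} {v : V2} {l : ℂ} (hv : v ≠ 0) (h : act g v = l • v) : l ≠ 0 := by
  rintro rfl
  rw [zero_smul] at h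
  exact act_ne hv h

lemma lox_eig {g : SL2C} (hg : IsLoxodromic g) : ∃ (l : ℂ) (v w : V2), 1 < ‖l‖ ∧ v ≠ 0 ∧ w ≠ 0 ∧ act g v = l • v ∧ act g w = l⁻¹ • w ∧ dt v w ≠ 0 := by
  obtain ⟨l, m, h1, h2⟩ := roots_ex (g.1 0 0 + g.1 1 1)
  have key : ∀ l m : ℂ, l + m = g.1 0 0 + g.1 1 1 → l * m = 1 → 1 < ‖l‖ → ∃ (l : ℂ) (v w : V2), 1 < ‖l‖ ∧ v ≠ 0 ∧ w ≠ 0 ∧ act g v = l • v ∧ act g w = l⁻¹ • w ∧ dt v w ≠ 0 := by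
    intro l m h1 h2 hl
    have hm : m = l⁻¹ := eq_inv_of_mul_eq_one_right h2
    obtain ⟨v, hv, hv'⟩ := eig_vec g (l := l) (by rw [← h1]; linear_combination (-1) * h2)
    obtain ⟨w, hw, hw'⟩ := eig_vec g (l := m) (by rw [← h1]; linear_combination (-1) * h2)
    refine ⟨l, v, w, hl, hv, hw, hv', hm ▸ hw', fun h0 => ?_⟩
    obtain ⟨c, rfl⟩ := dt_zero_par hv h0
    have hc : c ≠ 0 := by rintro rfl; simp at hw
    rw [act_smul, hv', smul_smul, smul_smul] at hw'
    have h3 : (c * l - m * c) • v = 0 := by rw [sub_smul, hw', sub_self]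
    have h4 : c * l - m * c = 0 := (smul_eq_zero.1 h3).resolve_right hv
    have h5 : l = m := mul_left_cancel₀ hc (by linear_combination h4)
    rw [← h5] at h2
    have : ‖l‖ * ‖l‖ = 1 := by rw [← norm_mul, h2, norm_one]
    nlinarith
  have hlm : ‖l‖ * ‖m‖ = 1 := by rw [← norm_mul, h2, norm_one]
  rcases lt_trichotomy 1 ‖l‖ with h | h | h
  · exact key l m h1 h2 h
  · exfalso
    have hm : m = (starRingEnd ℂ) l := by
      have : l * (starRingEnd ℂ) l = 1 := by rw [Complex.mul_conj, Complex.normSq_eq_norm_sq, ← h]; simp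
      have hl0 : l ≠ 0 := by rintro rfl; simp at h2
      exact mul_left_cancel₀ hl0 (h2.trans this.symm)
    have h3 : Matrix.trace g.1 = ((2 * l.re : ℝ) : ℂ) := by
      rw [Matrix.trace_fin_two, ← h1, hm, Complex.add_conj]
    have h4 := hg _ h3
    have h5 := Complex.abs_re_le_norm l
    rw [abs_mul, abs_two] at h4
    linarith
  · have : 1 < ‖m‖ := by
      by_contra hc
      push Not at hc
      nlinarith [norm_nonneg l, norm_nonneg m]
    exact key m l (by rw [add_comm, h1]) (by rw [mul_comm, h2]) this

lemma act_pow_eig {g : SL2C} {v : V2} {l : ℂ} (h : act g v = l • v) (n : ℕ) : act (g ^ n) v = l ^ n • v := by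
  induction n with
  | zero => simp [act_one]
  | succ n ih => rw [pow_succ, act_mul, h, act_smul, ih, smul_smul, pow_succ, mul_comm]

lemma act_inv_eig {g : SL2C} {v : V2} {l : ℂ} (hv : v ≠ 0) (h : act g v = l • v) : act g⁻¹ v = l⁻¹ • v := by
  have h0 := eig_ne hv h
  have : act g⁻¹ (act g v) = v := act_inv_act g v
  rw [h, act_smul] at this
  rw [← this, smul_smul, inv_mul_cancel₀ h0, one_smul, this]

lemma Lc_of_eig {G : Type*} [Group G] {R : G →* SL2C} {γ : G} {v : V2} {l : ℂ} (hv : v ≠ 0) (h : act (R γ) v = l • v) (hl : ‖l‖ < 1) : pr v ∈ Lc R := by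
  intro ε hε
  obtain ⟨n, hn⟩ := exists_pow_lt_of_lt_one hε hl
  refine ⟨γ ^ n, ?_⟩
  have h1 := Nn_eq (R (γ ^ n)) hv
  rw [map_pow, act_pow_eig h, norm_smul, norm_pow] at h1
  rw [map_pow, mul_right_cancel₀ (norm_ne_zero_iff.2 hv) h1]
  exact hn

lemma lox_nt {G : Type*} [Group G] {R : G →* SL2C} {γ : G} (h : IsLoxodromic (R γ)) : (Lc R).Nontrivial := by
  obtain ⟨l, v, w, hl, hv, hw, hv', hw', hd⟩ := lox_eig h
  have hl' : ‖l⁻¹‖ < 1 := by rw [norm_inv]; exact inv_lt_one_of_one_lt₀ hl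
  refine ⟨pr v, Lc_of_eig (γ := γ⁻¹) hv (l := l⁻¹) (by rw [map_inv]; exact act_inv_eig hv hv') hl', pr w, Lc_of_eig hw hw' hl', fun e => hd ?_⟩
  have := sg_pr hv hw
  rw [e, sg_self, zero_mul] at this
  exact norm_eq_zero.1 this.symm

lemma comm_fix {x y : SL2C} {v : V2} {a b : ℂ} (hv : v ≠ 0) (hx : act x v = a • v) (hy : act y v = b • v) : act ⁅x, y⁆ v = v := by
  rw [commutatorElement_def, act_mul, act_mul, act_mul, act_inv_eig hv hy, act_smul, act_inv_eig hv hx]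
  simp only [act_smul, hy, hx]
  have := eig_ne hv hx
  have := eig_ne hv hy
  simp only [smul_smul]
  rw [show b⁻¹ * (a⁻¹ * (b * a)) = 1 by field_simp, one_smul]

lemma unip_comm {c d : SL2C} {v : V2} (hv : v ≠ 0) (hc : act c v = v) (hd : act d v = v) : ⁅c, d⁆ = 1 := by
  rw [commutatorElement_eq_one_iff_mul_comm]
  have key : ∀ c : SL2C, act c v = v → ∀ u, ∃ s : ℂ, act c u = u + s • v := by
    intro c hc u
    have h1 := dt_act c v u
    rw [hc] at h1
    have h2 : dt v (act c u - u) = 0 := by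
      have : dt v (act c u - u) = dt v (act c u) - dt v u := by unfold dt; simp; ring
      rw [this, h1, sub_self]
    obtain ⟨s, hs⟩ := dt_zero_par hv h2
    exact ⟨s, by rw [← hs]; abel⟩
  refine act_ext fun u => ?_
  obtain ⟨s, hs⟩ := key c hc u
  obtain ⟨t, ht⟩ := key d hd u
  rw [act_mul, act_mul, hs, ht, act_add, act_add, act_smul, act_smul, hc, hd, hs, ht]
  abel

lemma comm_rel {x y : SL2C} {v : V2} {a b : ℂ} (hv : v ≠ 0) (hx : act (x ^ 2) v = a • v) (hy : act (y ^ 2) v = b • v) :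
    ⁅⁅x ^ 2, y ^ 2⁆, ⁅x ^ 4, y ^ 2⁆⁆ = 1 := by
  refine unip_comm hv (comm_fix hv hx hy) (comm_fix hv (a := a ^ 2) ?_ hy)
  have := act_pow_eig hx 2
  rwa [← pow_mul] at this

lemma word_ne {k : ℕ} {i j : Fin k} (hij : i ≠ j) :
    ⁅⁅FreeGroup.of i ^ 2, FreeGroup.of j ^ 2⁆, ⁅FreeGroup.of i ^ 4, FreeGroup.of j ^ 2⁆⁆ ≠ 1 := by
  intro h
  let f : Fin k → Equiv.Perm (Fin 5) := fun m => if m = i then Equiv.swap 2 3 * Equiv.swap 3 4 else Equiv.swap 0 1 * Equiv.swap 1 2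
  have h1 := congrArg (FreeGroup.lift f) h
  simp only [map_commutatorElement, map_pow, FreeGroup.lift_apply_of, map_one] at h1
  simp only [f, if_true, if_neg hij.symm, commutatorElement_def] at h1
  revert h1
  set_option maxRecDepth 100000 in decide

lemma scal_of_eig {b : SL2C} {u v : V2} {l : ℂ} (h : dt u v ≠ 0) (hu : act b u = l • u) (hv : act b v = l • v) : b = 1 ∨ b = -1 := by
  have h1 := dt_act b u v
  rw [hu, hv, dt_smul] at h1
  have h2 : l ^ 2 = 1 := mul_right_cancel₀ h (by linear_combination h1)
  have h3 : ∀ w, act b w = l • w := by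
    intro w
    rw [V2_basis h w, act_add, act_smul, act_smul, hu, hv, smul_add, smul_comm, smul_comm l (dt u w / dt u v)]
  rcases sq_eq_one_iff.1 h2 with rfl | rfl
  · left; exact act_ext fun w => by rw [h3, act_one, one_smul]
  · right; exact act_ext fun w => by rw [h3, act_neg, act_one, neg_smul, one_smul]

lemma eig_perm {b x : SL2C} (h1 : b ≠ 1) (h2 : b ≠ -1) (hc : b * (x * b * x⁻¹) = (x * b * x⁻¹) * b) {v : V2} {l : ℂ} (hv : v ≠ 0) (h : act b v = l • v) :
    ∃ m : ℂ, act b (act x⁻¹ v) = m • act x⁻¹ v := by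
  set c := x * b * x⁻¹ with hcd
  have h3 : act b (act c v) = l • act c v := by rw [← act_mul, hc, act_mul, h, act_smul]
  have h4 : dt v (act c v) = 0 := by
    by_contra h0
    rcases scal_of_eig h0 h h3 with h | h
    · exact h1 h
    · exact h2 h
  obtain ⟨m, hm⟩ := dt_zero_par hv h4
  refine ⟨m, ?_⟩
  have : act x⁻¹ (act c v) = act b (act x⁻¹ v) := by
    rw [hcd, act_mul, act_mul, act_inv_act]
  rw [← this, hm, act_smul]

lemma sq_fix {b x : SL2C} (h1 : b ≠ 1) (h2 : b ≠ -1) (hc : b * (x * b * x⁻¹) = (x * b * x⁻¹) * b) {v : V2} {l : ℂ} (hv : v ≠ 0) (h : act b v = l • v) :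
    ∃ a : ℂ, act (x ^ 2) v = a • v := by
  obtain ⟨m, hm⟩ := eig_perm h1 h2 hc hv h
  have hv1 : act x⁻¹ v ≠ 0 := act_ne hv
  obtain ⟨n, hn⟩ := eig_perm h1 h2 hc hv1 hm
  have hv2 : act x⁻¹ (act x⁻¹ v) ≠ 0 := act_ne hv1
  have hback : ∀ c : ℂ, act x⁻¹ (act x⁻¹ v) = c • v → ∃ a : ℂ, act (x ^ 2) v = a • v := by
    intro c hc
    have e : act (x ^ 2) (act x⁻¹ (act x⁻¹ v)) = v := by rw [pow_two, act_mul, act_act_inv, act_act_inv]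
    rw [hc, act_smul] at e
    have hc0 : c ≠ 0 := by rintro rfl; rw [zero_smul] at e; exact hv e.symm
    refine ⟨c⁻¹, ?_⟩
    conv_rhs => rw [← e]
    rw [smul_smul, inv_mul_cancel₀ hc0, one_smul]
  by_cases d1 : dt v (act x⁻¹ v) = 0
  · obtain ⟨c, hc'⟩ := dt_zero_par hv d1
    exact hback (c * c) (by rw [hc', act_smul, hc', smul_smul])
  by_cases d2 : dt v (act x⁻¹ (act x⁻¹ v)) = 0
  · obtain ⟨c, hc'⟩ := dt_zero_par hv d2
    exact hback c hc'
  exfalso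
  have d3 : dt (act x⁻¹ v) (act x⁻¹ (act x⁻¹ v)) ≠ 0 := by rwa [dt_act]
  have e1 := dt_act b v (act x⁻¹ v)
  have e2 := dt_act b v (act x⁻¹ (act x⁻¹ v))
  have e3 := dt_act b (act x⁻¹ v) (act x⁻¹ (act x⁻¹ v))
  rw [h, hm, dt_smul] at e1
  rw [h, hn, dt_smul] at e2
  rw [hm, hn, dt_smul] at e3
  have f1 : l * m = 1 := mul_right_cancel₀ d1 (by rw [e1, one_mul])
  have f2 : l * n = 1 := mul_right_cancel₀ d2 (by rw [e2, one_mul])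
  have f3 : m * n = 1 := mul_right_cancel₀ d3 (by rw [e3, one_mul])
  have hmn : m = n := mul_left_cancel₀ (eig_ne hv h) (f1.trans f2.symm)
  rw [← hmn] at hn
  rcases scal_of_eig d3 hm hn with h | h
  · exact h1 h
  · exact h2 h

lemma comm_bound {b x : SL2C} {M : ℝ} (hx : mn x ≤ M) (hb : dm b 1 ≤ 1) : dm ⁅b, x * b * x⁻¹⁆ 1 ≤ 72 * M ^ 4 * dm b 1 ^ 2 := by
  have hM : 1 ≤ M := (one_le_mn x).trans hx
  have hb0 := dm_nonneg b 1
  have hmb : mn b ≤ 3 := by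
    have := mn_diff_le b 1
    have h1 : mn (1 : SL2C) = 2 := by simp [mn]; norm_num
    linarith
  set c := x * b * x⁻¹ with hc
  have hβ : ∀ u, ‖act b u - u‖ ≤ dm b 1 * ‖u‖ := fun u => by
    have := act_diff_le b 1 u; rwa [act_one] at this
  have hA : ∀ (g : SL2C) (K : ℝ), mn g ≤ K → ∀ u, ‖act g u‖ ≤ K * ‖u‖ := fun g K hK u =>
    (norm_act_le g u).trans (by gcongr)
  have hxi : mn x⁻¹ ≤ M := by rwa [mn_inv]
  have hbi : mn b⁻¹ ≤ 3 := by rwa [mn_inv]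
  have hκ : ∀ u, ‖act c u - u‖ ≤ M ^ 2 * dm b 1 * ‖u‖ := fun u => by
    have e : act c u - u = act x (act b (act x⁻¹ u) - act x⁻¹ u) := by
      rw [act_sub, act_act_inv, hc, act_mul, act_mul]
    rw [e]
    calc _ ≤ M * ‖act b (act x⁻¹ u) - act x⁻¹ u‖ := hA _ _ hx _
      _ ≤ M * (dm b 1 * ‖act x⁻¹ u‖) := by gcongr; exact hβ _
      _ ≤ M * (dm b 1 * (M * ‖u‖)) := by gcongr; exact hA _ _ hxi _
      _ = _ := by ring
  have hci : ∀ u, ‖act c⁻¹ u‖ ≤ 3 * M ^ 2 * ‖u‖ := fun u => by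
    have e : c⁻¹ = x * b⁻¹ * x⁻¹ := by rw [hc]; group
    rw [e, act_mul, act_mul]
    calc _ ≤ M * ‖act b⁻¹ (act x⁻¹ u)‖ := hA _ _ hx _
      _ ≤ M * (3 * ‖act x⁻¹ u‖) := by gcongr; exact hA _ _ hbi _
      _ ≤ M * (3 * (M * ‖u‖)) := by gcongr; exact hA _ _ hxi _
      _ = _ := by ring
  have key : ∀ u : V2, ‖u‖ ≤ 1 → ‖act ⁅b, c⁆ u - act 1 u‖ ≤ 18 * M ^ 4 * dm b 1 ^ 2 := by
    intro u hu
    set w := act b⁻¹ (act c⁻¹ u) with hw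
    have hwn : ‖w‖ ≤ 9 * M ^ 2 := by
      calc ‖w‖ ≤ 3 * ‖act c⁻¹ u‖ := hA _ _ hbi _
        _ ≤ 3 * (3 * M ^ 2 * ‖u‖) := by gcongr; exact hci _
        _ ≤ 3 * (3 * M ^ 2 * 1) := by gcongr
        _ = _ := by ring
    have hu' : u = act c (act b w) := by rw [hw, act_act_inv, act_act_inv]
    have e : act ⁅b, c⁆ u - act 1 u = (act b (act c w - w) - (act c w - w)) - (act c (act b w - w) - (act b w - w)) := by
      have e1 : act ⁅b, c⁆ u = act b (act c w) := by rw [commutatorElement_def, act_mul, act_mul, act_mul]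
      rw [e1, act_one, act_sub, act_sub, ← hu']; abel
    rw [e]
    calc _ ≤ ‖act b (act c w - w) - (act c w - w)‖ + ‖act c (act b w - w) - (act b w - w)‖ := norm_sub_le _ _
      _ ≤ dm b 1 * ‖act c w - w‖ + M ^ 2 * dm b 1 * ‖act b w - w‖ := by gcongr; exact hβ _; exact hκ _
      _ ≤ dm b 1 * (M ^ 2 * dm b 1 * ‖w‖) + M ^ 2 * dm b 1 * (dm b 1 * ‖w‖) := by gcongr; exact hκ _; exact hβ _
      _ = 2 * M ^ 2 * dm b 1 ^ 2 * ‖w‖ := by ring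
      _ ≤ 2 * M ^ 2 * dm b 1 ^ 2 * (9 * M ^ 2) := by gcongr
      _ = _ := by ring
  have := dm_le_of_act key
  linarith

/-- Zassenhaus-type lemma. -/
lemma zass {H : Subgroup SL2C} {ε M : ℝ} (hε : 0 < ε) (hd : ∀ a ∈ H, dm a 1 < ε → a = 1) {x y : SL2C} (hx : x ∈ H) (hy : y ∈ H)
    (hxM : mn x ≤ M) (hyM : mn y ≤ M) (hw : ⁅⁅x ^ 2, y ^ 2⁆, ⁅x ^ 4, y ^ 2⁆⁆ ≠ 1) {a : SL2C} (ha : a ∈ H) (had : dm a 1 < 1 / (288 * M ^ 4)) : a = 1 := by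
  by_contra ha1
  have hM : 1 ≤ M := (one_le_mn x).trans hxM
  set S := {t : ℝ | ∃ b ∈ H, b ≠ 1 ∧ t = dm b 1}
  have hSb : ∀ t ∈ S, ε ≤ t := by
    rintro t ⟨b, hb, hb1, rfl⟩
    by_contra hc
    exact hb1 (hd b hb (not_le.1 hc))
  have hSn : S.Nonempty := ⟨_, a, ha, ha1, rfl⟩
  have hbd : BddBelow S := ⟨ε, hSb⟩
  set d := sInf S
  have hd0 : 0 < d := hε.trans_le (le_csInf hSn hSb)
  have hda : d ≤ dm a 1 := csInf_le hbd ⟨a, ha, ha1, rfl⟩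
  obtain ⟨_, ⟨b, hb, hb1, rfl⟩, hbd2⟩ := exists_lt_of_csInf_lt hSn (show d < 2 * d by linarith)
  have hK : d * (288 * M ^ 4) < 1 := by
    rw [lt_div_iff₀ (by positivity)] at had
    have : d * (288 * M ^ 4) ≤ dm a 1 * (288 * M ^ 4) := by gcongr
    linarith
  have hM4 : 1 ≤ M ^ 4 := one_le_pow₀ hM
  have hb2 : dm b 1 ≤ 1 := by nlinarith
  have hbn : b ≠ -1 := by
    rintro rfl
    have : dm (-1) 1 = 4 := by
      simp only [dm, Matrix.SpecialLinearGroup.coe_neg, Matrix.SpecialLinearGroup.coe_one]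
      norm_num [Matrix.neg_apply, Matrix.one_apply]
    linarith
  have hcomm : ∀ x ∈ H, mn x ≤ M → b * (x * b * x⁻¹) = (x * b * x⁻¹) * b := by
    intro x hx hxM
    have hc : x * b * x⁻¹ ∈ H := H.mul_mem (H.mul_mem hx hb) (H.inv_mem hx)
    have hcm : ⁅b, x * b * x⁻¹⁆ ∈ H := by
      rw [commutatorElement_def]
      exact H.mul_mem (H.mul_mem (H.mul_mem hb hc) (H.inv_mem hb)) (H.inv_mem hc)
    rw [← commutatorElement_eq_one_iff_mul_comm]
    by_contra h1
    have h2 : d ≤ dm ⁅b, x * b * x⁻¹⁆ 1 := csInf_le hbd ⟨_, hcm, h1, rfl⟩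
    have h3 := comm_bound hxM hb2
    have h4 : dm b 1 ^ 2 ≤ (2 * d) ^ 2 := by
      have := dm_nonneg b 1
      gcongr
    have h5 : 72 * M ^ 4 * dm b 1 ^ 2 ≤ 72 * M ^ 4 * (2 * d) ^ 2 := by gcongr
    nlinarith
  obtain ⟨v, l, hv, hvl⟩ := eig_ex b
  obtain ⟨p, hp⟩ := sq_fix hb1 hbn (hcomm x hx hxM) hv hvl
  obtain ⟨q, hq⟩ := sq_fix hb1 hbn (hcomm y hy hyM) hv hvl
  exact hw (comm_rel hv hp hq)

end Rep16

lemma cl_ball {t : ℝ} (ht : 0 < t) : closure (ofC '' Metric.ball (0:ℂ) t) = ofC '' Metric.closedBall 0 t := by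
  apply subset_antisymm
  · exact closure_minimal (image_mono Metric.ball_subset_closedBall) (closed_ofC_of_bdd (isCompact_closedBall _ _))
  · rw [← closure_ball (0:ℂ) ht.ne']
    exact image_closure_subset_closure_image continuous_ofC

lemma fr_ball {t : ℝ} (ht : 0 < t) : frontier (ofC '' Metric.ball (0:ℂ) t) = ofC '' Metric.sphere 0 t := by
  rw [frontier, cl_ball ht, (isOpen_ofC Metric.isOpen_ball).interior_eq, ← image_sdiff ofC_injective, Metric.closedBall_diff_ball]

lemma fr_ext {t : ℝ} (ht : 0 < t) : frontier (ofC '' Metric.closedBall (0:ℂ) t)ᶜ = ofC '' Metric.sphere 0 t := by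
  have h : interior (ofC '' Metric.closedBall (0:ℂ) t) = ofC '' Metric.ball 0 t := by
    apply subset_antisymm
    · intro x hx
      obtain ⟨z, hz, rfl⟩ := interior_subset hx
      refine ⟨z, ?_, rfl⟩
      rw [← interior_closedBall (0:ℂ) ht.ne', mem_interior]
      refine ⟨ofC ⁻¹' interior (ofC '' Metric.closedBall (0:ℂ) t), ?_, isOpen_interior.preimage continuous_ofC, hx⟩
      intro w hw
      obtain ⟨w', hw', e⟩ := interior_subset hw
      exact ofC_injective e ▸ hw'
    · exact interior_maximal (image_mono Metric.ball_subset_closedBall) (isOpen_ofC Metric.isOpen_ball)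
  rw [frontier_compl, frontier, (closed_ofC_of_bdd (isCompact_closedBall _ _)).closure_eq, h, ← image_sdiff ofC_injective, Metric.closedBall_diff_ball]

lemma aff_sphere {a : ℂ} (ha : a ≠ 0) (b c : ℂ) (r : ℝ) : (fun w => a * w + b) '' Metric.sphere c r = Metric.sphere (a * c + b) (‖a‖ * r) := by
  ext z
  simp only [mem_image, mem_sphere_iff_norm]
  constructor
  · rintro ⟨w, hw, rfl⟩
    rw [show a * w + b - (a * c + b) = a * (w - c) by ring, norm_mul, hw]
  · intro h
    refine ⟨(z - b) / a, ?_, by field_simp; ring⟩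
    have : z - (a * c + b) = a * ((z - b) / a - c) := by field_simp; ring
    rw [this, norm_mul] at h
    exact mul_left_cancel₀ (norm_ne_zero_iff.2 ha) h

lemma jordan_sphere {t : ℝ} (ht : 0 < t) : IsJordanCurve (ofC '' Metric.sphere (0:ℂ) t) := by
  have ht' : (t:ℂ) ≠ 0 := by exact_mod_cast ht.ne'
  refine ⟨fun w => ofC (t * w + 0), (continuous_ofC.comp (by fun_prop)).continuousOn, ?_, ?_⟩
  · intro x _ y _ h
    simpa [ht'] using ofC_injective h
  · have := aff_sphere ht' 0 0 1
    rw [unitCircle, ← image_image ofC (fun w : ℂ => (t:ℂ) * w + 0), this]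
    simp [abs_of_pos ht]

lemma round_any (h : SL2C) : ∃ s : ℝ, 0 < s ∧ ∀ t, s ≤ t → IsRoundCircle (mobius h '' (ofC '' Metric.sphere (0:ℂ) t)) := by
  by_cases hc : h.1 1 0 = 0
  · refine ⟨1, one_pos, fun t ht => Or.inl ?_⟩
    have hd := SL2C_det h
    rw [hc, mul_zero, sub_zero] at hd
    have h1 : h.1 1 1 ≠ 0 := by rintro h'; rw [h'] at hd; simp at hd
    have h0 : h.1 0 0 ≠ 0 := by rintro h'; rw [h'] at hd; simp at hd
    have ha : h.1 0 0 / h.1 1 1 ≠ 0 := div_ne_zero h0 h1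
    refine ⟨h.1 0 0 / h.1 1 1 * 0 + h.1 0 1 / h.1 1 1, ‖h.1 0 0 / h.1 1 1‖ * t, by positivity, ?_⟩
    rw [← aff_sphere ha, image_image, image_image]
    refine image_congr fun w _ => ?_
    rw [← pr_ofC w, mobius_pr h (by simp), ← pr_ofC (_ + _), ← pr_smul h1 (_, 1)]
    congr 1
    ext
    · simp only [act, Prod.smul_fst, smul_eq_mul]; field_simp
    · simp only [act, Prod.smul_snd, smul_eq_mul, hc]; ring
  · obtain ⟨A, P, θ, rfl⟩ := exists_Mx h hc
    refine ⟨‖P‖ + 1, by positivity, fun t ht => Or.inl ?_⟩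
    have ht0 : 0 < t := by linarith [norm_nonneg P]
    have hP : ofC P ∉ ofC '' Metric.sphere (0:ℂ) t := by
      rintro ⟨w, hw, e⟩
      rw [ofC_injective e, mem_sphere_zero_iff_norm] at hw
      linarith
    obtain ⟨c, r, hr, e⟩ := round_image (Or.inl ⟨0, t, ht0, rfl⟩) hP
    have hE : Complex.exp θ ^ 2 ≠ 0 := pow_ne_zero _ (Complex.exp_ne_zero _)
    refine ⟨Complex.exp θ ^ 2 * c + A, ‖Complex.exp θ ^ 2‖ * r, by positivity, ?_⟩
    rw [← aff_sphere hE, image_image]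
    have e2 : (fun w => ofC (-1 / (w - P))) '' Metric.sphere (0:ℂ) t = ofC '' Metric.sphere c r := by
      rw [← e, image_image]
      refine image_congr fun w hw => ?_
      rw [Mx_ofC _ _ _ _ (fun h' => hP ⟨w, hw, by rw [h']⟩)]
      simp [neg_div]
    have e3 : (fun w => -1 / (w - P)) '' Metric.sphere (0:ℂ) t = Metric.sphere c r := by
      rw [← image_image ofC] at e2
      exact ofC_injective.image_injective e2
    rw [← e3, image_image, image_image]
    refine image_congr fun w hw => ?_
    rw [Mx_ofC _ _ _ _ (fun h' => hP ⟨w, hw, by rw [h']⟩)]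
    congr 1
    ring

lemma rank1 {Γ : Subgroup PSL2C} (h : IsSchottkyOfRank Γ 1) : IsClassicalSchottky Γ := by
  obtain ⟨S, hS, hF, hK, hC⟩ := h
  obtain ⟨l, v, w, hl, hv, hw, ev, ew, hd⟩ := lox_eig (S.lox 0)
  set h : SL2C := ⟨!![v.1, w.1 / dt v w; v.2, w.2 / dt v w], by
    rw [Matrix.det_fin_two_of]
    have : dt v w = v.1 * w.2 - v.2 * w.1 := rfl
    rw [← mul_div_assoc, div_mul_eq_mul_div, ← sub_div, div_eq_one_iff_eq hd, this]; ring⟩ with hh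
  have hh1 : ∀ z : ℂ, act h (z, 1) = z • v + (dt v w)⁻¹ • w := by
    intro z
    ext <;> simp [act, hh] <;> ring
  obtain ⟨t, ht, hr⟩ := round_any h
  have hl0 : l ≠ 0 := by rintro rfl; simp at hl; linarith
  have hconj : ∀ z : ℂ, mobius (S.gen 0) (mobius h (ofC z)) = mobius h (ofC (l ^ 2 * z)) := by
    intro z
    rw [← pr_ofC, ← pr_ofC, mobius_pr h (by simp), mobius_pr h (by simp), mobius_pr _ (act_ne (by simp)), hh1, hh1, act_add, act_smul, act_smul, ev, ew, ← pr_smul hl0]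
    congr 1
    rw [smul_add, smul_smul, smul_smul, smul_smul, smul_smul]
    congr 2
    · ring
    · field_simp
  have hn : ‖l ^ 2‖ = ‖l‖ ^ 2 := norm_pow _ _
  set s := ‖l ^ 2‖ * t with hs
  have hts : t < s := by rw [hs, hn]; nlinarith [mul_pos ht (show 0 < ‖l‖ ^ 2 - 1 by nlinarith)]
  have hs0 : 0 < s := ht.trans hts
  have him : ∀ (A : Set ℂ), mobius (S.gen 0) '' (mobius h '' (ofC '' A)) = mobius h '' (ofC '' ((fun z => l ^ 2 * z + 0) '' A)) := by
    intro A
    simp only [image_image, hconj, add_zero]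
  let D : Fin 1 ⊕ Fin 1 → Set RSphere := fun i => mobius h '' (Sum.elim (fun _ => ofC '' Metric.ball 0 t) (fun _ => (ofC '' Metric.closedBall 0 s)ᶜ) i)
  have hfr : ∀ A : Set RSphere, frontier (mobius h '' A) = mobius h '' frontier A := fun A => ((mobHomeo h).image_frontier A).symm
  have hcl : ∀ A : Set RSphere, closure (mobius h '' A) = mobius h '' closure A := fun A => ((mobHomeo h).image_closure A).symm
  have hop : ∀ A : Set RSphere, IsOpen A → IsOpen (mobius h '' A) := fun A hA => (mobHomeo h).isOpen_image.2 hA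
  have hdis : closure (D (Sum.inl 0)) ∩ closure (D (Sum.inr 0)) = ∅ := by
    simp only [D, Sum.elim_inl, Sum.elim_inr, hcl]
    rw [← image_inter (mobius_inj h), image_eq_empty, cl_ball ht, ← disjoint_iff_inter_eq_empty]
    have : closure (ofC '' Metric.closedBall (0:ℂ) s)ᶜ ⊆ (ofC '' Metric.ball (0:ℂ) s)ᶜ :=
      closure_minimal (compl_subset_compl.2 (image_mono Metric.ball_subset_closedBall)) (isOpen_ofC Metric.isOpen_ball).isClosed_compl
    refine Disjoint.mono_right this (disjoint_compl_right_iff_subset.2 (image_mono (Metric.closedBall_subset_ball hts)))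
  refine ⟨1, ⟨S.gen, D, ?_, ?_, ?_, ?_, S.lox, ?_, ?_⟩, hS, hF, ?_, hK, hC⟩
  · rintro (i | i)
    · exact hop _ (isOpen_ofC Metric.isOpen_ball)
    · exact hop _ (closed_ofC_of_bdd (isCompact_closedBall _ _)).isOpen_compl
  · rintro (i | i)
    · exact ((Metric.nonempty_ball.2 ht).image _).image _
    · refine Set.Nonempty.image _ ⟨infty, ?_⟩
      rintro ⟨z, _, e⟩; exact ofC_ne_infty z e
  · rintro (i | i)
    · simp only [D, Sum.elim_inl, hfr, fr_ball ht]
      exact (jordan_sphere ht).image (mobHomeo h)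
    · simp only [D, Sum.elim_inr, hfr, fr_ext hs0]
      exact (jordan_sphere hs0).image (mobHomeo h)
  · rintro (i | i) (j | j) hij
    · exact absurd (by rw [Subsingleton.elim i j]) hij
    · rw [Subsingleton.elim i 0, Subsingleton.elim j 0]; exact hdis
    · rw [Subsingleton.elim i 0, Subsingleton.elim j 0, inter_comm]; exact hdis
    · exact absurd (by rw [Subsingleton.elim i j]) hij
  · intro i
    rw [Subsingleton.elim i 0]
    simp only [D, Sum.elim_inl, Sum.elim_inr, hfr, fr_ball ht, fr_ext hs0]
    rw [him, aff_sphere (pow_ne_zero _ hl0)]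
    simp [hs]
  · intro i
    rw [Subsingleton.elim i 0]
    simp only [D, Sum.elim_inl, Sum.elim_inr]
    rw [him, ← image_inter (mobius_inj h), image_eq_empty, ← disjoint_iff_inter_eq_empty]
    refine disjoint_compl_right_iff_subset.2 (image_mono ?_)
    rintro _ ⟨z, hz, rfl⟩
    rw [mem_ball_zero_iff] at hz
    rw [mem_closedBall_zero_iff]
    show ‖l ^ 2 * z + 0‖ ≤ s
    rw [add_zero, norm_mul, hs]
    gcongr
  · rintro (i | i)
    · show IsRoundCircle (frontier (D _))
      simp only [D, Sum.elim_inl, hfr, fr_ball ht]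
      exact hr t le_rfl
    · show IsRoundCircle (frontier (D _))
      simp only [D, Sum.elim_inr, hfr, fr_ext hs0]
      exact hr s hts.le

lemma rank0 {Γ : Subgroup PSL2C} (h : IsSchottkyOfRank Γ 0) : IsClassicalSchottky Γ := by
  obtain ⟨S, hS, hF, hK, hC⟩ := h
  refine ⟨0, S, hS, hF, ?_, hK, hC⟩
  rintro (i | i) <;> exact i.elim0

open scoped commutatorElement
lemma dm_zero {a b : SL2C} (h : dm a b = 0) : a = b := by
  apply act_ext
  intro u
  have := act_diff_le a b u
  rw [h, zero_mul] at this
  exact sub_eq_zero.1 (norm_le_zero_iff.1 this)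

lemma dm_mul_tendsto {ι : Type*} {l : Filter ι} {a b : ι → SL2C} {a' b' : SL2C} (ha : Tendsto (fun i => dm (a i) a') l (𝓝 0))
    (hb : Tendsto (fun i => dm (b i) b') l (𝓝 0)) : Tendsto (fun i => dm (a i * b i) (a' * b')) l (𝓝 0) := by
  have h : Tendsto (fun i => 4 * ((mn a' + dm (a i) a') * dm (b i) b' + dm (a i) a' * mn b')) l (𝓝 (4 * ((mn a' + 0) * 0 + 0 * mn b'))) := by
    refine Tendsto.const_mul _ (((ha.const_add _).mul hb).add (ha.mul_const _))
  simp only [mul_zero, zero_mul, add_zero] at h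
  refine squeeze_zero (fun _ => dm_nonneg _ _) (fun i => (dm_mul_le _ _ _ _).trans ?_) h
  have := mul_le_mul_of_nonneg_right (mn_diff_le (a i) a') (dm_nonneg (b i) b')
  linarith

lemma nR_tendsto {G ι : Type*} [Group G] {l : Filter ι} {R : G →* SL2C} {f : ι → (G →* SL2C)} (h : Tendsto f l (nR R)) (γ : G) :
    Tendsto (fun i => dm (f i γ) (R γ)) l (𝓝 0) := by
  rw [Metric.tendsto_nhds]
  intro ε hε
  filter_upwards [h.eventually (nR_ev R γ hε)] with i hi
  rwa [Real.dist_eq, sub_zero, abs_of_nonneg (dm_nonneg _ _)]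

lemma dm_neg_one : dm (-1) 1 = 4 := by
  have h : ∀ i j : Fin 2, (-1 : SL2C).1 i j = - (1 : SL2C).1 i j := fun i j => rfl
  simp [dm, h, Matrix.one_apply]
  norm_num

lemma zassR {k : ℕ} {R : FreeGroup (Fin k) →* SL2C} {Rn : ℕ → (FreeGroup (Fin k) →* SL2C)} (hT : Tendsto Rn atTop (nR R))
    (hk : 2 ≤ k) (hinj : ∀ γ, ((R γ : SL2C) : PSL2C) = 1 → γ = 1) {Γn : ℕ → Subgroup PSL2C} (hd : ∀ n, DiscreteTopology (Γn n))
    (hm : ∀ n γ, ((Rn n γ : SL2C) : PSL2C) ∈ Γn n) : ∃ δ > 0, ∀ᶠ n in atTop, ∀ a : SL2C, (a : PSL2C) ∈ Γn n → dm a 1 < δ → a = 1 := by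
  let i : Fin k := ⟨0, by omega⟩
  let j : Fin k := ⟨1, by omega⟩
  have hij : i ≠ j := by simp [i, j]
  set w := ⁅⁅FreeGroup.of i ^ 2, FreeGroup.of j ^ 2⁆, ⁅FreeGroup.of i ^ 4, FreeGroup.of j ^ 2⁆⁆ with hw
  have hw1 : R w ≠ 1 := fun h => word_ne hij (hinj w (by rw [h]; rfl))
  have hpos : 0 < dm 1 (R w) := lt_of_le_of_ne (dm_nonneg _ _) fun h => hw1 (dm_zero h.symm).symm
  set M := mn (R (FreeGroup.of i)) + mn (R (FreeGroup.of j)) + 1 with hM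
  have hM1 : 1 ≤ M := by linarith [mn_nonneg (R (FreeGroup.of i)), mn_nonneg (R (FreeGroup.of j))]
  refine ⟨1 / (288 * M ^ 4), by positivity, ?_⟩
  filter_upwards [hT.eventually (nR_ev R w hpos), hT.eventually (nR_ev R (FreeGroup.of i) one_pos), hT.eventually (nR_ev R (FreeGroup.of j) one_pos)] with n h1 h2 h3 a ha had
  obtain ⟨ε, hε, he⟩ := disc_sl (hd n)
  have hwn : Rn n w ≠ 1 := by rintro h; rw [h] at h1; exact lt_irrefl _ h1
  refine zass (H := (Γn n).comap (QuotientGroup.mk' _)) (ε := min ε 1) (M := M) (by positivity) ?_ (x := Rn n (FreeGroup.of i)) (y := Rn n (FreeGroup.of j)) (hm n _) (hm n _) ?_ ?_ ?_ ha had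
  · intro b hb hbd
    have := psl_eq (a := b) (b := 1) (he b hb (hbd.trans_le (min_le_left _ _)))
    rcases this with h | h
    · exact h
    · rw [h, dm_neg_one] at hbd
      have := hbd.trans_le (min_le_right _ _)
      norm_num at this
  · linarith [mn_diff_le (Rn n (FreeGroup.of i)) (R (FreeGroup.of i)), mn_nonneg (R (FreeGroup.of j))]
  · linarith [mn_diff_le (Rn n (FreeGroup.of j)) (R (FreeGroup.of j)), mn_nonneg (R (FreeGroup.of i))]
  · rw [hw] at hwn
    simpa only [map_commutatorElement, map_pow] using hwn

lemma one_le_dimH_univ : 1 ≤ dimH (univ : Set RSphere) := by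
  have hf : LipschitzWith 1 (fun z : RSphere => dist z infty) := LipschitzWith.dist_left infty
  refine le_trans ?_ (hf.dimH_image_le univ)
  have hc : IsPreconnected ((fun z : RSphere => dist z infty) '' univ) := isPreconnected_univ.image _ hf.continuous.continuousOn
  have h0 : 0 < dist (ofC 0) infty := dist_pos.2 (ofC_ne_infty 0)
  have hs : Icc 0 (dist (ofC 0) infty) ⊆ (fun z : RSphere => dist z infty) '' univ :=
    hc.Icc_subset ⟨infty, trivial, dist_self _⟩ ⟨ofC 0, trivial, rfl⟩
  have : dimH (Icc 0 (dist (ofC 0) infty)) = 1 := by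
    have := Real.dimH_of_nonempty_interior (E := ℝ) (s := Icc 0 (dist (ofC 0) infty)) (by rw [interior_Icc]; exact nonempty_Ioo.2 h0)
    simpa using this
  rw [← this]
  exact dimH_mono hs

lemma three_Lc {k : ℕ} (hk : 2 ≤ k) {R : FreeGroup (Fin k) →* SL2C} (hnt : (Lc R).Nontrivial) (hinj : ∀ γ, ((R γ : SL2C) : PSL2C) = 1 → γ = 1) :
    ∃ p q r, p ∈ Lc R ∧ q ∈ Lc R ∧ r ∈ Lc R ∧ p ≠ q ∧ p ≠ r ∧ q ≠ r := by
  obtain ⟨p, hp, q, hq, hpq⟩ := hnt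
  by_contra hcon
  push Not at hcon
  have hcon' : ∀ r ∈ Lc R, r = p ∨ r = q := by
    intro r hr
    by_contra h
    rw [not_or] at h
    exact h.2 (hcon p q r hp hq hr hpq (Ne.symm h.1)).symm
  have h2 : ∀ γ, mobius (R γ ^ 2) p = p := by
    intro γ
    rw [pow_two, mobius_mul]
    rcases hcon' _ (((Lc_inv R).iff γ p).2 hp) with h | h
    · rw [h, h]
    · rcases hcon' _ (((Lc_inv R).iff γ q).2 hq) with h' | h'
      · rw [h, h']
      · exact absurd (mobius_inj _ (h.trans h'.symm)) hpq
  have h3 : ∀ γ, ∃ a : ℂ, act (R γ ^ 2) (lft p) = a • lft p := by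
    intro γ
    obtain ⟨c, _, _, h⟩ := act_lft (R γ ^ 2) p
    rw [h2] at h
    exact ⟨c, h⟩
  let i : Fin k := ⟨0, by omega⟩
  let j : Fin k := ⟨1, by omega⟩
  have hij : i ≠ j := by simp [i, j]
  obtain ⟨a, ha⟩ := h3 (FreeGroup.of i)
  obtain ⟨b, hb⟩ := h3 (FreeGroup.of j)
  have := comm_rel (lft_ne p) ha hb
  simp only [← map_pow, ← map_commutatorElement] at this
  exact word_ne hij (hinj _ (by rw [this]; rfl))

lemma setup (g : ℕ) (lam : ℝ≥0∞) (hlam : lam < 1)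
    (γn : ℕ → Fin g → SL2C) (γ : Fin g → SL2C)
    (hcl : ∀ n, IsClassicalSchottkyOfRank (groupOfGens (γn n)) g)
    (hdim : ∀ n, limitDim (groupOfGens (γn n)) ≤ lam)
    (hconv : ∀ i, Filter.Tendsto (fun n => γn n i) Filter.atTop (nhds (γ i)))
    (hs : IsSchottky (groupOfGens γ))
    (hnc : ¬IsClassicalSchottky (groupOfGens γ))
    (W : Set ℂ) (hW : IsCompact W)
    (hWl : RSphere.ofC ⁻¹' limitSet (groupOfGens γ) ⊆ W) :
    ∃ (k : ℕ) (R : FreeGroup (Fin k) →* SL2C) (Rn : ℕ → (FreeGroup (Fin k) →* SL2C)),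
      Good R ∧ Img R (groupOfGens γ) ∧ limitSet (groupOfGens γ) = Lc R ∧ (∀ x, ((R x : SL2C) : PSL2C) = 1 → x = 1) ∧
      Tendsto Rn atTop (nR R) ∧
      (∀ᶠ n in atTop, Img (Rn n) (groupOfGens (γn n)) ∧ limitSet (groupOfGens (γn n)) = Lc (Rn n)) ∧
      PP R ∧ (∃ p q r, p ∈ Lc R ∧ q ∈ Lc R ∧ r ∈ Lc R ∧ p ≠ q ∧ p ≠ r ∧ q ≠ r) ∧ infty ∉ Lc R ∧
      (∀ n, (limitSet (groupOfGens (γn n))).Nontrivial) ∧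
      ∀ᶠ m in atTop, ∃ a : SL2C, (a : PSL2C) ∈ groupOfGens γ ∧ (a : PSL2C) ∉ groupOfGens (γn m) := by
  obtain ⟨k, hk⟩ := hs
  have hk2 : 2 ≤ k := by
    by_contra h
    have : k = 0 ∨ k = 1 := by omega
    rcases this with rfl | rfl
    · exact hnc (rank0 hk)
    · exact hnc (rank1 hk)
  obtain ⟨S, hS, hF, hK, hC⟩ := hk
  set Γ := groupOfGens γ with hΓ
  set R : FreeGroup (Fin k) →* SL2C := FreeGroup.lift S.gen with hR
  have hSg : groupOfGens S.gen = Γ := hS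
  have hImg : Img R Γ := by rw [← hSg]; exact Img_lift S.gen
  have hinj : ∀ x, ((R x : SL2C) : PSL2C) = 1 → x = 1 := fun x hx => free_inj hF hx
  have hlim := limitSet_eq hImg hC.2
  have hclosed := Lc_closed hImg hC.2
  let i0 : Fin k := ⟨0, by omega⟩
  have hnt : (Lc R).Nontrivial := by
    refine lox_nt (γ := FreeGroup.of i0) ?_
    rw [hR, FreeGroup.lift_apply_of]
    exact S.lox i0
  have hdisc : DiscG R := disc_R hF (by rw [hSg]; exact hK.1)
  have h3 := three_Lc hk2 hnt hinj
  -- lifts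
  set Φ : FreeGroup (Fin g) →* SL2C := FreeGroup.lift γ with hΦ
  have hImgΦ : Img Φ Γ := Img_lift γ
  have hΦT : Tendsto (fun n => (FreeGroup.lift (γn n) : FreeGroup (Fin g) →* SL2C)) atTop (nR Φ) := by
    refine tendsto_free fun i => ?_
    simp only [hΦ, FreeGroup.lift_apply_of]
    exact dm_tendsto (hconv i)
  have hw : ∀ j, ∃ w, ((S.gen j : SL2C) : PSL2C) = (Φ w : PSL2C) := by
    intro j
    refine (hImgΦ _).1 ((hImg _).2 ⟨FreeGroup.of j, ?_⟩)
    rw [hR, FreeGroup.lift_apply_of]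
  choose w hw using hw
  set Rn : ℕ → (FreeGroup (Fin k) →* SL2C) := fun n => FreeGroup.lift (fun j => (S.gen j * (Φ (w j))⁻¹) * FreeGroup.lift (γn n) (w j)) with hRn
  have hT : Tendsto Rn atTop (nR R) := by
    refine tendsto_free fun j => ?_
    simp only [hRn, hR, FreeGroup.lift_apply_of]
    have h1 : Tendsto (fun n : ℕ => dm (S.gen j * (Φ (w j))⁻¹) (S.gen j * (Φ (w j))⁻¹)) atTop (𝓝 0) := by simp only [dm_self]; exact tendsto_const_nhds
    have := dm_mul_tendsto h1 (nR_tendsto hΦT (w j))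
    rwa [inv_mul_cancel_right] at this
  have hmem : ∀ n x, ((Rn n x : SL2C) : PSL2C) ∈ groupOfGens (γn n) := by
    intro n x
    have hle : (⊤ : Subgroup (FreeGroup (Fin k))) ≤ (groupOfGens (γn n)).comap ((QuotientGroup.mk' (Subgroup.center SL2C)).comp (Rn n)) := by
      rw [← FreeGroup.closure_range_of, Subgroup.closure_le]
      rintro _ ⟨j, rfl⟩
      show ((Rn n (FreeGroup.of j) : SL2C) : PSL2C) ∈ groupOfGens (γn n)
      simp only [hRn, FreeGroup.lift_apply_of]
      rw [QuotientGroup.mk_mul, QuotientGroup.mk_mul, QuotientGroup.mk_inv, hw, mul_inv_cancel, one_mul]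
      exact (Img_lift (γn n) _).2 ⟨_, rfl⟩
    exact hle (Subgroup.mem_top x)
  obtain ⟨δ, hδ, hz⟩ := zassR hT hk2 hinj (Γn := fun n => groupOfGens (γn n)) (fun n => (hcl n).choose_spec.2.2.2.1.1) hmem
  have hImgn : ∀ᶠ n in atTop, Img (Rn n) (groupOfGens (γn n)) := by
    have hu : ∀ i, ∃ u, ((γ i : SL2C) : PSL2C) = (R u : PSL2C) := fun i =>
      (hImg _).1 ((hImgΦ _).2 ⟨FreeGroup.of i, by rw [hΦ, FreeGroup.lift_apply_of]⟩)
    choose u hu using hu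
    have hev : ∀ i, ∀ᶠ n in atTop, ((γn n i : SL2C) : PSL2C) = (Rn n (u i) : PSL2C) := by
      intro i
      have hc1 : ((((γ i) * (R (u i))⁻¹)⁻¹ : SL2C) : PSL2C) = 1 := by
        rw [QuotientGroup.mk_inv, QuotientGroup.mk_mul, QuotientGroup.mk_inv, hu, mul_inv_cancel, inv_one]
      have h1 : Tendsto (fun n => dm (γn n i * (Rn n (u i))⁻¹) (γ i * (R (u i))⁻¹)) atTop (𝓝 0) := by
        refine dm_mul_tendsto (dm_tendsto (hconv i)) ?_
        simp only [dm_inv]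
        exact nR_tendsto hT (u i)
      have h2 : Tendsto (fun n : ℕ => dm (γ i * (R (u i))⁻¹)⁻¹ (γ i * (R (u i))⁻¹)⁻¹) atTop (𝓝 0) := by simp only [dm_self]; exact tendsto_const_nhds
      have h3 := dm_mul_tendsto h2 h1
      rw [inv_mul_cancel] at h3
      filter_upwards [hz, h3.eventually (gt_mem_nhds hδ)] with n hn hn'
      have h4 := congrArg (fun a : SL2C => (a : PSL2C)) (hn _ (by
        rw [QuotientGroup.mk_mul, hc1, one_mul, QuotientGroup.mk_mul, QuotientGroup.mk_inv]
        exact mul_mem ((Img_lift (γn n) _).2 ⟨FreeGroup.of i, by rw [FreeGroup.lift_apply_of]⟩) (inv_mem (hmem n _))) hn')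
      simp only [QuotientGroup.mk_mul] at h4
      rw [hc1, one_mul, QuotientGroup.mk_inv, QuotientGroup.mk_one] at h4
      exact mul_inv_eq_one.1 h4
    filter_upwards [eventually_all.2 hev] with n hn a
    constructor
    · intro ha
      have hle : groupOfGens (γn n) ≤ ((QuotientGroup.mk' (Subgroup.center SL2C)).comp (Rn n)).range := by
        rw [groupOfGens, Subgroup.closure_le]
        rintro _ ⟨i, rfl⟩
        exact ⟨u i, (hn i).symm⟩
      obtain ⟨x, hx⟩ := hle ha
      exact ⟨x, hx.symm⟩
    · rintro ⟨x, hx⟩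
      rw [hx]; exact hmem n x
  have hlimn : ∀ᶠ n in atTop, Img (Rn n) (groupOfGens (γn n)) ∧ limitSet (groupOfGens (γn n)) = Lc (Rn n) := by
    filter_upwards [hImgn] with n hn
    exact ⟨hn, limitSet_eq hn (hcl n).choose_spec.2.2.2.2.2⟩
  have hne : Lc R ≠ univ := by
    intro huniv
    obtain ⟨A, r, hE⟩ := exists_exp R hclosed hnt.nonempty
    obtain ⟨n, hn, hn'⟩ := (hlimn.and (hT.eventually (nrA_ev R hE.fin hE.pos))).exists
    have : Lc (Rn n) = univ := by
      apply eq_univ_of_forall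
      intro z
      refine r1path hE hn' le_rfl fun x => ?_
      rw [huniv, Metric.infDist_zero_of_mem (mem_univ _)]
      exact hE.pos
    have h := hdim n
    rw [limitDim, hn.2, this] at h
    exact absurd (one_le_dimH_univ.trans h) (not_le.2 hlam)
  have hgood : Good R := ⟨hclosed, hnt, hne, hdisc⟩
  have hg : 0 < g := by
    rcases Nat.eq_zero_or_pos g with rfl | h
    · exfalso
      have hΓ1 : Γ = ⊥ := by
        rw [hΓ, groupOfGens, Subgroup.closure_eq_bot_iff]
        rintro _ ⟨i, _⟩; exact i.elim0
      have : ((R (FreeGroup.of i0) : SL2C) : PSL2C) ∈ Γ := (hImg _).2 ⟨_, rfl⟩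
      rw [hΓ1, Subgroup.mem_bot] at this
      exact FreeGroup.of_ne_one _ (hinj _ this)
    · exact h
  have hPP : PP R := by
    obtain ⟨n, hn, hn'⟩ := (hImgn.and (hT.eventually (PP_loc hgood))).exists
    rw [← hn']
    obtain ⟨Sn, e1, _, e2, _⟩ := hcl n
    obtain ⟨η, hη⟩ := PP_classical hg Sn e2
    exact ⟨η, Img.QC (e1 ▸ Img_lift Sn.gen) hn hη⟩
  have hntn : ∀ n, (limitSet (groupOfGens (γn n))).Nontrivial := by
    intro n
    obtain ⟨Sn, e1, _⟩ := hcl n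
    have hIn : Img (FreeGroup.lift Sn.gen) (groupOfGens (γn n)) := by rw [← e1]; exact Img_lift Sn.gen
    refine (lox_nt (R := FreeGroup.lift Sn.gen) (γ := FreeGroup.of ⟨0, hg⟩) ?_).mono (Lc_sub_limitSet fun x => (hIn _).2 ⟨x, rfl⟩)
    rw [FreeGroup.lift_apply_of]
    exact Sn.lox _
  refine ⟨k, R, Rn, hgood, hImg, hlim, hinj, hT, hlimn, hPP, h3, ?_, hntn, ?_⟩
  · intro hinf
    obtain ⟨p, q, r, hp, hq, hr, hpq, hpr, hqr⟩ := h3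
    obtain ⟨B, hB⟩ := hW.isBounded.exists_norm_le
    have hb : 0 < max B 1 := by positivity
    obtain ⟨x, z, hz1, hz2, hz3⟩ := claimA3 hinf hpq hpr hqr (ε := 1 / (2 * max B 1)) (by positivity)
    have hzL : z ∈ Lc R := by rcases hz1 with rfl | rfl | rfl <;> assumption
    have hzL' := ((Lc_inv R).iff x z).2 hzL
    rcases RSphere.cases' (mobius (R x) z) with h | ⟨w, h⟩
    · exact hz2 h
    · rw [h] at hzL' hz3
      have hwB : ‖w‖ ≤ B := hB w (hWl (by rw [mem_preimage, hlim]; exact hzL'))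
      have h1 := sg_ofC_infty w
      have h2 := sg_le_dist (ofC w) infty
      rw [dist_comm] at hz3
      have h4 : max ‖w‖ 1 ≤ max B 1 := max_le_max_right _ hwB
      rw [lt_div_iff₀ (by positivity)] at hz3
      have h5 := mul_le_mul h2 h4 (by positivity) (by positivity)
      linarith
  · have hev : ∀ i, ∀ᶠ n in atTop, dm (γn n i * (γ i)⁻¹) 1 < δ := by
      intro i
      have h2 : Tendsto (fun n : ℕ => dm (γ i)⁻¹ (γ i)⁻¹) atTop (𝓝 0) := by simp only [dm_self]; exact tendsto_const_nhds
      have h3 := dm_mul_tendsto (dm_tendsto (hconv i)) h2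
      rw [mul_inv_cancel] at h3
      exact h3.eventually (gt_mem_nhds hδ)
    filter_upwards [eventually_all.2 hev, hz] with n hn hn'
    by_contra hcon
    push Not at hcon
    have : γn n = γ := by
      funext i
      have h1 : ((γ i : SL2C) : PSL2C) ∈ groupOfGens (γn n) := hcon _ (Subgroup.subset_closure ⟨i, rfl⟩)
      have h2 : ((γn n i : SL2C) : PSL2C) ∈ groupOfGens (γn n) := Subgroup.subset_closure ⟨i, rfl⟩
      exact mul_inv_eq_one.1 (hn' _ (by rw [QuotientGroup.mk_mul, QuotientGroup.mk_inv]; exact mul_mem h2 (inv_mem h1)) (hn i))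
    apply hnc
    rw [hΓ, ← this]
    exact ⟨g, hcl n⟩

lemma circleParam_cont : Continuous circleParam := by
  unfold circleParam
  exact (continuous_circleMap 0 1).subtype_mk _

lemma circleParam_inj : Set.InjOn circleParam (Ico 0 (2 * Real.pi)) := by
  intro a ha b hb h
  have h1 : circleMap 0 1 a = circleMap 0 1 b := congrArg Subtype.val h
  exact injOn_circleMap_of_abs_sub_le' (c := 0) one_ne_zero (by linarith) ha hb h1

lemma circleParam_surj (x : S1) : ∃ t ∈ Ico 0 (2 * Real.pi), circleParam t = x := by
  have hx : x.1 ∈ circleMap 0 1 '' Ioc 0 (2 * Real.pi) := by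
    rw [image_circleMap_Ioc (0:ℂ) 1]
    simpa using x.2
  obtain ⟨t, ht, e⟩ := hx
  rcases ht.2.lt_or_eq with h | h
  · exact ⟨t, ⟨ht.1.le, h⟩, Subtype.ext e⟩
  · refine ⟨0, ⟨le_rfl, by positivity⟩, Subtype.ext (Eq.trans ?_ e)⟩
    rw [h]
    simp [circleParam, circleMap]

lemma range_param (h : C(S1, ℂ)) : range h = (fun t => h (circleParam t)) '' Ico 0 (2 * Real.pi) := by
  ext y
  constructor
  · rintro ⟨x, rfl⟩
    obtain ⟨t, ht, e⟩ := circleParam_surj x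
    exact ⟨t, ht, by simp only [e]⟩
  · rintro ⟨t, _, rfl⟩
    exact ⟨_, rfl⟩

lemma edist_le_H {φ : ℝ → ℂ} (hφ : Continuous φ) {a b : ℝ} (hab : a ≤ b) : edist (φ a) (φ b) ≤ μH[1] (φ '' Ico a b) := by
  have hf : LipschitzWith 1 (fun z : ℂ => dist z (φ a)) := LipschitzWith.dist_left _
  have h1 := hf.hausdorffMeasure_image_le (d := 1) zero_le_one (φ '' Ico a b)
  simp only [ENNReal.coe_one, ENNReal.one_rpow, one_mul] at h1
  refine le_trans ?_ h1
  rw [hausdorffMeasure_real, image_image]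
  have hc : ContinuousOn (fun t => dist (φ t) (φ a)) (Icc a b) := (hφ.dist continuous_const).continuousOn
  have h2 := intermediate_value_Ico hab hc
  refine le_trans ?_ (measure_mono h2)
  simp only [dist_self, Real.volume_Ico, sub_zero]
  rw [edist_dist, dist_comm]

lemma len_le_H {h : C(S1, ℂ)} (hi : Function.Injective h) : curveLength h ≤ μH[1] (range h) := by
  set φ : ℝ → ℂ := fun t => h (circleParam t) with hφ
  have hc : Continuous φ := h.continuous.comp circleParam_cont
  have hinj : InjOn φ (Ico 0 (2 * Real.pi)) := fun a ha b hb e => circleParam_inj ha hb (hi e)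
  have key : ∀ (u : ℕ → ℝ), Monotone u → (∀ i, u i ∈ Icc 0 (2 * Real.pi)) → ∀ n, ∑ i ∈ Finset.range n, edist (φ (u (i+1))) (φ (u i)) ≤ μH[1] (φ '' Ico (u 0) (u n)) := by
    intro u hu hm n
    induction n with
    | zero => simp
    | succ n ih =>
      have e : Ico (u 0) (u (n+1)) = Ico (u 0) (u n) ∪ Ico (u n) (u (n+1)) := (Ico_union_Ico_eq_Ico (hu (Nat.zero_le _)) (hu (Nat.le_succ _))).symm
      have hsub : ∀ i, Ico (u i) (u (n+1)) ⊆ Ico 0 (2 * Real.pi) := fun i x hx => ⟨(hm i).1.trans hx.1, hx.2.trans_le (hm (n+1)).2⟩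
      have hsub0 : Ico (u 0) (u n) ⊆ Ico 0 (2 * Real.pi) := fun x hx => ⟨(hm 0).1.trans hx.1, hx.2.trans_le (hm n).2⟩
      rw [Finset.sum_range_succ, e, image_union, measure_union]
      · refine add_le_add ih ?_
        rw [edist_comm]
        exact edist_le_H hc (hu (Nat.le_succ _))
      · refine Set.disjoint_left.2 ?_
        rintro _ ⟨a, ha, rfl⟩ ⟨b, hb, e⟩
        have := hinj (hsub n hb) (hsub0 ha) e
        subst this
        exact not_lt.2 hb.1 ha.2
      · exact measurableSet_Ico.image_of_continuousOn_injOn hc.continuousOn (hinj.mono (hsub n))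
  rw [range_param, curveLength, eVariationOn]
  refine iSup_le ?_
  rintro ⟨n, u, hu, hm⟩
  refine (key u hu hm n).trans (measure_mono (image_mono ?_))
  exact fun x hx => ⟨(hm 0).1.trans hx.1, hx.2.trans_le (hm n).2⟩

lemma H_le_len (h : C(S1, ℂ)) : μH[1] (range h) ≤ curveLength h := by
  by_cases hfin : curveLength h = ⊤
  · rw [hfin]; exact le_top
  set φ : ℝ → ℂ := fun t => h (circleParam t) with hφ
  set I := Icc 0 (2 * Real.pi) with hI
  have h0 : (0:ℝ) ∈ I := ⟨le_rfl, by positivity⟩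
  have hbv : BoundedVariationOn φ I := hfin
  have hloc := hbv.locallyBoundedVariationOn
  set s : ℝ → ℝ := fun t => variationOnFromTo φ I 0 t with hs
  have hd : ∀ a ∈ I, ∀ b ∈ I, a ≤ b → dist (φ a) (φ b) ≤ dist (s a) (s b) := by
    intro a ha b hb hab
    have h1 := variationOnFromTo.add hloc h0 ha hb
    have h2 : variationOnFromTo φ I a b = s b - s a := by simp only [hs]; linarith
    have h3 : edist (φ a) (φ b) ≤ eVariationOn φ (I ∩ Icc a b) := eVariationOn.edist_le _ ⟨ha, le_rfl, hab⟩ ⟨hb, hab, le_rfl⟩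
    rw [dist_edist, dist_comm (s a), Real.dist_eq, ← h2, variationOnFromTo.eq_of_le _ _ hab, abs_of_nonneg ENNReal.toReal_nonneg]
    exact ENNReal.toReal_mono (hloc a b ha hb) h3
  have hd' : ∀ a ∈ I, ∀ b ∈ I, dist (φ a) (φ b) ≤ dist (s a) (s b) := by
    intro a ha b hb
    rcases le_total a b with h | h
    · exact hd a ha b hb h
    · rw [dist_comm, dist_comm (s a)]; exact hd b hb a ha h
  set g : ℝ → ℂ := φ ∘ Function.invFunOn s I with hg
  have hgs : ∀ a ∈ I, g (s a) = φ a := by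
    intro a ha
    have hex : ∃ b ∈ I, s b = s a := ⟨a, ha, rfl⟩
    have h1 := Function.invFunOn_mem hex
    have h2 := Function.invFunOn_eq hex
    have := hd' _ h1 _ ha
    rw [h2, dist_self] at this
    exact dist_le_zero.1 this
  have hL : LipschitzOnWith 1 g (s '' I) := by
    apply LipschitzOnWith.of_dist_le_mul
    rintro _ ⟨a, ha, rfl⟩ _ ⟨b, hb, rfl⟩
    rw [hgs a ha, hgs b hb, NNReal.coe_one, one_mul]
    exact hd' a ha b hb
  have h1 := hL.hausdorffMeasure_image_le (d := 1) zero_le_one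
  simp only [ENNReal.coe_one, ENNReal.one_rpow, one_mul, hausdorffMeasure_real] at h1
  have h2 : range h ⊆ g '' (s '' I) := by
    rw [range_param]
    rintro _ ⟨t, ht, rfl⟩
    exact ⟨s t, ⟨t, Ico_subset_Icc_self ht, rfl⟩, hgs t (Ico_subset_Icc_self ht)⟩
  refine (measure_mono h2).trans (h1.trans ?_)
  have h3 : s '' I ⊆ Icc 0 (curveLength h).toReal := by
    rintro _ ⟨t, ht, rfl⟩
    simp only [hs, variationOnFromTo.eq_of_le _ _ ht.1]
    exact ⟨ENNReal.toReal_nonneg, ENNReal.toReal_mono hfin (eVariationOn.mono _ inter_subset_left)⟩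
  refine (measure_mono h3).trans ?_
  rw [Real.volume_Icc, sub_zero, ENNReal.ofReal_toReal hfin]

lemma len_lsc {f : C(S1, ℂ)} {v : ℝ≥0∞} (hv : v < curveLength f) : ∃ δ > 0, ∀ h : C(S1, ℂ), (∀ t, dist (h t) (f t) < δ) → v < curveLength h := by
  by_contra hcon
  push Not at hcon
  have : ∀ n : ℕ, ∃ h : C(S1, ℂ), (∀ t, dist (h t) (f t) < 1 / ((n:ℝ) + 1)) ∧ curveLength h ≤ v := fun n => hcon _ (by positivity)
  choose h h1 h2 using this
  have ht : ∀ x ∈ Icc 0 (2 * Real.pi), Tendsto (fun n => (fun t => h n (circleParam t)) x) atTop (𝓝 ((fun t => f (circleParam t)) x)) := by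
    intro x _
    rw [tendsto_iff_dist_tendsto_zero]
    exact squeeze_zero (fun _ => dist_nonneg) (fun n => (h1 n _).le) tendsto_one_div_add_atTop_nhds_zero_nat
  obtain ⟨n, hn⟩ := (eVariationOn.lowerSemicontinuous_aux ht hv).exists
  exact absurd hn (not_lt.2 (h2 n))

/-! ### lengths -/
def toC : RSphere → ℂ := Function.invFun ofC

lemma toC_ofC (z : ℂ) : toC (ofC z) = z := Function.leftInverse_invFun ofC_injective z

lemma toC_lip {B : ℝ} (hB : 0 ≤ B) : LipschitzOnWith (Real.toNNReal (2 * B ^ 2)) toC (ofC '' {b | max ‖b‖ 1 ≤ B}) := by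
  refine LipschitzOnWith.of_dist_le_mul ?_
  rintro _ ⟨a, ha, rfl⟩ _ ⟨b, hb, rfl⟩
  simp only [mem_setOf_eq] at ha hb
  rw [toC_ofC, toC_ofC, Real.coe_toNNReal _ (by positivity), dist_eq_norm, ← sg_ofC]
  have := sg_le_dist (ofC a) (ofC b)
  calc _ ≤ 2 * dist (ofC a) (ofC b) * (B * B) := by gcongr
    _ = _ := by ring

lemma near_ofC {B ε : ℝ} (hB : 1 ≤ B) (hε : 0 ≤ ε) (hεB : ε * (8 * B) ≤ 1) {a : ℂ} (ha : ‖a‖ ≤ B) {y : RSphere} (hy : dist y (ofC a) ≤ ε) :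
    ∃ b, y = ofC b ∧ max ‖b‖ 1 ≤ 2 * B ∧ ‖b - a‖ ≤ 4 * ε * B ^ 2 ∧ max ‖b‖ 1 ≤ (1 + 4 * ε * B ^ 2) * max ‖a‖ 1 := by
  have hMa : max ‖a‖ 1 ≤ B := max_le ha hB
  have hMa1 : 1 ≤ max ‖a‖ 1 := le_max_right _ _
  have hs : sg (ofC a) y ≤ 2 * ε := by
    have := sg_le_dist (ofC a) y
    rw [dist_comm] at this; linarith
  rcases RSphere.cases' y with h | ⟨b, h⟩
  · exfalso
    rw [h] at hs
    have h1 := sg_ofC_infty a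
    have : sg (ofC a) infty * max ‖a‖ 1 ≤ 2 * ε * B := by gcongr
    nlinarith
  · rw [h] at hs
    have h1 := sg_ofC a b
    have hMb1 : 1 ≤ max ‖b‖ 1 := le_max_right _ _
    have h2 : ‖a - b‖ ≤ 2 * ε * (B * max ‖b‖ 1) := by rw [← h1]; gcongr
    have h3 : max ‖b‖ 1 ≤ max ‖a‖ 1 + ‖a - b‖ := by
      refine max_le ?_ (by linarith [norm_nonneg (a - b)])
      have : ‖b‖ ≤ ‖a‖ + ‖a - b‖ := by
        have := norm_sub_le a (a - b); rwa [sub_sub_cancel] at this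
      linarith [le_max_left ‖a‖ 1]
    have h4 : 2 * ε * (B * max ‖b‖ 1) ≤ max ‖b‖ 1 / 4 := by nlinarith
    have h5 : max ‖b‖ 1 ≤ 2 * B := by linarith
    have h6 : ‖a - b‖ ≤ 4 * ε * B ^ 2 := by
      calc _ ≤ 2 * ε * (B * (2 * B)) := h2.trans (by gcongr)
        _ = _ := by ring
    refine ⟨b, h, h5, by rwa [norm_sub_rev], ?_⟩
    have : 0 ≤ 4 * ε * B ^ 2 := by positivity
    nlinarith

section Rep20
variable {G : Type*} [Group G]

lemma LB' {R : G →* SL2C} {M : Set RSphere} (hi : GInv R M) {y y' : RSphere} (hy : y ∈ M) (hy' : y' ∈ M) (hne : y ≠ y') (γ : G) (z : RSphere) :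
    sg y y' / 64 * Metric.infDist z M * mn (R γ) ≤ Nn (R γ) z := by
  obtain ⟨w, hw, hb⟩ := near_mn (R γ) z hne
  have : mobius (R γ)⁻¹ w ∈ M := by
    rw [← map_inv]; apply hi; rcases hw with rfl | rfl <;> assumption
  have h3 := Metric.infDist_le_dist_of_mem (x := z) this
  have := mn_nonneg (R γ)
  have := sg_pos hne
  have : Metric.infDist z M * (sg y y' * mn (R γ)) ≤ dist z (mobius (R γ)⁻¹ w) * (sg y y' * mn (R γ)) := by
    gcongr
  linarith

lemma STC.nn {R R1 : G →* SL2C} {ρ ε : ℝ} {F0 D : V2 → V2} {Ψ : RSphere ≃ₜ RSphere} (h : STC R R1 ρ ε F0 D Ψ)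
    {p0 p1 : RSphere} (h0 : p0 ∈ Lc R) (h1 : p1 ∈ Lc R) (hp : p0 ≠ p1) {r0 : ℝ} (hr0 : 0 < r0) (he1 : ε ≤ dist p0 p1 / 4) (he2 : ε ≤ r0 / 4)
    {z : RSphere} (hz : r0 ≤ Metric.infDist z (Lc R)) (γ : G) :
    dist p0 p1 * r0 / 512 * mn (R1 γ) ≤ Nn (R1 γ) (Ψ z) := by
  have hd := dist_pos.2 hp
  have hA : ∀ x y, dist x y - 2 * ε ≤ dist (Ψ x) (Ψ y) := by
    intro x y
    have h2 := h.close x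
    have h3 := h.close y
    have h4 := dist_triangle4 x (Ψ x) (Ψ y) y
    rw [dist_comm x (Ψ x)] at h4
    linarith
  have hm : ∀ p ∈ Lc R, Ψ p ∈ Lc R1 := fun p hp => h.img ▸ mem_image_of_mem _ hp
  have hL := LB' (Lc_inv R1) (hm _ h0) (hm _ h1) (Ψ.injective.ne hp) γ (Ψ z)
  have hs : dist p0 p1 / 4 ≤ sg (Ψ p0) (Ψ p1) := by
    have := hA p0 p1
    have := dist_le_sg (Ψ p0) (Ψ p1)
    linarith
  have hi : r0 / 2 ≤ Metric.infDist (Ψ z) (Lc R1) := by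
    refine (Metric.le_infDist ⟨_, hm _ h0⟩).2 ?_
    rw [← h.img]
    rintro _ ⟨y, hy, rfl⟩
    have := hA z y
    have := Metric.infDist_le_dist_of_mem (x := z) hy
    linarith
  have := mn_nonneg (R1 γ)
  have := sg_nonneg (Ψ p0) (Ψ p1)
  calc _ = dist p0 p1 / 4 / 64 * (r0 / 2) * mn (R1 γ) := by ring
    _ ≤ _ := by gcongr
    _ ≤ _ := hL

lemma lenC [Countable G] {R R1 : G →* SL2C} {η : Set RSphere} {X : Set ℂ} (hX : ofC '' X = η) (hη : QC R η) {B : ℝ} (hB : 1 ≤ B) (hXB : ∀ a ∈ X, ‖a‖ ≤ B)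
    {r0 c θ : ℝ} (hr0 : 0 < r0) (hcov : ∀ z, z ∉ Lc R → ∃ γ, r0 < Metric.infDist (mobius (R γ) z) (Lc R))
    {p0 p1 : RSphere} (h0 : p0 ∈ Lc R) (h1 : p1 ∈ Lc R) (hp : p0 ≠ p1) (hc : 0 < c) (hcmp : ∀ γ, c * mn (R γ) ^ (1 - θ) ≤ mn (R1 γ))
    {ρ ε : ℝ} (hρ : ρ ≤ r0) (hε : 0 ≤ ε) (hεB : ε * (8 * B) ≤ 1) (he0 : ε ≤ 1) (he1 : ε ≤ dist p0 p1 / 4) (he2 : ε ≤ r0 / 4)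
    {F0 D : V2 → V2} {Ψ : RSphere ≃ₜ RSphere} (h : STC R R1 ρ ε F0 D Ψ) (hΛ : μH[1] (Lc R1) = 0) (F : Set G)
    (hF : ∀ γ ∈ F, ∀ z, r0 ≤ Metric.infDist z (Lc R) → ρ ≤ Metric.infDist (mobius (R γ) z) (Lc R)) :
    μH[1] ((fun a => toC (Ψ (ofC a))) '' X) ≤
      ENNReal.ofReal ((1 + ε) * (1 + 4 * ε * B ^ 2) ^ 2) * μH[1] {a ∈ X | ∃ γ ∈ F, ∃ z, r0 ≤ Metric.infDist z (Lc R) ∧ ofC a = mobius (R γ) z} +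
      ∑' γ : ↥Fᶜ, ENNReal.ofReal (16 * B ^ 2 / (dist p0 p1 * r0 / 512 * c) ^ 2 * mn (R γ) ^ (-(2 * (1 - θ)))) * μH[1] (η ∩ {z | r0 ≤ Metric.infDist z (Lc R)}) := by
  have hnear : ∀ a ∈ X, ∃ b, Ψ (ofC a) = ofC b ∧ max ‖b‖ 1 ≤ 2 * B ∧ ‖b - a‖ ≤ 4 * ε * B ^ 2 ∧ max ‖b‖ 1 ≤ (1 + 4 * ε * B ^ 2) * max ‖a‖ 1 :=
    fun a ha => near_ofC hB hε hεB (hXB a ha) (h.close _)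
  have hd := dist_pos.2 hp
  set φ : ℂ → ℂ := fun a => toC (Ψ (ofC a)) with hφ
  set XF : Set ℂ := {a ∈ X | ∃ γ ∈ F, ∃ z, r0 ≤ Metric.infDist z (Lc R) ∧ ofC a = mobius (R γ) z} with hXF
  set K0 : Set RSphere := {z | r0 ≤ Metric.infDist z (Lc R)} with hK0
  -- cover
  have hsub : φ '' X ⊆ toC '' (Lc R1 ∩ ofC '' {b | max ‖b‖ 1 ≤ 2 * B}) ∪ (φ '' XF ∪ ⋃ γ : ↥Fᶜ, (fun z => toC (mobius (R1 γ) (Ψ z))) '' (η ∩ K0)) := by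
    rintro _ ⟨a, ha, rfl⟩
    by_cases hL : ofC a ∈ Lc R
    · left
      obtain ⟨b, e, hb, _⟩ := hnear a ha
      refine ⟨Ψ (ofC a), ⟨h.img ▸ mem_image_of_mem _ hL, b, hb, e.symm⟩, rfl⟩
    · right
      obtain ⟨γ, hγ⟩ := hcov _ hL
      have e : ofC a = mobius (R γ⁻¹) (mobius (R γ) (ofC a)) := by rw [map_inv, mobius_inv_mobius]
      by_cases hγF : γ⁻¹ ∈ F
      · left
        exact ⟨a, ⟨ha, γ⁻¹, hγF, _, hγ.le, e⟩, rfl⟩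
      · right
        refine mem_iUnion.2 ⟨⟨γ⁻¹, hγF⟩, mobius (R γ) (ofC a), ⟨?_, hγ.le⟩, ?_⟩
        · rw [← hη.inv γ]
          exact mem_image_of_mem _ (hX ▸ mem_image_of_mem _ ha)
        · simp only [hφ, ← h.eqv, ← e]
  refine (measure_mono hsub).trans ((measure_union_le _ _).trans ?_)
  -- limit set
  have hz : μH[1] (toC '' (Lc R1 ∩ ofC '' {b | max ‖b‖ 1 ≤ 2 * B})) = 0 := by
    have hL := (toC_lip (B := 2 * B) (by positivity)).mono (inter_subset_right (s := Lc R1))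
    have := hL.hausdorffMeasure_image_le (d := 1) zero_le_one
    rw [measure_mono_null inter_subset_left hΛ, mul_zero] at this
    exact le_antisymm this bot_le
  rw [hz, zero_add]
  refine (measure_union_le _ _).trans (add_le_add ?_ ?_)
  · have hL : LipschitzOnWith (Real.toNNReal ((1 + ε) * (1 + 4 * ε * B ^ 2) ^ 2)) φ XF := by
      refine LipschitzOnWith.of_dist_le_mul ?_
      have hρ' : ∀ a ∈ XF, ρ ≤ Metric.infDist (ofC a) (Lc R) := by
        rintro a ⟨_, γ, hγ, z, hz, e⟩
        rw [e]; exact hF γ hγ z hz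
      intro a ha b hb
      obtain ⟨a', ea, _, _, ha'⟩ := hnear a ha.1
      obtain ⟨b', eb, _, _, hb'⟩ := hnear b hb.1
      have hs := (abs_le.1 (h.sgc _ _ (hρ' a ha) (hρ' b hb))).2
      rw [ea, eb] at hs
      simp only [hφ, ea, eb, toC_ofC]
      rw [Real.coe_toNNReal _ (by positivity), dist_eq_norm, dist_eq_norm, ← sg_ofC, ← sg_ofC]
      have := sg_nonneg (ofC a) (ofC b)
      calc _ ≤ ((1 + ε) * sg (ofC a) (ofC b)) * (((1 + 4 * ε * B ^ 2) * max ‖a‖ 1) * ((1 + 4 * ε * B ^ 2) * max ‖b‖ 1)) := by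
            gcongr; linarith
        _ = _ := by ring
    have := hL.hausdorffMeasure_image_le (d := 1) zero_le_one
    rwa [ENNReal.rpow_one] at this
  · refine (measure_iUnion_le _).trans (ENNReal.tsum_le_tsum fun γ => ?_)
    set κ := dist p0 p1 * r0 / 512 with hκ
    have hκ0 : 0 < κ := by positivity
    have hL : LipschitzOnWith (Real.toNNReal (16 * B ^ 2 / (κ * c) ^ 2 * mn (R γ) ^ (-(2 * (1 - θ))))) (fun z => toC (mobius (R1 γ) (Ψ z))) (η ∩ K0) := by
      refine LipschitzOnWith.of_dist_le_mul ?_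
      have hmn : 0 < mn (R γ) := by linarith [one_le_mn (R γ)]
      have hmn1 : 0 < mn (R1 γ) := by linarith [one_le_mn (R1 γ)]
      have hpt : ∀ z ∈ η, ∃ b, mobius (R1 γ) (Ψ z) = ofC b ∧ max ‖b‖ 1 ≤ 2 * B := by
        intro z hz
        have : mobius (R γ) z ∈ η := by rw [← hη.inv γ]; exact mem_image_of_mem _ hz
        rw [← hX] at this
        obtain ⟨a, ha, e⟩ := this
        obtain ⟨b, hb, hb', _⟩ := hnear a ha
        exact ⟨b, by rw [← h.eqv, ← e, hb], hb'⟩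
      rintro z ⟨hz, hz'⟩ w ⟨hw, hw'⟩
      obtain ⟨a, ea, ha⟩ := hpt z hz
      obtain ⟨b, eb, hb⟩ := hpt w hw
      have hnz := h.nn h0 h1 hp hr0 he1 he2 hz' γ
      have hnw := h.nn h0 h1 hp hr0 he1 he2 hw' γ
      have hs := (abs_le.1 (h.sgc z w (hρ.trans hz') (hρ.trans hw'))).2
      have hs2 : sg (Ψ z) (Ψ w) ≤ 4 * dist z w := by
        have := sg_le_dist z w
        have := sg_nonneg z w
        nlinarith
      have hs3 : sg (ofC a) (ofC b) ≤ 4 * dist z w / (κ * mn (R1 γ)) ^ 2 := by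
        rw [← ea, ← eb, sg_mobius_eq, sq]
        have := Nn_pos (R1 γ) (Ψ z)
        gcongr
      simp only [ea, eb, toC_ofC]
      rw [Real.coe_toNNReal _ (by positivity), dist_eq_norm, ← sg_ofC]
      have e1 : mn (R γ) ^ (-(2 * (1 - θ))) = 1 / (mn (R γ) ^ (1 - θ)) ^ 2 := by
        rw [Real.rpow_neg hmn.le, mul_comm, Real.rpow_mul hmn.le, one_div]; norm_cast
      calc _ ≤ 4 * dist z w / (κ * mn (R1 γ)) ^ 2 * (2 * B * (2 * B)) := by gcongr
        _ ≤ 4 * dist z w / (κ * (c * mn (R γ) ^ (1 - θ))) ^ 2 * (2 * B * (2 * B)) := by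
            gcongr; exact hcmp γ
        _ = _ := by
            rw [e1]
            have : mn (R γ) ^ (1 - θ) ≠ 0 := (Real.rpow_pos_of_pos hmn _).ne'
            field_simp
            ring
    have := hL.hausdorffMeasure_image_le (d := 1) zero_le_one
    rwa [ENNReal.rpow_one] at this
end Rep20

section Rep21
variable {G : Type*} [Group G]

lemma STC.mono {R R1 : G →* SL2C} {ρ ρ' ε ε' : ℝ} {F0 D : V2 → V2} {Ψ : RSphere ≃ₜ RSphere} (h : STC R R1 ρ ε F0 D Ψ) (hρ : ρ ≤ ρ') (hε : ε ≤ ε') :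
    STC R R1 ρ' ε' F0 D Ψ :=
  ⟨h.eqv, fun z => (h.close z).trans hε, fun z w hz hw => (h.sgc z w (hρ.trans hz) (hρ.trans hw)).trans (by
    have := sg_nonneg z w; gcongr), h.img, h.form⟩

lemma Hfin {R : G →* SL2C} (hR : Good R) {η : Set RSphere} (hη : QC R η) {r : ℝ} (hr : 0 < r) : μH[1] (η ∩ {z | r ≤ Metric.infDist z (Lc R)}) < ⊤ := by
  have hK : IsCompact {z : RSphere | r ≤ Metric.infDist z (Lc R)} := (isClosed_le continuous_const (Metric.continuous_infDist_pt _)).isCompact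
  rw [inter_comm]
  refine hK.induction_on (p := fun s => μH[1] (s ∩ η) < ⊤) (by simp) (fun s t hst h => (measure_mono (inter_subset_inter_left _ hst)).trans_lt h) ?_ ?_
  · intro s t hs ht
    rw [union_inter_distrib_right]
    exact (measure_union_le _ _).trans_lt (ENNReal.add_lt_top.2 ⟨hs, ht⟩)
  · intro z hz
    have hz' : z ∉ Lc R := fun h => by
      have h2 : r ≤ Metric.infDist z (Lc R) := hz
      rw [Metric.infDist_zero_of_mem h] at h2
      linarith
    obtain ⟨U, hU, hU'⟩ := hη.loc z hz'
    exact ⟨U, mem_nhdsWithin_of_mem_nhds hU, by rwa [inter_comm]⟩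

lemma sumR {R : G →* SL2C} (hR : Good R) {Rn : ℕ → (G →* SL2C)} (hT : Tendsto Rn atTop (nR R)) {lam : ℝ≥0∞} (hlam : lam < 1)
    (hdim : ∀ᶠ n in atTop, dimH (Lc (Rn n)) ≤ lam) :
    ∃ θ c : ℝ, 0 < c ∧ Summable (fun γ => mn (R γ) ^ (-(2 * (1 - θ)))) ∧ ∀ᶠ n in atTop, (∀ γ, c * mn (R γ) ^ (1 - θ) ≤ mn (Rn n γ)) ∧ Good (Rn n) ∧ μH[1] (Lc (Rn n)) = 0 := by
  obtain ⟨s0, hs1, hs2⟩ := ENNReal.lt_iff_exists_nnreal_btwn.1 hlam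
  have hs2' : s0 < 1 := by exact_mod_cast hs2
  set s : ℝ≥0 := max s0 (1/2) with hs
  have hsp : 0 < s := lt_of_lt_of_le (by norm_num) (le_max_right _ _)
  have hs1' : s < 1 := max_lt hs2' (by rw [← NNReal.coe_lt_coe]; push_cast; norm_num)
  have hlams : lam < (s : ℝ≥0∞) := hs1.trans_le (by exact_mod_cast le_max_left _ _)
  set θ : ℝ := (1 - s) / 2 with hθ
  have hsr : (s : ℝ) < 1 := by exact_mod_cast hs1'
  have hsp' : 0 < (s : ℝ) := by exact_mod_cast hsp
  obtain ⟨c, hc, hev⟩ := Compare hR (θ := θ) (by rw [hθ]; linarith) (by rw [hθ]; linarith)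
  have hev' := (hT.eventually hev).and hdim
  refine ⟨θ, c, hc, ?_, ?_⟩
  · obtain ⟨n, ⟨-, ⟨c1, hc1, h1⟩, hg⟩, hd⟩ := hev'.exists
    have hz : μH[(s:ℝ)] (Lc (Rn n)) = 0 := hausdorffMeasure_of_dimH_lt (hd.trans_lt hlams)
    refine Summable.of_nonneg_of_le (fun γ => Real.rpow_nonneg (mn_nonneg _) _) (fun γ => ?_) ((Poinc hg hsp' hz).mul_left (c1 ^ (-(2 * (1 - θ)))))
    have hm : 1 ≤ mn (Rn n γ) := one_le_mn _
    have hp : 0 < c1 * mn (Rn n γ) ^ (1 - θ) := mul_pos hc1 (Real.rpow_pos_of_pos (by linarith) _)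
    have hle : -(2 * (1 - θ)) ≤ 0 := by rw [hθ]; linarith
    refine (Real.rpow_le_rpow_of_nonpos hp (h1 γ) hle).trans ?_
    rw [Real.mul_rpow hc1.le (Real.rpow_nonneg (by linarith) _), ← Real.rpow_mul (by linarith)]
    gcongr
    rw [hθ]; nlinarith
  · filter_upwards [hev'] with n hn
    refine ⟨hn.1.1, hn.1.2.2, ?_⟩
    have := hausdorffMeasure_of_dimH_lt (s := Lc (Rn n)) (d := 1) (hn.2.trans_lt (by simpa using hlam))
    simpa using this

lemma mkh {R R1 : G →* SL2C} {ρ ε B : ℝ} {F0 D : V2 → V2} {Ψ : RSphere ≃ₜ RSphere} (h : STC R R1 ρ ε F0 D Ψ) {f : C(S1, ℂ)} (hfi : Function.Injective f)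
    (hB : 1 ≤ B) (hfB : ∀ t, ‖f t‖ ≤ B) (hε : 0 ≤ ε) (hεB : ε * (8 * B) ≤ 1) :
    ∃ h : C(S1, ℂ), Function.Injective h ∧ range h = (fun a => toC (Ψ (ofC a))) '' range f ∧ (∀ t, ofC (h t) = Ψ (ofC (f t))) ∧ ∀ t, dist (h t) (f t) ≤ 4 * ε * B ^ 2 := by
  have hn : ∀ t, ∃ b, Ψ (ofC (f t)) = ofC b ∧ max ‖b‖ 1 ≤ 2 * B ∧ ‖b - f t‖ ≤ 4 * ε * B ^ 2 := fun t => by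
    obtain ⟨b, h1, h2, h3, _⟩ := near_ofC hB hε hεB (hfB t) (h.close _)
    exact ⟨b, h1, h2, h3⟩
  have hc : Continuous fun t => toC (Ψ (ofC (f t))) :=
    (toC_lip (B := 2 * B) (by positivity)).continuousOn.comp_continuous (Ψ.continuous.comp (continuous_ofC.comp f.continuous)) (fun t => by
      obtain ⟨b, h1, h2, _⟩ := hn t
      exact ⟨b, h2, h1.symm⟩)
  have he : ∀ t, ofC (toC (Ψ (ofC (f t)))) = Ψ (ofC (f t)) := fun t => by
    obtain ⟨b, h1, _⟩ := hn t
    rw [h1, toC_ofC]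
  refine ⟨⟨_, hc⟩, fun t t' e => ?_, ?_, he, fun t => ?_⟩
  · simp only [ContinuousMap.coe_mk] at e
    have := congrArg ofC e
    rw [he, he] at this
    exact hfi (ofC_injective (Ψ.injective this))
  · rw [← range_comp]; rfl
  · obtain ⟨b, h1, _, h2⟩ := hn t
    simp only [ContinuousMap.coe_mk, h1, toC_ofC]
    rwa [dist_eq_norm]

lemma lenT [Countable G] {R : G →* SL2C} (hR : Good R) {Rn : ℕ → (G →* SL2C)} (hT : Tendsto Rn atTop (nR R)) {lam : ℝ≥0∞} (hlam : lam < 1)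
    (hdim : ∀ᶠ n in atTop, dimH (Lc (Rn n)) ≤ lam) {η : Set RSphere} (hη : QC R η) {f : C(S1, ℂ)} (hfi : Function.Injective f) (hf : ofC '' range f = η) :
    curveLength f < ⊤ ∧ ∀ ε' > 0, ∃ ρ > 0, ∃ ε > 0, (∀ z, z ∉ Lc R → ∃ γ, ρ < Metric.infDist (mobius (R γ) z) (Lc R)) ∧ ε ≤ 1/2 ∧
      ∀ᶠ n in atTop, ∀ F0 D Ψ, STC R (Rn n) ρ ε F0 D Ψ → ∃ h : C(S1, ℂ), Function.Injective h ∧ (∀ t, ofC (h t) = Ψ (ofC (f t))) ∧ (∀ t, dist (h t) (f t) < ε') ∧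
        curveLength h < ⊤ ∧ |(curveLength h).toReal - (curveLength f).toReal| < ε' := by
  obtain ⟨B0, hB0⟩ := (isCompact_range f.continuous).isBounded.exists_norm_le
  set B := max B0 1 with hBd
  have hB : 1 ≤ B := le_max_right _ _
  have hfB : ∀ t, ‖f t‖ ≤ B := fun t => (hB0 _ ⟨t, rfl⟩).trans (le_max_left _ _)
  have hXB : ∀ a ∈ range f, ‖a‖ ≤ B := by rintro _ ⟨t, rfl⟩; exact hfB t
  obtain ⟨p0, h0, p1, h1, hp⟩ := hR.nt
  have hd := dist_pos.2 hp
  obtain ⟨r0, hr0, hcov⟩ := hR.cov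
  obtain ⟨θ, c, hc, hsum, hev⟩ := sumR hR hT hlam hdim
  set K := 16 * B ^ 2 / (dist p0 p1 * r0 / 512 * c) ^ 2 with hK
  set M := μH[1] (η ∩ {z | r0 ≤ Metric.infDist z (Lc R)}) with hM
  have hMfin : M < ⊤ := Hfin hR hη hr0
  set t : G → ℝ≥0∞ := fun γ => ENNReal.ofReal (K * mn (R γ) ^ (-(2 * (1 - θ)))) * M with ht
  have htfin : ∑' γ, t γ ≠ ⊤ := by
    rw [ht, ENNReal.tsum_mul_right]
    refine ENNReal.mul_ne_top ?_ hMfin.ne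
    rw [← ENNReal.ofReal_tsum_of_nonneg _ (hsum.mul_left K)]
    · exact ENNReal.ofReal_ne_top
    · intro γ
      have := Real.rpow_nonneg (mn_nonneg (R γ)) (-(2 * (1 - θ)))
      positivity
  set ε0 := min (min (1 / (8 * B)) (1/2)) (min (dist p0 p1 / 4) (r0 / 4)) with hε0
  have hε0p : 0 < ε0 := by positivity
  have hε01 : ε0 * (8 * B) ≤ 1 := by
    rw [← le_div_iff₀ (by positivity)]; exact (min_le_left _ _).trans (min_le_left _ _)
  have hε02 : ε0 ≤ 1/2 := (min_le_left _ _).trans (min_le_right _ _)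
  have hε03 : ε0 ≤ dist p0 p1 / 4 := (min_le_right _ _).trans (min_le_left _ _)
  have hε04 : ε0 ≤ r0 / 4 := (min_le_right _ _).trans (min_le_right _ _)
  have hfin : curveLength f ≤ ∑' γ, t γ := by
    by_contra hcon
    obtain ⟨δ, hδ, hl⟩ := len_lsc (not_le.1 hcon)
    set ε := min ε0 (δ / (8 * B ^ 2)) with hε
    have hεp : 0 < ε := by positivity
    have hεle : ε ≤ ε0 := min_le_left _ _
    obtain ⟨κ, hκ, hS⟩ := STab hR hr0 hεp
    obtain ⟨n, ⟨F0, -, hn⟩, hcmp, -, hz⟩ := ((hT.eventually hS).and hev).exists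
    obtain ⟨Ψ, hΨ⟩ := hn _ (DOK_zero R r0 hκ.le)
    have hεB : ε * (8 * B) ≤ 1 := le_trans (by gcongr) hε01
    obtain ⟨h, hi, hr, he, hdd⟩ := mkh hΨ hfi hB hfB hεp.le hεB
    have hlen := lenC hf hη hB hXB hr0 hcov h0 h1 hp hc hcmp le_rfl hεp.le hεB (by linarith) (hεle.trans hε03) (hεle.trans hε04) hΨ hz ∅ (by simp)
    rw [← hr] at hlen
    have h2 : curveLength h ≤ ∑' γ, t γ := by
      refine (len_le_H hi).trans (hlen.trans ?_)
      simp only [mem_empty_iff_false, false_and, exists_false, and_false, setOf_false, measure_empty, mul_zero, zero_add]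
      exact ENNReal.tsum_comp_le_tsum_of_injective (f := ((↑) : ↥(∅ᶜ : Set G) → G)) Subtype.val_injective t
    refine absurd h2 (not_le.2 (hl h fun x => (hdd x).trans_lt ?_))
    have : ε ≤ δ / (8 * B ^ 2) := min_le_right _ _
    rw [le_div_iff₀ (by positivity)] at this
    linarith
  have hfin' : curveLength f < ⊤ := hfin.trans_lt htfin.lt_top
  refine ⟨hfin', fun ε' hε' => ?_⟩
  set L := (curveLength f).toReal with hL
  have hL0 : 0 ≤ L := ENNReal.toReal_nonneg
  have hfL : curveLength f = ENNReal.ofReal L := (ENNReal.ofReal_toReal hfin'.ne).symm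
  obtain ⟨F, hF⟩ := ((ENNReal.tendsto_tsum_compl_atTop_zero htfin).eventually (gt_mem_nhds (ENNReal.ofReal_pos.2 (show 0 < ε' / 3 by positivity)))).exists
  -- choose ρ
  obtain ⟨ρ, hρ, hρr, hρF⟩ : ∃ ρ > 0, ρ ≤ r0 ∧ ∀ γ ∈ F, ∀ z, r0 ≤ Metric.infDist z (Lc R) → ρ ≤ Metric.infDist (mobius (R γ) z) (Lc R) := by
    have hK : IsCompact {z : RSphere | r0 ≤ Metric.infDist z (Lc R)} := (isClosed_le continuous_const (Metric.continuous_infDist_pt _)).isCompact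
    have h1 : ∀ γ, ∃ ρ > 0, ∀ z, r0 ≤ Metric.infDist z (Lc R) → ρ ≤ Metric.infDist (mobius (R γ) z) (Lc R) := by
      intro γ
      rcases {z : RSphere | r0 ≤ Metric.infDist z (Lc R)}.eq_empty_or_nonempty with he | hne
      · exact ⟨1, one_pos, fun z hz => absurd (show z ∈ {z : RSphere | r0 ≤ Metric.infDist z (Lc R)} from hz) (by rw [he]; simp)⟩
      · obtain ⟨z, hz, hmin⟩ := hK.exists_isMinOn hne ((Metric.continuous_infDist_pt (Lc R)).comp (continuous_mobius (R γ))).continuousOn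
        refine ⟨_, ?_, fun w hw => hmin hw⟩
        have hz' : z ∉ Lc R := fun h => by
          have h2 : r0 ≤ Metric.infDist z (Lc R) := hz
          rw [Metric.infDist_zero_of_mem h] at h2
          linarith
        exact (hR.closed.notMem_iff_infDist_pos hR.nt.nonempty).1 (fun h => hz' (((Lc_inv R).iff γ z).1 h))
    choose ρ hρ hρ' using h1
    obtain ⟨m, hm, hm'⟩ : ∃ m > 0, ∀ γ ∈ F, m ≤ ρ γ := by
      classical
      refine Finset.induction_on F ⟨1, one_pos, by simp⟩ ?_
      rintro a s _ ⟨m, hm, h⟩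
      exact ⟨min m (ρ a), lt_min hm (hρ a), by
        intro γ hγ
        rcases Finset.mem_insert.1 hγ with rfl | h'
        · exact min_le_right _ _
        · exact (min_le_left _ _).trans (h _ h')⟩
    exact ⟨min m r0, lt_min hm hr0, min_le_right _ _, fun γ hγ z hz => (min_le_left _ _).trans ((hm' γ hγ).trans (hρ' γ z hz))⟩
  -- lower bound δ
  obtain ⟨δ, hδ, hlow⟩ : ∃ δ > 0, ∀ h : C(S1, ℂ), (∀ t, dist (h t) (f t) < δ) → ENNReal.ofReal (L - ε' / 2) ≤ curveLength h := by
    by_cases hv : ENNReal.ofReal (L - ε' / 2) < curveLength f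
    · obtain ⟨δ, hδ, h⟩ := len_lsc hv
      exact ⟨δ, hδ, fun k hk => (h k hk).le⟩
    · refine ⟨1, one_pos, fun h _ => ?_⟩
      have hx : L - ε' / 2 ≤ 0 := by
        by_contra hx
        exact hv (by rw [hfL, ENNReal.ofReal_lt_ofReal_iff_of_nonneg] <;> linarith)
      rw [ENNReal.ofReal_of_nonpos hx]; exact bot_le
  -- choose ε
  obtain ⟨ε1, hε1, hε1'⟩ : ∃ ε1 > 0, ∀ ε, 0 ≤ ε → ε ≤ ε1 → (1 + ε) * (1 + 4 * ε * B ^ 2) ^ 2 * L < L + ε' / 3 := by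
    have hcont : Continuous fun ε : ℝ => (1 + ε) * (1 + 4 * ε * B ^ 2) ^ 2 * L := by fun_prop
    have := (hcont.tendsto 0).eventually (gt_mem_nhds (show (1 + (0:ℝ)) * (1 + 4 * 0 * B ^ 2) ^ 2 * L < L + ε' / 3 by norm_num; linarith))
    obtain ⟨e, he, h⟩ := Metric.eventually_nhds_iff.1 this
    exact ⟨e / 2, by positivity, fun ε h1 h2 => h (by rw [Real.dist_eq, sub_zero, abs_of_nonneg h1]; linarith)⟩
  set ε := min (min ε0 ε1) (min (δ / (8 * B ^ 2)) (ε' / (8 * B ^ 2))) with hε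
  have hεp : 0 < ε := by positivity
  have hεle : ε ≤ ε0 := (min_le_left _ _).trans (min_le_left _ _)
  have hεB : ε * (8 * B) ≤ 1 := le_trans (by gcongr) hε01
  have hεδ : 4 * ε * B ^ 2 < δ := by
    have : ε ≤ δ / (8 * B ^ 2) := (min_le_right _ _).trans (min_le_left _ _)
    rw [le_div_iff₀ (by positivity)] at this
    linarith
  have hεε : 4 * ε * B ^ 2 < ε' := by
    have : ε ≤ ε' / (8 * B ^ 2) := (min_le_right _ _).trans (min_le_right _ _)
    rw [le_div_iff₀ (by positivity)] at this
    linarith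
  refine ⟨ρ, hρ, ε, hεp, fun z hz => ?_, hεle.trans hε02, ?_⟩
  · obtain ⟨γ, hγ⟩ := hcov z hz
    exact ⟨γ, hρr.trans_lt hγ⟩
  filter_upwards [hev] with n hn F0 D Ψ hΨ
  obtain ⟨hcmp, -, hz⟩ := hn
  obtain ⟨h, hi, hr, he, hdd⟩ := mkh hΨ hfi hB hfB hεp.le hεB
  have hlen := lenC hf hη hB hXB hr0 hcov h0 h1 hp hc hcmp hρr hεp.le hεB (by linarith) (hεle.trans hε03) (hεle.trans hε04) hΨ hz (↑F) (fun γ hγ => hρF γ (by simpa using hγ))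
  rw [← hr] at hlen
  have hup : curveLength h ≤ ENNReal.ofReal (L + ε' / 3 + ε' / 3) := by
    refine (len_le_H hi).trans (hlen.trans ?_)
    rw [ENNReal.ofReal_add (by positivity) (by positivity)]
    refine add_le_add ?_ hF.le
    refine (mul_le_mul' le_rfl ((measure_mono (sep_subset _ _)).trans (H_le_len f))).trans ?_
    rw [hfL, ← ENNReal.ofReal_mul (by positivity)]
    exact ENNReal.ofReal_le_ofReal (hε1' ε hεp.le ((min_le_left _ _).trans (min_le_right _ _))).le
  have hlo := hlow h fun x => (hdd x).trans_lt hεδ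
  have hhfin : curveLength h < ⊤ := hup.trans_lt ENNReal.ofReal_lt_top
  refine ⟨h, hi, he, fun x => (hdd x).trans_lt hεε, hhfin, ?_⟩
  have hup' : (curveLength h).toReal ≤ L + ε' / 3 + ε' / 3 := ENNReal.toReal_le_of_le_ofReal (by positivity) hup
  have hlo' : L - ε' / 2 ≤ (curveLength h).toReal := (ENNReal.ofReal_le_iff_le_toReal hhfin.ne).1 hlo
  rw [abs_lt]
  constructor <;> linarith
end Rep21

section Rep22
variable {G : Type*} [Group G]

lemma stab_fin {R : G →* SL2C} (hR : Good R) {z1 : RSphere} (hz : z1 ∉ Lc R) (htf : ∀ γ : G, IsOfFinOrder γ → γ = 1)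
    {γ : G} (h : mobius (R γ) z1 = z1) : γ = 1 := by
  apply htf
  have h0 : 0 < Metric.infDist z1 (Lc R) := (hR.closed.notMem_iff_infDist_pos hR.nt.nonempty).1 hz
  have hfin := fin_T hR h0 h0
  have hp : ∀ n : ℕ, mobius (R (γ ^ n)) z1 = z1 := by
    intro n
    induction n with
    | zero => simp [mobius_one]
    | succ n ih => rw [pow_succ, map_mul, mobius_mul, h, ih]
  by_contra hno
  have hinj := injective_pow_iff_not_isOfFinOrder.2 hno
  refine Set.infinite_range_of_injective hinj (hfin.subset ?_)
  rintro _ ⟨n, rfl⟩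
  refine ⟨z1, le_rfl, ?_⟩
  have : mobius (R (γ ^ n)⁻¹) z1 = z1 := by
    conv_lhs => rw [← hp n]
    rw [map_inv, mobius_inv_mobius]
  rw [this]

/-- cut-off -/
def chi (z1 : RSphere) (δ : ℝ) (z : RSphere) : ℝ := max 0 (min 1 (2 - dist z z1 / δ))

lemma chi_nn (z1 : RSphere) (δ : ℝ) (z : RSphere) : 0 ≤ chi z1 δ z := le_max_left _ _
lemma chi_le (z1 : RSphere) (δ : ℝ) (z : RSphere) : chi z1 δ z ≤ 1 := max_le zero_le_one (min_le_left _ _)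
lemma chi_one {z1 : RSphere} {δ : ℝ} (hδ : 0 < δ) {z : RSphere} (h : dist z z1 < δ) : chi z1 δ z = 1 := by
  have : dist z z1 / δ ≤ 1 := (div_le_one hδ).2 h.le
  rw [chi, min_eq_left (by linarith), max_eq_right zero_le_one]
lemma chi_zero {z1 : RSphere} {δ : ℝ} (hδ : 0 < δ) {z : RSphere} (h : ¬ dist z z1 < 2 * δ) : chi z1 δ z = 0 := by
  have : 2 ≤ dist z z1 / δ := (le_div_iff₀ hδ).2 (not_lt.1 h)
  rw [chi, max_eq_left]
  exact (min_le_right _ _).trans (by linarith)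
lemma chi_lip (z1 : RSphere) {δ : ℝ} (hδ : 0 < δ) (z w : RSphere) : |chi z1 δ z - chi z1 δ w| ≤ 1 / δ * dist z w := by
  unfold chi
  refine (abs_max_sub_max_le_max _ _ _ _).trans ?_
  have h1 : |min 1 (2 - dist z z1 / δ) - min 1 (2 - dist w z1 / δ)| ≤ 1 / δ * dist z w := by
    refine (abs_min_sub_min_le_max _ _ _ _).trans ?_
    have h2 : |(2 - dist z z1 / δ) - (2 - dist w z1 / δ)| ≤ 1 / δ * dist z w := by
      have e : (2 - dist z z1 / δ) - (2 - dist w z1 / δ) = 1 / δ * (dist w z1 - dist z z1) := by field_simp; ring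
      rw [e, abs_mul, abs_of_pos (by positivity)]
      gcongr
      rw [dist_comm z w]
      exact abs_dist_sub_le _ _ _
    simp only [sub_self, abs_zero]
    exact max_le (by positivity) h2
  simp only [sub_self, abs_zero]
  exact max_le (by positivity) h1

lemma Qf_lip' {L : ℝ} {φ : RSphere → ℝ} (hL : 0 ≤ L) (nn : ∀ z, 0 ≤ φ z) (le1 : ∀ z, φ z ≤ 1)
    (lip : ∀ z w, |φ z - φ w| ≤ L * dist z w) (u v : V2) : ‖Qf φ u - Qf φ v‖ ≤ (1 + 4 * L) * ‖u - v‖ := by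
  by_cases hu : u = 0
  · simp only [hu, Qf, smul_zero, zero_sub, norm_neg, norm_smul, Complex.norm_real, Real.norm_of_nonneg (nn _)]
    have := le1 (pr v); have := norm_nonneg v
    nlinarith [nn (pr v), mul_nonneg hL this]
  by_cases hv : v = 0
  · simp only [hv, Qf, smul_zero, sub_zero, norm_smul, Complex.norm_real, Real.norm_of_nonneg (nn _)]
    have := le1 (pr u); have := norm_nonneg u
    nlinarith [nn (pr u), mul_nonneg hL this]
  have e : Qf φ u - Qf φ v = ((φ (pr u) - φ (pr v) : ℝ) : ℂ) • u + (φ (pr v) : ℂ) • (u - v) := by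
    simp only [Qf, Complex.ofReal_sub, sub_smul, smul_sub]; abel
  rw [e]
  refine (norm_add_le _ _).trans ?_
  rw [norm_smul, norm_smul, Complex.norm_real, Complex.norm_real, Real.norm_eq_abs, Real.norm_of_nonneg (nn _)]
  have a := mul_le_mul_of_nonneg_right (lip (pr u) (pr v)) (norm_nonneg u)
  have b := mul_le_mul_of_nonneg_left (dist_pr_le hu hv) hL
  have c := mul_le_mul_of_nonneg_right (le1 (pr v)) (norm_nonneg (u - v))
  linarith

lemma sep_one (g : SL2C) {z1 w : RSphere} (h : mobius g w ≠ z1) :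
    ∀ᶠ δ : ℝ in 𝓝[>] 0, ∀ z, dist z w < 2 * δ → ¬ dist (mobius g z) z1 < 2 * δ := by
  have hd : 0 < dist (mobius g w) z1 := dist_pos.2 h
  obtain ⟨δ1, h1, h2⟩ := Metric.continuous_iff.1 (continuous_mobius g) w _ (half_pos hd)
  have : ∀ᶠ δ : ℝ in 𝓝[>] 0, δ < min (δ1 / 2) (dist (mobius g w) z1 / 4) :=
    nhdsWithin_le_nhds (gt_mem_nhds (lt_min (by positivity) (by positivity)))
  filter_upwards [this] with δ hδ z hz hz'
  have a := h2 z (by linarith [hδ.trans_le (min_le_left _ _)])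
  have b := hδ.trans_le (min_le_right _ _)
  have c := dist_triangle (mobius g w) (mobius g z) z1
  rw [dist_comm (mobius g w) (mobius g z)] at c
  linarith

lemma pert {R : G →* SL2C} (hR : Good R) (htf : ∀ γ : G, IsOfFinOrder γ → γ = 1) {ρ : ℝ} (hρ : 0 < ρ) {z1 w1 : RSphere}
    (hz : ρ < Metric.infDist z1 (Lc R)) (hw : w1 ∉ Lc R → ∀ γ, mobius (R γ) w1 ≠ z1) :
    ∃ δ > 0, ∃ C > 0, (∀ z, dist z z1 < δ → ρ ≤ Metric.infDist z (Lc R)) ∧ ∀ B : V2 →L[ℂ] V2, ∃ D, DOK R ρ (C * ‖B‖) D ∧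
      ∀ R1 : G →* SL2C, (∀ z, dist z z1 < δ → AV R R1 D (lft z) = B (lft z)) ∧ (w1 ∉ Lc R → AV R R1 D (lft w1) = 0) := by
  have hz1 : z1 ∉ Lc R := (hR.closed.notMem_iff_infDist_pos hR.nt.nonempty).2 (hρ.trans hz)
  have e1 : ∀ᶠ δ : ℝ in 𝓝[>] 0, ∀ z, dist z z1 < 2 * δ → ρ ≤ Metric.infDist z (Lc R) := by
    have : ∀ᶠ δ : ℝ in 𝓝[>] 0, δ < (Metric.infDist z1 (Lc R) - ρ) / 2 :=
      nhdsWithin_le_nhds (gt_mem_nhds (by linarith))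
    filter_upwards [this] with δ hδ z hz
    have := Metric.infDist_le_infDist_add_dist (s := Lc R) (x := z1) (y := z)
    rw [dist_comm] at this
    linarith
  have e2 : ∀ᶠ δ : ℝ in 𝓝[>] 0, ∀ γ ∈ {γ : G | ∃ z, ρ ≤ Metric.infDist z (Lc R) ∧ ρ ≤ Metric.infDist (mobius (R γ⁻¹) z) (Lc R)},
      γ ≠ 1 → ∀ z, dist z z1 < 2 * δ → ¬ dist (mobius (R γ⁻¹) z) z1 < 2 * δ := by
    refine (Filter.eventually_all_finite (fin_T hR hρ hρ)).2 fun γ _ => ?_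
    by_cases h1 : γ = 1
    · exact Eventually.of_forall fun δ h => absurd h1 h
    · filter_upwards [sep_one (R γ⁻¹) (z1 := z1) (w := z1) (fun h => h1 (inv_eq_one.1 (stab_fin hR hz1 htf h)))] with δ h _ using h
  have e3 : ∀ᶠ δ : ℝ in 𝓝[>] 0, w1 ∉ Lc R → ∀ γ ∈ {γ : G | ∃ z, Metric.infDist w1 (Lc R) ≤ Metric.infDist z (Lc R) ∧ ρ ≤ Metric.infDist (mobius (R γ⁻¹) z) (Lc R)},
      ¬ dist (mobius (R γ⁻¹) w1) z1 < 2 * δ := by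
    by_cases hw1 : w1 ∈ Lc R
    · exact Eventually.of_forall fun δ h => absurd hw1 h
    have h0 : 0 < Metric.infDist w1 (Lc R) := (hR.closed.notMem_iff_infDist_pos hR.nt.nonempty).1 hw1
    have : ∀ᶠ δ : ℝ in 𝓝[>] 0, ∀ γ ∈ {γ : G | ∃ z, Metric.infDist w1 (Lc R) ≤ Metric.infDist z (Lc R) ∧ ρ ≤ Metric.infDist (mobius (R γ⁻¹) z) (Lc R)},
      ¬ dist (mobius (R γ⁻¹) w1) z1 < 2 * δ := by
      refine (Filter.eventually_all_finite (fin_T hR h0 hρ)).2 fun γ _ => ?_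
      filter_upwards [sep_one (R γ⁻¹) (hw hw1 γ⁻¹), self_mem_nhdsWithin] with δ h hδ
      exact h w1 (by rw [dist_self]; have : (0:ℝ) < δ := hδ; linarith)
    filter_upwards [this] with δ h _ using h
  obtain ⟨δ, hδ, h1, h2, h3⟩ := ((eventually_mem_nhdsWithin (s := Ioi (0:ℝ)) (a := 0)).and (e1.and (e2.and e3))).exists
  have hδ : 0 < δ := hδ
  refine ⟨δ, hδ, 1 + 4 * (1 / δ), by positivity, fun z hz => h1 z (by linarith), fun B => ⟨fun u => B (Qf (chi z1 δ) u), ⟨?_, ?_, ?_⟩, ?_⟩⟩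
  · intro c u; simp only [Qf_hom, map_smul]
  · intro u v
    rw [← map_sub]
    refine (B.le_opNorm _).trans ?_
    have := Qf_lip' (L := 1 / δ) (by positivity) (chi_nn z1 δ) (chi_le z1 δ) (chi_lip z1 hδ) u v
    have := mul_le_mul_of_nonneg_left this (norm_nonneg B)
    linarith
  · intro u hu h
    have : ¬ dist (pr u) z1 < 2 * δ := fun h' => absurd (h1 _ h') (not_le.2 h)
    simp [Qf, chi_zero hδ this]
  · intro R1
    have key : ∀ (γ : G) z, ¬ dist (mobius (R γ⁻¹) z) z1 < 2 * δ → act (R1 γ) (B (Qf (chi z1 δ) (act (R γ⁻¹) (lft z)))) = 0 := by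
      intro γ z h
      rw [mobius_eq] at h
      rw [Qf, chi_zero hδ h]; simp [act_zero]
    refine ⟨fun z hz => ?_, fun hw1 => ?_⟩
    · rw [AV, finsum_eq_single _ (1 : G)]
      · simp [act_one, Qf, pr_lft, chi_one hδ hz]
      · intro γ hγ
        apply key
        intro h
        exact h2 γ ⟨z, h1 _ (by linarith), h1 _ h⟩ hγ z (by linarith) h
    · rw [AV]
      have : ∀ γ : G, act (R1 γ) (B (Qf (chi z1 δ) (act (R γ⁻¹) (lft w1)))) = 0 := by
        intro γ
        apply key
        intro h
        exact h3 hw1 γ ⟨w1, le_rfl, h1 _ h⟩ h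
      simp only [this, finsum_zero]

lemma projD (u : V2) {e : V2} (he : ‖e‖ = 1) : ∃ c : ℂ, ‖u - c • e‖ ≤ ‖dt u e‖ := by
  have h : max ‖e.1‖ ‖e.2‖ = 1 := he
  rcases le_total ‖e.1‖ ‖e.2‖ with hl | hl
  · rw [max_eq_right hl] at h
    have h0 : e.2 ≠ 0 := by intro h'; simp [h'] at h
    refine ⟨u.2 / e.2, ?_⟩
    have a : u - (u.2 / e.2) • e = (dt u e / e.2, 0) := by
      ext <;> simp [dt] <;> field_simp
      ring
    rw [a, Prod.norm_def]
    simp [h]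
  · rw [max_eq_left hl] at h
    have h0 : e.1 ≠ 0 := by intro h'; simp [h'] at h
    refine ⟨u.1 / e.1, ?_⟩
    have a : u - (u.1 / e.1) • e = (0, - dt u e / e.1) := by
      ext <;> simp [dt] <;> field_simp
      ring
    rw [a, Prod.norm_def]
    simp [h]

lemma exB {l : V2} (hl : ‖l‖ = 1) (w : V2) : ∃ B : V2 →L[ℂ] V2, B l = w ∧ ‖B‖ ≤ ‖w‖ := by
  have h0 : l ≠ 0 := by intro h; simp [h] at hl
  obtain ⟨φ, h1, h2⟩ := exists_dual_vector ℂ l (by simpa using h0)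
  refine ⟨φ.smulRight w, by simp [h2, hl], ?_⟩
  rw [ContinuousLinearMap.norm_smulRight_apply, h1, one_mul]

lemma DOK.mono {R : G →* SL2C} {ρ κ κ' : ℝ} {D : V2 → V2} (h : DOK R ρ κ D) (hk : κ ≤ κ') : DOK R ρ κ' D :=
  ⟨h.hom, fun u v => (h.lip u v).trans (by gcongr), h.van⟩

lemma AV_zero (R R1 : G →* SL2C) (u : V2) : AV R R1 (fun _ => 0) u = 0 := by
  simp [AV, act_zero]

lemma hole {R R1 : G →* SL2C} (hR : Good R) (htf : ∀ γ : G, IsOfFinOrder γ → γ = 1) {ρ ε κ : ℝ} (hρ : 0 < ρ) (hε : ε ≤ 1/2)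
    (hκ : 0 < κ) {F0 : V2 → V2} (hF : ∀ z, ρ ≤ Metric.infDist z (Lc R) → ‖F0 (lft z) - lft z‖ ≤ ε)
    (hS : ∀ D, DOK R ρ κ D → ∃ Ψ : RSphere ≃ₜ RSphere, STC R R1 ρ ε F0 D Ψ)
    {Ψo : RSphere ≃ₜ RSphere} (h0 : STC R R1 ρ ε F0 (fun _ => 0) Ψo) {z1 w1 : RSphere}
    (hz : ρ < Metric.infDist z1 (Lc R)) (hw : w1 ∉ Lc R → ∀ γ, mobius (R γ) w1 ≠ z1) {η : Set RSphere}
    (hnd : ∀ δ > 0, ∃ z, dist z z1 < δ ∧ z ∉ η) :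
    ∃ D Ψ, STC R R1 ρ ε F0 D Ψ ∧ Ψo z1 ∉ Ψ '' η ∧ (w1 ∉ Lc R → Ψ w1 = Ψo w1) := by
  obtain ⟨δ, hδ, C, hC, h1, h2⟩ := pert hR htf hρ hz hw
  have hm : 0 < min (1/8) (κ / (4 * C)) := lt_min (by norm_num) (by positivity)
  obtain ⟨δ', hδ', h3⟩ := Metric.continuous_iff.1 Ψo.continuous z1 (min (1/8) (κ / (4 * C)) / 2) (half_pos hm)
  obtain ⟨z, hzd, hzη⟩ := hnd (min δ δ') (lt_min hδ hδ')
  have hzδ : dist z z1 < δ := hzd.trans_le (min_le_left _ _)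
  have hzρ := h1 z hzδ
  have hzL : z ∉ Lc R := (hR.closed.notMem_iff_infDist_pos hR.nt.nonempty).2 (hρ.trans_le hzρ)
  have hd := h3 z (hzd.trans_le (min_le_right _ _))
  set u := F0 (lft z) with hu
  have hun : ‖u - lft z‖ ≤ 1 / 2 := (hF z hzρ).trans hε
  have hl := norm_lft z
  have hu1 : 1/2 ≤ ‖u‖ := by
    have := norm_sub_norm_le (lft z) u
    rw [norm_sub_rev] at this; linarith
  have hu2 : ‖u‖ ≤ 2 := by
    have := norm_sub_norm_le u (lft z)
    linarith
  have hune : u ≠ 0 := by intro h; rw [h] at hu1; simp at hu1; linarith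
  have hP : Ψo z = pr u := by rw [h0.form z hzL, AV_zero, add_zero]
  set y0 := Ψo z1
  obtain ⟨c, hc⟩ := projD u (norm_lft y0)
  have hsg : ‖dt u (lft y0)‖ ≤ 4 * dist (Ψo z) y0 := by
    have a := sg_pr hune (lft_ne y0)
    rw [pr_lft, ← hP, norm_lft, mul_one] at a
    have b := sg_le_dist (Ψo z) y0
    have := sg_nonneg (Ψo z) y0
    rw [← a]; nlinarith
  have hk1 : ‖u - c • lft y0‖ < 1/2 := by
    have := min_le_left (1/8) (κ / (4 * C)); linarith
  have hk2 : C * ‖u - c • lft y0‖ ≤ κ := by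
    have a := min_le_right (1/8) (κ / (4 * C))
    have b : ‖u - c • lft y0‖ ≤ 4 * (κ / (4 * C)) := by linarith
    calc C * ‖u - c • lft y0‖ ≤ C * (4 * (κ / (4 * C))) := by gcongr
      _ = κ := by field_simp
  have hcne : c ≠ 0 := by
    intro h; rw [h, zero_smul, sub_zero] at hk1; linarith
  obtain ⟨B, hB1, hB2⟩ := exB hl (c • lft y0 - u)
  obtain ⟨D, hD, hDA⟩ := h2 B
  have hBn : C * ‖B‖ ≤ κ := by
    rw [norm_sub_rev] at hB2
    exact (mul_le_mul_of_nonneg_left hB2 hC.le).trans hk2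
  obtain ⟨Ψ, hΨ⟩ := hS D (hD.mono hBn)
  refine ⟨D, Ψ, hΨ, ?_, ?_⟩
  · have e : Ψ z = y0 := by
      rw [hΨ.form z hzL, (hDA R1).1 z hzδ, hB1, ← hu, add_sub_cancel, pr_smul hcne, pr_lft]
    rintro ⟨x, hx, hxe⟩
    exact hzη ((Ψ.injective (hxe.trans e.symm)) ▸ hx)
  · intro hw1
    rw [hΨ.form w1 hw1, (hDA R1).2 hw1, h0.form w1 hw1, AV_zero]

end Rep22

section Rep23
variable {G : Type*} [Group G]

lemma toC_sub {S : Set RSphere} {c : ℝ} (hc : 0 < c) (h : ∀ z ∈ S, c ≤ dist z infty) :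
    S ⊆ ofC '' {b : ℂ | max ‖b‖ 1 ≤ 2 / c} := by
  intro z hz
  have hd := h z hz
  rcases RSphere.cases' z with rfl | ⟨b, rfl⟩
  · rw [dist_self] at hd; linarith
  · refine ⟨b, ?_, rfl⟩
    have a := sg_ofC_infty b
    have e := dist_le_sg (ofC b) infty
    show max ‖b‖ 1 ≤ 2 / c
    rw [le_div_iff₀ hc]
    have : 0 < max ‖b‖ 1 := lt_max_of_lt_right one_pos
    nlinarith

lemma closed_far {S : Set RSphere} (hS : IsClosed S) (h : infty ∉ S) : ∃ c > 0, ∀ z ∈ S, c ≤ dist z infty := by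
  obtain ⟨c, hc, hb⟩ := Metric.isOpen_iff.1 hS.isOpen_compl infty h
  refine ⟨c, hc, fun z hz => ?_⟩
  by_contra hlt
  exact hb (Metric.mem_ball.2 (not_le.1 hlt)) hz

lemma fin_near {U : Set RSphere} (hU : IsOpen U) (hne : U.Nonempty) : ∃ a : ℂ, ofC a ∈ U := by
  obtain ⟨z, hz⟩ := hne
  rcases RSphere.cases' z with rfl | ⟨b, rfl⟩
  · obtain ⟨c, hc, hb⟩ := Metric.isOpen_iff.1 hU infty hz
    obtain ⟨n, hn⟩ := exists_nat_gt (2 / c)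
    refine ⟨(n : ℂ), hb (Metric.mem_ball.2 ?_)⟩
    have a := sg_ofC_infty (n : ℂ)
    have e := dist_le_sg (ofC (n : ℂ)) infty
    rw [div_lt_iff₀ hc] at hn
    have h1 : (n : ℝ) ≤ max ‖(n : ℂ)‖ 1 := by simp
    have h2 : 0 < max ‖(n : ℂ)‖ 1 := lt_max_of_lt_right one_pos
    by_contra hlt
    have h3 := not_lt.1 hlt
    nlinarith
  · exact ⟨b, hz⟩

lemma open_H {U : Set RSphere} (hU : IsOpen U) (hne : U.Nonempty) : μH[1] U = ⊤ := by
  obtain ⟨a, ha⟩ := fin_near hU hne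
  by_contra hfin
  set V : Set ℂ := ofC ⁻¹' U ∩ Metric.ball a 1 with hV
  have hVo : IsOpen V := (hU.preimage continuous_ofC).inter Metric.isOpen_ball
  have hVn : V.Nonempty := ⟨a, ha, Metric.mem_ball_self one_pos⟩
  have hVe : V = toC '' (ofC '' V) := by
    rw [image_image]; simp [toC_ofC]
  have hsub : ofC '' V ⊆ ofC '' {b : ℂ | max ‖b‖ 1 ≤ ‖a‖ + 1} := by
    apply image_mono
    intro b hb
    have h1 : dist b a < 1 := hb.2
    rw [dist_eq_norm] at h1
    have := norm_sub_norm_le b a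
    show max ‖b‖ 1 ≤ ‖a‖ + 1
    exact max_le (by linarith) (by linarith [norm_nonneg a])
  have h1 : μH[1] V ≠ ⊤ := by
    rw [hVe]
    refine ne_top_of_le_ne_top ?_ (((toC_lip (B := ‖a‖ + 1) (by positivity)).mono hsub).hausdorffMeasure_image_le zero_le_one)
    refine ENNReal.mul_ne_top (by simp) (ne_top_of_le_ne_top hfin (measure_mono ?_))
    rintro _ ⟨b, hb, rfl⟩; exact hb.1
  have h2 : dimH V ≤ ((1 : ℝ≥0) : ℝ≥0∞) := dimH_le_of_hausdorffMeasure_ne_top (by simpa using h1)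
  rw [Real.dimH_of_nonempty_interior (by rwa [hVo.interior_eq]), Complex.finrank_real_complex] at h2
  norm_num at h2

lemma QC.nd {R : G →* SL2C} {η : Set RSphere} (h : QC R η) {z1 : RSphere} (hz : z1 ∉ Lc R) :
    ∀ δ > 0, ∃ z, dist z z1 < δ ∧ z ∉ η := by
  intro δ hδ
  by_contra hcon
  push Not at hcon
  obtain ⟨U, hU, hf⟩ := h.loc z1 hz
  have hn : Metric.ball z1 δ ∩ U ∈ 𝓝 z1 := inter_mem (Metric.ball_mem_nhds _ hδ) hU
  have : μH[1] (interior (Metric.ball z1 δ ∩ U)) = ⊤ := open_H isOpen_interior ⟨z1, mem_interior_iff_mem_nhds.2 hn⟩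
  refine hf.ne (top_le_iff.1 (this ▸ measure_mono ?_))
  intro z hz
  have := interior_subset hz
  exact ⟨hcon z this.1, this.2⟩

lemma fix_count {b : SL2C} (h : (b : PSL2C) ≠ 1) : {z | mobius b z = z}.Countable := by
  have hb1 : b ≠ 1 := by rintro rfl; exact h rfl
  have hb2 : b ≠ -1 := by rintro rfl; exact h (psl_neg 1)
  have heig : ∀ z, mobius b z = z → ∃ l : ℂ, act b (lft z) = l • lft z := by
    intro z hz
    obtain ⟨c, -, -, hc⟩ := act_lft b z
    exact ⟨c, by rw [hc, hz]⟩
  have hdt : ∀ z w, z ≠ w → dt (lft z) (lft w) ≠ 0 := by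
    intro z w hzw h0
    have := sg_pos hzw
    rw [sg, h0, norm_zero] at this
    exact lt_irrefl _ this
  rcases eq_empty_or_nonempty {z | mobius b z = z} with he | ⟨p, hp⟩
  · rw [he]; exact countable_empty
  have hsub : ({z | mobius b z = z} \ {p}).Subsingleton := by
    rintro q ⟨hq, hqp⟩ r ⟨hr, hrp⟩
    by_contra hqr
    obtain ⟨lp, ep⟩ := heig p hp
    obtain ⟨lq, eq⟩ := heig q hq
    obtain ⟨lr, er⟩ := heig r hr
    have h1 := dt_act b (lft p) (lft q)
    have h2 := dt_act b (lft p) (lft r)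
    rw [ep, eq, dt_smul] at h1
    rw [ep, er, dt_smul] at h2
    have a1 : lp * lq = 1 := mul_right_cancel₀ (hdt p q (fun h => hqp h.symm)) (by rw [h1, one_mul])
    have a2 : lp * lr = 1 := mul_right_cancel₀ (hdt p r (fun h => hrp h.symm)) (by rw [h2, one_mul])
    have a0 : lp ≠ 0 := by rintro rfl; simp at a1
    have a3 : lq = lr := mul_left_cancel₀ a0 (a1.trans a2.symm)
    rw [← a3] at er
    rcases scal_of_eig (hdt q r hqr) eq er with h | h
    · exact hb1 h
    · exact hb2 h
  exact (hsub.countable.union (countable_singleton p)).mono (by intro z hz; by_cases h : z = p <;> simp [h]; exact hz)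

lemma IsJordanCurve.compact {η : Set RSphere} (h : IsJordanCurve η) : IsCompact η := by
  obtain ⟨f, hf, -, rfl⟩ := h
  exact (isCompact_sphere (0:ℂ) 1).image_of_continuousOn hf

lemma mkf {η : Set RSphere} (h : IsJordanCurve η) (hi : infty ∉ η) : ∃ f : C(S1, ℂ), Function.Injective f ∧ ofC '' range f = η := by
  obtain ⟨c, hc, hfar⟩ := closed_far h.compact.isClosed hi
  have hsub := toC_sub hc hfar
  obtain ⟨φ, hφ, hinj, rfl⟩ := h
  have hcont : ContinuousOn toC (φ '' unitCircle) := ((toC_lip (by positivity)).mono hsub).continuousOn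
  have hfc : Continuous fun t : S1 => toC (φ t) :=
    hcont.comp_continuous (continuousOn_iff_continuous_restrict.1 hφ) fun t => ⟨t, t.2, rfl⟩
  have hof : ∀ t : S1, ofC (toC (φ t)) = φ t := by
    intro t
    obtain ⟨b, -, hb⟩ := hsub ⟨(t : ℂ), t.2, rfl⟩
    rw [← hb, toC_ofC]
  refine ⟨⟨_, hfc⟩, fun s t hst => ?_, ?_⟩
  · have : toC (φ s) = toC (φ t) := hst
    have e : φ s = φ t := by rw [← hof s, this, hof t]
    exact Subtype.ext (hinj s.2 t.2 e)
  · ext z; constructor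
    · rintro ⟨_, ⟨t, rfl⟩, rfl⟩
      exact ⟨t, t.2, (hof t).symm⟩
    · rintro ⟨t, ht, rfl⟩
      exact ⟨_, ⟨⟨t, ht⟩, rfl⟩, hof ⟨t, ht⟩⟩

lemma mkinf {R : G →* SL2C} (hR : Good R) (htf : ∀ γ : G, IsOfFinOrder γ → γ = 1) (hi : infty ∉ Lc R) (hP : PP R) :
    ∃ η, QC R η ∧ infty ∉ η := by
  obtain ⟨η0, h0⟩ := hP
  obtain ⟨r, hr, hcov⟩ := hR.cov
  have hI : 0 < Metric.infDist infty (Lc R) := (hR.closed.notMem_iff_infDist_pos hR.nt.nonempty).1 hi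
  set I := Metric.infDist infty (Lc R) with hIdef
  have hρ : 0 < min r (I / 2) := lt_min hr (by positivity)
  have hε : 0 < min (1/2) (I / 4) := lt_min (by norm_num) (by positivity)
  have hcov' : ∀ z, z ∉ Lc R → ∃ γ, min r (I / 2) < Metric.infDist (mobius (R γ) z) (Lc R) := by
    intro z hz
    obtain ⟨γ, hγ⟩ := hcov z hz
    exact ⟨γ, (min_le_left _ _).trans_lt hγ⟩
  obtain ⟨κ, hκ, hev⟩ := STab hR hρ hε
  obtain ⟨F0, hF, hS⟩ := (pure_le_nR R) hev
  obtain ⟨Ψo, hΨo⟩ := hS _ (DOK_zero R _ hκ.le)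
  set z1 := Ψo.symm infty with hz1
  have e1 : Ψo z1 = infty := by rw [hz1, Homeomorph.apply_symm_apply]
  have hz : min r (I / 2) < Metric.infDist z1 (Lc R) := by
    have a := hΨo.close z1
    rw [e1] at a
    have b := Metric.infDist_le_infDist_add_dist (s := Lc R) (x := infty) (y := z1)
    have := min_le_right (1/2) (I / 4)
    have := min_le_right r (I / 2)
    linarith
  have hzL : z1 ∉ Lc R := (hR.closed.notMem_iff_infDist_pos hR.nt.nonempty).2 (hρ.trans hz)
  obtain ⟨w, hw⟩ := hR.nt.nonempty
  obtain ⟨D, Ψ, hΨ, hn, -⟩ := hole hR htf hρ (min_le_left _ _) hκ hF hS hΨo (w1 := w) hz (fun h => absurd hw h) (h0.nd hzL)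
  rw [e1] at hn
  exact ⟨_, hΨ.QC_fwd (min_le_left _ _) hcov' h0, hn⟩

end Rep23

section Rep24
variable {G : Type*} [Group G]

lemma null_mobius {N : Set RSphere} (h : μH[1] N = 0) (g : SL2C) : μH[1] (mobius g '' N) = 0 := by
  have := (lipschitz_mobius g).hausdorffMeasure_image_le zero_le_one N
  rw [h, mul_zero] at this
  exact le_antisymm this zero_le'

lemma pos_H {h : C(S1, ℂ)} (hi : Function.Injective h) {S : Set RSphere} (hS : ofC '' range h = S) : μH[1] S ≠ 0 := by
  intro h0
  obtain ⟨B, hB⟩ := (isCompact_range h.continuous).isBounded.exists_norm_le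
  have hsub : S ⊆ ofC '' {b : ℂ | max ‖b‖ 1 ≤ max B 1} := by
    rw [← hS]
    exact image_mono fun b hb => max_le_max (hB b hb) le_rfl
  have a := ((toC_lip (B := max B 1) (le_max_of_le_right zero_le_one)).mono hsub).hausdorffMeasure_image_le (d := 1) zero_le_one
  rw [h0, mul_zero, ← hS, image_image] at a
  simp only [toC_ofC, image_id'] at a
  have b := (len_le_H hi).trans a
  have hc : h (circleParam 0) = h (circleParam 1) := by
    have := eVariationOn.edist_le (fun t => h (circleParam t)) (s := Icc 0 (2 * Real.pi)) (x := 0) (y := 1)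
      ⟨le_rfl, by positivity⟩ ⟨zero_le_one, by linarith [Real.pi_gt_three]⟩
    exact edist_le_zero.1 (this.trans b)
  have := circleParam_inj ⟨le_rfl, by positivity⟩ ⟨zero_le_one, by linarith [Real.pi_gt_three]⟩ (hi hc)
  norm_num at this

lemma noninv [Countable G] {R R1 : G →* SL2C} (hR : Good R) (htf : ∀ γ : G, IsOfFinOrder γ → γ = 1) {ρ ε κ : ℝ} (hρ : 0 < ρ) (hε : ε ≤ 1/2)
    (hκ : 0 < κ) {F0 : V2 → V2} (hF : ∀ z, ρ ≤ Metric.infDist z (Lc R) → ‖F0 (lft z) - lft z‖ ≤ ε)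
    (hS : ∀ D, DOK R ρ κ D → ∃ Ψ : RSphere ≃ₜ RSphere, STC R R1 ρ ε F0 D Ψ)
    (hcov : ∀ z, z ∉ Lc R → ∃ γ, ρ < Metric.infDist (mobius (R γ) z) (Lc R))
    {η : Set RSphere} (hη : QC R η) {a : SL2C} (ha : ∀ γ, (a : PSL2C) ≠ ((R1 γ : SL2C) : PSL2C)) (hΛ : μH[1] (Lc R1) = 0)
    (hpos : ∀ D Ψ, STC R R1 ρ ε F0 D Ψ → μH[1] (Ψ '' η) ≠ 0) :
    ∃ D Ψ, STC R R1 ρ ε F0 D Ψ ∧ mobius a '' (Ψ '' η) ≠ Ψ '' η := by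
  obtain ⟨Ψo, h0⟩ := hS _ (DOK_zero R _ hκ.le)
  by_cases hinv : mobius a '' (Ψo '' η) ≠ Ψo '' η
  · exact ⟨_, Ψo, h0, hinv⟩
  push Not at hinv
  set N : Set RSphere := mobius a⁻¹ '' Lc R1 ∪ ⋃ γ : G, {y | mobius ((R1 γ)⁻¹ * a) y = y} with hN
  have hN0 : μH[1] N = 0 := by
    refine measure_union_null (null_mobius hΛ _) ?_
    haveI : NullSingletonClass (μH[1] : Measure RSphere) := Measure.nullSingletonClass_hausdorff RSphere one_pos
    refine (countable_iUnion fun γ => fix_count ?_).measure_zero _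
    intro h
    rw [QuotientGroup.mk_mul, QuotientGroup.mk_inv, inv_mul_eq_one] at h
    exact ha γ h.symm
  have hex : ∃ z1 ∈ η, ρ < Metric.infDist z1 (Lc R) ∧ Ψo z1 ∉ N := by
    by_contra hcon
    push Not at hcon
    apply hpos _ _ h0
    refine measure_mono_null (t := Lc R1 ∪ ⋃ γ : G, mobius (R1 γ⁻¹) '' N) ?_
      (measure_union_null hΛ (measure_iUnion_null fun γ => null_mobius hN0 _))
    rintro _ ⟨z, hz, rfl⟩
    by_cases hzL : z ∈ Lc R
    · left; rw [← h0.img]; exact ⟨z, hzL, rfl⟩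
    · right
      obtain ⟨γ, hγ⟩ := hcov z hzL
      refine mem_iUnion.2 ⟨γ, ⟨_, hcon (mobius (R γ) z) (by rw [← hη.inv γ]; exact ⟨z, hz, rfl⟩) hγ, ?_⟩⟩
      rw [h0.eqv, map_inv, mobius_inv_mobius]
  obtain ⟨z1, hz1η, hz1ρ, hz1N⟩ := hex
  set y0 := Ψo z1 with hy0
  have hzL : z1 ∉ Lc R := (hR.closed.notMem_iff_infDist_pos hR.nt.nonempty).2 (hρ.trans hz1ρ)
  have hmem : mobius a y0 ∈ Ψo '' η := by
    rw [← hinv]; exact ⟨y0, ⟨z1, hz1η, rfl⟩, rfl⟩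
  obtain ⟨w1, hw1η, hw1⟩ := hmem
  have hw1L : w1 ∉ Lc R := by
    intro h
    apply hz1N
    left
    refine ⟨mobius a y0, ?_, mobius_inv_mobius _ _⟩
    rw [← hw1, ← h0.img]; exact ⟨w1, h, rfl⟩
  have hw : ∀ γ, mobius (R γ) w1 ≠ z1 := by
    intro γ h
    apply hz1N
    right
    refine mem_iUnion.2 ⟨γ⁻¹, ?_⟩
    show mobius ((R1 γ⁻¹)⁻¹ * a) y0 = y0
    rw [mobius_mul, ← hw1, map_inv, inv_inv, ← h0.eqv, h]
  obtain ⟨D, Ψ, hΨ, hn, hwe⟩ := hole hR htf hρ hε hκ hF hS h0 hz1ρ (fun _ => hw) (hη.nd hzL)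
  refine ⟨D, Ψ, hΨ, fun he => hn ?_⟩
  have h1 : mobius a y0 ∈ Ψ '' η := ⟨w1, hw1η, by rw [hwe hw1L, hw1]⟩
  rw [← he] at h1
  obtain ⟨y, hy, hye⟩ := h1
  rwa [mobius_inj a hye] at hy

end Rep24

section Rep25

lemma fr_le {W : Set ℂ} (h₁ h₂ : RCurve W) {d : ℝ} (h : ∀ t, dist (h₁.toFun t) (h₂.toFun t) ≤ d) :
    frechetDist h₁ h₂ ≤ d + |(curveLength h₁.toFun).toReal - (curveLength h₂.toFun).toReal| := by
  unfold frechetDist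
  gcongr
  have hb : BddBelow (range fun σ : (S1 ≃ₜ S1) × (S1 ≃ₜ S1) => ⨆ t : S1, dist (h₁.toFun (σ.1 t)) (h₂.toFun (σ.2 t))) := by
    refine ⟨0, ?_⟩
    rintro _ ⟨σ, rfl⟩
    exact Real.iSup_nonneg fun t => dist_nonneg
  refine (ciInf_le hb (Homeomorph.refl _, Homeomorph.refl _)).trans ?_
  haveI : Nonempty S1 := ⟨circleParam 0⟩
  exact ciSup_le fun t => h t

lemma fr_self {W : Set ℂ} (h : RCurve W) : frechetDist h h ≤ 0 := by
  have := fr_le h h (d := 0) (fun t => by rw [dist_self])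
  simpa using this

lemma fr_ge {W : Set ℂ} (h₁ h₂ : RCurve W) {d : ℝ} {p : ℂ} (hp : p ∈ range h₂.toFun) (h : ∀ t, d ≤ dist (h₁.toFun t) p) :
    d ≤ frechetDist h₁ h₂ := by
  unfold frechetDist
  have a := abs_nonneg ((curveLength h₁.toFun).toReal - (curveLength h₂.toFun).toReal)
  suffices d ≤ ⨅ σ : (S1 ≃ₜ S1) × (S1 ≃ₜ S1), ⨆ t : S1, dist (h₁.toFun (σ.1 t)) (h₂.toFun (σ.2 t)) by linarith
  haveI : Nonempty ((S1 ≃ₜ S1) × (S1 ≃ₜ S1)) := ⟨(Homeomorph.refl _, Homeomorph.refl _)⟩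
  refine le_ciInf fun σ => ?_
  obtain ⟨s, rfl⟩ := hp
  have hc : Continuous fun t : S1 => dist (h₁.toFun (σ.1 t)) (h₂.toFun (σ.2 t)) := by fun_prop
  have hb := (isCompact_range hc).bddAbove
  have := le_ciSup hb (σ.2.symm s)
  simp only [Homeomorph.apply_symm_apply] at this
  exact (h _).trans this

/-- scaled curve -/
def scl (w0 m : ℂ) (h : C(S1, ℂ)) : C(S1, ℂ) := ⟨fun t => w0 + m * (h t - w0), by fun_prop⟩

lemma len_scl (w0 m : ℂ) (h : C(S1, ℂ)) : curveLength (scl w0 m h) ≤ (‖m‖₊ : ℝ≥0∞) * curveLength h := by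
  have hl : LipschitzOnWith ‖m‖₊ (fun z : ℂ => w0 + m * (z - w0)) univ := by
    refine (LipschitzWith.of_dist_le_mul fun x y => ?_).lipschitzOnWith
    rw [dist_add_left, dist_eq_norm, dist_eq_norm, ← mul_sub, norm_mul]
    simp
  have := hl.comp_eVariationOn_le (g := fun t : ℝ => h (circleParam t)) (s := Icc 0 (2 * Real.pi)) (fun _ _ => mem_univ _)
  unfold curveLength
  exact this

lemma len_scl_eq (w0 : ℂ) {m : ℂ} (hm : m ≠ 0) (h : C(S1, ℂ)) : curveLength (scl w0 m h) = (‖m‖₊ : ℝ≥0∞) * curveLength h := by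
  refine le_antisymm (len_scl w0 m h) ?_
  have e : scl w0 m⁻¹ (scl w0 m h) = h := by
    ext t; simp [scl, hm]
  have a := len_scl w0 m⁻¹ (scl w0 m h)
  rw [e] at a
  calc (‖m‖₊ : ℝ≥0∞) * curveLength h ≤ (‖m‖₊ : ℝ≥0∞) * ((‖m⁻¹‖₊ : ℝ≥0∞) * curveLength (scl w0 m h)) := by gcongr
    _ = curveLength (scl w0 m h) := by
      rw [← mul_assoc, ← ENNReal.coe_mul, ← nnnorm_mul, mul_inv_cancel₀ hm]; simp

lemma bad_dim {K P : Set ℂ} (hK : μH[1] K < ⊤) (hP : P.Countable) (w0 : ℂ) :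
    dimH (⋃ p ∈ P, (fun z : ℂ => (p - w0) / (z - w0)) '' (K \ {w0})) ≤ 1 := by
  rw [dimH_bUnion hP]
  refine iSup₂_le fun p _ => ?_
  have h1 : dimH (K \ {w0}) ≤ ((1 : ℝ≥0) : ℝ≥0∞) :=
    (dimH_mono sdiff_subset).trans (dimH_le_of_hausdorffMeasure_ne_top (by simpa using hK.ne))
  refine (dimH_image_le_of_locally_lipschitzOn ?_).trans (by simpa using h1)
  rintro z ⟨-, hz⟩
  have hne : z - w0 ≠ 0 := sub_ne_zero.2 hz
  have hcd : ContDiffAt ℂ 1 (fun z : ℂ => (p - w0) / (z - w0)) z := by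
    exact contDiffAt_const.div (contDiffAt_id.sub contDiffAt_const) hne
  obtain ⟨C, t, ht, hl⟩ := hcd.exists_lipschitzOnWith
  exact ⟨C, t, mem_nhdsWithin_of_mem_nhds ht, hl⟩

lemma scl_ex {W : Set ℂ} (ξ : RCurve W) {w0 : ℂ} (hw : w0 ∈ range ξ.toFun) (hwW : w0 ∈ W) {P : Set ℂ} (hPc : IsCompact P)
    (hPn : P.Countable) (hwP : w0 ∉ P) (hne : P.Nonempty) {ε : ℝ} (hε : 0 < ε) :
    ∃ ξ' : RCurve W, frechetDist ξ ξ' < ε ∧ ∃ d > 0, ∀ t, ∀ p ∈ P, d ≤ dist (ξ'.toFun t) p := by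
  have hK : μH[1] (range ξ.toFun) < ⊤ := (H_le_len _).trans_lt ξ.bddLength
  set bad := ⋃ p ∈ P, (fun z : ℂ => (p - w0) / (z - w0)) '' (range ξ.toFun \ {w0}) with hbad
  have hden : Dense badᶜ := by
    apply dense_compl_of_dimH_lt_finrank
    refine (bad_dim hK hPn w0).trans_lt ?_
    rw [Complex.finrank_real_complex]; norm_num
  obtain ⟨M, hM⟩ := (isCompact_range ξ.toFun.continuous).isBounded.exists_norm_le
  set L := (curveLength ξ.toFun).toReal with hL
  have hL0 : 0 ≤ L := ENNReal.toReal_nonneg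
  have hM0 : 0 ≤ M := (norm_nonneg _).trans (hM _ hw)
  set δ := min (1/2) (ε / (2 * (2 * M + L + 1))) with hδ
  have hδ0 : 0 < δ := lt_min (by norm_num) (by positivity)
  obtain ⟨m, hm, hmb⟩ := Metric.dense_iff.1 hden 1 δ hδ0
  have hm1 : ‖m - 1‖ < δ := by rw [← dist_eq_norm]; exact hm
  have hm0 : m ≠ 0 := by
    rintro rfl
    have := min_le_left (1/2) (ε / (2 * (2 * M + L + 1)))
    simp at hm1; linarith
  have hlen : curveLength (scl w0 m ξ.toFun) = (‖m‖₊ : ℝ≥0∞) * curveLength ξ.toFun := len_scl_eq w0 hm0 _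
  obtain ⟨s, hs⟩ := hw
  let ξ' : RCurve W := ⟨scl w0 m ξ.toFun, ⟨w0, ⟨s, by simp [scl, hs]⟩, hwW⟩, by
    rw [hlen]; exact ENNReal.mul_lt_top (by simp) ξ.bddLength⟩
  refine ⟨ξ', ?_, ?_⟩
  · have h1 : ∀ t, dist (ξ.toFun t) (ξ'.toFun t) ≤ δ * (2 * M) := by
      intro t
      have e : ξ.toFun t - ξ'.toFun t = -(m - 1) * (ξ.toFun t - w0) := by
        show ξ.toFun t - (w0 + m * (ξ.toFun t - w0)) = _
        ring
      rw [dist_eq_norm, e, norm_mul, norm_neg]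
      have a := norm_sub_le (ξ.toFun t) w0
      have b := hM _ ⟨t, rfl⟩
      have c := hM _ ⟨s, hs⟩
      gcongr
      linarith
    have h2 : |(curveLength ξ.toFun).toReal - (curveLength ξ'.toFun).toReal| ≤ δ * L := by
      have e : (curveLength ξ'.toFun).toReal = ‖m‖ * L := by
        show (curveLength (scl w0 m ξ.toFun)).toReal = _
        rw [hlen, ENNReal.toReal_mul]; simp [hL]
      rw [e, ← hL]
      have e2 : L - ‖m‖ * L = (1 - ‖m‖) * L := by ring
      rw [e2, abs_mul, abs_of_nonneg hL0]
      gcongr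
      have := abs_norm_sub_norm_le (1:ℂ) m
      rw [norm_one, norm_sub_rev] at this
      linarith
    have h3 := fr_le ξ ξ' h1
    have h4 : δ * (2 * (2 * M + L + 1)) ≤ ε := by
      have := min_le_right (1/2) (ε / (2 * (2 * M + L + 1)))
      rw [le_div_iff₀ (by positivity)] at this
      exact this
    nlinarith
  · obtain ⟨x, hx, hmin⟩ := ((isCompact_range ξ'.toFun.continuous).prod hPc).exists_isMinOn
      (((range_nonempty_iff_nonempty.2 ⟨circleParam 0⟩)).prod hne) (f := fun x : ℂ × ℂ => dist x.1 x.2) (by fun_prop)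
    refine ⟨dist x.1 x.2, ?_, fun t p hp => hmin (a := (ξ'.toFun t, p)) ⟨⟨t, rfl⟩, hp⟩⟩
    apply dist_pos.2
    obtain ⟨⟨t, ht⟩, hp⟩ := hx
    intro he
    rw [← ht] at he
    have he' : w0 + m * (ξ.toFun t - w0) = x.2 := he
    have hne' : ξ.toFun t ≠ w0 := by
      intro h; rw [h, sub_self, mul_zero, add_zero] at he'; exact hwP (he' ▸ hp)
    apply hmb
    refine mem_iUnion₂.2 ⟨x.2, hp, ξ.toFun t, ⟨⟨t, rfl⟩, hne'⟩, ?_⟩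
    show (x.2 - w0) / (ξ.toFun t - w0) = m
    rw [← he', add_sub_cancel_left, mul_div_assoc, div_self (sub_ne_zero.2 hne'), mul_one]

lemma front {W : Set ℂ} {U : Set (RCurve W)} {ξ : RCurve W} (hξ : ξ ∈ U) {w0 : ℂ} (hw : w0 ∈ range ξ.toFun) (hwW : w0 ∈ W)
    {P : Set ℂ} (hPc : IsCompact P) (hPn : P.Countable) (hwP : w0 ∉ P) (hne : P.Nonempty)
    (hUP : ∀ h ∈ U, ∃ p ∈ P, p ∈ range h.toFun) : ξ ∈ dFrontier (dClosure U) := by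
  have hcl : ∀ A : Set (RCurve W), A ⊆ dClosure A := fun A h hh ε hε => ⟨h, hh, (fr_self h).trans_lt hε⟩
  refine ⟨hcl _ (hcl _ hξ), fun ε hε => ?_⟩
  obtain ⟨ξ', h1, d, hd, h2⟩ := scl_ex ξ hw hwW hPc hPn hwP hne hε
  refine ⟨ξ', fun hcon => ?_, h1⟩
  obtain ⟨h, hh, hlt⟩ := hcon d hd
  obtain ⟨p, hp, hpr⟩ := hUP h hh
  exact absurd (fr_ge ξ' h hpr (fun t => h2 t p hp)) (not_le.2 hlt)

end Rep25

section Rep25b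
variable {G : Type*} [Group G]

lemma lim_pts {R : G →* SL2C} (hR : Good R) {Rn : ℕ → (G →* SL2C)} (hT : Tendsto Rn atTop (nR R)) {q : ℂ} (hq : ofC q ∈ Lc R)
    {ε : ℝ} (hε : 0 < ε) : ∀ᶠ n in atTop, ∃ b, ofC b ∈ Lc (Rn n) ∧ dist b q < ε := by
  set B := max ‖q‖ 1 with hB
  have hB1 : 1 ≤ B := le_max_right _ _
  set e := min (1 / (8 * B)) (ε / (8 * B ^ 2)) with he
  have he0 : 0 < e := lt_min (by positivity) (by positivity)
  obtain ⟨κ, hκ, hev⟩ := STab hR one_pos he0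
  filter_upwards [hT.eventually hev] with n hn
  obtain ⟨F0, -, hS⟩ := hn
  obtain ⟨Ψ, h⟩ := hS _ (DOK_zero R _ hκ.le)
  have h1 : e * (8 * B) ≤ 1 := by
    rw [← le_div_iff₀ (by positivity)]; exact min_le_left _ _
  have h2 : e * (8 * B ^ 2) ≤ ε := by
    rw [← le_div_iff₀ (by positivity)]; exact min_le_right _ _
  obtain ⟨b, hb, -, hb2, -⟩ := near_ofC hB1 he0.le h1 (le_max_left ‖q‖ 1) (h.close (ofC q))
  refine ⟨b, ?_, ?_⟩
  · rw [← hb, ← h.img]; exact ⟨_, hq, rfl⟩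
  · rw [dist_eq_norm]; nlinarith

lemma exP {R : G →* SL2C} (hR : Good R) {Rn : ℕ → (G →* SL2C)} (hT : Tendsto Rn atTop (nR R)) (hi : infty ∉ Lc R)
    {Γ : ℕ → Subgroup PSL2C} (hΓ : ∀ᶠ n in atTop, limitSet (Γ n) = Lc (Rn n)) (hnt : ∀ n, (limitSet (Γ n)).Nontrivial)
    (W : Set ℂ) (w0 : ℂ) : ∃ P : Set ℂ, IsCompact P ∧ P.Countable ∧ w0 ∉ P ∧ P.Nonempty ∧
      ∀ h ∈ ⋃ n, ECurves W (Γ n), ∃ p ∈ P, p ∈ range h.toFun := by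
  obtain ⟨q, hq, hqw⟩ : ∃ q, ofC q ∈ Lc R ∧ q ≠ w0 := by
    obtain ⟨x, hx, hxw⟩ := hR.nt.exists_ne (ofC w0)
    rcases RSphere.cases' x with rfl | ⟨q, rfl⟩
    · exact absurd hx hi
    · exact ⟨q, hx, fun h => hxw (by rw [h])⟩
  have hch : ∀ n : ℕ, ∃ p : ℂ, p ≠ w0 ∧ ((∃ b, b ≠ w0 ∧ ofC b ∈ limitSet (Γ n)) → ofC p ∈ limitSet (Γ n)) ∧
      ∀ b, b ≠ w0 → ofC b ∈ limitSet (Γ n) → dist p q ≤ dist b q + 1 / ((n : ℝ) + 1) := by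
    intro n
    by_cases hS : {b | b ≠ w0 ∧ ofC b ∈ limitSet (Γ n)}.Nonempty
    · have hpos : (0:ℝ) < 1 / ((n : ℝ) + 1) := by positivity
      obtain ⟨p, hp, hlt⟩ := (Metric.infDist_lt_iff (x := q) hS).1 (lt_add_of_pos_right _ hpos)
      refine ⟨p, hp.1, fun _ => hp.2, fun b hb hb' => ?_⟩
      have := Metric.infDist_le_dist_of_mem (x := q) (show b ∈ {b | b ≠ w0 ∧ ofC b ∈ limitSet (Γ n)} from ⟨hb, hb'⟩)
      rw [dist_comm p, dist_comm b]; linarith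
    · refine ⟨q, hqw, fun h => absurd h hS, fun b hb hb' => absurd ⟨b, hb, hb'⟩ hS⟩
  choose p hp1 hp2 hp3 using hch
  have hlim : Tendsto p atTop (𝓝 q) := by
    rw [Metric.tendsto_nhds]
    intro ε hε
    have hd : 0 < dist q w0 := dist_pos.2 hqw
    have h1 := tendsto_one_div_add_atTop_nhds_zero_nat.eventually (gt_mem_nhds (half_pos hε))
    filter_upwards [lim_pts hR hT hq (lt_min (half_pos hε) hd), hΓ, h1] with n hn hΓn hn1
    obtain ⟨b, hb, hbd⟩ := hn
    have hbw : b ≠ w0 := by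
      rintro rfl
      rw [dist_comm] at hbd
      exact absurd (hbd.trans_le (min_le_right _ _)) (lt_irrefl _)
    have := hp3 n b hbw (by rw [hΓn]; exact hb)
    have := hbd.trans_le (min_le_left _ _)
    linarith
  refine ⟨insert q (range p), hlim.isCompact_insert_range, (countable_range p).insert q, ?_, ⟨q, mem_insert _ _⟩, ?_⟩
  · rintro (h | ⟨n, h⟩)
    · exact hqw h.symm
    · exact hp1 n h
  · intro h hh
    obtain ⟨n, hn⟩ := mem_iUnion.1 hh
    have hsub : limitSet (Γ n) ⊆ ofC '' range h.toFun := hn.2.1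
    obtain ⟨x, hx, hxw⟩ := (hnt n).exists_ne (ofC w0)
    obtain ⟨b, -, rfl⟩ := hsub hx
    have hpn := hp2 n ⟨b, fun h => hxw (by rw [h]), hx⟩
    obtain ⟨c, hc, hce⟩ := hsub hpn
    refine ⟨p n, mem_insert_of_mem _ ⟨n, rfl⟩, ?_⟩
    rwa [← ofC_injective hce]

end Rep25b

lemma isQC_of {G : Type*} [Group G] {R : G →* SL2C} {Γ : Subgroup PSL2C} (hI : Img R Γ) (hL : limitSet Γ = Lc R) {η : Set RSphere}
    (h : QC R η) : IsQuasiCircle Γ η := by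
  refine ⟨h.jor, hL ▸ h.sub, fun a ha => ?_⟩
  obtain ⟨x, hx⟩ := (hI a).1 ha
  rw [psl_mobius hx]; exact h.inv x

lemma gen_sub {G : Type*} [Group G] {R : G →* SL2C} {Γ : Subgroup PSL2C} (hI : Img R Γ) (hL : limitSet Γ = Lc R) (ζ : Set RSphere)
    {a : SL2C} (ha : (a : PSL2C) ∈ Γ) : mobius a '' generatedBy Γ ζ ⊆ generatedBy Γ ζ := by
  rintro _ ⟨z, hz | hz, rfl⟩
  · left
    obtain ⟨x, hx⟩ := (hI a).1 ha
    rw [psl_mobius hx]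
    rw [hL] at hz ⊢
    exact Lc_inv R x z hz
  · right
    obtain ⟨⟨b, hb⟩, y, hy, rfl⟩ := mem_iUnion.1 hz
    refine mem_iUnion.2 ⟨⟨a * b, ?_⟩, y, hy, mobius_mul a b y⟩
    exact mul_mem ha hb

lemma gen_inv {G : Type*} [Group G] {R : G →* SL2C} {Γ : Subgroup PSL2C} (hI : Img R Γ) (hL : limitSet Γ = Lc R) (ζ : Set RSphere)
    {a : SL2C} (ha : (a : PSL2C) ∈ Γ) : mobius a '' generatedBy Γ ζ = generatedBy Γ ζ := by
  refine (gen_sub hI hL ζ ha).antisymm fun z hz => ?_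
  have ha' : ((a⁻¹ : SL2C) : PSL2C) ∈ Γ := inv_mem ha
  exact ⟨mobius a⁻¹ z, gen_sub hI hL ζ ha' ⟨z, hz, rfl⟩, mobius_mobius_inv a z⟩

/-- **Singularity.** Let `Γ_n ∈ 𝔥` with `Γ_n → Γ` a Schottky group, and
assume `Γ` is a non-classical Schottky group. Then there is a quasi-circle `η_Γ` of `Γ`
such that every relative (Fréchet-metric) open neighborhood of it in `Ψ_Γ` contains a
deformation which is a non-quasi-circle: a closed curve that is not a Jordan curve or is
not `Γ`-invariant. -/
theorem nonclassical_limit_gives_singular_deformations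
    (g : ℕ) (lam : ℝ≥0∞) (hlam : lam < 1)
    (γn : ℕ → Fin g → SL2C) (γ : Fin g → SL2C)
    (hcl : ∀ n, IsClassicalSchottkyOfRank (groupOfGens (γn n)) g)
    (hdim : ∀ n, limitDim (groupOfGens (γn n)) ≤ lam)
    (hconv : ∀ i, Filter.Tendsto (fun n => γn n i) Filter.atTop (nhds (γ i)))
    (hs : IsSchottky (groupOfGens γ))
    (hnc : ¬IsClassicalSchottky (groupOfGens γ))
    (W : Set ℂ) (hW : IsCompact W)
    (hWn : ∀ n, RSphere.ofC ⁻¹' limitSet (groupOfGens (γn n)) ⊆ W)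
    (hWl : RSphere.ofC ⁻¹' limitSet (groupOfGens γ) ⊆ W) :
    ∃ h : RCurve W, IsQuasiCircle (groupOfGens γ) h.carrier ∧
      ∀ ε : ℝ, 0 < ε →
        ∃ ξ ∈ PsiSet W (fun n => groupOfGens (γn n)) (groupOfGens γ),
          frechetDist ξ h < ε ∧
          (¬IsJordanCurve ξ.carrier ∨
            ∃ a : SL2C, (a : PSL2C) ∈ groupOfGens γ ∧
              mobius a '' ξ.carrier ≠ ξ.carrier) := by
  obtain ⟨k, R, Rn, hR, hI, hL, hinj, hT, hev, hP, ⟨p, -, -, hp, -⟩, hi, hnt, hea⟩ :=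
    setup g lam hlam γn γ hcl hdim hconv hs hnc W hW hWl
  have htf : ∀ x : FreeGroup (Fin k), IsOfFinOrder x → x = 1 := by
    intro x hx
    obtain ⟨n, hn, h⟩ := isOfFinOrder_iff_pow_eq_one.1 hx
    exact (pow_eq_one_iff_left hn.ne').1 h
  have hdim' : ∀ᶠ n in atTop, dimH (Lc (Rn n)) ≤ lam := by
    filter_upwards [hev] with n hn
    rw [← hn.2]; exact hdim n
  obtain ⟨η, hη, hηi⟩ := mkinf hR htf hi hP
  obtain ⟨f, hfi, hf⟩ := mkf hη.jor hηi
  obtain ⟨hfl, hlen⟩ := lenT hR hT hlam hdim' hη hfi hf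
  have hmeet : (range f ∩ W).Nonempty := by
    have hp' := hη.sub hp
    rw [← hf] at hp'
    obtain ⟨w, hw, e⟩ := hp'
    exact ⟨w, hw, hWl (by rw [mem_preimage, e, hL]; exact hp)⟩
  refine ⟨⟨f, hmeet, hfl⟩, ?_, fun ε hε => ?_⟩
  · show IsQuasiCircle _ (ofC '' range f)
    rw [hf]; exact isQC_of hI hL hη
  obtain ⟨ρ, hρ, ε0, hε0, hcov, hε2, hl⟩ := hlen (ε / 3) (by positivity)
  obtain ⟨κ, hκ, hS⟩ := STab hR hρ hε0
  obtain ⟨θ, c, -, -, hsum⟩ := sumR hR hT hlam hdim'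
  obtain ⟨m, hl, ⟨F0, hF, hS⟩, ⟨hIm, hLm⟩, ⟨-, -, hμ⟩, ⟨a, ha, ham⟩⟩ :=
    (hl.and ((hT.eventually hS).and (hev.and (hsum.and hea)))).exists
  have hran : ∀ {h' : C(S1, ℂ)} {Ψ : RSphere ≃ₜ RSphere}, (∀ t, ofC (h' t) = Ψ (ofC (f t))) → ofC '' range h' = Ψ '' η := by
    intro h' Ψ e
    rw [← hf, ← range_comp, ← range_comp, ← range_comp]
    congr 1
    funext t; exact e t
  have hpos : ∀ D Ψ, STC R (Rn m) ρ ε0 F0 D Ψ → μH[1] (Ψ '' η) ≠ 0 := by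
    intro D Ψ hst
    obtain ⟨h', hi', he, -⟩ := hl F0 D Ψ hst
    exact pos_H hi' (hran he)
  obtain ⟨D, Ψ, hst, hne⟩ := noninv hR htf hρ hε2 hκ hF hS hcov hη
    (fun x hx => ham ((hIm a).2 ⟨x, hx⟩)) hμ hpos
  obtain ⟨h', hi', he, hd, hlt, hll⟩ := hl F0 D Ψ hst
  have hcar := hran he
  have hQ : QC (Rn m) (Ψ '' η) := hst.QC_fwd hε2 hcov hη
  obtain ⟨q, hq, -⟩ := hnt m
  have hq' : q ∈ ofC '' range h' := by
    rw [hcar]; exact hQ.sub (hLm ▸ hq)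
  obtain ⟨w0, hw0, rfl⟩ := hq'
  have hw0W : w0 ∈ W := hWn m hq
  let ξ : RCurve W := ⟨h', ⟨w0, hw0, hw0W⟩, hlt⟩
  have hξc : ξ.carrier = Ψ '' η := hcar
  obtain ⟨P, hPc, hPn, hwP, hPne, hU⟩ := exP hR hT hi (Γ := fun n => groupOfGens (γn n)) (hev.mono fun n h => h.2) hnt W w0
  have hξU : ξ ∈ ⋃ n, ECurves W (groupOfGens (γn n)) := by
    refine mem_iUnion.2 ⟨m, ?_⟩
    show IsQuasiCircle _ ξ.carrier
    rw [hξc]; exact isQC_of hIm hLm hQ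
  refine ⟨ξ, ⟨front hξU hw0 hw0W hPc hPn hwP hPne hU, ?_⟩, ?_, Or.inr ⟨a, ha, by rw [hξc]; exact hne⟩⟩
  · rintro ⟨g', S, -, ζ, -, e⟩
    apply hne
    rw [← hξc, ← e]
    exact gen_inv hI hL _ ha
  · have h1 := fr_le ξ ⟨f, hmeet, hfl⟩ (d := ε / 3) (fun t => (hd t).le)
    have h2 : |(curveLength ξ.toFun).toReal - (curveLength f).toReal| < ε / 3 := hll
    have h3 : frechetDist ξ ⟨f, hmeet, hfl⟩ ≤ ε / 3 + |(curveLength ξ.toFun).toReal - (curveLength f).toReal| := h1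
    linarith
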